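/- For all integers d ≥ 1 and k ≥ 1 and every δ₀ ∈ (0, 1/2), there exists M = M(d, k, δ₀) ∈ ℕ such that for every real polynomial Q in d variables of total degree at most k, the function S : ℝ → [0,∞) defined by S(β) := |{ξ ∈ [0,1]^d : β − δ₀ ≤ Q(ξ) ≤ β + δ₀}| is piecewise monotone with at most M pieces: there exist at most M − 1 points −∞ < t₁ ≤ t₂ ≤ ⋯ < ∞ such that on each of the at most M intervals into which they partition ℝ, the function S is either nondecreasing or nonincreasing. -/

import Mathlib

open MeasureTheory Real Set
open scoped ENNReal

noncomputable section

/-- `S(β) = |{ξ ∈ [0,1]^d : β − δ₀ ≤ Q(ξ) ≤ β + δ₀}|` (Lebesgue measure). -/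
def Sfun (d : ℕ) (δ₀ : ℝ) (Q : MvPolynomial (Fin d) ℝ) (β : ℝ) : ℝ :=
  (volume {ξ ∈ Icc (0 : Fin d → ℝ) 1 |
      β - δ₀ ≤ MvPolynomial.eval ξ Q ∧ MvPolynomial.eval ξ Q ≤ β + δ₀}).toReal

/-- For `n` partition points `t 0 ≤ t 1 ≤ ⋯ ≤ t (n-1)`, the `i`-th of the `n + 1`
closed intervals into which they partition `ℝ` (`0 ≤ i ≤ n`). -/
def piece (t : ℕ → ℝ) (n i : ℕ) : Set ℝ :=
  {x : ℝ | (i = 0 ∨ t (i - 1) ≤ x) ∧ (i = n ∨ x ≤ t i)}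

namespace Tame
open Filter Topology

lemma exists_word {κ : Type*} [Fintype κ] (α : κ → ℕ) (n : ℕ) (h : ∑ i, α i = n) :
    ∃ f : Fin n → κ, ∀ x : κ → ℝ, ∏ j, x (f j) = ∏ i, x i ^ α i := by
  classical
  have hc : Fintype.card (Σ i, Fin (α i)) = n := by simp [h]
  let e : Fin n ≃ (Σ i, Fin (α i)) := (Fintype.equivFinOfCardEq hc).symm
  refine ⟨fun j => (e j).1, fun x => ?_⟩
  rw [Fintype.prod_equiv e (fun j => x (e j).1) (fun s => x s.1) (fun _ => rfl),
    Fintype.prod_sigma]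
  simp

lemma abs_monomial_le {κ : Type*} [Fintype κ] {x : κ → ℝ} {r : ℝ}
    (hx : ∀ i, |x i| ≤ r) (α : κ → ℕ) : |∏ i, x i ^ α i| ≤ r ^ ∑ i, α i := by
  rw [Finset.abs_prod, ← Finset.prod_pow_eq_pow_sum]
  refine Finset.prod_le_prod (fun _ _ => abs_nonneg _) fun i _ => ?_
  rw [abs_pow]
  exact pow_le_pow_left₀ (abs_nonneg _) (hx i) _

lemma summable_monomial {κ E : Type*} [Fintype κ] {a : E → ℝ} {μ : E → κ → ℕ} {r : ℝ}
    (ha : Summable fun e => |a e| * r ^ ∑ i, μ e i) {x : κ → ℝ} (hx : ∀ i, |x i| ≤ r) :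
    Summable fun e => a e * ∏ i, x i ^ μ e i := by
  refine Summable.of_norm_bounded ha fun e => ?_
  rw [Real.norm_eq_abs, abs_mul]
  exact mul_le_mul_of_nonneg_left (abs_monomial_le hx _) (abs_nonneg _)

/-- A monomial series which converges absolutely at a positive radius is analytic. -/
theorem analyticAt_tsum_monomial {κ E : Type*} [Fintype κ] {a : E → ℝ} {μ : E → κ → ℕ} {r : ℝ}
    (hr : 0 < r) (ha : Summable fun e => |a e| * r ^ ∑ i, μ e i) :
    AnalyticAt ℝ (fun x : κ → ℝ => ∑' e, a e * ∏ i, x i ^ μ e i) 0 := by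
  classical
  choose word hword using fun (n : ℕ) (e : {e : E // ∑ i, μ e i = n}) =>
    exists_word (μ e.1) n e.2
  let M : ∀ n : ℕ, {e : E // ∑ i, μ e i = n} →
      ContinuousMultilinearMap ℝ (fun _ : Fin n => κ → ℝ) ℝ := fun n e =>
    (ContinuousMultilinearMap.mkPiAlgebra ℝ (Fin n) ℝ).compContinuousLinearMap
      fun j => ContinuousLinearMap.proj (word n e j)
  have hMapp : ∀ n e (x : κ → ℝ), M n e (fun _ => x) = ∏ i, x i ^ μ e.1 i := by
    intro n e x
    simp only [M, ContinuousMultilinearMap.compContinuousLinearMap_apply,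
      ContinuousMultilinearMap.mkPiAlgebra_apply, ContinuousLinearMap.proj_apply]
    exact hword n e x
  have hMnorm : ∀ n e, ‖M n e‖ ≤ 1 := by
    intro n e
    refine ContinuousMultilinearMap.opNorm_le_bound zero_le_one fun m => ?_
    simp only [M, ContinuousMultilinearMap.compContinuousLinearMap_apply,
      ContinuousMultilinearMap.mkPiAlgebra_apply, ContinuousLinearMap.proj_apply, one_mul]
    rw [norm_prod]
    exact Finset.prod_le_prod (fun _ _ => norm_nonneg _) fun j _ => norm_le_pi_norm (m j) _
  have hsub : ∀ n, Summable fun e : {e : E // ∑ i, μ e i = n} => |a e.1| * r ^ n := by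
    intro n
    refine (ha.comp_injective
      (Subtype.val_injective (p := fun e => ∑ i, μ e i = n))).congr fun e => ?_
    simp only [Function.comp, e.2]
  have hsub' : ∀ n, Summable fun e : {e : E // ∑ i, μ e i = n} => |a e.1| := fun n =>
    (summable_mul_right_iff (pow_ne_zero n hr.ne')).1 (hsub n)
  have hbd : ∀ n (e : {e : E // ∑ i, μ e i = n}), ‖a e.1 • M n e‖ ≤ |a e.1| := by
    intro n e
    rw [norm_smul, Real.norm_eq_abs]
    exact mul_le_of_le_one_right (abs_nonneg _) (hMnorm n e)
  have hsumM : ∀ n, Summable fun e : {e : E // ∑ i, μ e i = n} => a e.1 • M n e := fun n =>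
    Summable.of_norm_bounded (hsub' n) (hbd n)
  let p : FormalMultilinearSeries ℝ (κ → ℝ) ℝ := fun n =>
    ∑' e : {e : E // ∑ i, μ e i = n}, a e.1 • M n e
  have hpn : ∀ n, ‖p n‖ * r ^ n ≤ ∑' e, |a e| * r ^ ∑ i, μ e i := by
    intro n
    have h1 : ‖p n‖ ≤ ∑' e : {e : E // ∑ i, μ e i = n}, |a e.1| :=
      tsum_of_norm_bounded (hsub' n).hasSum (hbd n)
    calc ‖p n‖ * r ^ n ≤ (∑' e : {e : E // ∑ i, μ e i = n}, |a e.1|) * r ^ n := by gcongr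
      _ = ∑' e : {e : E // ∑ i, μ e i = n}, |a e.1| * r ^ ∑ i, μ e.1 i := by
          rw [← tsum_mul_right]
          exact tsum_congr fun e => by rw [e.2]
      _ ≤ _ := ha.tsum_subtype_le (fun e => |a e| * r ^ ∑ i, μ e i) {e | ∑ i, μ e i = n}
          (fun e => by positivity)
  refine ⟨p, ENNReal.ofReal r, ?_, by simpa using hr, ?_⟩
  · have := p.le_radius_of_bound (r := r.toNNReal) _ (fun n => by
      rw [Real.coe_toNNReal r hr.le]; exact hpn n)
    simpa [ENNReal.ofReal] using this
  · intro y hy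
    have hy' : ‖y‖ < r := by
      rw [Metric.mem_eball, edist_zero_right] at hy
      rw [← ofReal_norm] at hy
      exact (ENNReal.ofReal_lt_ofReal_iff hr).1 hy
    have hyi : ∀ i, |y i| ≤ r := fun i => (norm_le_pi_norm y i).trans hy'.le
    have hs := (summable_monomial ha hyi).hasSum
    rw [zero_add]
    rw [← (Equiv.sigmaFiberEquiv (fun e => ∑ i, μ e i)).hasSum_iff] at hs
    refine hs.sigma fun n => ?_
    have := (hsumM n).hasSum.map
      (ContinuousMultilinearMap.apply ℝ (fun _ : Fin n => κ → ℝ) ℝ (fun _ => y))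
      (ContinuousMultilinearMap.apply ℝ (fun _ : Fin n => κ → ℝ) ℝ (fun _ => y)).continuous
    have h2 : (ContinuousMultilinearMap.apply ℝ (fun _ : Fin n => κ → ℝ) ℝ (fun _ => y)) ∘
        (fun e : {e : E // ∑ i, μ e i = n} => a e.1 • M n e) =
        fun e => a e.1 * ∏ i, y i ^ μ e.1 i := by
      funext e
      simp only [Function.comp, ContinuousMultilinearMap.apply_apply,
        _root_.smul_apply, smul_eq_mul, hMapp]
    rw [h2] at this
    exact this

/-- An analytic function is the sum of an absolutely convergent monomial series. -/
theorem exists_monomial_series {κ : Type*} [Fintype κ] {H : (κ → ℝ) → ℝ}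
    (hH : AnalyticAt ℝ H 0) :
    ∃ (c : (κ → ℕ) → ℝ) (r : ℝ), 0 < r ∧ (Summable fun α => |c α| * r ^ ∑ i, α i) ∧
      ∀ x : κ → ℝ, (∀ i, |x i| ≤ r) → HasSum (fun α => c α * ∏ i, x i ^ α i) (H x) := by
  classical
  obtain ⟨p, R, hp⟩ := hH
  obtain ⟨r₀, hr₀, hr₀R⟩ : ∃ r₀ : NNReal, 0 < r₀ ∧ (r₀ : ℝ≥0∞) < R := by
    obtain ⟨r₀, h1, h2⟩ := ENNReal.lt_iff_exists_nnreal_btwn.1 hp.r_pos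
    exact ⟨r₀, by simpa using h1, h2⟩
  obtain ⟨C, hC, hbound⟩ := p.norm_mul_pow_le_of_lt_radius (hr₀R.trans_le hp.r_le)
  set N : ℝ := (Fintype.card κ : ℝ) with hN
  have hN0 : 0 ≤ N := by positivity
  set r : ℝ := r₀ / (2 * (N + 1)) with hr
  have hrpos : 0 < r := by have : (0 : ℝ) < r₀ := hr₀; positivity
  have hrr₀ : r < r₀ := by
    have : (0 : ℝ) < r₀ := hr₀
    rw [hr, div_lt_iff₀ (by positivity)]; nlinarith
  let a : (Σ n, Fin n → κ) → ℝ := fun w => p w.1 fun j => Pi.single (w.2 j) 1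
  let μ : (Σ n, Fin n → κ) → κ → ℕ := fun w i => (Finset.univ.filter fun j => w.2 j = i).card
  have hμdeg : ∀ w, ∑ i, μ w i = w.1 := by
    intro w
    have := Finset.card_eq_sum_card_fiberwise (s := Finset.univ) (t := Finset.univ) (f := w.2)
      (fun _ _ => by simp)
    simpa [μ] using this.symm
  have hμmon : ∀ w (x : κ → ℝ), ∏ i, x i ^ μ w i = ∏ j, x (w.2 j) := by
    intro w x
    rw [← Finset.prod_fiberwise (s := Finset.univ) (g := w.2) (f := fun j => x (w.2 j))]
    refine Finset.prod_congr rfl fun i _ => ?_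
    rw [Finset.prod_congr rfl (g := fun _ => x i) (fun j hj => by simp_all), Finset.prod_const]
  have ha : ∀ w, |a w| ≤ ‖p w.1‖ := by
    intro w
    refine ((p w.1).le_opNorm _).trans ?_
    refine mul_le_of_le_one_right (norm_nonneg _) ?_
    refine Finset.prod_le_one (fun _ _ => norm_nonneg _) fun j _ => ?_
    refine (pi_norm_le_iff_of_nonneg zero_le_one).2 fun i => ?_
    by_cases h : i = w.2 j
    · subst h; simp
    · simp [Pi.single_eq_of_ne h]
  have hsum : Summable fun w => |a w| * r ^ ∑ i, μ w i := by
    have key : ∀ n, ∑ f : Fin n → κ, |a ⟨n, f⟩| * r ^ n ≤ C * (1 / 2) ^ n := by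
      intro n
      calc ∑ f : Fin n → κ, |a ⟨n, f⟩| * r ^ n ≤ ∑ f : Fin n → κ, ‖p n‖ * r ^ n :=
            Finset.sum_le_sum fun f _ => mul_le_mul_of_nonneg_right (ha ⟨n, f⟩) (by positivity)
        _ = ‖p n‖ * (N * r) ^ n := by
            rw [Finset.sum_const, nsmul_eq_mul, Finset.card_univ, Fintype.card_fun,
              Fintype.card_fin, mul_pow]
            push_cast; ring
        _ ≤ ‖p n‖ * (r₀ * (1 / 2)) ^ n := by
            have : (0 : ℝ) < r₀ := hr₀
            refine mul_le_mul_of_nonneg_left (pow_le_pow_left₀ (by positivity) ?_ n) (norm_nonneg _)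
            rw [hr, ← mul_div_assoc, div_le_iff₀ (by positivity)]
            nlinarith
        _ = ‖p n‖ * r₀ ^ n * (1 / 2) ^ n := by rw [mul_pow]; ring
        _ ≤ C * (1 / 2) ^ n := by gcongr; exact hbound n
    refine (summable_sigma_of_nonneg (fun w => by positivity)).2 ⟨fun n => ?_, ?_⟩
    · exact Summable.of_finite
    · refine Summable.of_nonneg_of_le (fun n => tsum_nonneg fun f => by positivity) (fun n => ?_)
        ((summable_geometric_of_lt_one (by norm_num) (by norm_num : (1 / 2 : ℝ) < 1)).mul_left C)
      rw [tsum_fintype]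
      simp only [hμdeg]
      exact key n
  have hval : ∀ x : κ → ℝ, (∀ i, |x i| ≤ r) →
      HasSum (fun w => a w * ∏ i, x i ^ μ w i) (H x) := by
    intro x hx
    have hs := (summable_monomial hsum hx).hasSum
    have hx' : x ∈ Metric.eball (0 : κ → ℝ) R := by
      rw [Metric.mem_eball, edist_zero_right]
      refine lt_of_le_of_lt ?_ hr₀R
      rw [← ofReal_norm, ← ENNReal.ofReal_coe_nnreal]
      refine ENNReal.ofReal_le_ofReal ?_
      exact ((pi_norm_le_iff_of_nonneg hrpos.le).2 hx).trans hrr₀.le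
    have h1 := hs.sigma (fun n => (Summable.of_finite (f := fun f : Fin n → κ =>
      a ⟨n, f⟩ * ∏ i, x i ^ μ ⟨n, f⟩ i)).hasSum)
    have h2 := hp.hasSum hx'
    rw [zero_add] at h2
    have h3 : (fun n => p n fun _ => x) = fun n => ∑' f : Fin n → κ,
        a ⟨n, f⟩ * ∏ i, x i ^ μ ⟨n, f⟩ i := by
      funext n
      have hx0 : x = ∑ i, x i • (Pi.single i (1 : ℝ) : κ → ℝ) := by
        funext j
        simp [Finset.sum_apply, Pi.single_apply]
      conv_lhs => rw [hx0]
      rw [tsum_fintype]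
      have := (p n).toMultilinearMap.map_sum (fun (_ : Fin n) i => x i • (Pi.single i (1 : ℝ) : κ → ℝ))
      simp only [ContinuousMultilinearMap.coe_coe] at this
      rw [this]
      refine Finset.sum_congr rfl fun f _ => ?_
      have h4 := (p n).toMultilinearMap.map_smul_univ (fun j => x (f j))
        (fun j => (Pi.single (f j) (1 : ℝ) : κ → ℝ))
      simp only [ContinuousMultilinearMap.coe_coe] at h4
      rw [h4, hμmon, smul_eq_mul, mul_comm]
    rw [h3] at h2
    rw [h2.unique h1]
    exact hs
  refine ⟨fun α => ∑' e : {w // μ w = α}, a e.1, r, hrpos, ?_, fun x hx => ?_⟩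
  · rw [← (Equiv.sigmaFiberEquiv μ).summable_iff] at hsum
    have hs2 := (summable_sigma_of_nonneg (fun w => by simp only [Function.comp]; positivity)).1 hsum
    refine Summable.of_nonneg_of_le (fun α => by positivity) (fun α => ?_) hs2.2
    have e1 : ∀ e : {w // μ w = α}, |a e.1| * r ^ ∑ i, μ e.1 i = |a e.1| * r ^ ∑ i, α i :=
      fun e => by rw [e.2]
    have h5 : Summable fun e : {w // μ w = α} => |a e.1| := by
      have := hs2.1 α
      simp only [Function.comp, Equiv.sigmaFiberEquiv, Equiv.coe_fn_mk, e1] at this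
      exact (summable_mul_right_iff (pow_ne_zero _ hrpos.ne')).1 this
    have h6 : ∑' e : {w // μ w = α}, |a e.1| * r ^ ∑ i, μ e.1 i =
        (∑' e : {w // μ w = α}, |a e.1|) * r ^ ∑ i, α i := by
      rw [← tsum_mul_right]; exact tsum_congr e1
    refine le_trans ?_ h6.ge
    gcongr
    have := norm_tsum_le_tsum_norm (f := fun e : {w // μ w = α} => a e.1) (by simpa using h5)
    simpa using this
  · have hv := hval x hx
    rw [← (Equiv.sigmaFiberEquiv μ).hasSum_iff] at hv
    refine hv.sigma fun α => ?_
    have h7 : (fun e : {w // μ w = α} => a e.1 * ∏ i, x i ^ α i) =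
        fun e => ((fun w => a w * ∏ i, x i ^ μ w i) ∘ (Equiv.sigmaFiberEquiv μ)) ⟨α, e⟩ := by
      funext e
      simp only [Function.comp, Equiv.sigmaFiberEquiv, Equiv.coe_fn_mk, e.2]
    rw [← h7]
    have h5 : Summable fun e : {w // μ w = α} => a e.1 := by
      rw [← (Equiv.sigmaFiberEquiv μ).summable_iff] at hsum
      have hs2 := (summable_sigma_of_nonneg
        (fun w => by simp only [Function.comp]; positivity)).1 hsum
      have e1 : ∀ e : {w // μ w = α}, |a e.1| * r ^ ∑ i, μ e.1 i = |a e.1| * r ^ ∑ i, α i :=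
        fun e => by rw [e.2]
      have := hs2.1 α
      simp only [Function.comp, Equiv.sigmaFiberEquiv, Equiv.coe_fn_mk, e1] at this
      exact ((summable_mul_right_iff (pow_ne_zero _ hrpos.ne')).1 this).of_abs
    exact h5.hasSum.mul_right _

end Tame

namespace Tame
open Filter Topology

section Division

variable {N : ℕ}

local notation "PS" => MvPowerSeries (Fin N) ℝ

/-- An injective monoid homomorphism from exponents to positive integers. -/
def primeIndex (α : Fin N →₀ ℕ) : ℕ := ∏ i : Fin N, Nat.nth Nat.Prime (i : ℕ) ^ α i

lemma primeIndex_pos (α : Fin N →₀ ℕ) : 0 < primeIndex α :=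
  Finset.prod_pos fun i _ => pow_pos (Nat.prime_nth_prime i).pos _

lemma primeIndex_add (α β : Fin N →₀ ℕ) :
    primeIndex (α + β) = primeIndex α * primeIndex β := by
  simp [primeIndex, pow_add, Finset.prod_mul_distrib]

lemma primeIndex_injective : Function.Injective (primeIndex (N := N)) := by
  have key : ∀ (α : Fin N →₀ ℕ) (j : Fin N),
      (primeIndex α).factorization (Nat.nth Nat.Prime j) = α j := by
    intro α j
    rw [primeIndex, Nat.factorization_prod fun (i : Fin N) _ =>
      pow_ne_zero _ (Nat.prime_nth_prime i).ne_zero]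
    simp only [Nat.factorization_pow, Finsupp.coe_finsetSum, Finset.sum_apply, Finsupp.smul_apply,
      (Nat.prime_nth_prime _).factorization, Finsupp.single_apply, smul_eq_mul]
    rw [Finset.sum_eq_single j]
    · simp
    · intro i _ hij
      rw [if_neg]
      · simp
      · intro h
        exact hij (Fin.ext (Nat.nth_injective Nat.infinite_setOfPred_prime h))
    · simp
  intro α β h
  ext j
  rw [← key α j, ← key β j, h]

/-- Weights of exponents, decreasing in `τ`. -/
def wt (τ : ℕ) (α : Fin N →₀ ℕ) : ℝ≥0∞ := ((primeIndex α : ℝ≥0∞)⁻¹) ^ τ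

lemma wt_add (τ : ℕ) (α β : Fin N →₀ ℕ) : wt τ (α + β) = wt τ α * wt τ β := by
  rw [wt, primeIndex_add, wt, wt, ← mul_pow]
  push_cast
  rw [ENNReal.mul_inv] <;> simp

lemma wt_ne_zero (τ : ℕ) (α : Fin N →₀ ℕ) : wt τ α ≠ 0 := by
  simp [wt]

lemma wt_ne_top (τ : ℕ) (α : Fin N →₀ ℕ) : wt τ α ≠ ∞ := by
  have := primeIndex_pos α
  simp [wt, this.ne']

lemma wt_anti {τ τ' : ℕ} (h : τ ≤ τ') (α : Fin N →₀ ℕ) : wt τ' α ≤ wt τ α := by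
  refine pow_le_pow_right_of_le_one' ?_ h
  simpa using Nat.one_le_iff_ne_zero.2 (primeIndex_pos α).ne'

/-- Weighted `ℓ¹` norm of a power series. -/
def nrm (τ : ℕ) (f : PS) : ℝ≥0∞ := ∑' α, ‖MvPowerSeries.coeff α f‖ₑ * wt τ α

lemma coeff_le_nrm (τ : ℕ) (f : PS) (α : Fin N →₀ ℕ) :
    ‖MvPowerSeries.coeff α f‖ₑ * wt τ α ≤ nrm τ f :=
  ENNReal.le_tsum (f := fun α => ‖MvPowerSeries.coeff α f‖ₑ * wt τ α) α

lemma nrm_anti {τ τ' : ℕ} (h : τ ≤ τ') (f : PS) : nrm τ' f ≤ nrm τ f :=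
  ENNReal.tsum_le_tsum fun α => mul_le_mul_right (wt_anti h α) _

lemma nrm_zero (τ : ℕ) : nrm τ (0 : PS) = 0 := by simp [nrm]

lemma nrm_neg (τ : ℕ) (f : PS) : nrm τ (-f) = nrm τ f := by simp [nrm]

lemma nrm_add_le (τ : ℕ) (f g : PS) : nrm τ (f + g) ≤ nrm τ f + nrm τ g := by
  rw [nrm, nrm, nrm, ← ENNReal.tsum_add]
  refine ENNReal.tsum_le_tsum fun α => ?_
  rw [map_add, ← add_mul]
  exact mul_le_mul_left (enorm_add_le _ _) _

lemma nrm_sum_le {ι : Type*} (τ : ℕ) (s : Finset ι) (f : ι → PS) :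
    nrm τ (∑ i ∈ s, f i) ≤ ∑ i ∈ s, nrm τ (f i) := by
  classical
  induction s using Finset.induction_on with
  | empty => simp [nrm_zero]
  | insert a s ha ih =>
    rw [Finset.sum_insert ha, Finset.sum_insert ha]
    exact (nrm_add_le _ _ _).trans (by gcongr)

lemma nrm_mul_le (τ : ℕ) (f g : PS) : nrm τ (f * g) ≤ nrm τ f * nrm τ g := by
  classical
  calc nrm τ (f * g) ≤ ∑' α, ∑ p ∈ Finset.HasAntidiagonal.antidiagonal α,
        (‖MvPowerSeries.coeff p.1 f‖ₑ * wt τ p.1) * (‖MvPowerSeries.coeff p.2 g‖ₑ * wt τ p.2) := by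
        refine ENNReal.tsum_le_tsum fun α => ?_
        rw [MvPowerSeries.coeff_mul]
        refine (mul_le_mul_left (enorm_sum_le _ _) _).trans ?_
        rw [Finset.sum_mul]
        refine Finset.sum_le_sum fun p hp => ?_
        rw [← Finset.HasAntidiagonal.mem_antidiagonal.1 hp, wt_add, enorm_mul]
        apply le_of_eq; ring
    _ = ∑' x : (Σ α : Fin N →₀ ℕ, Finset.HasAntidiagonal.antidiagonal α),
        (‖MvPowerSeries.coeff x.2.1.1 f‖ₑ * wt τ x.2.1.1) *
          (‖MvPowerSeries.coeff x.2.1.2 g‖ₑ * wt τ x.2.1.2) := by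
        rw [ENNReal.tsum_sigma']
        refine tsum_congr fun α => ?_
        rw [tsum_fintype, ← Finset.sum_coe_sort]
    _ = ∑' x : (Fin N →₀ ℕ) × (Fin N →₀ ℕ),
        (‖MvPowerSeries.coeff x.1 f‖ₑ * wt τ x.1) * (‖MvPowerSeries.coeff x.2 g‖ₑ * wt τ x.2) :=
        Finset.HasAntidiagonal.sigmaAntidiagonalEquivProd.tsum_eq
          (fun x : (Fin N →₀ ℕ) × (Fin N →₀ ℕ) =>
            (‖MvPowerSeries.coeff x.1 f‖ₑ * wt τ x.1) * (‖MvPowerSeries.coeff x.2 g‖ₑ * wt τ x.2))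
    _ = nrm τ f * nrm τ g := by
        rw [ENNReal.tsum_prod', nrm, nrm, ← ENNReal.tsum_mul_right]
        refine tsum_congr fun a => ?_
        dsimp only
        rw [ENNReal.tsum_mul_left]

lemma nrm_one (τ : ℕ) : nrm τ (1 : PS) ≠ ∞ := by
  classical
  rw [nrm, tsum_eq_single 0]
  · simp [wt, primeIndex]
  · intro α h
    simp [MvPowerSeries.coeff_one, h]

/-- The ring of power series of finite norm for some `τ`. -/
def convSeries (N : ℕ) : Subring (MvPowerSeries (Fin N) ℝ) where
  carrier := {f | ∃ τ, nrm τ f ≠ ∞}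
  mul_mem' := by
    rintro f g ⟨a, ha⟩ ⟨b, hb⟩
    refine ⟨max a b, ne_top_of_le_ne_top (ENNReal.mul_ne_top ?_ ?_) (nrm_mul_le _ _ _)⟩
    · exact ne_top_of_le_ne_top ha (nrm_anti (le_max_left _ _) _)
    · exact ne_top_of_le_ne_top hb (nrm_anti (le_max_right _ _) _)
  add_mem' := by
    rintro f g ⟨a, ha⟩ ⟨b, hb⟩
    refine ⟨max a b, ne_top_of_le_ne_top (ENNReal.add_ne_top.2 ⟨?_, ?_⟩) (nrm_add_le _ _ _)⟩
    · exact ne_top_of_le_ne_top ha (nrm_anti (le_max_left _ _) _)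
    · exact ne_top_of_le_ne_top hb (nrm_anti (le_max_right _ _) _)
  one_mem' := ⟨0, nrm_one 0⟩
  zero_mem' := ⟨0, by simp [nrm_zero]⟩
  neg_mem' := by
    rintro f ⟨a, ha⟩
    exact ⟨a, by rwa [nrm_neg]⟩

/-- For large `τ` the lowest monomial dominates. -/
lemma exists_nrm_sub_monomial_le {f : PS} {α : Fin N →₀ ℕ} {τ₁ : ℕ} (hf : nrm τ₁ f ≠ ∞)
    (hα : MvPowerSeries.coeff α f = 1)
    (hmin : ∀ β, MvPowerSeries.coeff β f ≠ 0 → primeIndex α ≤ primeIndex β) :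
    ∃ τ₂, ∀ τ, τ₂ ≤ τ → nrm τ (f - MvPowerSeries.monomial α 1) ≤ 2⁻¹ * wt τ α := by
  classical
  set n := primeIndex α with hn
  have hn0 : 0 < n := primeIndex_pos α
  have hq : (n : ℝ≥0∞) * ((n + 1 : ℕ) : ℝ≥0∞)⁻¹ < 1 := by
    rw [← div_eq_mul_inv]
    refine (ENNReal.div_lt_iff ?_ ?_).2 ?_
    · left; simp
    · left; simp
    · rw [one_mul]; exact_mod_cast Nat.lt_succ_self n
  have hlim := ENNReal.Tendsto.const_mul (a := nrm τ₁ f)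
    (ENNReal.tendsto_pow_atTop_nhds_zero_of_lt_one hq) (Or.inr hf)
  rw [mul_zero] at hlim
  have hpos : 0 < 2⁻¹ * wt τ₁ α := pos_iff_ne_zero.2 (mul_ne_zero (by simp) (wt_ne_zero _ _))
  obtain ⟨s₀, hs₀⟩ := eventually_atTop.1 (hlim.eventually (gt_mem_nhds hpos))
  refine ⟨τ₁ + s₀, fun τ hτ => ?_⟩
  obtain ⟨s, rfl⟩ : ∃ s, τ = τ₁ + s := ⟨τ - τ₁, by omega⟩
  have hs := (hs₀ s (by omega)).le
  have h1 : nrm (τ₁ + s) (f - MvPowerSeries.monomial α 1) ≤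
      nrm τ₁ f * (((n + 1 : ℕ) : ℝ≥0∞)⁻¹) ^ s := by
    rw [nrm, nrm, ← ENNReal.tsum_mul_right]
    refine ENNReal.tsum_le_tsum fun β => ?_
    by_cases hβ : β = α
    · subst hβ; simp [hα]
    rw [map_sub, MvPowerSeries.coeff_monomial, if_neg hβ, sub_zero]
    by_cases h0 : MvPowerSeries.coeff β f = 0
    · simp [h0]
    have h2 : n + 1 ≤ primeIndex β := by
      refine Nat.lt_of_le_of_ne (hmin β h0) fun h => hβ ?_
      exact (primeIndex_injective h).symm
    rw [wt, pow_add, mul_assoc]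
    gcongr
    rfl
  calc nrm (τ₁ + s) (f - MvPowerSeries.monomial α 1)
      ≤ nrm τ₁ f * (((n + 1 : ℕ) : ℝ≥0∞)⁻¹) ^ s := h1
    _ = (nrm τ₁ f * ((n : ℝ≥0∞) * ((n + 1 : ℕ) : ℝ≥0∞)⁻¹) ^ s) * ((n : ℝ≥0∞)⁻¹) ^ s := by
        rw [mul_pow, mul_assoc, mul_right_comm ((n : ℝ≥0∞) ^ s), ← mul_pow,
          ENNReal.mul_inv_cancel (by simp [hn0.ne']) (by simp), one_pow, one_mul]
    _ ≤ (2⁻¹ * wt τ₁ α) * ((n : ℝ≥0∞)⁻¹) ^ s := by gcongr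
    _ = 2⁻¹ * wt (τ₁ + s) α := by rw [wt, wt, pow_add, mul_assoc]

/-- Division of a convergent power series by finitely many series with dominating leading
monomials. -/
lemma exists_division {ι : Type*} (F : Finset ι) (ex : ι → Fin N →₀ ℕ) (f : ι → PS) (τ : ℕ)
    (hf : ∀ i ∈ F, nrm τ (f i - MvPowerSeries.monomial (ex i) 1) ≤ 2⁻¹ * wt τ (ex i))
    (g : PS) (hg : nrm τ g ≠ ∞) :
    ∃ (Q : ι → PS) (R : PS), g = ∑ i ∈ F, Q i * f i + R ∧
      (∀ i ∈ F, nrm τ (Q i) ≤ (2 * (wt τ (ex i))⁻¹) * nrm τ g) ∧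
      ∀ β, (∃ i ∈ F, ex i ≤ β) → MvPowerSeries.coeff β R = 0 := by
  classical
  set P : (Fin N →₀ ℕ) → Prop := fun β => ∃ i ∈ F, ex i ≤ β with hP
  let sel : ι → (Fin N →₀ ℕ) → Prop := fun i β => ∃ h : P β, h.choose = i
  let q : ι → PS → PS := fun i u β =>
    if sel i (β + ex i) then MvPowerSeries.coeff (β + ex i) u else 0
  let rem : PS → PS := fun u β => if P β then 0 else MvPowerSeries.coeff β u
  have hq : ∀ i u β, MvPowerSeries.coeff β (q i u) =
      if sel i (β + ex i) then MvPowerSeries.coeff (β + ex i) u else 0 := fun _ _ _ => rfl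
  have hrem : ∀ u β, MvPowerSeries.coeff β (rem u) =
      if P β then 0 else MvPowerSeries.coeff β u := fun _ _ => rfl
  have hqmon : ∀ i u β, MvPowerSeries.coeff β (q i u * MvPowerSeries.monomial (ex i) 1) =
      if sel i β ∧ ex i ≤ β then MvPowerSeries.coeff β u else 0 := by
    intro i u β
    rw [MvPowerSeries.coeff_mul_monomial, hq]
    by_cases h : ex i ≤ β
    · simp [h, tsub_add_cancel_of_le h]
    · simp [h]
  have hsplit : ∀ u, u = ∑ i ∈ F, q i u * MvPowerSeries.monomial (ex i) 1 + rem u := by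
    intro u
    ext β
    rw [map_add, map_sum, hrem]
    simp only [hqmon]
    by_cases h : P β
    · rw [if_pos h, Finset.sum_eq_single h.choose, if_pos ⟨⟨h, rfl⟩, h.choose_spec.2⟩, add_zero]
      · rintro i _ hne
        rw [if_neg]
        rintro ⟨⟨_, h'⟩, _⟩
        exact hne h'.symm
      · intro h'
        exact absurd h.choose_spec.1 h'
    · rw [if_neg h, Finset.sum_eq_zero, zero_add]
      intro i _
      rw [if_neg]
      rintro ⟨⟨h', _⟩, _⟩
      exact h h'
  have hnq : ∀ u, ∑ i ∈ F, nrm τ (q i u) * wt τ (ex i) ≤ nrm τ u := by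
    intro u
    have h1 : ∀ i ∈ F, nrm τ (q i u) * wt τ (ex i) ≤
        ∑' β, if sel i β then ‖MvPowerSeries.coeff β u‖ₑ * wt τ β else 0 := by
      intro i _
      rw [nrm, ← ENNReal.tsum_mul_right]
      calc _ = ∑' β, (fun β => if sel i β then ‖MvPowerSeries.coeff β u‖ₑ * wt τ β else 0)
            (β + ex i) := by
            refine tsum_congr fun β => ?_
            dsimp only
            rw [hq, wt_add]
            split_ifs
            · ring
            · simp
        _ ≤ _ := ENNReal.tsum_comp_le_tsum_of_injective (add_left_injective (ex i)) _
    refine (Finset.sum_le_sum h1).trans ?_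
    rw [← Summable.tsum_finsetSum fun _ _ => ENNReal.summable]
    refine ENNReal.tsum_le_tsum fun β => ?_
    by_cases h : P β
    · rw [Finset.sum_eq_single h.choose]
      · split_ifs <;> simp
      · intro i _ hne
        rw [if_neg]
        rintro ⟨_, h'⟩
        exact hne h'.symm
      · intro h'
        exact absurd h.choose_spec.1 h'
    · rw [Finset.sum_eq_zero]
      · exact zero_le
      · intro i _
        rw [if_neg]
        rintro ⟨h', _⟩
        exact h h'
  let T : PS → PS := fun u => -∑ i ∈ F, q i u * (f i - MvPowerSeries.monomial (ex i) 1)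
  have hT : ∀ u, nrm τ (T u) ≤ 2⁻¹ * nrm τ u := by
    intro u
    rw [nrm_neg]
    refine (nrm_sum_le _ _ _).trans ?_
    calc _ ≤ ∑ i ∈ F, 2⁻¹ * (nrm τ (q i u) * wt τ (ex i)) := by
          refine Finset.sum_le_sum fun i hi => (nrm_mul_le _ _ _).trans ?_
          refine (mul_le_mul_right (hf i hi) _).trans (le_of_eq ?_)
          ring
      _ ≤ _ := by
          rw [← Finset.mul_sum]
          exact mul_le_mul_right (hnq u) _
  have hstep : ∀ u, u = ∑ i ∈ F, q i u * f i + rem u + T u := by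
    intro u
    conv_lhs => rw [hsplit u]
    simp only [T, mul_sub, Finset.sum_sub_distrib]
    ring
  let G : ℕ → PS := fun k => T^[k] g
  have hG : ∀ k, nrm τ (G k) ≤ (2⁻¹) ^ k * nrm τ g := by
    intro k
    induction k with
    | zero => simp [G]
    | succ k ih =>
      simp only [G, Function.iterate_succ_apply']
      refine (hT _).trans ?_
      rw [pow_succ', mul_assoc]
      exact mul_le_mul_right ih _
  have hgeom : ∑' k : ℕ, ((2 : ℝ≥0∞)⁻¹) ^ k = 2 := by
    rw [ENNReal.tsum_geometric, ENNReal.one_sub_inv_two, inv_inv]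
  have hGsum : ∑' k, nrm τ (G k) ≤ 2 * nrm τ g := by
    refine (ENNReal.tsum_le_tsum hG).trans ?_
    rw [ENNReal.tsum_mul_right, hgeom]
  have hcoefG : ∀ β, Summable fun k => MvPowerSeries.coeff β (G k) := by
    intro β
    refine Summable.of_enorm ?_
    refine ne_top_of_le_ne_top (b := 2 * nrm τ g * (wt τ β)⁻¹) ?_ ?_
    · exact ENNReal.mul_ne_top (ENNReal.mul_ne_top (by simp) hg) (by simp [wt_ne_zero])
    · rw [← div_eq_mul_inv, ENNReal.le_div_iff_mul_le (Or.inl (wt_ne_zero _ _))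
        (Or.inl (wt_ne_top _ _)), ← ENNReal.tsum_mul_right]
      exact (ENNReal.tsum_le_tsum fun k => coeff_le_nrm τ (G k) β).trans hGsum
  have hiter : ∀ K, g = ∑ i ∈ F, (∑ k ∈ Finset.range K, q i (G k)) * f i +
      ∑ k ∈ Finset.range K, rem (G k) + G K := by
    intro K
    induction K with
    | zero => simp [G]
    | succ K ih =>
      have h1 : G K = ∑ i ∈ F, q i (G K) * f i + rem (G K) + G (K + 1) := by
        simp only [G, Function.iterate_succ_apply']
        exact hstep _
      conv_lhs => rw [ih, h1]
      simp only [Finset.sum_range_succ, add_mul, Finset.sum_add_distrib]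
      ring
  let Q : ι → PS := fun i β => ∑' k, MvPowerSeries.coeff β (q i (G k))
  have hQ : ∀ i β, MvPowerSeries.coeff β (Q i) = ∑' k, MvPowerSeries.coeff β (q i (G k)) :=
    fun _ _ => rfl
  have hQs : ∀ i β, Summable fun k => MvPowerSeries.coeff β (q i (G k)) := by
    intro i β
    simp only [hq]
    by_cases h : sel i (β + ex i)
    · simpa [h] using hcoefG (β + ex i)
    · simp [h, summable_zero]
  let R : PS := g - ∑ i ∈ F, Q i * f i
  refine ⟨Q, R, by simp [R], ?_, ?_⟩
  · intro i hi
    have h1 : nrm τ (Q i) ≤ ∑' k, nrm τ (q i (G k)) := by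
      simp only [nrm]
      rw [ENNReal.tsum_comm]
      refine ENNReal.tsum_le_tsum fun β => ?_
      rw [ENNReal.tsum_mul_right, hQ]
      gcongr
      exact enorm_tsum_le_tsum_enorm
    refine h1.trans ?_
    have h2 : ∀ k, nrm τ (q i (G k)) ≤ (wt τ (ex i))⁻¹ * nrm τ (G k) := by
      intro k
      rw [mul_comm, ← div_eq_mul_inv, ENNReal.le_div_iff_mul_le (Or.inl (wt_ne_zero _ _))
        (Or.inl (wt_ne_top _ _))]
      exact (Finset.single_le_sum (f := fun i => nrm τ (q i (G k)) * wt τ (ex i))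
        (fun _ _ => zero_le) hi).trans (hnq _)
    refine (ENNReal.tsum_le_tsum h2).trans ?_
    rw [ENNReal.tsum_mul_left, mul_comm 2, mul_assoc]
    exact mul_le_mul_right hGsum _
  · intro β hβ
    have hlim : Tendsto (fun K => MvPowerSeries.coeff β (∑ i ∈ F,
        (∑ k ∈ Finset.range K, q i (G k)) * f i)) atTop
        (𝓝 (MvPowerSeries.coeff β (∑ i ∈ F, Q i * f i))) := by
      simp only [map_sum, MvPowerSeries.coeff_mul]
      refine tendsto_finsetSum _ fun i _ => tendsto_finsetSum _ fun p _ => ?_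
      refine Tendsto.mul_const _ ?_
      exact (hQs i p.1).hasSum.tendsto_sum_nat
    have h0 := (hcoefG β).tendsto_atTop_zero
    have h1 : ∀ K, MvPowerSeries.coeff β g - MvPowerSeries.coeff β (∑ i ∈ F,
        (∑ k ∈ Finset.range K, q i (G k)) * f i) = MvPowerSeries.coeff β (G K) := by
      intro K
      conv_lhs => enter [1]; rw [hiter K]
      simp only [map_add]
      rw [map_sum (MvPowerSeries.coeff β) (fun k => rem (G k))]
      simp only [hrem, if_pos (show P β from hβ), Finset.sum_const_zero]
      ring
    have h2 := tendsto_const_nhds (x := MvPowerSeries.coeff β g).sub hlim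
    simp only [h1] at h2
    have h3 := tendsto_nhds_unique h2 h0
    simpa [R] using h3

lemma exists_leading {f : PS} (hf : f ≠ 0) :
    ∃ α, MvPowerSeries.coeff α f ≠ 0 ∧
      ∀ β, MvPowerSeries.coeff β f ≠ 0 → primeIndex α ≤ primeIndex β := by
  have hne : {α | MvPowerSeries.coeff α f ≠ 0}.Nonempty := by
    by_contra h
    rw [Set.not_nonempty_iff_eq_empty] at h
    refine hf (MvPowerSeries.ext fun α => ?_)
    by_contra h'
    have : α ∈ {α | MvPowerSeries.coeff α f ≠ 0} := h'
    rw [h] at this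
    exact this
  refine ⟨Function.argminOn primeIndex _ hne, Function.argminOn_mem primeIndex _ hne, fun β hβ => ?_⟩
  exact Function.argminOn_le primeIndex _ hβ

/-- Noetherianity of convergent power series with bounds, for a sequence of series. -/
theorem exists_uniform_generation (h : ℕ → PS) (τ₀ : ℕ) (hh : ∀ n, nrm τ₀ (h n) ≠ ∞) :
    ∃ (m τ : ℕ) (C : ℝ≥0∞) (Q : ℕ → ℕ → PS), C ≠ ∞ ∧
      ∀ n, h n = ∑ l ∈ Finset.range m, Q n l * h l ∧
        ∀ l ∈ Finset.range m, nrm τ (Q n l) ≤ C * nrm τ₀ (h n) := by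
  classical
  let J : Submodule (convSeries N) PS := Submodule.span (convSeries N) (Set.range h)
  have hsmul : ∀ (c : convSeries N) (x : PS), c • x = (c : PS) * x := fun _ _ => rfl
  have hJ : ∀ f ∈ J, f ∈ convSeries N := by
    intro f hf
    refine Submodule.span_induction ?_ (zero_mem _) (fun _ _ _ _ => add_mem) ?_ hf
    · rintro _ ⟨n, rfl⟩
      exact ⟨τ₀, hh n⟩
    · intro c x _ hx
      rw [hsmul]
      exact mul_mem c.2 hx
  let L : Set (Fin N →₀ ℕ) := {α | ∃ f ∈ J, MvPowerSeries.coeff α f = 1 ∧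
    ∀ β, MvPowerSeries.coeff β f ≠ 0 → primeIndex α ≤ primeIndex β}
  have hfin : {α | Minimal (· ∈ L) α}.Finite :=
    WellQuasiOrderedLE.finite_of_isAntichain (setOfPred_minimal_antichain _)
  set F := hfin.toFinset with hF
  have hFL : ∀ α ∈ F, α ∈ L := fun α hα => by
    rw [hF, Set.Finite.mem_toFinset] at hα
    exact hα.1
  have hup : ∀ β ∈ L, ∃ α ∈ F, α ≤ β := by
    intro β hβ
    obtain ⟨α, hαβ, hα⟩ := exists_minimal_le_of_wellFoundedLT (· ∈ L) β hβ
    exact ⟨α, by rw [hF, Set.Finite.mem_toFinset]; exact hα, hαβ⟩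
  have hlead : ∀ R ∈ J, (∀ β, (∃ α ∈ F, α ≤ β) → MvPowerSeries.coeff β R = 0) → R = 0 := by
    intro R hR h0
    by_contra hne
    obtain ⟨β, hβ, hmin⟩ := exists_leading hne
    have hc : MvPowerSeries.C (σ := Fin N) (MvPowerSeries.coeff β R)⁻¹ ∈ convSeries N := by
      refine ⟨0, ?_⟩
      rw [nrm, tsum_eq_single 0]
      · simp [wt]
      · intro α hα
        simp [MvPowerSeries.coeff_C, hα]
    refine hβ (h0 β (hup β ⟨_, J.smul_mem ⟨_, hc⟩ hR, ?_, fun γ hγ => hmin γ fun h' => hγ ?_⟩))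
    · rw [hsmul, MvPowerSeries.coeff_C_mul]
      exact inv_mul_cancel₀ hβ
    · rw [hsmul, MvPowerSeries.coeff_C_mul, h', mul_zero]
  have hex : ∀ α, ∃ f ∈ J, α ∈ F → MvPowerSeries.coeff α f = 1 ∧
      ∀ β, MvPowerSeries.coeff β f ≠ 0 → primeIndex α ≤ primeIndex β := by
    intro α
    by_cases hα : α ∈ F
    · obtain ⟨f, h1, h2⟩ := hFL α hα
      exact ⟨f, h1, fun _ => h2⟩
    · exact ⟨0, zero_mem _, fun h' => absurd h' hα⟩
  choose f hfJ hf using hex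
  have hc : ∀ α, ∃ c : ℕ →₀ convSeries N, (c.sum fun i a => a • h i) = f α := fun α =>
    Finsupp.mem_span_range_iff_exists_finsupp.1 (hfJ α)
  choose c hc using hc
  choose τ₁ hτ₁ using fun α => hJ (f α) (hfJ α)
  have hτ₂ : ∀ α, ∃ τ₂, ∀ τ, τ₂ ≤ τ → α ∈ F →
      nrm τ (f α - MvPowerSeries.monomial α 1) ≤ 2⁻¹ * wt τ α := by
    intro α
    by_cases hα : α ∈ F
    · obtain ⟨t, ht⟩ := exists_nrm_sub_monomial_le (hτ₁ α) (hf α hα).1 (hf α hα).2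
      exact ⟨t, fun τ h1 _ => ht τ h1⟩
    · exact ⟨0, fun _ _ h' => absurd h' hα⟩
  choose τ₂ hτ₂ using hτ₂
  choose τ₃ hτ₃ using fun α i => (c α i).2
  obtain ⟨m, hm⟩ : ∃ m, ∀ α ∈ F, ∀ i ∈ (c α).support, i < m := by
    refine ⟨(F.sup fun α => (c α).support.sup id) + 1, fun α hα i hi => Nat.lt_succ_of_le ?_⟩
    exact (Finset.le_sup (f := id) hi).trans
      (Finset.le_sup (f := fun α => (c α).support.sup id) hα)
  set τ := max τ₀ (F.sup fun α => max (τ₂ α) ((Finset.range m).sup (τ₃ α))) with hτ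
  have hτα : ∀ α ∈ F, max (τ₂ α) ((Finset.range m).sup (τ₃ α)) ≤ τ := fun α hα =>
    (Finset.le_sup (f := fun α => max (τ₂ α) ((Finset.range m).sup (τ₃ α))) hα).trans
      (le_max_right _ _)
  have hcn : ∀ α ∈ F, ∀ l ∈ Finset.range m, nrm τ (c α l : PS) ≠ ∞ := by
    intro α hα l hl
    refine ne_top_of_le_ne_top (hτ₃ α l) (nrm_anti ?_ _)
    exact ((Finset.le_sup (f := τ₃ α) hl).trans (le_max_right _ _)).trans (hτα α hα)
  have hfc : ∀ α ∈ F, f α = ∑ l ∈ Finset.range m, (c α l : PS) * h l := by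
    intro α hα
    rw [← hc α, Finsupp.sum_of_support_subset _ (fun i hi => Finset.mem_range.2 (hm α hα i hi))]
    · rfl
    · intro i _
      rw [zero_smul]
  have hdiv := fun n => exists_division F (fun α => α) f τ
    (fun α hα => hτ₂ α τ ((le_max_left _ _).trans (hτα α hα)) hα) (h n)
    (ne_top_of_le_ne_top (hh n) (nrm_anti (le_max_left _ _) _))
  choose Qd R hQR hQn hR0 using hdiv
  have hQd : ∀ n, ∀ α ∈ F, nrm τ (Qd n α) ≠ ∞ := fun n α hα =>
    ne_top_of_le_ne_top (ENNReal.mul_ne_top (ENNReal.mul_ne_top (by simp)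
      (by simp [wt_ne_zero])) (ne_top_of_le_ne_top (hh n) (nrm_anti (le_max_left _ _) _)))
      (hQn n α hα)
  have hR : ∀ n, R n = 0 := by
    intro n
    refine hlead (R n) ?_ (hR0 n)
    have : R n = h n - ∑ α ∈ F, Qd n α * f α := by
      conv_rhs => enter [1]; rw [hQR n]
      simp
    rw [this]
    refine sub_mem (Submodule.subset_span ⟨n, rfl⟩) (sum_mem fun α hα => ?_)
    exact J.smul_mem ⟨Qd n α, τ, hQd n α hα⟩ (hfJ α)
  refine ⟨m, τ, ∑ l ∈ Finset.range m, ∑ α ∈ F, 2 * (wt τ α)⁻¹ * nrm τ (c α l : PS),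
    fun n l => ∑ α ∈ F, Qd n α * c α l, ?_, fun n => ⟨?_, fun l hl => ?_⟩⟩
  · refine ENNReal.sum_ne_top.2 fun l hl => ENNReal.sum_ne_top.2 fun α hα => ?_
    exact ENNReal.mul_ne_top (ENNReal.mul_ne_top (by simp) (by simp [wt_ne_zero])) (hcn α hα l hl)
  · conv_lhs => rw [hQR n, hR n, add_zero]
    simp only [Finset.sum_mul]
    rw [Finset.sum_comm]
    refine Finset.sum_congr rfl fun α hα => ?_
    rw [hfc α hα, Finset.mul_sum]
    simp only [mul_assoc]
  · refine (nrm_sum_le _ _ _).trans ?_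
    calc _ ≤ ∑ α ∈ F, 2 * (wt τ α)⁻¹ * nrm τ (c α l : PS) * nrm τ₀ (h n) := by
          refine Finset.sum_le_sum fun α hα => (nrm_mul_le _ _ _).trans ?_
          refine (mul_le_mul_left (hQn n α hα) _).trans ?_
          rw [mul_right_comm]
          exact mul_le_mul_right (nrm_anti (le_max_left _ _) _) _
      _ = (∑ α ∈ F, 2 * (wt τ α)⁻¹ * nrm τ (c α l : PS)) * nrm τ₀ (h n) := by
          rw [Finset.sum_mul]
      _ ≤ _ := by
          refine mul_le_mul_left ?_ _
          exact Finset.single_le_sum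
            (f := fun l => ∑ α ∈ F, 2 * (wt τ α)⁻¹ * nrm τ (c α l : PS))
            (fun _ _ => zero_le) hl

end Division

end Tame

namespace Tame
open Filter Topology

lemma hasSum_congr {E : Type*} {f g : E → ℝ} {a : ℝ} (h : ∀ e, f e = g e) :
    HasSum f a ↔ HasSum g a := by
  rw [funext h]

section SeriesTwo

variable {κ : Type} [Fintype κ]

/-- The monomial `ε ^ μ * s ^ n`. -/
def mon (μ : κ → ℕ) (n : ℕ) (z : (κ → ℝ) × ℝ) : ℝ := (∏ i, z.1 i ^ μ i) * z.2 ^ n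

lemma analyticAt_tsum_two {E : Type*} {a : E → ℝ} {μ : E → κ → ℕ} {ν : E → ℕ} {r : ℝ} (hr : 0 < r)
    (ha : Summable fun e => |a e| * r ^ (∑ i, μ e i + ν e)) :
    AnalyticAt ℝ (fun z : (κ → ℝ) × ℝ => ∑' e, a e * mon (μ e) (ν e) z) 0 := by
  have h := analyticAt_tsum_monomial (κ := Option κ) (a := a)
    (μ := fun e o => o.elim (ν e) (μ e)) hr (by
      refine ha.congr fun e => ?_
      rw [Fintype.sum_option, add_comm]; rfl)
  have hL : AnalyticAt ℝ (fun z : (κ → ℝ) × ℝ => fun o : Option κ => o.elim z.2 z.1) 0 := by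
    rw [analyticAt_pi_iff]
    rintro (_ | i)
    · exact analyticAt_snd
    · exact ((ContinuousLinearMap.proj (R := ℝ) (φ := fun _ : κ => ℝ) i).analyticAt _).comp
        analyticAt_fst
  have h0 : (fun o : Option κ => o.elim (0 : (κ → ℝ) × ℝ).2 (0 : (κ → ℝ) × ℝ).1) = 0 := by
    ext (_ | i) <;> rfl
  have := AnalyticAt.comp_of_eq h hL h0
  refine this.congr (Eventually.of_forall fun z => ?_)
  refine tsum_congr fun e => ?_
  rw [Fintype.prod_option, mon, mul_comm (∏ i, z.1 i ^ μ e i)]; rfl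

/-- `z` lies in the closed polydisc of radius `r`. -/
def InBox (r : ℝ) (z : (κ → ℝ) × ℝ) : Prop := (∀ i, |z.1 i| ≤ r) ∧ |z.2| ≤ r

lemma eventually_inBox {r : ℝ} (hr : 0 < r) : ∀ᶠ z : (κ → ℝ) × ℝ in 𝓝 0, InBox r z := by
  refine ((eventually_all.2 fun i => ?_).and ?_)
  · have : Tendsto (fun z : (κ → ℝ) × ℝ => |z.1 i|) (𝓝 0) (𝓝 |(0 : (κ → ℝ) × ℝ).1 i|) :=
      (by fun_prop : Continuous fun z : (κ → ℝ) × ℝ => |z.1 i|).tendsto _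
    exact (this.eventually_lt_const (by simpa using hr)).mono fun _ => le_of_lt
  · have : Tendsto (fun z : (κ → ℝ) × ℝ => |z.2|) (𝓝 0) (𝓝 |(0 : (κ → ℝ) × ℝ).2|) :=
      (by fun_prop : Continuous fun z : (κ → ℝ) × ℝ => |z.2|).tendsto _
    exact (this.eventually_lt_const (by simpa using hr)).mono fun _ => le_of_lt

lemma abs_mon_le {r : ℝ} {z : (κ → ℝ) × ℝ} (hz : InBox r z) (μ : κ → ℕ) (n : ℕ) :
    |mon μ n z| ≤ r ^ (∑ i, μ i + n) := by
  rw [mon, abs_mul, pow_add, abs_pow]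
  have := abs_monomial_le hz.1 μ
  have h0 : 0 ≤ r := (abs_nonneg _).trans hz.2
  exact mul_le_mul this (pow_le_pow_left₀ (abs_nonneg _) hz.2 _) (by positivity) (by positivity)

lemma summable_two {E : Type*} {a : E → ℝ} {μ : E → κ → ℕ} {ν : E → ℕ} {r : ℝ}
    (ha : Summable fun e => |a e| * r ^ (∑ i, μ e i + ν e)) {z : (κ → ℝ) × ℝ} (hz : InBox r z) :
    Summable fun e => a e * mon (μ e) (ν e) z := by
  refine Summable.of_norm_bounded ha fun e => ?_
  rw [Real.norm_eq_abs, abs_mul]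
  exact mul_le_mul_of_nonneg_left (abs_mon_le hz _ _) (abs_nonneg _)

/-- `H` is the sum of the power series with coefficients `c` in the polydisc of radius `r`. -/
structure IsSeries (H : (κ → ℝ) × ℝ → ℝ) (c : (κ → ℕ) × ℕ → ℝ) (r : ℝ) : Prop where
  pos : 0 < r
  lt_one : r < 1
  summable : Summable fun e => |c e| * r ^ (∑ i, e.1 i + e.2)
  hasSum : ∀ z, InBox r z → HasSum (fun e => c e * mon e.1 e.2 z) (H z)

lemma exists_isSeries {H : (κ → ℝ) × ℝ → ℝ} (hH : AnalyticAt ℝ H 0) :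
    ∃ c r, IsSeries H c r := by
  have hL : AnalyticAt ℝ (fun x : Option κ → ℝ => ((fun i => x (some i), x none) : (κ → ℝ) × ℝ))
      0 := by
    refine AnalyticAt.prod ?_ ?_
    · rw [analyticAt_pi_iff]
      intro i
      exact (ContinuousLinearMap.proj (R := ℝ) (φ := fun _ : Option κ => ℝ) (some i)).analyticAt _
    · exact (ContinuousLinearMap.proj (R := ℝ) (φ := fun _ : Option κ => ℝ) none).analyticAt _
  obtain ⟨c, r, hr, hs, hsum⟩ := exists_monomial_series (AnalyticAt.comp_of_eq hH hL rfl)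
  let e : (κ → ℕ) × ℕ ≃ (Option κ → ℕ) := (Equiv.prodComm _ _).trans
    (Equiv.piOptionEquivProd (β := fun _ : Option κ => ℕ)).symm
  have he : ∀ p : (κ → ℕ) × ℕ, ∀ o, e p o = o.elim p.2 p.1 := by
    rintro p (_ | i) <;> rfl
  set r' : ℝ := min r (1 / 2) with hr'
  have hr'0 : 0 < r' := lt_min hr (by norm_num)
  refine ⟨fun p => c (e p), r', hr'0, (min_le_right _ _).trans_lt (by norm_num), ?_, ?_⟩
  · refine Summable.of_nonneg_of_le (fun p => by positivity) (fun p => ?_) (e.summable_iff.2 hs)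
    have : ∑ i, e p i = ∑ i, p.1 i + p.2 := by
      rw [Fintype.sum_option, add_comm]; rfl
    simp only [Function.comp, this]
    gcongr
    exact min_le_left _ _
  · intro z hz
    have := e.hasSum_iff.2 (hsum (fun o => o.elim z.2 z.1) (by
      rintro (_ | i)
      · exact hz.2.trans (min_le_left _ _)
      · exact (hz.1 i).trans (min_le_left _ _)))
    refine (hasSum_congr fun p => ?_).1 this
    simp only [Function.comp]
    rw [Fintype.prod_option, mon, mul_comm (∏ i, z.1 i ^ p.1 i)]; rfl

variable {H : (κ → ℝ) × ℝ → ℝ} {c : (κ → ℕ) × ℕ → ℝ} {r : ℝ}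

/-- Division with remainder by the last variable. -/
lemma exists_div (hH : AnalyticAt ℝ H 0) : ∃ H₁ : (κ → ℝ) × ℝ → ℝ, AnalyticAt ℝ H₁ 0 ∧
    ∀ᶠ z in 𝓝 0, H z = H (z.1, 0) + z.2 * H₁ z := by
  obtain ⟨c, r, hc⟩ := exists_isSeries hH
  have hinj : Function.Injective fun e : (κ → ℕ) × ℕ => (e.1, e.2 + 1) := by
    rintro ⟨a, b⟩ ⟨a', b'⟩ h
    simpa using h
  have hs : Summable fun e : (κ → ℕ) × ℕ => |c (e.1, e.2 + 1)| * r ^ (∑ i, e.1 i + e.2) := by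
    refine ((hc.summable.comp_injective hinj).mul_left r⁻¹).congr fun e => ?_
    have := hc.pos.ne'
    simp only [Function.comp, ← add_assoc, pow_succ]
    field_simp
  refine ⟨_, analyticAt_tsum_two hc.pos hs, ?_⟩
  filter_upwards [eventually_inBox hc.pos] with z hz
  have hz0 : InBox r (z.1, 0) := ⟨hz.1, by simpa using hc.pos.le⟩
  have h1 := (hc.hasSum z hz).sub (hc.hasSum _ hz0)
  rw [← hinj.hasSum_iff] at h1
  · have h2 := (summable_two hs hz).hasSum.mul_left z.2
    have : H z - H (z.1, 0) = _ := h1.unique ((hasSum_congr fun e => ?_).1 h2)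
    · linarith
    · simp [mon, pow_succ]; ring
  · rintro ⟨a, b⟩ hab
    cases b with
    | zero => simp [mon]
    | succ b => exact absurd ⟨(a, b), rfl⟩ hab

lemma IsSeries.hasDerivAt (hc : IsSeries H c r) {z : (κ → ℝ) × ℝ} (hz : ∀ i, |z.1 i| ≤ r)
    (hz2 : |z.2| < r / 2) : ∃ D, HasDerivAt (fun s => H (z.1, s)) D z.2 ∧
      HasSum (fun e => e.2 * c e * mon e.1 e.2 z) (z.2 * D) := by
  have hr := hc.pos
  have hb : ∀ (e : (κ → ℕ) × ℕ) (y : ℝ), y ∈ Metric.ball (0 : ℝ) (r / 2) →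
      ‖c e * ((∏ i, z.1 i ^ e.1 i) * (e.2 * y ^ (e.2 - 1)))‖ ≤
        2 / r * (|c e| * r ^ (∑ i, e.1 i + e.2)) := by
    intro e y hy
    have hy' : |y| ≤ r / 2 := by simpa using (mem_ball_zero_iff.1 hy).le
    have h1 : (e.2 : ℝ) * |y| ^ (e.2 - 1) ≤ 2 / r * r ^ e.2 := by
      rcases Nat.eq_zero_or_pos e.2 with h | h
      · simp [h]; positivity
      · obtain ⟨n, hn⟩ := Nat.exists_eq_succ_of_ne_zero h.ne'
        have h2 : ((n + 1 : ℕ) : ℝ) ≤ 2 ^ n := by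
          exact_mod_cast Nat.lt_two_pow_self
        calc (e.2 : ℝ) * |y| ^ (e.2 - 1) ≤ 2 ^ n * (r / 2) ^ n := by
              rw [hn]; simp only [Nat.succ_eq_add_one, Nat.add_sub_cancel]
              gcongr
          _ = r ^ n := by rw [← mul_pow]; congr 1; ring
          _ ≤ 2 * r ^ n := by nlinarith [pow_pos hr n]
          _ = 2 / r * r ^ e.2 := by rw [hn, pow_succ]; field_simp
    have h3 := abs_monomial_le hz e.1
    rw [Real.norm_eq_abs, abs_mul, abs_mul, abs_mul, abs_pow, Nat.abs_cast]
    calc _ ≤ |c e| * (r ^ (∑ i, e.1 i) * (2 / r * r ^ e.2)) := by gcongr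
      _ = _ := by rw [pow_add]; ring
  have hsum := hc.summable.mul_left (2 / r)
  have hzb : z.2 ∈ Metric.ball (0 : ℝ) (r / 2) := by simpa using hz2
  have hder := hasDerivAt_tsum_of_isPreconnected (g := fun e s => c e * mon e.1 e.2 (z.1, s))
    (g' := fun e y => c e * ((∏ i, z.1 i ^ e.1 i) * (e.2 * y ^ (e.2 - 1)))) hsum
    Metric.isOpen_ball (convex_ball (0 : ℝ) (r / 2)).isPreconnected
    (fun e y _ => by
      simpa only [mon] using
        ((hasDerivAt_pow e.2 y).const_mul (∏ i, z.1 i ^ e.1 i)).const_mul (c e)) hb hzb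
    (hc.hasSum z ⟨hz, hz2.le.trans (by linarith)⟩).summable hzb
  refine ⟨_, hder.congr_of_eventuallyEq ?_, ?_⟩
  · filter_upwards [Metric.isOpen_ball.mem_nhds hzb] with s hs
    have : |s| < r / 2 := by simpa using hs
    exact (hc.hasSum (z.1, s) ⟨hz, this.le.trans (by linarith)⟩).tsum_eq.symm
  · have := (Summable.of_norm_bounded hsum fun e => hb e z.2 hzb).hasSum.mul_left z.2
    refine (hasSum_congr fun e => ?_).1 this
    rw [mon]
    rcases e with ⟨a, b⟩
    cases b with
    | zero => simp
    | succ b => simp [pow_succ]; ring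

/-- Solution of the Euler type equation `lam * A + (s / m) ∂ₛ A = W`. -/
lemma exists_euler {W : (κ → ℝ) × ℝ → ℝ} (hW : AnalyticAt ℝ W 0) (lam : ℝ) {m : ℝ} (hm : 0 < m)
    (hl : ∀ n : ℕ, lam + n / m ≠ 0) : ∃ A : (κ → ℝ) × ℝ → ℝ, AnalyticAt ℝ A 0 ∧
    ∀ᶠ z in 𝓝 0, ∃ D, HasDerivAt (fun s => A (z.1, s)) D z.2 ∧
      lam * A z + z.2 / m * D = W z := by
  obtain ⟨c, r, hc⟩ := exists_isSeries hW
  obtain ⟨C, hC⟩ : ∃ C : ℝ, ∀ n : ℕ, |(lam + n / m)⁻¹| ≤ C := by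
    have : Tendsto (fun n : ℕ => (lam + n / m)⁻¹) atTop (𝓝 0) :=
      tendsto_inv_atTop_zero.comp (tendsto_atTop_add_const_left _ _
        (tendsto_natCast_atTop_atTop.atTop_div_const hm))
    obtain ⟨C, hC⟩ := (Metric.isBounded_range_of_tendsto _ this).exists_norm_le
    exact ⟨C, fun n => hC _ ⟨n, rfl⟩⟩
  have hs : Summable fun e : (κ → ℕ) × ℕ =>
      |(lam + e.2 / m)⁻¹ * c e| * r ^ (∑ i, e.1 i + e.2) := by
    refine Summable.of_nonneg_of_le (fun e => mul_nonneg (abs_nonneg _) (pow_nonneg hc.pos.le _))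
      (fun e => ?_) (hc.summable.mul_left C)
    rw [abs_mul, mul_assoc]
    exact mul_le_mul_of_nonneg_right (hC _) (mul_nonneg (abs_nonneg _) (pow_nonneg hc.pos.le _))
  have hA : IsSeries (fun z => ∑' e : (κ → ℕ) × ℕ, (lam + e.2 / m)⁻¹ * c e * mon e.1 e.2 z)
      (fun e => (lam + e.2 / m)⁻¹ * c e) r :=
    ⟨hc.pos, hc.lt_one, hs, fun z hz => (summable_two hs hz).hasSum⟩
  refine ⟨_, analyticAt_tsum_two hc.pos hs, ?_⟩
  filter_upwards [eventually_inBox (half_pos (half_pos hc.pos))] with z hz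
  have hr := hc.pos
  have hz' : InBox r z := ⟨fun i => (hz.1 i).trans (by linarith), hz.2.trans (by linarith)⟩
  obtain ⟨D, hD, hD'⟩ := hA.hasDerivAt hz'.1 (hz.2.trans_lt (by linarith))
  refine ⟨D, hD, ?_⟩
  have h1 := ((hA.hasSum z hz').mul_left lam).add (hD'.mul_left m⁻¹)
  refine (by rw [div_eq_inv_mul]; ring : _ = _).trans
    (h1.unique ((hasSum_congr fun e => ?_).1 (hc.hasSum z hz')))
  have := hl e.2
  have hm' := hm.ne'
  have h2 : (lam + e.2 / m)⁻¹ * (lam + e.2 / m) = 1 := inv_mul_cancel₀ this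
  linear_combination (-(c e * mon e.1 e.2 z)) * h2

/-- Replace the value at `none`. -/
def setNone {R : Type*} (x : Option κ → R) (t : R) : Option κ → R := fun o => o.elim t fun i => x (some i)

/-- Splitting of a series in `v = z.1 none` and `w = z.2` according to the sign of the
difference of the exponents of `w` and `v`. -/
lemma exists_split {H : (Option κ → ℝ) × ℝ → ℝ} (hH : AnalyticAt ℝ H 0) :
    ∃ W V : (Option κ → ℝ) × ℝ → ℝ, AnalyticAt ℝ W 0 ∧ AnalyticAt ℝ V 0 ∧
      (∀ x, V (x, 0) = 0) ∧ ∀ᶠ z in 𝓝 0,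
        H z = W (setNone z.1 (z.1 none * z.2), z.2) +
          V (setNone z.1 (z.1 none * z.2), z.1 none) := by
  classical
  obtain ⟨c, r, hc⟩ := exists_isSeries hH
  have hr := hc.pos
  have hr1 := hc.lt_one
  let E : Set ((Option κ → ℕ) × ℕ) := {e | e.1 none ≤ e.2}
  let μ : (Option κ → ℕ) × ℕ → Option κ → ℕ := fun e => setNone e.1 e.2
  have hle : ∀ e : (Option κ → ℕ) × ℕ, ∑ i, e.1 i = e.1 none + ∑ i, e.1 (some i) := fun e =>
    Fintype.sum_option _
  have hμ : ∀ e : (Option κ → ℕ) × ℕ, ∑ i, μ e i = e.2 + ∑ i, e.1 (some i) := fun e => by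
    rw [Fintype.sum_option]; rfl
  have hsW : Summable fun e : E => |c e| * (r ^ 2) ^ (∑ i, e.1.1 i + (e.1.2 - e.1.1 none)) := by
    refine Summable.of_nonneg_of_le (fun e => by positivity) (fun e => ?_)
      (hc.summable.comp_injective Subtype.val_injective)
    have h1 : e.1.1 none ≤ e.1.2 := e.2
    rw [← pow_mul]
    refine mul_le_mul_of_nonneg_left (pow_le_pow_of_le_one hr.le hr1.le ?_) (abs_nonneg _)
    have := hle e.1
    simp only [this]; omega
  have hsV : Summable fun e : (Eᶜ : Set _) =>
      |c e| * (r ^ 2) ^ (∑ i, μ e.1 i + (e.1.1 none - e.1.2)) := by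
    refine Summable.of_nonneg_of_le (fun e => by positivity) (fun e => ?_)
      (hc.summable.comp_injective Subtype.val_injective)
    have h1 : ¬ e.1.1 none ≤ e.1.2 := e.2
    rw [← pow_mul]
    refine mul_le_mul_of_nonneg_left (pow_le_pow_of_le_one hr.le hr1.le ?_) (abs_nonneg _)
    have := hle e.1
    have := hμ e.1
    simp only [*]; omega
  refine ⟨_, _, analyticAt_tsum_two (by positivity) hsW, analyticAt_tsum_two (by positivity) hsV,
    fun x => ?_, ?_⟩
  · refine (tsum_congr fun e => ?_).trans tsum_zero
    have h1 : ¬ e.1.1 none ≤ e.1.2 := e.2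
    simp [mon, show e.1.1 none - e.1.2 ≠ 0 by omega]
  · filter_upwards [eventually_inBox (show 0 < r ^ 2 by positivity)] with z hz
    have hrr : r ^ 2 ≤ r := by nlinarith
    have hz' : InBox r z := ⟨fun i => (hz.1 i).trans hrr, hz.2.trans hrr⟩
    have hup : ∀ i, |setNone z.1 (z.1 none * z.2) i| ≤ r ^ 2 := by
      rintro (_ | i)
      · simp only [setNone, Option.elim, abs_mul]
        have h1 := hz.1 none
        have h2 := hz'.2.trans hr1.le
        nlinarith [abs_nonneg (z.1 none), abs_nonneg z.2]
      · exact hz.1 (some i)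
    have hbW : InBox (r ^ 2) (setNone z.1 (z.1 none * z.2), z.2) := ⟨hup, hz.2⟩
    have hbV : InBox (r ^ 2) (setNone z.1 (z.1 none * z.2), z.1 none) :=
      ⟨hup, hz.1 none⟩
    have hW := (summable_two hsW hbW).hasSum
    have hV := (summable_two hsV hbV).hasSum
    have hprod : ∀ f : Option κ → ℕ, ∏ i, setNone z.1 (z.1 none * z.2) i ^ f i =
        (z.1 none * z.2) ^ f none * ∏ i, z.1 (some i) ^ f (some i) := fun f => by
      rw [Fintype.prod_option]; rfl
    have hmon : ∀ e : (Option κ → ℕ) × ℕ, mon e.1 e.2 z =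
        z.1 none ^ e.1 none * z.2 ^ e.2 * ∏ i, z.1 (some i) ^ e.1 (some i) := fun e => by
      rw [mon, Fintype.prod_option]; ring
    have h1 := (hasSum_congr (g := (fun e => c e * mon e.1 e.2 z) ∘ ((↑) : E → _))
      fun e => by
        simp only [Function.comp]
        rw [hmon]
        simp only [mon, hprod, mul_pow]
        have h1 : e.1.1 none ≤ e.1.2 := e.2
        obtain ⟨k, hk⟩ := Nat.exists_eq_add_of_le h1
        rw [hk, Nat.add_sub_cancel_left, pow_add]; ring).1 hW
    have h2 := (hasSum_congr (g := (fun e => c e * mon e.1 e.2 z) ∘ ((↑) : (Eᶜ : Set _) → _))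
      fun e => by
        simp only [Function.comp]
        rw [hmon]
        have h3 := hprod (μ e)
        have h4 : μ e none = e.1.2 := rfl
        have h5 : ∀ i, μ e (some i) = e.1.1 (some i) := fun i => rfl
        simp only [mon, h3, mul_pow, h4, h5]
        have h1 : ¬ e.1.1 none ≤ e.1.2 := e.2
        obtain ⟨k, hk⟩ := Nat.exists_eq_add_of_le (not_le.1 h1).le
        rw [hk, Nat.add_sub_cancel_left, pow_add]
        ring).1 hV
    exact (hc.hasSum z hz').unique (h1.add_compl h2)

end SeriesTwo

section Noetherian

variable {N : ℕ}

local notation "PS" => MvPowerSeries (Fin N) ℝ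

/-- Evaluation of a power series at a point. -/
def ev (f : PS) (x : Fin N → ℝ) : ℝ := ∑' α, MvPowerSeries.coeff α f * ∏ i, x i ^ α i

lemma wt_le (τ : ℕ) (α : Fin N →₀ ℕ) : wt τ α ≤ ENNReal.ofReal (((1 / 2 : ℝ) ^ τ) ^ ∑ i, α i) := by
  have h : (2 : ℝ) ^ ∑ i, α i ≤ primeIndex α := by
    have : 2 ^ ∑ i, α i ≤ primeIndex α := by
      rw [← Finset.prod_pow_eq_pow_sum]
      exact Finset.prod_le_prod' fun i _ =>
        Nat.pow_le_pow_left (Nat.prime_nth_prime i).two_le _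
    exact_mod_cast this
  have hp : (0 : ℝ) < primeIndex α := by exact_mod_cast primeIndex_pos α
  have : wt τ α = ENNReal.ofReal (((primeIndex α : ℝ)⁻¹) ^ τ) := by
    rw [wt, ENNReal.ofReal_pow (by positivity), ENNReal.ofReal_inv_of_pos hp,
      ENNReal.ofReal_natCast]
  rw [this, ← pow_mul, mul_comm τ, pow_mul]
  refine ENNReal.ofReal_le_ofReal (pow_le_pow_left₀ (by positivity) ?_ _)
  rw [one_div, inv_pow]
  exact inv_anti₀ (by positivity) h

lemma exists_le_wt (τ : ℕ) : ∃ r : ℝ, 0 < r ∧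
    ∀ α : Fin N →₀ ℕ, ENNReal.ofReal (r ^ ∑ i, α i) ≤ wt τ α := by
  set P : ℕ := ∏ i : Fin N, Nat.nth Nat.Prime (i : ℕ) with hP
  have hP0 : 0 < P := Finset.prod_pos fun i _ => (Nat.prime_nth_prime i).pos
  refine ⟨((P : ℝ)⁻¹) ^ τ, by positivity, fun α => ?_⟩
  have h : primeIndex α ≤ P ^ ∑ i, α i := by
    rw [← Finset.prod_pow_eq_pow_sum]
    exact Finset.prod_le_prod' fun i _ => Nat.pow_le_pow_left
      (Nat.le_of_dvd hP0 (Finset.dvd_prod_of_mem _ (Finset.mem_univ i))) _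
  have hp : (0 : ℝ) < primeIndex α := by exact_mod_cast primeIndex_pos α
  have : wt τ α = ENNReal.ofReal (((primeIndex α : ℝ)⁻¹) ^ τ) := by
    rw [wt, ENNReal.ofReal_pow (by positivity), ENNReal.ofReal_inv_of_pos hp,
      ENNReal.ofReal_natCast]
  rw [this, ← pow_mul, mul_comm τ, pow_mul]
  refine ENNReal.ofReal_le_ofReal (pow_le_pow_left₀ (by positivity) ?_ _)
  rw [inv_pow]
  exact inv_anti₀ hp (by exact_mod_cast h)

/-- Absolute convergence of a series of finite norm. -/
lemma summable_of_nrm {τ : ℕ} {r : ℝ} (hr : 0 < r)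
    (h : ∀ α : Fin N →₀ ℕ, ENNReal.ofReal (r ^ ∑ i, α i) ≤ wt τ α) {f : PS}
    (hf : nrm τ f ≠ ∞) :
    Summable fun α : Fin N →₀ ℕ => |MvPowerSeries.coeff α f| * r ^ ∑ i, α i := by
  have : ∑' α : Fin N →₀ ℕ, ENNReal.ofReal (|MvPowerSeries.coeff α f| * r ^ ∑ i, α i) ≠ ∞ := by
    refine ne_top_of_le_ne_top hf (ENNReal.tsum_le_tsum fun α => ?_)
    rw [ENNReal.ofReal_mul (abs_nonneg _), Real.enorm_eq_ofReal_abs]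
    exact mul_le_mul_right (h α) _
  exact (ENNReal.summable_toReal this).congr fun α => ENNReal.toReal_ofReal (by positivity)

lemma summable_ev {r : ℝ} {f : PS}
    (hf : Summable fun α : Fin N →₀ ℕ => |MvPowerSeries.coeff α f| * r ^ ∑ i, α i)
    {x : Fin N → ℝ} (hx : ∀ i, |x i| ≤ r) :
    Summable fun α : Fin N →₀ ℕ => ‖MvPowerSeries.coeff α f * ∏ i, x i ^ α i‖ := by
  refine Summable.of_nonneg_of_le (fun _ => norm_nonneg _) (fun α => ?_) hf
  rw [Real.norm_eq_abs, abs_mul]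
  exact mul_le_mul_of_nonneg_left (abs_monomial_le hx _) (abs_nonneg _)

lemma tsum_mul_antidiagonal {A : Type} [AddCommMonoid A] [Finset.HasAntidiagonal A] {f g : A → ℝ}
    (h1 : Summable fun a => ‖f a‖) (h2 : Summable fun a => ‖g a‖) :
    ∑' a, ∑ p ∈ Finset.HasAntidiagonal.antidiagonal a, f p.1 * g p.2 = (∑' a, f a) * ∑' a, g a :=
  (h1.of_norm.tsum_mul_tsum_eq_tsum_sum_antidiagonal h2.of_norm
    (summable_mul_of_summable_norm h1 h2)).symm

lemma ev_mul {r : ℝ} {f g : PS}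
    (hf : Summable fun α : Fin N →₀ ℕ => |MvPowerSeries.coeff α f| * r ^ ∑ i, α i)
    (hg : Summable fun α : Fin N →₀ ℕ => |MvPowerSeries.coeff α g| * r ^ ∑ i, α i)
    {x : Fin N → ℝ} (hx : ∀ i, |x i| ≤ r) : ev (f * g) x = ev f x * ev g x := by
  classical
  refine Eq.trans (tsum_congr fun α => ?_)
    (tsum_mul_antidiagonal (summable_ev hf hx) (summable_ev hg hx))
  rw [MvPowerSeries.coeff_mul, Finset.sum_mul]
  refine Finset.sum_congr rfl fun p hp => ?_
  have hp' : α = p.1 + p.2 := (Finset.HasAntidiagonal.mem_antidiagonal.1 hp).symm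
  have : ∏ i, x i ^ α i = (∏ i, x i ^ p.1 i) * ∏ i, x i ^ p.2 i := by
    rw [hp', ← Finset.prod_mul_distrib]
    exact Finset.prod_congr rfl fun i _ => by rw [Finsupp.add_apply, pow_add]
  rw [this]
  ring

lemma analyticAt_ev {r : ℝ} (hr : 0 < r) {f : PS}
    (hf : Summable fun α : Fin N →₀ ℕ => |MvPowerSeries.coeff α f| * r ^ ∑ i, α i) :
    AnalyticAt ℝ (ev f) 0 :=
  analyticAt_tsum_monomial (μ := fun (α : Fin N →₀ ℕ) i => α i) hr hf

lemma summable_family {τ : ℕ} {ρ : ℝ} (hρ : 0 < ρ)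
    (hw : ∀ α : Fin N →₀ ℕ, ENNReal.ofReal (ρ ^ ∑ i, α i) ≤ wt τ α) {f : ℕ → PS}
    (hf : ∑' n, nrm τ (f n) * ENNReal.ofReal (ρ ^ n) ≠ ∞) :
    Summable fun e : ℕ × (Fin N →₀ ℕ) =>
      |MvPowerSeries.coeff e.2 (f e.1)| * ρ ^ (∑ i, e.2 i + e.1) := by
  have : ∑' e : ℕ × (Fin N →₀ ℕ),
      ENNReal.ofReal (|MvPowerSeries.coeff e.2 (f e.1)| * ρ ^ (∑ i, e.2 i + e.1)) ≠ ∞ := by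
    rw [ENNReal.tsum_prod']
    refine ne_top_of_le_ne_top hf (ENNReal.tsum_le_tsum fun n => ?_)
    rw [nrm, ← ENNReal.tsum_mul_right]
    refine ENNReal.tsum_le_tsum fun α => ?_
    rw [pow_add, ← mul_assoc, ENNReal.ofReal_mul (by positivity),
      ENNReal.ofReal_mul (abs_nonneg _), Real.enorm_eq_ofReal_abs]
    exact mul_le_mul_left (mul_le_mul_right (hw α) _) _
  exact (ENNReal.summable_toReal this).congr fun α => ENNReal.toReal_ofReal (by positivity)

lemma hasSum_family {ρ : ℝ} {f : ℕ → PS}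
    (hf : Summable fun e : ℕ × (Fin N →₀ ℕ) =>
      |MvPowerSeries.coeff e.2 (f e.1)| * ρ ^ (∑ i, e.2 i + e.1)) {z : (Fin N → ℝ) × ℝ}
    (hz : InBox ρ z) : HasSum (fun n => ev (f n) z.1 * z.2 ^ n)
      (∑' e : ℕ × (Fin N →₀ ℕ), MvPowerSeries.coeff e.2 (f e.1) * mon (⇑e.2) e.1 z) := by
  have h1 := summable_two (μ := fun e : ℕ × (Fin N →₀ ℕ) => ⇑e.2) (ν := fun e => e.1) hf hz
  refine (hasSum_congr fun n => ?_).1 (h1.hasSum.prod_fiberwise fun n => (h1.prod_factor n).hasSum)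
  rw [ev, ← tsum_mul_right]
  exact tsum_congr fun α => by rw [mon]; ring

lemma exists_family_sum {τ : ℕ} {ρ : ℝ} (hρ : 0 < ρ)
    (hw : ∀ α : Fin N →₀ ℕ, ENNReal.ofReal (ρ ^ ∑ i, α i) ≤ wt τ α) (f : ℕ → PS)
    (hf : ∑' n, nrm τ (f n) * ENNReal.ofReal (ρ ^ n) ≠ ∞) :
    ∃ Y : (Fin N → ℝ) × ℝ → ℝ, AnalyticAt ℝ Y 0 ∧
      ∀ z, InBox ρ z → HasSum (fun n => ev (f n) z.1 * z.2 ^ n) (Y z) := by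
  have h1 := summable_family hρ hw hf
  exact ⟨_, analyticAt_tsum_two (a := fun e : ℕ × (Fin N →₀ ℕ) => MvPowerSeries.coeff e.2 (f e.1))
    (μ := fun e : ℕ × (Fin N →₀ ℕ) => ⇑e.2) (ν := fun e => e.1) hρ h1,
    fun z hz => hasSum_family (f := f) h1 hz⟩

lemma exists_family {H : (Fin N → ℝ) × ℝ → ℝ} (hH : AnalyticAt ℝ H 0) :
    ∃ (h : ℕ → PS) (τ₀ : ℕ) (r : ℝ), 0 < r ∧
      ∑' n, nrm τ₀ (h n) * ENNReal.ofReal (r ^ n) ≠ ∞ ∧ ∀ z, InBox r z →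
        H z = ∑' e : ℕ × (Fin N →₀ ℕ), MvPowerSeries.coeff e.2 (h e.1) * mon (⇑e.2) e.1 z := by
  obtain ⟨c, r, hc⟩ := exists_isSeries hH
  have hr := hc.pos
  obtain ⟨τ₀, hτ₀⟩ : ∃ τ : ℕ, (1 / 2 : ℝ) ^ τ < r := exists_pow_lt_of_lt_one hr (by norm_num)
  obtain ⟨h, hcoeff⟩ : ∃ h : ℕ → PS, ∀ n (α : Fin N →₀ ℕ),
      MvPowerSeries.coeff α (h n) = c (⇑α, n) := ⟨fun n α => c (⇑α, n), fun n α => rfl⟩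
  have hwt : ∀ α : Fin N →₀ ℕ, wt τ₀ α ≤ ENNReal.ofReal (r ^ ∑ i, α i) := fun α =>
    (wt_le τ₀ α).trans (ENNReal.ofReal_le_ofReal (pow_le_pow_left₀ (by positivity) hτ₀.le _))
  obtain ⟨e, he⟩ : ∃ e : ℕ × (Fin N →₀ ℕ) ≃ (Fin N → ℕ) × ℕ, ∀ x, e x = (⇑x.2, x.1) :=
    ⟨(Equiv.prodComm _ _).trans (Equiv.prodCongr Finsupp.equivFunOnFinite (Equiv.refl _)),
      fun x => rfl⟩
  refine ⟨h, τ₀, r, hr, ?_, fun z hz => ?_⟩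
  · have h1 := e.summable_iff.2 hc.summable
    refine ne_top_of_le_ne_top h1.tsum_ofReal_ne_top ?_
    rw [ENNReal.tsum_prod']
    refine ENNReal.tsum_le_tsum fun n => ?_
    rw [nrm, ← ENNReal.tsum_mul_right]
    refine ENNReal.tsum_le_tsum fun α => ?_
    rw [Function.comp, he, pow_add, ← mul_assoc, ENNReal.ofReal_mul (by positivity),
      ENNReal.ofReal_mul (abs_nonneg _), Real.enorm_eq_ofReal_abs, hcoeff]
    exact mul_le_mul_left (mul_le_mul_right (hwt α) _) _
  · rw [← (hc.hasSum z hz).tsum_eq, ← e.tsum_eq]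
    exact tsum_congr fun x => by rw [hcoeff, he]

lemma exists_noetherian_form_fin {H : (Fin N → ℝ) × ℝ → ℝ} (hH : AnalyticAt ℝ H 0) :
    ∃ (m : ℕ) (h : ℕ → (Fin N → ℝ) → ℝ) (X : ℕ → (Fin N → ℝ) × ℝ → ℝ),
      (∀ n, AnalyticAt ℝ (h n) 0) ∧ (∀ n, AnalyticAt ℝ (X n) 0) ∧
      ∀ᶠ z in 𝓝 0, H z = ∑ n ∈ Finset.range m, h n z.1 * z.2 ^ n * (1 + z.2 * X n z) := by
  obtain ⟨h, τ₀, r, hr, hsum, hHr⟩ := exists_family hH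
  have hfin : ∀ n, nrm τ₀ (h n) ≠ ∞ := fun n hn => by
    have := ENNReal.ne_top_of_tsum_ne_top hsum n
    rw [hn, ENNReal.top_mul (by simpa using pow_pos hr n)] at this
    exact this rfl
  obtain ⟨m, τ, C, Q, hC, hQ⟩ := exists_uniform_generation h τ₀ hfin
  obtain ⟨r₁, hr₁, hw₁⟩ := exists_le_wt (N := N) (max τ τ₀)
  set ρ : ℝ := min r r₁ with hρ
  have hρ0 : 0 < ρ := lt_min hr hr₁
  have hw : ∀ τ' ≤ max τ τ₀, ∀ α : Fin N →₀ ℕ, ENNReal.ofReal (ρ ^ ∑ i, α i) ≤ wt τ' α :=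
    fun τ' hτ' α => (ENNReal.ofReal_le_ofReal (pow_le_pow_left₀ hρ0.le (min_le_right _ _) _)).trans
      ((hw₁ α).trans (wt_anti hτ' α))
  have hsum' : ∑' n, nrm τ₀ (h n) * ENNReal.ofReal (ρ ^ n) ≠ ∞ := by
    refine ne_top_of_le_ne_top hsum (ENNReal.tsum_le_tsum fun n => mul_le_mul_right ?_ _)
    exact ENNReal.ofReal_le_ofReal (pow_le_pow_left₀ hρ0.le (min_le_left _ _) _)
  have hsumQ : ∀ l ∈ Finset.range m,
      ∑' n, nrm τ (Q (n + m) l) * ENNReal.ofReal (ρ ^ n) ≠ ∞ := by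
    intro l hl
    have h1 : ∀ n, nrm τ (Q (n + m) l) * ENNReal.ofReal (ρ ^ n) ≤
        C * ENNReal.ofReal (ρ ^ m)⁻¹ * (nrm τ₀ (h (n + m)) * ENNReal.ofReal (ρ ^ (n + m))) := by
      intro n
      have : ENNReal.ofReal (ρ ^ n) =
          ENNReal.ofReal (ρ ^ m)⁻¹ * ENNReal.ofReal (ρ ^ (n + m)) := by
        rw [← ENNReal.ofReal_mul (by positivity), pow_add]
        congr 1; field_simp
      rw [this, mul_mul_mul_comm]
      refine (mul_le_mul_left ((hQ (n + m)).2 l hl) _).trans (le_of_eq ?_)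
      ring
    refine ne_top_of_le_ne_top ?_ (ENNReal.tsum_le_tsum h1)
    rw [ENNReal.tsum_mul_left]
    refine ENNReal.mul_ne_top (ENNReal.mul_ne_top hC ENNReal.ofReal_ne_top) ?_
    exact ne_top_of_le_ne_top hsum' (ENNReal.tsum_comp_le_tsum_of_injective
      (add_left_injective m) fun n => nrm τ₀ (h n) * ENNReal.ofReal (ρ ^ n))
  have hsh : ∀ n, Summable fun α : Fin N →₀ ℕ => |MvPowerSeries.coeff α (h n)| * ρ ^ ∑ i, α i :=
    fun n => summable_of_nrm hρ0 (hw _ (le_max_right _ _)) (hfin n)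
  have hY : ∀ l, ∃ Y : (Fin N → ℝ) × ℝ → ℝ, AnalyticAt ℝ Y 0 ∧ (l ∈ Finset.range m →
      ∀ z, InBox ρ z → HasSum (fun n => ev (Q (n + m) l) z.1 * z.2 ^ n) (Y z)) := by
    intro l
    by_cases hl : l ∈ Finset.range m
    · obtain ⟨Y, hY1, hY2⟩ := exists_family_sum hρ0 (hw _ (le_max_left _ _))
        (fun n => Q (n + m) l) (hsumQ l hl)
      exact ⟨Y, hY1, fun _ => hY2⟩
    · exact ⟨fun _ => 0, analyticAt_const, fun h => absurd h hl⟩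
  choose Y hYa hYs using hY
  refine ⟨m, fun n => ev (h n), fun l z => z.2 ^ (m - 1 - l) * Y l z,
    fun n => analyticAt_ev hρ0 (hsh n), fun l => (analyticAt_snd.pow _).mul (hYa l), ?_⟩
  filter_upwards [eventually_inBox hρ0] with z hz
  have hz' : InBox r z :=
    ⟨fun i => (hz.1 i).trans (min_le_left _ _), hz.2.trans (min_le_left _ _)⟩
  have hHs : HasSum (fun n => ev (h n) z.1 * z.2 ^ n) (H z) := by
    rw [hHr z hz']
    exact hasSum_family (f := h) (summable_family hρ0 (hw _ (le_max_right _ _)) hsum') hz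
  have htail : HasSum (fun n => ev (h (n + m)) z.1 * z.2 ^ (n + m))
      (∑ l ∈ Finset.range m, Y l z * (ev (h l) z.1 * z.2 ^ m)) := by
    have h1 := hasSum_sum (s := Finset.range m) fun l hl =>
      (hYs l hl z hz).mul_right (ev (h l) z.1 * z.2 ^ m)
    refine (hasSum_congr fun n => ?_).1 h1
    have hsQ : ∀ l ∈ Finset.range m, Summable fun α : Fin N →₀ ℕ =>
        |MvPowerSeries.coeff α (Q (n + m) l)| * ρ ^ ∑ i, α i := fun l hl =>
      summable_of_nrm hρ0 (hw _ (le_max_left _ _)) (ne_top_of_le_ne_top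
        (ENNReal.mul_ne_top hC (hfin _)) ((hQ (n + m)).2 l hl))
    have h2 : ev (h (n + m)) z.1 =
        ∑ l ∈ Finset.range m, ev (Q (n + m) l) z.1 * ev (h l) z.1 := by
      rw [Finset.sum_congr rfl fun l hl => (ev_mul (hsQ l hl) (hsh l) hz.1).symm]
      conv_lhs => rw [(hQ (n + m)).1]
      simp only [ev, map_sum, Finset.sum_mul]
      refine Summable.tsum_finsetSum fun l hl => ?_
      refine (summable_ev (r := ρ) ?_ hz.1).of_norm
      refine summable_of_nrm hρ0 (hw _ le_rfl) (ne_top_of_le_ne_top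
        (ENNReal.mul_ne_top (ne_top_of_le_ne_top ?_ (nrm_anti (le_max_left τ τ₀) _))
          (ne_top_of_le_ne_top ?_ (nrm_anti (le_max_right τ τ₀) _))) (nrm_mul_le _ _ _))
      · exact ne_top_of_le_ne_top (ENNReal.mul_ne_top hC (hfin _)) ((hQ (n + m)).2 l hl)
      · exact hfin l
    rw [h2, Finset.sum_mul]
    refine Finset.sum_congr rfl fun l hl => ?_
    ring
  rw [← hHs.tsum_eq, ← hHs.summable.sum_add_tsum_nat_add m, htail.tsum_eq,
    ← Finset.sum_add_distrib]
  refine Finset.sum_congr rfl fun l hl => ?_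
  have hlm := Finset.mem_range.1 hl
  have : z.2 ^ m = z.2 ^ l * z.2 * z.2 ^ (m - 1 - l) := by
    rw [← pow_succ, ← pow_add]; congr 1; omega
  rw [this]; ring

end Noetherian

/-- Every analytic germ is a finite sum of terms `h n (ε) * s ^ n * unit`. -/
theorem exists_noetherian_form {κ : Type} [Fintype κ] {H : (κ → ℝ) × ℝ → ℝ}
    (hH : AnalyticAt ℝ H 0) :
    ∃ (m : ℕ) (h : ℕ → (κ → ℝ) → ℝ) (X : ℕ → (κ → ℝ) × ℝ → ℝ),
      (∀ n, AnalyticAt ℝ (h n) 0) ∧ (∀ n, AnalyticAt ℝ (X n) 0) ∧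
      ∀ᶠ z in 𝓝 0, H z = ∑ n ∈ Finset.range m, h n z.1 * z.2 ^ n * (1 + z.2 * X n z) := by
  let e := Fintype.equivFin κ
  let L : (κ → ℝ) →L[ℝ] (Fin (Fintype.card κ) → ℝ) :=
    ContinuousLinearMap.pi fun i => ContinuousLinearMap.proj (e.symm i)
  let L' : (Fin (Fintype.card κ) → ℝ) →L[ℝ] (κ → ℝ) :=
    ContinuousLinearMap.pi fun i => ContinuousLinearMap.proj (e i)
  have hL' : ∀ x, L' (L x) = x := fun x => by ext i; simp [L, L']
  have hLa : AnalyticAt ℝ L 0 := L.analyticAt _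
  have hL2 : AnalyticAt ℝ (fun z : (κ → ℝ) × ℝ => (L z.1, z.2)) 0 :=
    ((L.analyticAt _).comp analyticAt_fst).prod analyticAt_snd
  have hL2' : AnalyticAt ℝ (fun z : (Fin (Fintype.card κ) → ℝ) × ℝ => (L' z.1, z.2)) 0 :=
    ((L'.analyticAt _).comp analyticAt_fst).prod analyticAt_snd
  obtain ⟨m, h, X, hh, hX, hsum⟩ := exists_noetherian_form_fin
    (AnalyticAt.comp_of_eq hH hL2' (by simp))
  refine ⟨m, fun n x => h n (L x), fun n z => X n (L z.1, z.2),
    fun n => AnalyticAt.comp_of_eq (hh n) hLa (by simp),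
    fun n => AnalyticAt.comp_of_eq (hX n) hL2 (by simp), ?_⟩
  have ht : Tendsto (fun z : (κ → ℝ) × ℝ => (L z.1, z.2)) (𝓝 0) (𝓝 0) := by
    have := hL2.continuousAt.tendsto
    simpa [Prod.mk_zero_zero] using this
  filter_upwards [ht.eventually hsum] with z hz
  simpa [hL'] using hz

end Tame

namespace Tame
open Filter Topology

section Taylor

variable {κ : Type} [Fintype κ]

theorem tendsto_slice_zero : Tendsto (fun s : ℝ => ((0 : κ → ℝ), s)) (𝓝 0) (𝓝 0) := by
  have : Continuous (fun s : ℝ => ((0 : κ → ℝ), s)) := by fun_prop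
  simpa [Prod.mk_zero_zero] using this.tendsto 0

theorem tendsto_base_zero : Tendsto (fun x : κ → ℝ => (x, (0 : ℝ))) (𝓝 0) (𝓝 0) := by
  have : Continuous (fun x : κ → ℝ => (x, (0 : ℝ))) := by fun_prop
  simpa [Prod.mk_zero_zero] using this.tendsto 0

theorem analyticAt_base {H : (κ → ℝ) × ℝ → ℝ} (hH : AnalyticAt ℝ H 0) :
    AnalyticAt ℝ (fun x : κ → ℝ => H (x, 0)) 0 :=
  AnalyticAt.comp_of_eq hH (analyticAt_id.prod analyticAt_const) (by simp [Prod.mk_zero_zero])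

theorem analyticAt_fst_comp {h : (κ → ℝ) → ℝ} (hh : AnalyticAt ℝ h 0) :
    AnalyticAt ℝ (fun z : (κ → ℝ) × ℝ => h z.1) 0 :=
  AnalyticAt.comp_of_eq hh analyticAt_fst rfl

/-- Taylor expansion in the last variable. -/
theorem exists_taylor {H : (κ → ℝ) × ℝ → ℝ} (hH : AnalyticAt ℝ H 0) (d : ℕ) :
    ∃ (h : ℕ → (κ → ℝ) → ℝ) (K : (κ → ℝ) × ℝ → ℝ), (∀ n, AnalyticAt ℝ (h n) 0) ∧
      AnalyticAt ℝ K 0 ∧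
      ∀ᶠ z in 𝓝 0, H z = ∑ n ∈ Finset.range d, h n z.1 * z.2 ^ n + z.2 ^ d * K z := by
  induction d with
  | zero => exact ⟨fun _ _ => 0, H, fun _ => analyticAt_const, hH, by simp⟩
  | succ d ih =>
    obtain ⟨h, K, hh, hK, hz⟩ := ih
    obtain ⟨K₁, hK₁, hz₁⟩ := exists_div hK
    refine ⟨fun n => if n = d then fun x => K (x, 0) else h n, K₁, fun n => ?_, hK₁, ?_⟩
    · dsimp only
      split_ifs
      · exact analyticAt_base hK
      · exact hh n
    · filter_upwards [hz, hz₁] with z h1 h2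
      rw [h1, h2, Finset.sum_range_succ]
      have : ∀ n ∈ Finset.range d,
          (if n = d then fun x => K (x, 0) else h n) z.1 * z.2 ^ n = h n z.1 * z.2 ^ n := by
        intro n hn
        rw [if_neg (Finset.mem_range.1 hn).ne]
      rw [Finset.sum_congr rfl this]
      simp only [if_true]
      ring

/-- The partial derivative in the last variable. -/
def D (H : (κ → ℝ) × ℝ → ℝ) : (κ → ℝ) × ℝ → ℝ := fun z => fderiv ℝ H z (0, 1)

theorem analyticAt_D {H : (κ → ℝ) × ℝ → ℝ} {z : (κ → ℝ) × ℝ} (hH : AnalyticAt ℝ H z) :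
    AnalyticAt ℝ (D H) z :=
  ((ContinuousLinearMap.apply ℝ ℝ ((0 : κ → ℝ), (1 : ℝ))).analyticAt _).comp hH.fderiv

theorem analyticAt_D_iterate {H : (κ → ℝ) × ℝ → ℝ} {z : (κ → ℝ) × ℝ} (hH : AnalyticAt ℝ H z)
    (n : ℕ) : AnalyticAt ℝ (D^[n] H) z := by
  induction n with
  | zero => exact hH
  | succ n ih => rw [Function.iterate_succ_apply']; exact analyticAt_D ih

theorem hasDerivAt_D {H : (κ → ℝ) × ℝ → ℝ} {z : (κ → ℝ) × ℝ} (hH : AnalyticAt ℝ H z) :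
    HasDerivAt (fun s => H (z.1, s)) (D H z) z.2 := by
  have h1 : HasFDerivAt H (fderiv ℝ H z) (z.1, z.2) := hH.differentiableAt.hasFDerivAt
  have h2 : HasDerivAt (fun s : ℝ => (z.1, s)) ((0 : κ → ℝ), (1 : ℝ)) z.2 :=
    (hasDerivAt_const _ _).prodMk (hasDerivAt_id _)
  exact h1.comp_hasDerivAt z.2 h2

theorem D_congr {H H' : (κ → ℝ) × ℝ → ℝ} {z : (κ → ℝ) × ℝ} (h : H =ᶠ[𝓝 z] H') :
    D H =ᶠ[𝓝 z] D H' :=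
  h.fderiv.fun_comp (fun L => L (0, 1))

theorem D_eq_of_hasDerivAt {H H' : (κ → ℝ) × ℝ → ℝ} (hH : AnalyticAt ℝ H 0)
    (h : ∀ᶠ z in 𝓝 0, HasDerivAt (fun s => H (z.1, s)) (H' z) z.2) :
    D H =ᶠ[𝓝 0] H' := by
  filter_upwards [hH.eventually_analyticAt, h] with z h1 h2
  exact (hasDerivAt_D h1).unique h2

theorem D_iterate_taylor (d : ℕ) {H : (κ → ℝ) × ℝ → ℝ} (hH : AnalyticAt ℝ H 0)
    {h : ℕ → (κ → ℝ) → ℝ} {K : (κ → ℝ) × ℝ → ℝ} (hh : ∀ n, AnalyticAt ℝ (h n) 0)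
    (hK : AnalyticAt ℝ K 0)
    (hz : ∀ᶠ z in 𝓝 0, H z = ∑ n ∈ Finset.range d, h n z.1 * z.2 ^ n + z.2 ^ d * K z)
    {n : ℕ} (hn : n < d) :
    ∀ᶠ x in 𝓝 (0 : κ → ℝ), D^[n] H (x, 0) = n.factorial * h n x := by
  induction d generalizing H h K n with
  | zero => omega
  | succ d ih =>
    rcases n with _ | n
    · filter_upwards [tendsto_base_zero.eventually hz] with x hx
      rw [Function.iterate_zero, id, hx, Finset.sum_range_succ']
      simp
    · rw [Function.iterate_succ_apply]
      have hd : D H =ᶠ[𝓝 0] fun z => ∑ n ∈ Finset.range d, ((n + 1 : ℕ) * h (n + 1) z.1) * z.2 ^ n +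
          z.2 ^ d * ((d + 1 : ℕ) * K z + z.2 * D K z) := by
        refine D_eq_of_hasDerivAt hH ?_
        filter_upwards [hz.eventually_nhds, hK.eventually_analyticAt] with z h1 h2
        have h3 : HasDerivAt (fun s => ∑ n ∈ Finset.range (d + 1), h n z.1 * s ^ n +
            s ^ (d + 1) * K (z.1, s))
            (∑ n ∈ Finset.range (d + 1), h n z.1 * (n * z.2 ^ (n - 1)) +
              (((d + 1 : ℕ) * z.2 ^ (d + 1 - 1)) * K z + z.2 ^ (d + 1) * D K z)) z.2 := by
          refine HasDerivAt.add (HasDerivAt.fun_sum fun n _ => ?_) ?_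
          · exact (hasDerivAt_pow n z.2).const_mul _
          · exact (hasDerivAt_pow (d + 1) z.2).mul (hasDerivAt_D h2)
        have h4 : Tendsto (fun s : ℝ => (z.1, s)) (𝓝 z.2) (𝓝 z) := by
          have : Continuous (fun s : ℝ => (z.1, s)) := by fun_prop
          exact this.tendsto z.2
        refine (h3.congr_of_eventuallyEq (h4.eventually h1)).congr_deriv ?_
        rw [Finset.sum_range_succ']
        simp only [Nat.add_sub_cancel]
        push_cast
        have : ∀ n ∈ Finset.range d, h (n + 1) z.1 * (((n : ℝ) + 1) * z.2 ^ n) =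
            ((n : ℝ) + 1) * h (n + 1) z.1 * z.2 ^ n := fun n _ => by ring
        rw [Finset.sum_congr rfl this]
        ring
      have := ih (analyticAt_D hH) (h := fun n x => (n + 1 : ℕ) * h (n + 1) x)
        (K := fun z => (d + 1 : ℕ) * K z + z.2 * D K z)
        (fun n => analyticAt_const.mul (hh _))
        ((analyticAt_const.mul hK).add (analyticAt_snd.mul (analyticAt_D hK))) hd
        (n := n) (by omega)
      filter_upwards [this] with x hx
      rw [hx, Nat.factorial_succ]
      push_cast
      ring

theorem coeff_eq_zero_of_eventually (d : ℕ) {c : ℕ → ℝ} {k : ℝ → ℝ} (hk : ContinuousAt k 0)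
    (h : ∀ᶠ s in 𝓝[≠] (0 : ℝ), ∑ n ∈ Finset.range d, c n * s ^ n + s ^ d * k s = 0) :
    (∀ n < d, c n = 0) ∧ k 0 = 0 := by
  induction d generalizing c with
  | zero =>
    refine ⟨by simp, ?_⟩
    have h1 : Tendsto k (𝓝[≠] 0) (𝓝 (k 0)) := hk.tendsto.mono_left nhdsWithin_le_nhds
    refine tendsto_nhds_unique (h1.congr' ?_) tendsto_const_nhds
    filter_upwards [h] with s hs
    simpa using hs
  | succ d ih =>
    have h1 : Tendsto (fun s => ∑ n ∈ Finset.range (d + 1), c n * s ^ n + s ^ (d + 1) * k s)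
        (𝓝[≠] 0) (𝓝 (∑ n ∈ Finset.range (d + 1), c n * 0 ^ n + 0 ^ (d + 1) * k 0)) := by
      have : ContinuousAt (fun s => ∑ n ∈ Finset.range (d + 1), c n * s ^ n +
        s ^ (d + 1) * k s) 0 := by fun_prop
      exact this.tendsto.mono_left nhdsWithin_le_nhds
    have h2 : c 0 = 0 := by
      have := tendsto_nhds_unique (h1.congr' h) tendsto_const_nhds
      rw [Finset.sum_range_succ'] at this
      simpa using this
    have h3 := ih (c := fun n => c (n + 1)) (by
      filter_upwards [h, self_mem_nhdsWithin] with s hs hs0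
      rw [Finset.sum_range_succ', h2] at hs
      have : s * (∑ n ∈ Finset.range d, c (n + 1) * s ^ n + s ^ d * k s) = 0 := by
        rw [mul_add, Finset.mul_sum, ← hs]
        simp only [zero_mul, add_zero]
        congr 1
        · refine Finset.sum_congr rfl fun n _ => by ring
        · ring
      exact (mul_eq_zero.1 this).resolve_left hs0)
    refine ⟨fun n hn => ?_, h3.2⟩
    rcases n with _ | n
    · exact h2
    · exact h3.1 n (by omega)

/-- `H (0, ·)` vanishes to order exactly `d` at `0`. -/
def HasOrder (H : (κ → ℝ) × ℝ → ℝ) (d : ℕ) : Prop :=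
  ∃ g : ℝ → ℝ, AnalyticAt ℝ g 0 ∧ g 0 ≠ 0 ∧ ∀ᶠ s in 𝓝 (0 : ℝ), H (0, s) = s ^ d * g s

theorem exists_hasOrder {H : (κ → ℝ) × ℝ → ℝ} (hH : AnalyticAt ℝ H 0)
    (h : ¬ ∀ᶠ s in 𝓝 (0 : ℝ), H (0, s) = 0) : ∃ d, HasOrder H d := by
  have ha : AnalyticAt ℝ (fun s : ℝ => H (0, s)) 0 :=
    AnalyticAt.comp_of_eq hH (analyticAt_const.prod analyticAt_id) (by simp [Prod.mk_zero_zero])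
  obtain ⟨n, g, hg, hg0, hs⟩ := ha.exists_eventuallyEq_pow_smul_nonzero_iff.2 h
  exact ⟨n, g, hg, hg0, by simpa using hs⟩

theorem exists_hasOrder_lt {H : (κ → ℝ) × ℝ → ℝ} {p : Polynomial ℝ} {n : ℕ}
    (hn : p.coeff n ≠ 0) (h : ∀ᶠ s in 𝓝 (0 : ℝ), H (0, s) = p.eval s) :
    ∃ d ≤ n, HasOrder H d := by
  have hp : p ≠ 0 := by rintro rfl; simp at hn
  obtain ⟨q, hq⟩ := Polynomial.X_pow_dvd_iff.2 fun m (hm : m < p.natTrailingDegree) =>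
    Polynomial.coeff_eq_zero_of_lt_natTrailingDegree hm
  refine ⟨p.natTrailingDegree, Polynomial.natTrailingDegree_le_of_ne_zero hn,
    fun s => q.eval s, ?_, ?_, ?_⟩
  · exact AnalyticAt.aeval_polynomial (f := fun s : ℝ => s) analyticAt_id q |>.congr (by simp)
  · have h1 : p.coeff p.natTrailingDegree ≠ 0 := by
      simpa [Polynomial.trailingCoeff] using
        (Polynomial.trailingCoeff_nonzero_iff_nonzero.2 hp)
    have h2 : p.coeff p.natTrailingDegree = q.coeff 0 := by
      conv_lhs => rw [hq]
      rw [Polynomial.coeff_X_pow_mul', if_pos (by rw [← hq])]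
      congr 1
      rw [← hq]; simp
    rwa [h2, Polynomial.coeff_zero_eq_eval_zero] at h1
  · filter_upwards [h] with s hs
    rw [hs]
    conv_lhs => rw [hq]
    simp

theorem HasOrder.taylor {H : (κ → ℝ) × ℝ → ℝ} {d m : ℕ} (hd : HasOrder H d)
    {h : ℕ → (κ → ℝ) → ℝ} {K : (κ → ℝ) × ℝ → ℝ} (hK : AnalyticAt ℝ K 0)
    (hz : ∀ᶠ z in 𝓝 0, H z = ∑ n ∈ Finset.range m, h n z.1 * z.2 ^ n + z.2 ^ m * K z) :
    (m ≤ d → ∀ n < m, h n 0 = 0) ∧ (m = d → K 0 ≠ 0) ∧ (m = d + 1 → h d 0 ≠ 0) := by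
  obtain ⟨g, hg, hg0, hs⟩ := hd
  have hs' := hs.and (tendsto_slice_zero.eventually hz)
  have hKc : ContinuousAt (fun s : ℝ => K (0, s)) 0 :=
    ContinuousAt.comp (g := K) (by simpa [Prod.mk_zero_zero] using hK.continuousAt)
      (by fun_prop : Continuous fun s : ℝ => ((0 : κ → ℝ), s)).continuousAt
  have hgc := hg.continuousAt
  refine ⟨fun hmd => ?_, fun hmd => ?_, fun hmd => ?_⟩
  · refine (coeff_eq_zero_of_eventually m (k := fun s => K (0, s) - s ^ (d - m) * g s)
      (by fun_prop) ?_).1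
    refine Filter.Eventually.filter_mono nhdsWithin_le_nhds ?_
    filter_upwards [hs'] with s hs
    have : s ^ d = s ^ m * s ^ (d - m) := by rw [← pow_add]; congr 1; omega
    linear_combination hs.1 - hs.2 + g s * this
  · subst hmd
    have := (coeff_eq_zero_of_eventually m (c := fun n => h n 0)
      (k := fun s => K (0, s) - g s) (by fun_prop) (by
      refine Filter.Eventually.filter_mono nhdsWithin_le_nhds ?_
      filter_upwards [hs'] with s hs
      linear_combination hs.1 - hs.2)).2
    rw [show (0 : (κ → ℝ) × ℝ) = (0, 0) from rfl]
    intro h0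
    exact hg0 (by linarith)
  · subst hmd
    have := (coeff_eq_zero_of_eventually d (c := fun n => h n 0)
      (k := fun s => h d 0 + s * K (0, s) - g s) (by fun_prop) (by
      refine Filter.Eventually.filter_mono nhdsWithin_le_nhds ?_
      filter_upwards [hs'] with s hs
      have h2 := hs.2
      rw [Finset.sum_range_succ] at h2
      linear_combination hs.1 - h2)).2
    intro h0
    apply hg0
    simp only [zero_mul] at this
    linarith

theorem D_comp_shift {H : (κ → ℝ) × ℝ → ℝ} (hH : AnalyticAt ℝ H 0) {τ : (κ → ℝ) → ℝ}
    (hτ : AnalyticAt ℝ τ 0) (hτ0 : τ 0 = 0) (n : ℕ) :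
    D^[n] (fun z => H (z.1, τ z.1 + z.2)) =ᶠ[𝓝 0] fun z => D^[n] H (z.1, τ z.1 + z.2) := by
  have hΨ : AnalyticAt ℝ (fun z : (κ → ℝ) × ℝ => (z.1, τ z.1 + z.2)) 0 :=
    analyticAt_fst.prod ((analyticAt_fst_comp hτ).add analyticAt_snd)
  have hΨ0 : (fun z : (κ → ℝ) × ℝ => (z.1, τ z.1 + z.2)) 0 = 0 := by
    simp [hτ0, Prod.mk_zero_zero]
  have ht := hΨ.continuousAt.tendsto
  simp only [Prod.fst_zero, Prod.snd_zero, hτ0, add_zero, Prod.mk_zero_zero] at ht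
  induction n with
  | zero => exact EventuallyEq.rfl
  | succ n ih =>
    rw [Function.iterate_succ_apply', Function.iterate_succ_apply']
    refine (D_congr ih).trans (D_eq_of_hasDerivAt ?_ ?_)
    · exact AnalyticAt.comp_of_eq (analyticAt_D_iterate hH n) hΨ hΨ0
    · filter_upwards [ht.eventually (analyticAt_D_iterate hH n).eventually_analyticAt] with z hz
      exact (hasDerivAt_D hz).comp_const_add (τ z.1) z.2

/-- Tschirnhaus transformation: a shift kills the coefficient of index `d - 1`. -/
theorem exists_tschirnhaus {H : (κ → ℝ) × ℝ → ℝ} (hH : AnalyticAt ℝ H 0) {d : ℕ}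
    (hd : HasOrder H (d + 1)) :
    ∃ (τ : (κ → ℝ) → ℝ) (h : ℕ → (κ → ℝ) → ℝ) (K : (κ → ℝ) × ℝ → ℝ), AnalyticAt ℝ τ 0 ∧
      τ 0 = 0 ∧ (∀ n, AnalyticAt ℝ (h n) 0) ∧ (∀ n < d, h n 0 = 0) ∧ AnalyticAt ℝ K 0 ∧ K 0 ≠ 0 ∧
      ∀ᶠ z in 𝓝 0, H (z.1, τ z.1 + z.2) =
        ∑ n ∈ Finset.range d, h n z.1 * z.2 ^ n + z.2 ^ (d + 1) * K z := by
  obtain ⟨h₀, K₀, hh₀, hK₀, hz₀⟩ := exists_taylor hH (d + 1 + 1)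
  have hF := analyticAt_D_iterate hH d
  have hF0 : D^[d] H 0 = 0 := by
    have h1 := (D_iterate_taylor _ hH hh₀ hK₀ hz₀ (n := d) (by omega)).self_of_nhds
    rw [Prod.mk_zero_zero] at h1
    obtain ⟨h₁, K₁, hh₁, hK₁, hz₁⟩ := exists_taylor hH (d + 1)
    have h2 := (D_iterate_taylor _ hH hh₁ hK₁ hz₁ (n := d) (by omega)).self_of_nhds
    rw [Prod.mk_zero_zero] at h2
    rw [h2, (hd.taylor hK₁ hz₁).1 le_rfl d (by omega), mul_zero]
  have hF1 : D (D^[d] H) 0 ≠ 0 := by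
    have h1 := (D_iterate_taylor _ hH hh₀ hK₀ hz₀ (n := d + 1) (by omega)).self_of_nhds
    rw [Prod.mk_zero_zero, Function.iterate_succ_apply'] at h1
    rw [h1]
    exact mul_ne_zero (by positivity) ((hd.taylor hK₀ hz₀).2.2 rfl)
  have hinv : (fderiv ℝ (D^[d] H) (0, 0) ∘L .inr ℝ (κ → ℝ) ℝ).IsInvertible := by
    have hu : D (D^[d] H) (0, 0) ≠ 0 := hF1
    refine ⟨ContinuousLinearEquiv.unitsEquivAut ℝ (Units.mk0 _ hu), ?_⟩
    ext
    simp [D]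
  have hcd : ContDiffAt ℝ ⊤ (D^[d] H) ((0 : κ → ℝ), (0 : ℝ)) :=
    AnalyticAt.contDiffAt (by simpa [Prod.mk_zero_zero] using hF)
  have hne : (⊤ : WithTop ℕ∞) ≠ 0 := by simp
  obtain ⟨τ, hτ, hτ0, hτz⟩ : ∃ τ : (κ → ℝ) → ℝ, AnalyticAt ℝ τ 0 ∧ τ 0 = 0 ∧
      ∀ᶠ x in 𝓝 0, D^[d] H (x, τ x) = 0 := by
    refine ⟨hcd.implicitFunction hne hinv, ?_, ?_, ?_⟩
    · exact (hcd.contDiffAt_implicitFunction hne hinv).analyticAt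
    · exact hcd.implicitFunction_apply_self hne hinv
    · have := hcd.eventually_apply_implicitFunction hne hinv
      simp only [Prod.mk_zero_zero, hF0] at this
      simpa using this
  have hΨ : AnalyticAt ℝ (fun z : (κ → ℝ) × ℝ => (z.1, τ z.1 + z.2)) 0 :=
    analyticAt_fst.prod ((analyticAt_fst_comp hτ).add analyticAt_snd)
  have hH' : AnalyticAt ℝ (fun z : (κ → ℝ) × ℝ => H (z.1, τ z.1 + z.2)) 0 :=
    AnalyticAt.comp_of_eq hH hΨ (by simp [hτ0, Prod.mk_zero_zero])
  obtain ⟨h, K, hh, hK, hz⟩ := exists_taylor hH' (d + 1)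
  have hd' : HasOrder (fun z => H (z.1, τ z.1 + z.2)) (d + 1) := by
    obtain ⟨g, hg, hg0, hs⟩ := hd
    exact ⟨g, hg, hg0, by simpa [hτ0] using hs⟩
  refine ⟨τ, h, K, hτ, hτ0, hh, fun n hn => (hd'.taylor hK hz).1 le_rfl n (by omega), hK,
    (hd'.taylor hK hz).2.1 rfl, ?_⟩
  have h1 := D_iterate_taylor _ hH' hh hK hz (n := d) (by omega)
  have h2 := tendsto_base_zero.eventually (D_comp_shift hH hτ hτ0 d)
  have h3 : ∀ᶠ x in 𝓝 (0 : κ → ℝ), h d x = 0 := by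
    filter_upwards [h1, h2, hτz] with x h1 h2 h3
    simp only [add_zero] at h2
    rw [h2, h3] at h1
    rcases mul_eq_zero.1 h1.symm with h | h
    · exact absurd h (by positivity)
    · exact h
  have h4 : Tendsto (Prod.fst : (κ → ℝ) × ℝ → (κ → ℝ)) (𝓝 0) (𝓝 0) :=
    continuous_fst.tendsto 0
  filter_upwards [hz, h4.eventually h3] with z hz h5
  rw [hz, Finset.sum_range_succ, h5]
  ring

end Taylor

end Tame

namespace Tame
open Filter Topology

/-- The functions generated by `G` under ring operations, rational powers of absolute values and
restricted analytic functions. -/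
inductive IsTerm {X : Type} (G : Set (X → ℝ)) : (X → ℝ) → Prop
  | gen {f : X → ℝ} : f ∈ G → IsTerm G f
  | const (c : ℝ) : IsTerm G fun _ => c
  | add {f g : X → ℝ} : IsTerm G f → IsTerm G g → IsTerm G fun x => f x + g x
  | mul {f g : X → ℝ} : IsTerm G f → IsTerm G g → IsTerm G fun x => f x * g x
  | rpow {f : X → ℝ} (q : ℚ) : IsTerm G f → IsTerm G fun x => |f x| ^ (q : ℝ)
  | an {n : ℕ} {H : (Fin n → ℝ) → ℝ} {ψ : Fin n → X → ℝ} :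
      (∀ c, (∀ i, |c i| ≤ 1) → AnalyticAt ℝ H c) → (∀ i, IsTerm G (ψ i)) →
      IsTerm G fun x => if ∀ i, |ψ i x| ≤ 1 then H (fun i => ψ i x) else 0

namespace IsTerm

variable {X : Type} {G : Set (X → ℝ)} {f g : X → ℝ}

theorem congr (hf : IsTerm G f) (h : ∀ x, g x = f x) : IsTerm G g := (funext h) ▸ hf

theorem neg (hf : IsTerm G f) : IsTerm G fun x => -f x :=
  ((IsTerm.const (-1)).mul hf).congr fun x => by ring

theorem sub (hf : IsTerm G f) (hg : IsTerm G g) : IsTerm G fun x => f x - g x :=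
  (hf.add hg.neg).congr fun x => by ring

theorem abs (hf : IsTerm G f) : IsTerm G fun x => |f x| :=
  (hf.rpow 1).congr fun x => by simp

theorem inv (hf : IsTerm G f) : IsTerm G fun x => (f x)⁻¹ :=
  (hf.mul (hf.rpow (-2))).congr fun x => by
    push_cast
    rw [rpow_neg (abs_nonneg _), show (2 : ℝ) = (2 : ℕ) by norm_num, rpow_natCast, sq_abs]
    rcases eq_or_ne (f x) 0 with h | h
    · simp [h]
    · field_simp

theorem div (hf : IsTerm G f) (hg : IsTerm G g) : IsTerm G fun x => f x / g x :=
  (hf.mul hg.inv).congr fun x => by rw [div_eq_mul_inv]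

theorem pow (hf : IsTerm G f) (n : ℕ) : IsTerm G fun x => f x ^ n := by
  induction n with
  | zero => simpa using IsTerm.const 1
  | succ n ih => exact (ih.mul hf).congr fun x => by rw [pow_succ]

theorem sum {ι : Type} (s : Finset ι) {f : ι → X → ℝ} (hf : ∀ i ∈ s, IsTerm G (f i)) :
    IsTerm G fun x => ∑ i ∈ s, f i x := by
  classical
  induction s using Finset.induction_on with
  | empty => simpa using IsTerm.const 0
  | insert a s ha ih =>
    refine ((hf a (by simp)).add (ih fun i hi => hf i (by simp [hi]))).congr fun x => ?_
    rw [Finset.sum_insert ha]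

/-- Pullback of terms along a map. -/
theorem comp {Y : Type} {G' : Set (Y → ℝ)} {pr : Y → X} (h : ∀ g ∈ G, IsTerm G' fun y => g (pr y))
    (hf : IsTerm G f) : IsTerm G' fun y => f (pr y) := by
  induction hf with
  | gen h' => exact h _ h'
  | const c => exact .const c
  | add _ _ h1 h2 => exact h1.add h2
  | mul _ _ h1 h2 => exact h1.mul h2
  | rpow q _ h1 => exact h1.rpow q
  | an hH _ h1 => exact .an hH h1

end IsTerm

/-- Sets whose indicator function is a term. -/
def IsDef {X : Type} (G : Set (X → ℝ)) (A : Set X) : Prop := IsTerm G (A.indicator fun _ => 1)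

namespace IsDef

variable {X : Type} {G : Set (X → ℝ)} {f g : X → ℝ} {A B : Set X}

theorem univ : IsDef G univ := (IsTerm.const 1).congr fun x => by simp

theorem compl (hA : IsDef G A) : IsDef G Aᶜ :=
  ((IsTerm.const 1).sub hA).congr fun x => by
    by_cases h : x ∈ A <;> simp [h]

theorem inter (hA : IsDef G A) (hB : IsDef G B) : IsDef G (A ∩ B) :=
  (IsTerm.mul hA hB).congr fun x => by
    by_cases h : x ∈ A <;> by_cases h' : x ∈ B <;> simp [h, h']

theorem ne_zero (hf : IsTerm G f) : IsDef G {x | f x ≠ 0} :=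
  (hf.mul hf.inv).congr fun x => by
    by_cases h : f x = 0
    · simp [h]
    · rw [indicator_of_mem (by exact h), mul_inv_cancel₀ h]

theorem pos (hf : IsTerm G f) : IsDef G {x | 0 < f x} := by
  have := ne_zero (hf.add hf.abs)
  refine this.congr fun x => ?_
  congr 1
  ext x
  simp only [mem_ofPred_eq]
  constructor
  · intro h; rw [abs_of_pos h]; positivity
  · intro h
    by_contra h'
    exact h (by rw [abs_of_nonpos (not_lt.1 h')]; ring)

theorem lt (hf : IsTerm G f) (hg : IsTerm G g) : IsDef G {x | f x < g x} := by
  have := pos (hg.sub hf)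
  simpa [sub_pos] using this

theorem le (hf : IsTerm G f) (hg : IsTerm G g) : IsDef G {x | f x ≤ g x} := by
  have := (lt hg hf).compl
  refine this.congr fun x => ?_
  congr 1
  ext; simp

theorem eq (hf : IsTerm G f) (hg : IsTerm G g) : IsDef G {x | f x = g x} := by
  have := (ne_zero (hf.sub hg)).compl
  refine this.congr fun x => ?_
  congr 1
  ext; simp [sub_eq_zero]

theorem comp {Y : Type} {G' : Set (Y → ℝ)} {pr : Y → X} (h : ∀ g ∈ G, IsTerm G' fun y => g (pr y))
    (hA : IsDef G A) : IsDef G' (pr ⁻¹' A) := IsTerm.comp (pr := pr) h hA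

end IsDef

/-- The filter generated by the definable members of an ultrafilter. -/
def defF {X : Type} (G : Set (X → ℝ)) (W : Ultrafilter X) : Filter X where
  sets := {S | ∃ A, IsDef G A ∧ A ∈ W ∧ A ⊆ S}
  univ_sets := ⟨univ, IsDef.univ, univ_mem, subset_rfl⟩
  sets_of_superset := fun ⟨A, h1, h2, h3⟩ h => ⟨A, h1, h2, h3.trans h⟩
  inter_sets := fun ⟨A, h1, h2, h3⟩ ⟨B, k1, k2, k3⟩ =>
    ⟨A ∩ B, h1.inter k1, inter_mem h2 k2, inter_subset_inter h3 k3⟩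

section defF

variable {X : Type} {G : Set (X → ℝ)} {W : Ultrafilter X} {f g : X → ℝ}

theorem le_defF : (W : Filter X) ≤ defF G W := fun _ ⟨_, _, h2, h3⟩ => mem_of_superset h2 h3

theorem IsDef.mem_defF {A : Set X} (hA : IsDef G A) (h : A ∈ W) : A ∈ defF G W :=
  ⟨A, hA, h, subset_rfl⟩

theorem IsDef.mem_or {A : Set X} (hA : IsDef G A) (W : Ultrafilter X) :
    A ∈ defF G W ∨ Aᶜ ∈ defF G W := by
  rcases Ultrafilter.mem_or_compl_mem W A with h | h
  · exact .inl (hA.mem_defF h)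
  · exact .inr (hA.compl.mem_defF h)

instance : (defF G W).NeBot := neBot_of_le le_defF

theorem IsTerm.tendsto_defF (hf : IsTerm G f) {c : ℝ} (h : Tendsto f W (𝓝 c)) :
    Tendsto f (defF G W) (𝓝 c) := by
  rw [Metric.tendsto_nhds] at h ⊢
  intro ε hε
  exact (IsDef.lt (hf.sub (.const c)).abs (.const ε)).mem_defF (h ε hε)

theorem exists_tendsto_of_bdd {Z : Type} {W : Ultrafilter Z} {f : Z → ℝ} {C : ℝ}
    (h : ∀ᶠ x in (W : Filter Z), |f x| ≤ C) : ∃ c, |c| ≤ C ∧ Tendsto f W (𝓝 c) := by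
  have hK : IsCompact (Icc (-C) C) := isCompact_Icc
  obtain ⟨c, hc, h2⟩ := hK.ultrafilter_le_nhds (W.map f) (by
    rw [le_principal_iff]
    exact h.mono fun x hx => abs_le.1 hx)
  exact ⟨c, abs_le.2 hc, h2⟩

theorem IsTerm.exists_tendsto (hf : IsTerm G f) {C : ℝ}
    (h : ∀ᶠ x in (W : Filter X), |f x| ≤ C) : ∃ c, |c| ≤ C ∧ Tendsto f (defF G W) (𝓝 c) := by
  obtain ⟨c, hc, h⟩ := exists_tendsto_of_bdd h
  exact ⟨c, hc, hf.tendsto_defF h⟩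

/-- Analytic germs of infinitesimal terms are terms. -/
theorem exists_term_of_analyticAt {κ : Type} [Fintype κ] {H : (κ → ℝ) → ℝ} (hH : AnalyticAt ℝ H 0)
    {ψ : κ → X → ℝ} (hψ : ∀ i, IsTerm G (ψ i)) :
    ∃ f, IsTerm G f ∧ ∀ l : Filter X, (∀ i, Tendsto (ψ i) l (𝓝 0)) →
      ∀ᶠ x in l, f x = H fun i => ψ i x := by
  obtain ⟨r, hr, h⟩ := Metric.eventually_nhds_iff_ball.1 hH.eventually_analyticAt
  let e := Fintype.equivFin κ
  let L : (Fin (Fintype.card κ) → ℝ) →L[ℝ] (κ → ℝ) :=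
    ContinuousLinearMap.pi fun i => (r / 2) • ContinuousLinearMap.proj (e i)
  have hL : ∀ c, (∀ i, |c i| ≤ 1) → AnalyticAt ℝ (fun c => H (L c)) c := by
    intro c hc
    refine AnalyticAt.comp (h _ ?_) (L.analyticAt _)
    rw [mem_ball_zero_iff]
    refine lt_of_le_of_lt ((pi_norm_le_iff_of_nonneg (by positivity : 0 ≤ r / 2)).2 fun i => ?_)
      (half_lt_self hr)
    simp only [L, ContinuousLinearMap.coe_pi', _root_.smul_apply, ContinuousLinearMap.proj_apply,
      smul_eq_mul, norm_mul, Real.norm_eq_abs]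
    rw [abs_of_pos (by positivity : 0 < r / 2)]
    exact mul_le_of_le_one_right (by positivity) (hc _)
  refine ⟨_, IsTerm.an hL fun i => (IsTerm.const (2 / r)).mul (hψ (e.symm i)), fun l hl => ?_⟩
  have hev : ∀ᶠ x in l, ∀ i, |ψ i x| ≤ r / 2 := by
    rw [eventually_all]
    intro i
    have := (hl i).abs
    rw [abs_zero] at this
    exact this.eventually (eventually_le_nhds (by positivity))
  filter_upwards [hev] with x hx
  rw [if_pos]
  · congr 1
    ext i
    simp [L]
    field_simp
  · intro i
    rw [abs_mul, abs_of_pos (by positivity), div_mul_eq_mul_div, div_le_one hr]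
    linarith [hx (e.symm i)]

end defF

end Tame

namespace Tame
open Filter Topology

theorem analyticAt_apply {ι : Type} [Fintype ι] (i : ι) (c : ι → ℝ) :
    AnalyticAt ℝ (fun x : ι → ℝ => x i) c :=
  (ContinuousLinearMap.proj (R := ℝ) (φ := fun _ : ι => ℝ) i).analyticAt c

theorem analyticAt_fst_apply {ι : Type} [Fintype ι] (i : ι) (c : (ι → ℝ) × ℝ) :
    AnalyticAt ℝ (fun x : (ι → ℝ) × ℝ => x.1 i) c :=
  (analyticAt_apply i c.1).comp (f := fun x : (ι → ℝ) × ℝ => x.1) analyticAt_fst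

/-- A filter with infinitesimal parameters `E` and one distinguished infinitesimal variable `s`. -/
structure Sys (Z : Type) where
  l : Filter Z
  E : Set (Z → ℝ)
  s : Z → ℝ
  hE : ∀ φ ∈ E, Tendsto φ l (𝓝 0)
  hs : Tendsto s l (𝓝 0)

/-- `f` is an analytic function of parameters and of `s`; it becomes `g (s)` when the parameters
vanish. -/
def Germ {Z : Type} (S : Sys Z) (f : Z → ℝ) (g : ℝ → ℝ) : Prop :=
  ∃ (κ : Type) (_ : Fintype κ) (φ : κ → Z → ℝ) (H : (κ → ℝ) × ℝ → ℝ), (∀ i, φ i ∈ S.E) ∧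
    AnalyticAt ℝ H 0 ∧ (∀ᶠ z in S.l, f z = H (fun i => φ i z, S.s z)) ∧
    ∀ᶠ t in 𝓝 (0 : ℝ), H (0, t) = g t

namespace Germ

variable {Z : Type} {S S' : Sys Z} {f f₁ f₂ : Z → ℝ} {g g₁ g₂ : ℝ → ℝ}

theorem congr (h : Germ S f g) (hf : ∀ᶠ z in S.l, f₁ z = f z) (hg : ∀ᶠ t in 𝓝 0, g₁ t = g t) :
    Germ S f₁ g₁ := by
  obtain ⟨κ, i, φ, H, h1, h2, h3, h4⟩ := h
  exact ⟨κ, i, φ, H, h1, h2, hf.mp (h3.mono fun z h h' => h'.trans h),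
    hg.mp (h4.mono fun z h h' => h.trans h'.symm)⟩

theorem congr_left (h : Germ S f g) (hf : ∀ᶠ z in S.l, f₁ z = f z) : Germ S f₁ g :=
  h.congr hf (by simp)

theorem congr_right (h : Germ S f g) (hg : ∀ t, g₁ t = g t) : Germ S f g₁ :=
  h.congr (by simp) (by simp [hg])

theorem const (c : ℝ) : Germ S (fun _ => c) fun _ => c :=
  ⟨Empty, inferInstance, fun e => e.elim, fun _ => c, fun e => e.elim, analyticAt_const,
    by simp, by simp⟩

theorem param {φ : Z → ℝ} (h : φ ∈ S.E) : Germ S φ fun _ => 0 :=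
  ⟨Unit, inferInstance, fun _ => φ, fun z => z.1 (), fun _ => h, analyticAt_fst_apply _ _, by simp, by simp⟩

theorem var : Germ S S.s fun t => t :=
  ⟨Empty, inferInstance, fun e => e.elim, fun z => z.2, fun e => e.elim, analyticAt_snd,
    by simp, by simp⟩

theorem analyticAt (h : Germ S f g) : AnalyticAt ℝ g 0 := by
  obtain ⟨κ, i, φ, H, h1, h2, h3, h4⟩ := h
  refine (AnalyticAt.comp_of_eq h2 (analyticAt_const.prod analyticAt_id) ?_).congr h4
  simp [Prod.mk_zero_zero]

theorem tendsto_param {κ : Type} {φ : κ → Z → ℝ} (h : ∀ i, φ i ∈ S.E) :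
    Tendsto (fun z => (fun i => φ i z, S.s z)) S.l (𝓝 0) := by
  rw [← Prod.mk_zero_zero]
  exact Tendsto.prodMk_nhds (tendsto_pi_nhds.2 fun i => S.hE _ (h i)) S.hs

theorem tendsto (h : Germ S f g) : Tendsto f S.l (𝓝 (g 0)) := by
  obtain ⟨κ, i, φ, H, h1, h2, h3, h4⟩ := h
  have h5 : H 0 = g 0 := h4.self_of_nhds
  rw [← h5]
  exact (h2.continuousAt.tendsto.comp (tendsto_param h1)).congr'
    (h3.mono fun z hz => hz.symm)

theorem comp {ι : Type} [Fintype ι] {f : ι → Z → ℝ} {g : ι → ℝ → ℝ} {F : (ι → ℝ) → ℝ}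
    (h : ∀ i, Germ S (f i) (g i)) (hF : AnalyticAt ℝ F fun i => g i 0) :
    Germ S (fun z => F fun i => f i z) fun t => F fun i => g i t := by
  choose κ hκ φ H h1 h2 h3 h4 using h
  have hL : ∀ i, AnalyticAt ℝ
      (fun z : ((Σ i, κ i) → ℝ) × ℝ => H i (fun j => z.1 ⟨i, j⟩, z.2)) 0 := by
    intro i
    refine AnalyticAt.comp_of_eq (h2 i) (AnalyticAt.prod ?_ analyticAt_snd)
      (by simp [Prod.mk_zero_zero, Pi.zero_def])
    exact analyticAt_pi_iff.2 fun j => analyticAt_fst_apply _ _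
  refine ⟨Σ i, κ i, inferInstance, fun j => φ j.1 j.2,
    fun z => F fun i => H i (fun j => z.1 ⟨i, j⟩, z.2), fun j => h1 _ _, ?_, ?_, ?_⟩
  · refine AnalyticAt.comp_of_eq hF (analyticAt_pi_iff.2 hL) ?_
    ext i
    exact (h4 i).self_of_nhds
  · filter_upwards [eventually_all.2 h3] with z hz
    congr 1
    ext i
    exact hz i
  · filter_upwards [eventually_all.2 h4] with t ht
    congr 1
    ext i
    exact ht i

theorem comp₁ {F : ℝ → ℝ} (h : Germ S f g) (hF : AnalyticAt ℝ F (g 0)) :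
    Germ S (fun z => F (f z)) fun t => F (g t) :=
  comp (ι := Unit) (f := fun _ => f) (g := fun _ => g) (F := fun x => F (x ())) (fun _ => h)
    (AnalyticAt.comp_of_eq (g := F) hF (analyticAt_apply _ _) rfl)

theorem add (h₁ : Germ S f₁ g₁) (h₂ : Germ S f₂ g₂) :
    Germ S (fun z => f₁ z + f₂ z) fun t => g₁ t + g₂ t :=
  comp (ι := Bool) (f := fun b => if b then f₁ else f₂) (g := fun b => if b then g₁ else g₂)
    (F := fun x => x true + x false) (fun b => by cases b <;> simpa)
    ((analyticAt_apply _ _).add (analyticAt_apply _ _))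

theorem mul (h₁ : Germ S f₁ g₁) (h₂ : Germ S f₂ g₂) :
    Germ S (fun z => f₁ z * f₂ z) fun t => g₁ t * g₂ t :=
  comp (ι := Bool) (f := fun b => if b then f₁ else f₂) (g := fun b => if b then g₁ else g₂)
    (F := fun x => x true * x false) (fun b => by cases b <;> simpa)
    ((analyticAt_apply _ _).mul (analyticAt_apply _ _))

theorem sum {ι : Type} (s : Finset ι) {f : ι → Z → ℝ} {g : ι → ℝ → ℝ}
    (h : ∀ i ∈ s, Germ S (f i) (g i)) :
    Germ S (fun z => ∑ i ∈ s, f i z) fun t => ∑ i ∈ s, g i t := by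
  classical
  induction s using Finset.induction_on with
  | empty => simpa using const (S := S) 0
  | insert a s ha ih =>
    simp only [Finset.sum_insert ha]
    exact (h a (by simp)).add (ih fun i hi => h i (by simp [hi]))

theorem pow (h : Germ S f g) (n : ℕ) : Germ S (fun z => f z ^ n) fun t => g t ^ n :=
  h.comp₁ (F := fun x => x ^ n) (by fun_prop)

theorem rpow (h : Germ S f g) (h0 : 0 < g 0) (q : ℝ) :
    Germ S (fun z => f z ^ q) fun t => g t ^ q :=
  h.comp₁ (F := fun x => x ^ q) (by
    refine AnalyticAt.congr (f := fun x => exp (log x * q)) ?_ ?_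
    · exact ((analyticAt_log h0).mul analyticAt_const).rexp
    · filter_upwards [eventually_gt_nhds h0] with x hx
      rw [rpow_def_of_pos hx])

/-- If the distinguished variable is trivial, the second component may be taken constant. -/
theorem to_const (hs : S.s = fun _ => 0) (h : Germ S f g) : Germ S f fun _ => g 0 := by
  obtain ⟨κ, i, φ, H, h1, h2, h3, h4⟩ := h
  refine ⟨κ, i, φ, fun z => H (z.1, 0), h1, ?_, ?_, ?_⟩
  · exact AnalyticAt.comp_of_eq h2 (analyticAt_fst.prod analyticAt_const)
      (by simp [Prod.mk_zero_zero])
  · simpa [hs] using h3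
  · simp only [h4.self_of_nhds, eventually_const]

end Germ

/-- `S'` refines `S`. -/
structure Finer {Z : Type} (S' S : Sys Z) : Prop where
  le : S'.l ≤ S.l
  param : ∀ φ ∈ S.E, Germ S' φ fun _ => 0
  var : ∃ g : ℝ → ℝ, g 0 = 0 ∧ Germ S' S.s g

namespace Finer

variable {Z : Type} {S S' S'' : Sys Z} {f : Z → ℝ} {g : ℝ → ℝ}

theorem germ' (h : Finer S' S) {gs : ℝ → ℝ} (h0 : gs 0 = 0) (hs : Germ S' S.s gs)
    (hf : Germ S f g) : Germ S' f fun t => g (gs t) := by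
  obtain ⟨κ, i, φ, H, h1, h2, h3, h4⟩ := hf
  have := Germ.comp (S := S') (ι := Option κ)
    (f := fun o => o.elim S.s φ) (g := fun o => o.elim gs fun _ _ => 0)
    (F := fun x => H (fun i => x (some i), x none)) (fun o => by
      cases o with
      | none => exact hs
      | some i => exact h.param _ (h1 i)) (by
      refine AnalyticAt.comp_of_eq h2 (AnalyticAt.prod ?_ (analyticAt_apply _ _)) ?_
      · exact analyticAt_pi_iff.2 fun j => analyticAt_apply _ _
      · simp [h0, Prod.mk_zero_zero, Pi.zero_def])
  refine this.congr (h.le h3) ?_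
  have hgs : Tendsto gs (𝓝 0) (𝓝 0) := by
    have := hs.analyticAt.continuousAt.tendsto
    rwa [h0] at this
  filter_upwards [hgs.eventually h4] with t ht
  exact ht.symm

theorem germ (h : Finer S' S) (hf : Germ S f g) : ∃ g', g' 0 = g 0 ∧ Germ S' f g' := by
  obtain ⟨gs, h0, hs⟩ := h.var
  exact ⟨_, by rw [h0], h.germ' h0 hs hf⟩

theorem germ_const (h : Finer S' S) {c : ℝ} (hf : Germ S f fun _ => c) :
    Germ S' f fun _ => c := by
  obtain ⟨gs, h0, hs⟩ := h.var
  exact h.germ' h0 hs hf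

theorem refl (S : Sys Z) : Finer S S :=
  ⟨le_rfl, fun _ h => Germ.param h, _, rfl, Germ.var⟩

theorem trans (h : Finer S'' S') (h' : Finer S' S) : Finer S'' S := by
  obtain ⟨gs, h0, hs⟩ := h'.var
  obtain ⟨g, hg, hs'⟩ := h.germ hs
  exact ⟨h.le.trans h'.le, fun φ hφ => h.germ_const (h'.param φ hφ), g, hg.trans h0, hs'⟩

end Finer

end Tame

namespace Tame
open Filter Topology

section Base

variable {X : Type} (G : Set (X → ℝ)) (U : Ultrafilter (X × ℝ))

/-- The definable filter on the base. -/
def baseF : Filter X := defF G (U.map Prod.fst)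

/-- Infinitesimal terms of the base. -/
def baseE : Set (X × ℝ → ℝ) :=
  {φ | ∃ ψ : X → ℝ, IsTerm G ψ ∧ Tendsto ψ (baseF G U) (𝓝 0) ∧ φ = fun z => ψ z.1}

variable {G U}

instance : (baseF G U).NeBot := inferInstanceAs (defF G (U.map Prod.fst)).NeBot

theorem tendsto_fst_baseF : Tendsto Prod.fst (U : Filter (X × ℝ)) (baseF G U) :=
  le_defF (G := G) (W := U.map Prod.fst)

theorem IsTerm.tendsto_baseF {f : X → ℝ} (hf : IsTerm G f) {c : ℝ}
    (h : Tendsto (fun z : X × ℝ => f z.1) U (𝓝 c)) : Tendsto f (baseF G U) (𝓝 c) :=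
  hf.tendsto_defF (W := U.map Prod.fst) h

theorem IsDef.eventually_baseF {A : Set X} (hA : IsDef G A)
    (h : ∀ᶠ z : X × ℝ in U, z.1 ∈ A) : ∀ᶠ x in baseF G U, x ∈ A :=
  hA.mem_defF (W := U.map Prod.fst) h

theorem IsDef.eventually_or {A : Set X} (hA : IsDef G A) :
    (∀ᶠ x in baseF G U, x ∈ A) ∨ ∀ᶠ x in baseF G U, x ∉ A :=
  hA.mem_or (U.map Prod.fst)

theorem tendsto_of_baseE {l : Filter (X × ℝ)} (hl : l ≤ comap Prod.fst (baseF G U))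
    {φ : X × ℝ → ℝ} (h : φ ∈ baseE G U) : Tendsto φ l (𝓝 0) := by
  obtain ⟨ψ, -, h2, rfl⟩ := h
  exact h2.comp (tendsto_comap.mono_left hl)

theorem Germ.of_tendsto {S : Sys (X × ℝ)} (hS : baseE G U ⊆ S.E) {f : X → ℝ} (hf : IsTerm G f)
    {c : ℝ} (h : Tendsto f (baseF G U) (𝓝 c)) : Germ S (fun z => f z.1) fun _ => c := by
  have h0 : (fun z : X × ℝ => f z.1 - c) ∈ S.E :=
    hS ⟨fun x => f x - c, hf.sub (.const c), by simpa using h.sub_const c, rfl⟩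
  exact (((Germ.param h0).add (Germ.const c)).congr_left (by simp)).congr_right (by simp)

theorem Germ.of_bdd {S : Sys (X × ℝ)} (hS : baseE G U ⊆ S.E) {f : X → ℝ} (hf : IsTerm G f)
    {C : ℝ} (h : ∀ᶠ z : X × ℝ in U, |f z.1| ≤ C) :
    ∃ c, |c| ≤ C ∧ Tendsto f (baseF G U) (𝓝 c) ∧ Germ S (fun z => f z.1) fun _ => c := by
  obtain ⟨c, hc, h1⟩ := hf.exists_tendsto (W := U.map Prod.fst) h
  exact ⟨c, hc, h1, Germ.of_tendsto hS hf h1⟩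

end Base

/-- An interval of `y` on one side of the center `θ`, bounded by the scales `b₁` and `1 / b₂`. -/
structure Chart {X : Type} (G : Set (X → ℝ)) where
  θ : X → ℝ
  b₁ : X → ℝ
  b₂ : X → ℝ
  σ : ℝ
  hθ : IsTerm G θ
  hb₁ : IsTerm G b₁
  hb₂ : IsTerm G b₂
  hσ : σ = 1 ∨ σ = -1
  nn₁ : ∀ x, 0 ≤ b₁ x
  nn₂ : ∀ x, 0 ≤ b₂ x

namespace Chart

variable {X : Type} {G : Set (X → ℝ)} (c : Chart G) (U : Ultrafilter (X × ℝ))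

/-- The coordinate of a chart. -/
def p (z : X × ℝ) : ℝ := c.σ * (z.2 - c.θ z.1)

/-- The filter of a chart. -/
def l : Filter (X × ℝ) :=
  comap Prod.fst (baseF G U) ⊓ 𝓟 {z | 0 < c.p z} ⊓ comap (fun z => c.b₁ z.1 / c.p z) (𝓝 0) ⊓
    comap (fun z => c.b₂ z.1 * c.p z) (𝓝 0)

theorem le_l_iff {l' : Filter (X × ℝ)} : l' ≤ c.l U ↔
    l' ≤ comap Prod.fst (baseF G U) ∧ (∀ᶠ z in l', 0 < c.p z) ∧
      Tendsto (fun z => c.b₁ z.1 / c.p z) l' (𝓝 0) ∧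
      Tendsto (fun z => c.b₂ z.1 * c.p z) l' (𝓝 0) := by
  simp only [l, le_inf_iff, tendsto_iff_comap, le_principal_iff, and_assoc]
  rfl

theorem l_le : c.l U ≤ comap Prod.fst (baseF G U) := ((c.le_l_iff U).1 le_rfl).1

theorem p_pos : ∀ᶠ z in c.l U, 0 < c.p z := ((c.le_l_iff U).1 le_rfl).2.1

theorem tendsto_v : Tendsto (fun z => c.b₁ z.1 / c.p z) (c.l U) (𝓝 0) :=
  ((c.le_l_iff U).1 le_rfl).2.2.1

theorem tendsto_w : Tendsto (fun z => c.b₂ z.1 * c.p z) (c.l U) (𝓝 0) :=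
  ((c.le_l_iff U).1 le_rfl).2.2.2

theorem eventually_base {P : X → Prop} (h : ∀ᶠ x in baseF G U, P x) :
    ∀ᶠ z in c.l U, P z.1 :=
  (tendsto_comap.mono_left (c.l_le U)).eventually h

/-- Powers of the two small quantities of a chart. -/
def powE : Set (X × ℝ → ℝ) :=
  {φ | ∃ q : ℚ, 0 < q ∧ ((φ = fun z => (c.b₁ z.1 / c.p z) ^ (q : ℝ)) ∨
    φ = fun z => (c.b₂ z.1 * c.p z) ^ (q : ℝ))}

/-- The germs of a chart. -/
def sys : Sys (X × ℝ) where
  l := c.l U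
  E := baseE G U ∪ c.powE
  s := fun _ => 0
  hE := by
    rintro φ (h | ⟨q, hq, rfl | rfl⟩)
    · exact tendsto_of_baseE (c.l_le U) h
    · have hq' : (0 : ℝ) < q := by exact_mod_cast hq
      simpa [zero_rpow hq'.ne'] using (c.tendsto_v U).rpow_const (p := q) (.inr hq'.le)
    · have hq' : (0 : ℝ) < q := by exact_mod_cast hq
      simpa [zero_rpow hq'.ne'] using (c.tendsto_w U).rpow_const (p := q) (.inr hq'.le)
  hs := tendsto_const_nhds

/-- The chart describes a neighbourhood of the ultrafilter. -/
def Valid : Prop := (U : Filter (X × ℝ)) ≤ c.l U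

variable {c U}

theorem valid_iff : c.Valid U ↔ (∀ᶠ z in U, 0 < c.p z) ∧
      Tendsto (fun z => c.b₁ z.1 / c.p z) U (𝓝 0) ∧
      Tendsto (fun z => c.b₂ z.1 * c.p z) U (𝓝 0) := by
  rw [Valid, le_l_iff]
  exact and_iff_right (tendsto_iff_comap.1 tendsto_fst_baseF)

theorem base_sub : baseE G U ⊆ (c.sys U).E := subset_union_left

theorem germ_small₁ {β : X → ℝ} (hβ : IsTerm G β) (h0 : ∀ x, 0 ≤ β x) (h1 : ∀ x, β x ≤ c.b₁ x)
    {q : ℚ} (hq : 0 < q) :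
    Germ (c.sys U) (fun z => (β z.1 / c.p z) ^ (q : ℝ)) fun _ => 0 := by
  have hq' : (0 : ℝ) < q := by exact_mod_cast hq
  obtain ⟨C, -, -, hC⟩ := Germ.of_bdd (U := U) (S := c.sys U) c.base_sub
    ((hβ.div c.hb₁).rpow q) (C := 1) (.of_forall fun z => by
      rw [abs_of_nonneg (rpow_nonneg (abs_nonneg _) _)]
      refine rpow_le_one (abs_nonneg _) ?_ hq'.le
      rw [abs_div, abs_of_nonneg (h0 _), abs_of_nonneg (c.nn₁ _)]
      exact div_le_one_of_le₀ (h1 _) (c.nn₁ _))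
  have h2 : Germ (c.sys U) (fun z => (c.b₁ z.1 / c.p z) ^ (q : ℝ)) fun _ => 0 :=
    Germ.param (Or.inr ⟨q, hq, .inl rfl⟩)
  refine ((hC.mul h2).congr_left ?_).congr_right (by simp)
  filter_upwards [c.p_pos U] with z hz
  rw [← mul_rpow (abs_nonneg _) (div_nonneg (c.nn₁ _) hz.le),
    abs_of_nonneg (div_nonneg (h0 _) (c.nn₁ _))]
  congr 1
  rcases eq_or_ne (c.b₁ z.1) 0 with h | h
  · have := h1 z.1
    rw [h] at this
    simp [h, le_antisymm this (h0 z.1)]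
  · field_simp

theorem germ_small₂ {β : X → ℝ} (hβ : IsTerm G β) (h0 : ∀ x, 0 ≤ β x) (h1 : ∀ x, β x ≤ c.b₂ x)
    {q : ℚ} (hq : 0 < q) :
    Germ (c.sys U) (fun z => (β z.1 * c.p z) ^ (q : ℝ)) fun _ => 0 := by
  have hq' : (0 : ℝ) < q := by exact_mod_cast hq
  obtain ⟨C, -, -, hC⟩ := Germ.of_bdd (U := U) (S := c.sys U) c.base_sub
    ((hβ.div c.hb₂).rpow q) (C := 1) (.of_forall fun z => by
      rw [abs_of_nonneg (rpow_nonneg (abs_nonneg _) _)]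
      refine rpow_le_one (abs_nonneg _) ?_ hq'.le
      rw [abs_div, abs_of_nonneg (h0 _), abs_of_nonneg (c.nn₂ _)]
      exact div_le_one_of_le₀ (h1 _) (c.nn₂ _))
  have h2 : Germ (c.sys U) (fun z => (c.b₂ z.1 * c.p z) ^ (q : ℝ)) fun _ => 0 :=
    Germ.param (Or.inr ⟨q, hq, .inr rfl⟩)
  refine ((hC.mul h2).congr_left ?_).congr_right (by simp)
  filter_upwards [c.p_pos U] with z hz
  rw [← mul_rpow (abs_nonneg _) (mul_nonneg (c.nn₂ _) hz.le),
    abs_of_nonneg (div_nonneg (h0 _) (c.nn₂ _))]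
  congr 1
  rcases eq_or_ne (c.b₂ z.1) 0 with h | h
  · have := h1 z.1
    rw [h] at this
    simp [h, le_antisymm this (h0 z.1)]
  · field_simp

/-- `f` is a term of the base times a power of the coordinate times a unit. -/
def Prepared (c : Chart G) (U : Ultrafilter (X × ℝ)) (f : X × ℝ → ℝ) : Prop :=
  ∃ (a : X → ℝ) (κ : ℚ) (u : X × ℝ → ℝ) (C : ℝ), IsTerm G a ∧ 0 < C ∧
    Germ (c.sys U) u (fun _ => C) ∧ ∀ᶠ z in c.l U, f z = a z.1 * c.p z ^ (κ : ℝ) * u z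

theorem germ_pos {u : X × ℝ → ℝ} {C : ℝ} (hC : 0 < C) (hu : Germ (c.sys U) u fun _ => C) :
    ∀ᶠ z in c.l U, 0 < u z :=
  hu.tendsto.eventually (eventually_gt_nhds hC)

theorem Prepared.congr {f g : X × ℝ → ℝ} (h : Prepared c U f) (hg : ∀ᶠ z in c.l U, g z = f z) :
    Prepared c U g := by
  obtain ⟨a, κ, u, C, h1, h2, h3, h4⟩ := h
  exact ⟨a, κ, u, C, h1, h2, h3, hg.mp (h4.mono fun z h h' => h'.trans h)⟩

theorem Prepared.base {a : X → ℝ} (h : IsTerm G a) : Prepared c U fun z => a z.1 :=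
  ⟨a, 0, fun _ => 1, 1, h, one_pos, Germ.const 1, by simp⟩

theorem Prepared.coord : Prepared c U c.p :=
  ⟨fun _ => 1, 1, fun _ => 1, 1, .const 1, one_pos, Germ.const 1, by simp⟩

theorem Prepared.mul {f g : X × ℝ → ℝ} (hf : Prepared c U f) (hg : Prepared c U g) :
    Prepared c U fun z => f z * g z := by
  obtain ⟨a, κ, u, C, h1, h2, h3, h4⟩ := hf
  obtain ⟨a', κ', u', C', h1', h2', h3', h4'⟩ := hg
  refine ⟨_, κ + κ', _, _, h1.mul h1', mul_pos h2 h2', h3.mul h3', ?_⟩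
  filter_upwards [h4, h4', c.p_pos U] with z h h' hp
  rw [h, h']
  push_cast
  rw [rpow_add hp]
  ring

theorem Prepared.abs_rpow {f : X × ℝ → ℝ} (hf : Prepared c U f) (q : ℚ) :
    Prepared c U fun z => |f z| ^ (q : ℝ) := by
  obtain ⟨a, κ, u, C, h1, h2, h3, h4⟩ := hf
  refine ⟨_, κ * q, _, _, h1.rpow q, rpow_pos_of_pos h2 q, h3.rpow h2 q, ?_⟩
  filter_upwards [h4, c.p_pos U, germ_pos h2 h3] with z h hp hu
  rw [h, abs_mul, abs_mul, mul_rpow (by positivity) (abs_nonneg _),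
    mul_rpow (abs_nonneg _) (abs_nonneg _), abs_of_pos hu, abs_of_pos (rpow_pos_of_pos hp _),
    ← rpow_mul hp.le]
  push_cast
  rfl

theorem Prepared.unit {u : X × ℝ → ℝ} {C : ℝ} (hC : C ≠ 0) (hu : Germ (c.sys U) u fun _ => C) :
    Prepared c U u := by
  rcases lt_or_gt_of_ne hC with h | h
  · refine ⟨fun _ => -1, 0, fun z => -1 * u z, -1 * C, .const _, by linarith,
      (Germ.const (-1)).mul hu, ?_⟩
    simp
  · exact ⟨fun _ => 1, 0, u, C, .const _, h, hu, by simp⟩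

/-- Refinement of charts. -/
structure Ref (U : Ultrafilter (X × ℝ)) (c' c : Chart G) : Prop where
  valid : c'.Valid U
  finer : Finer (c'.sys U) (c.sys U)
  coord : Prepared c' U c.p

variable {c' c'' : Chart G}

theorem Ref.refl (h : c.Valid U) : Ref U c c := ⟨h, Finer.refl _, Prepared.coord⟩

theorem Ref.le (h : Ref U c' c) : c'.l U ≤ c.l U := h.finer.le

theorem Ref.germ (h : Ref U c' c) {f : X × ℝ → ℝ} {C : ℝ} (hf : Germ (c.sys U) f fun _ => C) :
    Germ (c'.sys U) f fun _ => C := h.finer.germ_const hf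

theorem Ref.prepared (h : Ref U c' c) {f : X × ℝ → ℝ} (hf : Prepared c U f) :
    Prepared c' U f := by
  obtain ⟨a, κ, u, C, h1, h2, h3, h4⟩ := hf
  have h5 := ((Prepared.base (c := c') (U := U) h1).mul (h.coord.abs_rpow κ)).mul
    (Prepared.unit h2.ne' (h.germ h3))
  refine h5.congr ?_
  filter_upwards [h.le h4, h.le (c.p_pos U)] with z h hp
  rw [h, abs_of_pos hp]

theorem Ref.trans (h : Ref U c'' c') (h' : Ref U c' c) : Ref U c'' c :=
  ⟨h.valid, h.finer.trans h'.finer, h.prepared h'.coord⟩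

/-- Shrinking a chart. -/
def shrink (c : Chart G) {β₁ β₂ : X → ℝ} (h₁ : IsTerm G β₁) (h₂ : IsTerm G β₂)
    (n₁ : ∀ x, 0 ≤ β₁ x) (n₂ : ∀ x, 0 ≤ β₂ x) : Chart G where
  θ := c.θ
  b₁ := fun x => c.b₁ x + β₁ x
  b₂ := fun x => c.b₂ x + β₂ x
  σ := c.σ
  hθ := c.hθ
  hb₁ := c.hb₁.add h₁
  hb₂ := c.hb₂.add h₂
  hσ := c.hσ
  nn₁ := fun x => add_nonneg (c.nn₁ x) (n₁ x)
  nn₂ := fun x => add_nonneg (c.nn₂ x) (n₂ x)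

theorem shrink_ref (hc : c.Valid U) {β₁ β₂ : X → ℝ} (h₁ : IsTerm G β₁) (h₂ : IsTerm G β₂)
    (n₁ : ∀ x, 0 ≤ β₁ x) (n₂ : ∀ x, 0 ≤ β₂ x)
    (t₁ : Tendsto (fun z => β₁ z.1 / c.p z) U (𝓝 0))
    (t₂ : Tendsto (fun z => β₂ z.1 * c.p z) U (𝓝 0)) : Ref U (c.shrink h₁ h₂ n₁ n₂) c := by
  have hv : (c.shrink h₁ h₂ n₁ n₂).Valid U := by
    obtain ⟨k1, k2, k3⟩ := valid_iff.1 hc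
    refine valid_iff.2 ⟨k1, ?_, ?_⟩
    · have := k2.add t₁
      rw [add_zero] at this
      exact this.congr fun z => by simp only [shrink, p]; ring
    · have := k3.add t₂
      rw [add_zero] at this
      exact this.congr fun z => by simp only [shrink, p]; ring
  refine ⟨hv, ⟨?_, ?_, ?_⟩, Prepared.coord⟩
  · refine (c.le_l_iff U).2 ⟨l_le _ U, p_pos _ U, ?_, ?_⟩
    · refine squeeze_zero' ?_ ?_ (tendsto_v _ U)
      · filter_upwards [p_pos _ U] with z hz using div_nonneg (c.nn₁ _) (le_of_lt hz)
      · filter_upwards [p_pos _ U] with z hz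
        exact div_le_div_of_nonneg_right (le_add_of_nonneg_right (n₁ _)) (le_of_lt hz)
    · refine squeeze_zero' ?_ ?_ (tendsto_w _ U)
      · filter_upwards [p_pos _ U] with z hz using mul_nonneg (c.nn₂ _) (le_of_lt hz)
      · filter_upwards [p_pos _ U] with z hz
        exact mul_le_mul_of_nonneg_right (le_add_of_nonneg_right (n₂ _)) (le_of_lt hz)
  · rintro φ (h | ⟨q, hq, rfl | rfl⟩)
    · exact Germ.param (.inl h)
    · exact germ_small₁ (c := c.shrink h₁ h₂ n₁ n₂) c.hb₁ c.nn₁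
        (fun x => le_add_of_nonneg_right (n₁ _)) hq
    · exact germ_small₂ (c := c.shrink h₁ h₂ n₁ n₂) c.hb₂ c.nn₂
        (fun x => le_add_of_nonneg_right (n₂ _)) hq
  · exact ⟨_, rfl, Germ.const 0⟩

end Chart

end Tame

namespace Tame
open Filter Topology

/-- A disc around the center `θ` of radius of order `1 / B`. -/
structure Disc {X : Type} (G : Set (X → ℝ)) where
  θ : X → ℝ
  B : X → ℝ
  hθ : IsTerm G θ
  hB : IsTerm G B

/-- The ultrafilter does not concentrate on the graph of a term. -/
def NonGraph {X : Type} (G : Set (X → ℝ)) (U : Ultrafilter (X × ℝ)) : Prop :=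
  ∀ θ, IsTerm G θ → ∀ᶠ z in (U : Filter (X × ℝ)), z.2 ≠ θ z.1

/-- The function `g` vanishes to order exactly `d` at `0`. -/
def Ord (g : ℝ → ℝ) (d : ℕ) : Prop :=
  ∃ k : ℝ → ℝ, AnalyticAt ℝ k 0 ∧ k 0 ≠ 0 ∧ ∀ᶠ t in 𝓝 (0 : ℝ), g t = t ^ d * k t

theorem exists_ord {g : ℝ → ℝ} (hg : AnalyticAt ℝ g 0)
    (h : ¬ ∀ᶠ t in 𝓝 (0 : ℝ), g t = 0) : ∃ d, Ord g d :=
  exists_hasOrder (κ := Empty) (H := fun z => g z.2)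
    (AnalyticAt.comp_of_eq hg analyticAt_snd rfl) h

theorem exists_ord_le {g : ℝ → ℝ} {p : Polynomial ℝ} {n : ℕ}
    (hn : p.coeff n ≠ 0) (h : ∀ᶠ t in 𝓝 (0 : ℝ), g t = p.eval t) : ∃ d ≤ n, Ord g d :=
  exists_hasOrder_lt (κ := Empty) (H := fun z => g z.2) hn h

theorem ultrafilter_exists_max {Z ι : Type} (U : Ultrafilter Z) {s : Finset ι} (hs : s.Nonempty)
    (F : ι → Z → ℝ) : ∃ i ∈ s, ∀ᶠ z in (U : Filter Z), ∀ j ∈ s, F j z ≤ F i z := by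
  have h : (⋃ i ∈ (s : Set ι), {z | ∀ j ∈ s, F j z ≤ F i z}) ∈ U := by
    refine mem_of_superset univ_mem fun z _ => ?_
    obtain ⟨i, hi, h⟩ := s.exists_max_image (fun i => F i z) hs
    simp only [mem_iUnion]
    exact ⟨i, hi, h⟩
  obtain ⟨i, hi, h⟩ := (Ultrafilter.finite_biUnion_mem_iff s.finite_toSet).1 h
  exact ⟨i, hi, h⟩

theorem ultrafilter_eventually_ge {Z : Type} (U : Ultrafilter Z) {F : Z → ℝ}
    (h0 : ∀ᶠ z in (U : Filter Z), 0 ≤ F z) (h : ¬ Tendsto F U (𝓝 0)) :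
    ∃ ε > 0, ∀ᶠ z in (U : Filter Z), ε ≤ F z := by
  rw [Metric.tendsto_nhds] at h
  push Not at h
  obtain ⟨ε, hε, h⟩ := h
  refine ⟨ε, hε, ?_⟩
  filter_upwards [h, h0] with z hz h1
  simpa [abs_of_nonneg h1] using hz

namespace Disc

variable {X : Type} {G : Set (X → ℝ)} (δ : Disc G) (U : Ultrafilter (X × ℝ))

/-- The coordinate of a disc. -/
def s (z : X × ℝ) : ℝ := δ.B z.1 * (z.2 - δ.θ z.1)

/-- The germs of a disc. -/
def sys : Sys (X × ℝ) where
  l := comap Prod.fst (baseF G U) ⊓ comap δ.s (𝓝 0)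
  E := baseE G U
  s := δ.s
  hE := fun _ h => tendsto_of_baseE inf_le_left h
  hs := tendsto_comap.mono_left inf_le_right

theorem le_l_iff {l' : Filter (X × ℝ)} : l' ≤ (δ.sys U).l ↔
    l' ≤ comap Prod.fst (baseF G U) ∧ Tendsto δ.s l' (𝓝 0) := by
  rw [tendsto_iff_comap, sys, le_inf_iff]

theorem l_le : (δ.sys U).l ≤ comap Prod.fst (baseF G U) := inf_le_left

theorem eventually_base {P : X → Prop} (h : ∀ᶠ x in baseF G U, P x) :
    ∀ᶠ z in (δ.sys U).l, P z.1 :=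
  (tendsto_comap.mono_left (δ.l_le U)).eventually h

/-- The disc describes a neighbourhood of the ultrafilter. -/
def Valid : Prop := (∀ᶠ x in baseF G U, δ.B x ≠ 0) ∧ Tendsto δ.s U (𝓝 0)

variable {δ U}

theorem Valid.le (h : δ.Valid U) : (U : Filter (X × ℝ)) ≤ (δ.sys U).l :=
  (δ.le_l_iff U).2 ⟨tendsto_iff_comap.1 tendsto_fst_baseF, h.2⟩

theorem exists_chart (hU : NonGraph G U) (hδ : δ.Valid U) {β : X → ℝ} (hβ : IsTerm G β)
    (n : ∀ x, 0 ≤ β x) (ht : Tendsto (fun z => β z.1 / |δ.s z|) U (𝓝 0)) :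
    ∃ c : Chart G, c.Valid U ∧ Finer (c.sys U) (δ.sys U) ∧ c.Prepared U δ.s ∧
      (∃ e : ℝ, (e = 1 ∨ e = -1) ∧ ∀ᶠ z in c.l U, δ.s z = e * |δ.s z| ∧ δ.s z ≠ 0) ∧
      ∀ γ : X → ℝ, IsTerm G γ → (∀ x, 0 ≤ γ x) → (∀ x, γ x ≤ β x) → ∀ q : ℚ, 0 < q →
        Germ (c.sys U) (fun z => (γ z.1 / |δ.s z|) ^ (q : ℝ)) fun _ => 0 := by
  obtain ⟨σ, hσ, hp⟩ : ∃ σ : ℝ, (σ = 1 ∨ σ = -1) ∧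
      ∀ᶠ z in (U : Filter (X × ℝ)), 0 < σ * (z.2 - δ.θ z.1) := by
    rcases Ultrafilter.em U (fun z => δ.θ z.1 < z.2) with h | h
    · exact ⟨1, .inl rfl, h.mono fun z hz => by linarith⟩
    · refine ⟨-1, .inr rfl, ?_⟩
      filter_upwards [h, hU _ δ.hθ] with z h1 h2
      have := lt_of_le_of_ne (not_lt.1 h1) h2
      linarith
  have hσ1 : |σ| = 1 := by rcases hσ with rfl | rfl <;> simp
  have hσ2 : σ * σ = 1 := by rcases hσ with rfl | rfl <;> simp
  let c : Chart G := ⟨δ.θ, fun x => β x / |δ.B x|, fun x => |δ.B x|, σ, δ.hθ, hβ.div δ.hB.abs,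
    δ.hB.abs, hσ, fun x => div_nonneg (n x) (abs_nonneg _), fun x => abs_nonneg _⟩
  have hs : ∀ z, δ.s z = δ.B z.1 * σ * c.p z := fun z => by
    simp only [s, Chart.p, c]
    linear_combination -δ.B z.1 * (z.2 - δ.θ z.1) * hσ2
  have hsa : ∀ z, 0 < c.p z → |δ.s z| = |δ.B z.1| * c.p z := fun z hz => by
    rw [hs, abs_mul, abs_mul, hσ1, mul_one, abs_of_pos hz]
  have hv : c.Valid U := by
    refine Chart.valid_iff.2 ⟨hp, ?_, ?_⟩
    · refine ht.congr' ?_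
      filter_upwards [hp] with z hz
      rw [hsa z hz, div_div]
    · have := hδ.2.abs
      rw [abs_zero] at this
      refine this.congr' ?_
      filter_upwards [hp] with z hz using hsa z hz
  have hw : Tendsto δ.s (c.l U) (𝓝 0) := by
    rw [tendsto_zero_iff_abs_tendsto_zero]
    refine (c.tendsto_w U).congr' ?_
    filter_upwards [c.p_pos U] with z hz using (hsa z hz).symm
  have hB0 : ∀ᶠ z in c.l U, δ.B z.1 ≠ 0 := c.eventually_base U hδ.1
  obtain ⟨e, he, hBe⟩ : ∃ e : ℝ, (e = 1 ∨ e = -1) ∧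
      ∀ᶠ z in c.l U, 0 < e * δ.B z.1 := by
    rcases IsDef.eventually_or (U := U) (IsDef.pos δ.hB) with h | h
    · exact ⟨1, .inl rfl, (c.eventually_base U h).mono fun z hz => by simpa using hz⟩
    · refine ⟨-1, .inr rfl, ?_⟩
      filter_upwards [c.eventually_base U h, hB0] with z h1 h2
      have := lt_of_le_of_ne (not_lt.1 h1) h2
      linarith
  have he1 : |e| = 1 := by rcases he with rfl | rfl <;> simp
  have he2 : e * e = 1 := by rcases he with rfl | rfl <;> simp
  have hBa : ∀ᶠ z in c.l U, |δ.B z.1| = e * δ.B z.1 := by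
    filter_upwards [hBe] with z hz
    rw [← abs_of_pos hz, abs_mul, he1, one_mul]
  have hbase : baseE G U ⊆ (c.sys U).E := Chart.base_sub
  refine ⟨c, hv, ⟨?_, ?_, ?_⟩, ?_, ⟨e * σ, ?_, ?_⟩, ?_⟩
  · exact (δ.le_l_iff U).2 ⟨c.l_le U, hw⟩
  · exact fun φ h => Germ.param (hbase h)
  · refine ⟨fun _ => 0, rfl, ?_⟩
    have h2 : Germ (c.sys U) (fun z => (|δ.B z.1| * c.p z) ^ ((1 : ℚ) : ℝ)) fun _ => 0 :=
      Germ.param (Or.inr ⟨1, one_pos, .inr rfl⟩)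
    refine (((Germ.const (e * σ)).mul h2).congr_left ?_).congr_right (by simp)
    filter_upwards [hBa] with z hz
    change δ.s z = _
    rw [hs, hz]
    simp only [Rat.cast_one, rpow_one]
    linear_combination -δ.B z.1 * σ * c.p z * he2
  · exact ((Chart.Prepared.base (δ.hB.mul (.const σ))).mul Chart.Prepared.coord).congr
      (.of_forall hs)
  · rcases hσ with rfl | rfl <;> rcases he with rfl | rfl <;> simp
  · filter_upwards [hBa, c.p_pos U, hB0] with z hz hp hB
    refine ⟨?_, ?_⟩
    · rw [hsa z hp, hz, hs]
      linear_combination -δ.B z.1 * σ * c.p z * he2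
    · rw [hs]
      refine mul_ne_zero (mul_ne_zero hB ?_) hp.ne'
      rcases hσ with rfl | rfl <;> simp
  · intro γ hγ h0 h1 q hq
    refine (Chart.germ_small₁ (c := c) (hγ.div δ.hB.abs) (fun x => div_nonneg (h0 x) (abs_nonneg _))
      (fun x => div_le_div_of_nonneg_right (h1 x) (abs_nonneg _)) hq).congr_left ?_
    filter_upwards [c.p_pos U] with z hz
    rw [hsa z hz, div_div]

/-- Recentering a disc at `s = τ` and rescaling by `α`. -/
def recenter (δ : Disc G) {τ α : X → ℝ} (hτ : IsTerm G τ) (hα : IsTerm G α) : Disc G where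
  θ := fun x => δ.θ x + τ x / δ.B x
  B := fun x => δ.B x / α x
  hθ := δ.hθ.add (hτ.div δ.hB)
  hB := δ.hB.div hα

theorem recenter_spec (hδ : δ.Valid U) {τ α : X → ℝ} (hτ : IsTerm G τ) (hα : IsTerm G α)
    (hτ0 : Tendsto τ (baseF G U) (𝓝 0)) {a : ℝ} (hαa : Tendsto α (baseF G U) (𝓝 a))
    (hα0 : ∀ᶠ x in baseF G U, α x ≠ 0)
    (ht : Tendsto (fun z => (δ.s z - τ z.1) / α z.1) U (𝓝 0)) :
    (δ.recenter hτ hα).Valid U ∧ Finer ((δ.recenter hτ hα).sys U) (δ.sys U) ∧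
      ∀ᶠ z in ((δ.recenter hτ hα).sys U).l, δ.s z = τ z.1 + α z.1 * (δ.recenter hτ hα).s z := by
  have hx : ∀ z : X × ℝ, δ.B z.1 ≠ 0 → α z.1 ≠ 0 →
      δ.s z = τ z.1 + α z.1 * (δ.recenter hτ hα).s z := by
    intro z h1 h2
    simp only [s, recenter]
    field_simp
    ring
  have h1 : ∀ᶠ z in ((δ.recenter hτ hα).sys U).l,
      δ.s z = τ z.1 + α z.1 * (δ.recenter hτ hα).s z := by
    filter_upwards [(δ.recenter hτ hα).eventually_base U hα0,
      (δ.recenter hτ hα).eventually_base U hδ.1] with z h1 h2 using hx z h2 h1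
  have hg : Germ ((δ.recenter hτ hα).sys U) δ.s fun t => a * t := by
    have k1 : Germ ((δ.recenter hτ hα).sys U) (fun z => τ z.1) fun _ => 0 :=
      Germ.of_tendsto (U := U) subset_rfl hτ hτ0
    have k2 : Germ ((δ.recenter hτ hα).sys U) (fun z => α z.1) fun _ => a :=
      Germ.of_tendsto (U := U) subset_rfl hα hαa
    exact ((k1.add (k2.mul Germ.var)).congr_left h1).congr_right (by simp)
  refine ⟨⟨?_, ?_⟩, ⟨?_, fun φ h => Germ.param h, fun t => a * t, by simp, hg⟩, h1⟩
  · filter_upwards [hδ.1, hα0] with x h1 h2 using div_ne_zero h1 h2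
  · refine ht.congr' ?_
    filter_upwards [tendsto_fst_baseF.eventually hδ.1, tendsto_fst_baseF.eventually hα0]
      with z h1 h2
    rw [hx z h1 h2]
    field_simp
    ring
  · refine (δ.le_l_iff U).2 ⟨l_le _ U, ?_⟩
    simpa using hg.tendsto

end Disc

end Tame

namespace Tame
open Filter Topology

/-- A polynomial without term of index `d` and with a term of index `d + 1`, recentered at `r`,
keeps a term of index at most `d`, unless it is the monomial and `r = 0`. -/
theorem exists_taylor_coeff_ne_zero {d : ℕ} {ξ : ℕ → ℝ} {k r : ℝ} (hk : k ≠ 0) {n : ℕ} (hn : n < d)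
    (hξ : ξ n ≠ 0) :
    ∃ p : Polynomial ℝ, (∃ m ≤ d, p.coeff m ≠ 0) ∧
      ∀ t, p.eval t = ∑ n ∈ Finset.range d, ξ n * (r + t) ^ n + (r + t) ^ (d + 1) * k := by
  let q : Polynomial ℝ := ∑ n ∈ Finset.range d, Polynomial.C (ξ n) * Polynomial.X ^ n +
    Polynomial.C k * Polynomial.X ^ (d + 1)
  refine ⟨Polynomial.taylor r q, ?_, fun t => ?_⟩
  · rcases eq_or_ne r 0 with rfl | hr
    · refine ⟨n, hn.le, ?_⟩
      rw [Polynomial.taylor_zero]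
      simp only [q, Polynomial.coeff_add, Polynomial.finsetSum_coeff, Polynomial.coeff_C_mul,
        Polynomial.coeff_X_pow]
      rw [Finset.sum_eq_single n (fun b _ hb => by simp [hb.symm])
        (fun h => absurd (Finset.mem_range.2 hn) h), if_neg (show n ≠ d + 1 by omega)]
      simpa using hξ
    · refine ⟨d, le_rfl, ?_⟩
      rw [Polynomial.taylor_coeff]
      simp only [q, map_add, map_sum, Polynomial.C_mul_X_pow_eq_monomial,
        Polynomial.hasseDeriv_monomial, Polynomial.eval_add, Polynomial.eval_finsetSum]
      rw [Finset.sum_eq_zero]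
      · simp [hk, hr]
        positivity
      · intro i hi
        rw [Nat.choose_eq_zero_of_lt (Finset.mem_range.1 hi)]
        simp
  · rw [Polynomial.taylor_eval]
    simp only [q, Polynomial.eval_add, Polynomial.eval_finsetSum, Polynomial.eval_mul,
      Polynomial.eval_C, Polynomial.eval_pow, Polynomial.eval_X]
    rw [add_comm t r]
    ring

theorem Chart.Prepared.pow {X : Type} {G : Set (X → ℝ)} {U : Ultrafilter (X × ℝ)} {c : Chart G}
    {f : X × ℝ → ℝ} (hf : c.Prepared U f) (n : ℕ) : c.Prepared U fun z => f z ^ n := by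
  induction n with
  | zero => simpa using Chart.Prepared.base (c := c) (U := U) (.const 1)
  | succ n ih => exact (ih.mul hf).congr (.of_forall fun z => pow_succ _ _)

namespace Disc

variable {X : Type} {G : Set (X → ℝ)} {U : Ultrafilter (X × ℝ)}

theorem exists_prepared (hU : NonGraph G U) (d : ℕ) (δ : Disc G) (hδ : δ.Valid U)
    {f : X × ℝ → ℝ} {g : ℝ → ℝ} (hf : Germ (δ.sys U) f g) (hg : Ord g d) :
    ∃ c : Chart G, c.Valid U ∧ Finer (c.sys U) (δ.sys U) ∧ c.Prepared U f := by
  induction d using Nat.strong_induction_on generalizing δ f g with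
  | _ d ih =>
  rcases d with _ | d
  · obtain ⟨k, hk, hk0, hgk⟩ := hg
    obtain ⟨c, hc, hfin, -⟩ := exists_chart hU hδ (.const 0) (fun _ => le_rfl) (by simp)
    obtain ⟨g', hg', h⟩ := hfin.germ hf
    refine ⟨c, hc, hfin, Chart.Prepared.unit ?_ (h.to_const rfl)⟩
    rw [hg', hgk.self_of_nhds]
    simpa using hk0
  obtain ⟨κ, _, φ, H, hφ, hH, hfH, hHg⟩ := hf
  have hord : HasOrder H (d + 1) := by
    obtain ⟨k, hk, hk0, hgk⟩ := hg
    exact ⟨k, hk, hk0, by filter_upwards [hHg, hgk] with t h1 h2 using h1.trans h2⟩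
  obtain ⟨τ, h, K, hτ, hτ0, hh, hh0, hK, hK0, hexp⟩ := exists_tschirnhaus hH hord
  change ∀ i, φ i ∈ baseE G U at hφ
  choose ψ hψ hψ0 hφψ using hφ
  obtain ⟨T, hT, hTe⟩ := exists_term_of_analyticAt (G := G) hτ hψ
  have hTe := hTe _ hψ0
  have hterm : ∀ n, ∃ f, IsTerm G f ∧ ∀ᶠ x in baseF G U, f x = h n fun i => ψ i x := fun n => by
    obtain ⟨f, hf, hfe⟩ := exists_term_of_analyticAt (G := G) (hh n) hψ
    exact ⟨f, hf, hfe _ hψ0⟩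
  choose F hF hFe using hterm
  have hψt : Tendsto (fun x i => ψ i x) (baseF G U) (𝓝 0) := tendsto_pi_nhds.2 hψ0
  have hT0 : Tendsto T (baseF G U) (𝓝 0) := by
    have := hτ.continuousAt.tendsto.comp hψt
    rw [hτ0] at this
    exact this.congr' (hTe.mono fun x hx => hx.symm)
  have hF0 : ∀ n < d, Tendsto (F n) (baseF G U) (𝓝 0) := fun n hn => by
    have := (hh n).continuousAt.tendsto.comp hψt
    rw [hh0 n hn] at this
    exact this.congr' ((hFe n).mono fun x hx => hx.symm)
  let α : ℕ → X → ℝ := fun n x => |F n x| ^ (((1 : ℚ) / (d + 1 - n : ℕ) : ℚ) : ℝ)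
  have hα : ∀ n, IsTerm G (α n) := fun n => (hF n).rpow _
  have hαn : ∀ n x, 0 ≤ α n x := fun n x => rpow_nonneg (abs_nonneg _) _
  have hαp : ∀ n < d, ∀ x, α n x ^ (d + 1 - n) = |F n x| := fun n hn x => by
    simp only [α]
    rw [← rpow_natCast, ← rpow_mul (abs_nonneg _)]
    push_cast
    rw [one_div, inv_mul_cancel₀, rpow_one]
    have : 0 < d + 1 - n := by omega
    positivity
  have hα0 : ∀ n < d, Tendsto (α n) (baseF G U) (𝓝 0) := fun n hn => by
    have h1 : (0 : ℝ) < (((1 : ℚ) / (d + 1 - n : ℕ) : ℚ) : ℝ) := by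
      have : 0 < d + 1 - n := by omega
      push_cast
      positivity
    have := ((hF0 n hn).abs.rpow_const (p := (((1 : ℚ) / (d + 1 - n : ℕ) : ℚ) : ℝ)) (.inr h1.le))
    rwa [abs_zero, zero_rpow h1.ne'] at this
  -- the expansion of `f` in the recentered variable
  have hfexp : ∀ (l : Filter (X × ℝ)) (s' : X × ℝ → ℝ), l ≤ (δ.sys U).l → Tendsto s' l (𝓝 0) →
      (∀ᶠ z in l, δ.s z = T z.1 + s' z) → ∀ᶠ z in l, f z =
        ∑ n ∈ Finset.range d, F n z.1 * s' z ^ n + s' z ^ (d + 1) * K (fun i => ψ i z.1, s' z) := by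
    intro l s' hl hs' hss
    have hb : Tendsto Prod.fst l (baseF G U) := tendsto_comap.mono_left (hl.trans (δ.l_le U))
    have ht : Tendsto (fun z => (fun i => ψ i z.1, s' z)) l (𝓝 0) := by
      rw [← Prod.mk_zero_zero]
      exact (hψt.comp hb).prodMk_nhds hs'
    have hFe' : ∀ᶠ x in baseF G U, ∀ n ∈ Finset.range d, F n x = h n fun i => ψ i x :=
      (Finset.range d).eventually_all.2 fun n _ => hFe n
    filter_upwards [hl hfH, ht.eventually hexp, hss, hb.eventually hTe, hb.eventually hFe']
      with z h1 h2 h3 h4 h5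
    rw [h1]
    have : (fun i => φ i z) = fun i => ψ i z.1 := by ext i; rw [hφψ]
    rw [this]
    change H (_, δ.s z) = _
    rw [h3, h4, h2]
    congr 1
    exact Finset.sum_congr rfl fun n hn => by rw [h5 n hn]
  have hs0 : Tendsto (fun z => δ.s z - T z.1) U (𝓝 0) := by
    simpa using hδ.2.sub (hT0.comp tendsto_fst_baseF)
  by_cases hA : ∀ n < d, Tendsto (fun z => α n z.1 / |δ.s z - T z.1|) U (𝓝 0)
  · obtain ⟨hv', hfin', hss'⟩ := recenter_spec hδ hT (.const 1) hT0 tendsto_const_nhds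
      (.of_forall fun _ => one_ne_zero) (by simpa using hs0)
    set δ' := δ.recenter hT (.const 1) with hδ'
    have hsU : ∀ᶠ z in (U : Filter (X × ℝ)), δ.s z - T z.1 = δ'.s z := by
      filter_upwards [hv'.le hss'] with z hz
      rw [hz]; ring
    obtain ⟨c, hc, hfin, hsp, ⟨e, he, hse⟩, hsmall⟩ := exists_chart hU hv'
      (IsTerm.sum (Finset.range d) fun n _ => hα n) (fun x => Finset.sum_nonneg fun n _ => hαn n x)
      (by
        have : Tendsto (fun z => ∑ n ∈ Finset.range d, α n z.1 / |δ.s z - T z.1|) U (𝓝 0) := by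
          simpa using tendsto_finsetSum (Finset.range d) fun n hn => hA n (Finset.mem_range.1 hn)
        refine this.congr' ?_
        filter_upwards [hsU] with z hz
        rw [Finset.sum_div, hz])
    refine ⟨c, hc, hfin.trans hfin', ?_⟩
    have hKg : Germ (c.sys U) (fun z => K (fun i => ψ i z.1, δ'.s z)) fun _ => K 0 := by
      have h1 : Germ (δ'.sys U) (fun z => K (fun i => ψ i z.1, δ'.s z)) fun t => K (0, t) :=
        ⟨κ, inferInstance, fun i z => ψ i z.1, K, fun i => ⟨ψ i, hψ i, hψ0 i, rfl⟩, hK,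
          .of_forall fun _ => rfl, .of_forall fun _ => rfl⟩
      obtain ⟨g', hg', h2⟩ := hfin.germ h1
      have := h2.to_const rfl
      rwa [hg'] at this
    have hterms : ∀ n ∈ Finset.range d, Germ (c.sys U)
        (fun z => F n z.1 / δ'.s z ^ (d + 1 - n)) fun _ => 0 := by
      intro n hn
      have hn' := Finset.mem_range.1 hn
      have hpos : 0 < d + 1 - n := by omega
      have k1 := hsmall (α n) (hα n) (hαn n)
        (fun x => Finset.single_le_sum (f := fun n => α n x) (fun n _ => hαn n x) hn)
        (d + 1 - n : ℕ) (by exact_mod_cast hpos)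
      obtain ⟨C, -, -, k2⟩ := Germ.of_bdd (U := U) (S := c.sys U) Chart.base_sub
        ((hF n).div (hF n).abs) (C := 1) (.of_forall fun z => by
          rw [abs_div, abs_abs]
          exact div_self_le_one _)
      refine (((k2.mul (Germ.const (e ^ (d + 1 - n)))).mul k1).congr_left ?_).congr_right (by simp)
      filter_upwards [hse] with z hz
      have he2 : e * e = 1 := by rcases he with rfl | rfl <;> simp
      have he0 : e ≠ 0 := by rcases he with rfl | rfl <;> simp
      push_cast
      rw [rpow_natCast, div_pow, hαp n hn']
      have hz2 : |δ'.s z| = e * δ'.s z := by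
        conv_rhs => rw [hz.1]
        linear_combination -|δ'.s z| * he2
      rw [hz2, mul_pow]
      have := hz.2
      rcases eq_or_ne (F n z.1) 0 with h0 | h0
      · simp [h0]
      · have := abs_ne_zero.2 h0
        field_simp
    have hbr := (Germ.sum (S := c.sys U) (Finset.range d) hterms).add hKg
    refine ((hsp.pow (d + 1)).mul (Chart.Prepared.unit (C := K 0) hK0
      (hbr.congr_right (by simp)))).congr ?_
    have hl : c.l U ≤ (δ'.sys U).l := hfin.le
    filter_upwards [hfexp (c.l U) δ'.s (hl.trans hfin'.le) ((δ'.sys U).hs.mono_left hl)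
      ((hss'.filter_mono hl).mono fun z hz => by rw [hz, one_mul]), hse] with z h1 h2
    rw [h1, mul_add, Finset.mul_sum]
    congr 1
    refine Finset.sum_congr rfl fun n hn => ?_
    have := h2.2
    have hn' := Finset.mem_range.1 hn
    rw [show d + 1 = n + (d + 1 - n) by omega, pow_add,
      show n + (d + 1 - n) - n = d + 1 - n by omega]
    field_simp
  · push Not at hA
    obtain ⟨n₀, hn₀, hA⟩ := hA
    obtain ⟨n₁, hn₁, hmax⟩ := ultrafilter_exists_max U (s := Finset.range d)
      ⟨n₀, Finset.mem_range.2 hn₀⟩ (fun n z => α n z.1)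
    have hn₁' := Finset.mem_range.1 hn₁
    obtain ⟨ε, hε, hge⟩ := ultrafilter_eventually_ge U
      (F := fun z => α n₁ z.1 / |δ.s z - T z.1|)
      (.of_forall fun z => div_nonneg (hαn _ _) (abs_nonneg _)) (fun hlim => hA (by
        refine squeeze_zero' (.of_forall fun z => div_nonneg (hαn _ _) (abs_nonneg _)) ?_ hlim
        filter_upwards [hmax] with z hz
        exact div_le_div_of_nonneg_right (hz n₀ (Finset.mem_range.2 hn₀)) (abs_nonneg _)))
    have hαpos : ∀ᶠ z in (U : Filter (X × ℝ)), 0 < α n₁ z.1 := by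
      filter_upwards [hge] with z hz
      refine lt_of_le_of_ne (hαn _ _) fun h0 => ?_
      rw [← h0, zero_div] at hz
      linarith
    obtain ⟨r, -, hr⟩ := exists_tendsto_of_bdd (W := U) (C := 1 / ε)
      (f := fun z => (δ.s z - T z.1) / α n₁ z.1) (by
        filter_upwards [hge, hαpos] with z hz h0
        rw [abs_div, abs_of_pos h0]
        rcases eq_or_ne (δ.s z - T z.1) 0 with h1 | h1
        · rw [h1, abs_zero, zero_div]
          positivity
        · have := abs_pos.2 h1
          rw [le_div_iff₀ this] at hz
          rw [div_le_div_iff₀ h0 hε]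
          linarith)
    have hα0' : ∀ᶠ x in baseF G U, α n₁ x ≠ 0 :=
      (IsDef.ne_zero (hα n₁)).eventually_baseF (hαpos.mono fun z hz => hz.ne')
    have hTr : IsTerm G fun x => T x + r * α n₁ x := hT.add ((IsTerm.const r).mul (hα n₁))
    obtain ⟨hv', hfin', hss'⟩ := recenter_spec hδ hTr (hα n₁)
      (by simpa using hT0.add ((hα0 n₁ hn₁').const_mul r)) (hα0 n₁ hn₁') hα0' (by
        have := hr.sub_const r
        rw [sub_self] at this
        refine this.congr' ?_
        filter_upwards [hαpos] with z hz
        have := hz.ne'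
        field_simp
        ring)
    set δ' := δ.recenter hTr (hα n₁) with hδ'
    have hξ : ∀ n ∈ Finset.range d, ∃ ξ : ℝ, Tendsto (fun x => F n x / α n₁ x ^ (d + 1 - n))
        (baseF G U) (𝓝 ξ) ∧ Germ (δ'.sys U) (fun z => F n z.1 / α n₁ z.1 ^ (d + 1 - n))
          fun _ => ξ := by
      intro n hn
      obtain ⟨C, -, h1, h2⟩ := Germ.of_bdd (U := U) (S := δ'.sys U) subset_rfl
        ((hF n).div ((hα n₁).pow (d + 1 - n))) (C := 1) (by
          filter_upwards [hmax, hαpos] with z hz h0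
          rw [abs_div, abs_of_pos (pow_pos h0 _), div_le_one (pow_pos h0 _),
            ← hαp n (Finset.mem_range.1 hn)]
          exact pow_le_pow_left₀ (hαn _ _) (hz n hn) _)
      exact ⟨C, h1, h2⟩
    choose! ξ hξ1 hξ2 using hξ
    have hξn : ξ n₁ ≠ 0 := by
      have h1 : Tendsto (fun x => |F n₁ x / α n₁ x ^ (d + 1 - n₁)|) (baseF G U) (𝓝 1) := by
        refine tendsto_const_nhds.congr' ?_
        filter_upwards [hα0'] with x hx
        rw [abs_div, abs_of_nonneg (pow_nonneg (hαn _ _) _), hαp n₁ hn₁', div_self]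
        rw [← hαp n₁ hn₁']
        exact pow_ne_zero _ hx
      have := tendsto_nhds_unique (hξ1 n₁ hn₁).abs h1
      intro h0
      rw [h0, abs_zero] at this
      exact zero_ne_one this
    obtain ⟨p, ⟨m, hm, hpm⟩, hp⟩ := exists_taylor_coeff_ne_zero (r := r) hK0 hn₁' hξn
    obtain ⟨m', hm', hord'⟩ := exists_ord_le (g := fun t => p.eval t) hpm (.of_forall fun _ => rfl)
    have hy : Germ (δ'.sys U) (fun z => r + δ'.s z) fun t => r + t := (Germ.const r).add Germ.var
    have hαg : Germ (δ'.sys U) (fun z => α n₁ z.1) fun _ => 0 :=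
      Germ.of_tendsto (U := U) subset_rfl (hα n₁) (hα0 n₁ hn₁')
    have hKg : Germ (δ'.sys U) (fun z => K (fun i => ψ i z.1, α n₁ z.1 * (r + δ'.s z)))
        fun _ => K 0 := by
      have := Germ.comp (S := δ'.sys U) (ι := Option κ)
        (f := fun o => o.elim (fun z => α n₁ z.1 * (r + δ'.s z)) fun i z => ψ i z.1)
        (g := fun _ _ => 0) (F := fun x => K (fun i => x (some i), x none)) (fun o => by
          cases o with
          | none => exact (hαg.mul hy).congr_right (by simp)
          | some i => exact Germ.param ⟨ψ i, hψ i, hψ0 i, rfl⟩) (by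
          refine AnalyticAt.comp_of_eq hK (AnalyticAt.prod ?_ (analyticAt_apply _ _)) ?_
          · exact analyticAt_pi_iff.2 fun j => analyticAt_apply _ _
          · simp [Prod.mk_zero_zero, Pi.zero_def])
      exact this.congr_right fun t => rfl
    have hFg := (Germ.sum (S := δ'.sys U) (Finset.range d) fun n hn =>
      (hξ2 n hn).mul (hy.pow n)).add ((hy.pow (d + 1)).mul hKg)
    obtain ⟨c, hc, hfin, hprep⟩ := ih m' (by omega) δ' hv' (hFg.congr_right (fun t => hp t)) hord'
    refine ⟨c, hc, hfin.trans hfin', ?_⟩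
    refine ((Chart.Prepared.base ((hα n₁).pow (d + 1))).mul hprep).congr ?_
    have hl : c.l U ≤ (δ'.sys U).l := hfin.le
    have hse' : ∀ᶠ z in c.l U, δ.s z = T z.1 + α n₁ z.1 * (r + δ'.s z) :=
      (hss'.filter_mono hl).mono fun z hz => by linear_combination hz
    have hlim : Tendsto (fun z => α n₁ z.1 * (r + δ'.s z)) (c.l U) (𝓝 0) := by
      simpa using ((hαg.mul hy).tendsto).mono_left hl
    filter_upwards [hfexp (c.l U) (fun z => α n₁ z.1 * (r + δ'.s z)) (hl.trans hfin'.le) hlim hse', c.eventually_base U hα0'] with z h1 h2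
    rw [h1, mul_add (α n₁ z.1 ^ (d + 1)), Finset.mul_sum]
    congr 1
    · refine Finset.sum_congr rfl fun n hn => ?_
      have hn' := Finset.mem_range.1 hn
      rw [show d + 1 = n + (d + 1 - n) by omega, pow_add,
        show n + (d + 1 - n) - n = d + 1 - n by omega, mul_pow]
      field_simp
    · rw [mul_pow, mul_assoc]

end Disc

end Tame

namespace Tame
open Filter Topology

namespace Chart

variable {X : Type} {G : Set (X → ℝ)} {c : Chart G} {U : Ultrafilter (X × ℝ)}

theorem exists_disc (hc : c.Valid U) {β : X → ℝ} (hβ : IsTerm G β) {r : ℝ} (hr : 0 < r)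
    (ht : Tendsto (fun z => β z.1 * c.p z) U (𝓝 r)) :
    ∃ δ : Disc G, δ.Valid U ∧ Finer (δ.sys U) (c.sys U) ∧ (∀ᶠ x in baseF G U, 0 < β x) ∧
      (∀ᶠ z in (δ.sys U).l, c.p z = r / β z.1 * (1 + δ.s z)) ∧
      ∀ c' : Chart G, c'.Valid U → Finer (c'.sys U) (δ.sys U) → Ref U c' c := by
  obtain ⟨k1, k2, k3⟩ := valid_iff.1 hc
  have hβU : ∀ᶠ z in (U : Filter (X × ℝ)), 0 < β z.1 := by
    filter_upwards [k1, ht.eventually (eventually_gt_nhds hr)] with z h1 h2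
    exact pos_of_mul_pos_left h2 h1.le
  have hβ0 : ∀ᶠ x in baseF G U, 0 < β x := (IsDef.pos hβ).eventually_baseF hβU
  have hσ2 : c.σ * c.σ = 1 := by rcases c.hσ with h | h <;> simp [h]
  set δ : Disc G := ⟨fun x => c.θ x + c.σ * (r / β x), fun x => c.σ * (β x / r),
    c.hθ.add ((IsTerm.const _).mul ((IsTerm.const r).div hβ)),
    (IsTerm.const _).mul (hβ.div (.const r))⟩ with hδ
  have hs : ∀ z : X × ℝ, 0 < β z.1 → δ.s z = β z.1 * c.p z / r - 1 := by
    intro z hz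
    simp only [Disc.s, hδ, p]
    field_simp
    linear_combination (-r) * hσ2
  have hlp : ∀ᶠ z in (δ.sys U).l, c.p z = r / β z.1 * (1 + δ.s z) := by
    filter_upwards [δ.eventually_base U hβ0] with z hz
    rw [hs z hz]
    field_simp
    ring
  have hs1 : ∀ᶠ z in (δ.sys U).l, 0 < 1 + δ.s z := by
    have := ((δ.sys U).hs.const_add 1).eventually (eventually_gt_nhds (by norm_num : (0 : ℝ) < 1 + 0))
    exact this
  have hv0 : Tendsto (fun x => c.b₁ x * β x / r) (baseF G U) (𝓝 0) := by
    refine ((c.hb₁.mul hβ).div (.const r)).tendsto_baseF ?_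
    have := (k2.mul ht).div_const r
    rw [zero_mul, zero_div] at this
    refine this.congr' ?_
    filter_upwards [k1] with z hz
    field_simp
  have hw0 : Tendsto (fun x => c.b₂ x * r / β x) (baseF G U) (𝓝 0) := by
    refine ((c.hb₂.mul (.const r)).div hβ).tendsto_baseF ?_
    have := (k3.mul (tendsto_const_nhds (x := r))).div ht hr.ne'
    rw [zero_mul, zero_div] at this
    refine this.congr' ?_
    filter_upwards [k1, hβU] with z hz hz'
    have := hz.ne'
    have := hz'.ne'
    simp only [Pi.div_apply]
    field_simp
  have hgs : Germ (δ.sys U) (fun z => 1 + δ.s z) fun t => 1 + t := (Germ.const 1).add Germ.var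
  have hle : (δ.sys U).l ≤ c.l U := by
    refine (c.le_l_iff U).2 ⟨δ.l_le U, ?_, ?_, ?_⟩
    · filter_upwards [hlp, hs1, δ.eventually_base U hβ0] with z h1 h2 h3
      rw [h1]
      positivity
    · have := ((hv0.comp (tendsto_comap.mono_left (δ.l_le U))).mul
        (hgs.tendsto.inv₀ (by norm_num)))
      rw [zero_mul] at this
      refine this.congr' ?_
      filter_upwards [hlp, hs1, δ.eventually_base U hβ0] with z h1 h2 h3
      rw [h1]
      simp only [Function.comp]
      have := h2.ne'
      field_simp
    · have := ((hw0.comp (tendsto_comap.mono_left (δ.l_le U))).mul hgs.tendsto)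
      rw [zero_mul] at this
      refine this.congr' ?_
      filter_upwards [hlp] with z h1
      rw [h1]
      simp only [Function.comp]
      ring
  have hfin : Finer (δ.sys U) (c.sys U) := by
    refine ⟨hle, ?_, ⟨_, rfl, Germ.const 0⟩⟩
    rintro φ (h | ⟨q, hq, rfl | rfl⟩)
    · exact Germ.param h
    all_goals have hq' : (0 : ℝ) < q := by exact_mod_cast hq
    · have h0 : Tendsto (fun x => |c.b₁ x * β x / r| ^ (q : ℝ)) (baseF G U) (𝓝 0) := by
        simpa [zero_rpow hq'.ne'] using hv0.abs.rpow_const (p := q) (.inr hq'.le)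
      refine (((Germ.of_tendsto (S := δ.sys U) subset_rfl
        (((c.hb₁.mul hβ).div (.const r)).rpow q) h0).mul
        (hgs.rpow (by norm_num) (-q))).congr_left ?_).congr_right (by simp)
      filter_upwards [hlp, hs1, δ.eventually_base U hβ0] with z h1 h2 h3
      have h4 := c.nn₁ z.1
      rw [h1, abs_of_nonneg (by positivity), rpow_neg h2.le, ← inv_rpow h2.le,
        ← mul_rpow (by positivity) (by positivity)]
      congr 1
      have := h2.ne'
      field_simp
    · have h0 : Tendsto (fun x => |c.b₂ x * r / β x| ^ (q : ℝ)) (baseF G U) (𝓝 0) := by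
        simpa [zero_rpow hq'.ne'] using hw0.abs.rpow_const (p := q) (.inr hq'.le)
      refine (((Germ.of_tendsto (S := δ.sys U) subset_rfl
        (((c.hb₂.mul (.const r)).div hβ).rpow q) h0).mul
        (hgs.rpow (by norm_num) q)).congr_left ?_).congr_right (by simp)
      filter_upwards [hlp, hs1, δ.eventually_base U hβ0] with z h1 h2 h3
      have h4 := c.nn₂ z.1
      rw [h1, abs_of_nonneg (by positivity), ← mul_rpow (by positivity) (by positivity)]
      congr 1
      ring
  refine ⟨δ, ⟨?_, ?_⟩, hfin, hβ0, hlp, fun c' hc' hf => ⟨hc', hf.trans hfin, ?_⟩⟩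
  · filter_upwards [hβ0] with x hx
    have : c.σ ≠ 0 := left_ne_zero_of_mul_eq_one hσ2
    simp only [hδ]
    positivity
  · have := (ht.div_const r).sub_const 1
    rw [div_self hr.ne', sub_self] at this
    refine this.congr' ?_
    filter_upwards [hβU] with z hz
    rw [hs z hz]
  · obtain ⟨g', h0, hg'⟩ := hf.germ hgs
    have h1 := hg'.to_const rfl
    rw [h0] at h1
    refine ((Prepared.base ((IsTerm.const r).div hβ)).mul
      (Prepared.unit (by norm_num) h1)).congr ?_
    exact hf.le hlp

theorem Prepared.exists_germ (hU : NonGraph G U) (hc : c.Valid U) {f : X × ℝ → ℝ}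
    (hf : Prepared c U f) {K : ℝ} (hK : ∀ᶠ z in (U : Filter (X × ℝ)), |f z| ≤ K) :
    ∃ c', Ref U c' c ∧ ∃ C, Germ (c'.sys U) f fun _ => C := by
  obtain ⟨a, κ, u, C, ha, hC, hu, hfe⟩ := hf
  suffices h : ∃ c', Ref U c' c ∧ ∃ C, Germ (c'.sys U) (fun z => |a z.1| * c.p z ^ (κ : ℝ))
      fun _ => C by
    obtain ⟨c', hr, C', h⟩ := h
    obtain ⟨e, -, -, he⟩ := Germ.of_bdd (U := U) (S := c'.sys U) c'.base_sub (ha.div ha.abs)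
      (C := 1) (.of_forall fun z => by rw [abs_div, abs_abs]; exact div_self_le_one _)
    refine ⟨c', hr, _, ((he.mul h).mul (hr.germ hu)).congr_left ?_⟩
    filter_upwards [hr.le hfe] with z hz
    rw [hz]
    rcases eq_or_ne (a z.1) 0 with h0 | h0
    · simp [h0]
    · have := abs_ne_zero.2 h0
      field_simp
  obtain ⟨k1, k2, k3⟩ := valid_iff.1 hc
  have hb : ∀ᶠ z in (U : Filter (X × ℝ)), |(|a z.1| * c.p z ^ (κ : ℝ))| ≤ K / (C / 2) := by
    have h1 : ∀ᶠ z in c.l U, C / 2 < u z := hu.tendsto.eventually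
      (eventually_gt_nhds (by linarith))
    filter_upwards [hK, hc h1, hc hfe, k1] with z h2 h3 h4 h5
    rw [le_div_iff₀ (by linarith)]
    refine le_trans ?_ h2
    rw [h4, abs_mul, abs_mul, abs_mul, abs_abs]
    refine mul_le_mul_of_nonneg_left ?_ (by positivity)
    rw [abs_of_pos (by linarith : 0 < u z)]
    exact h3.le
  rcases eq_or_ne κ 0 with hκ | hκ
  · subst hκ
    obtain ⟨e, -, -, he⟩ := Germ.of_bdd (U := U) (S := c.sys U) c.base_sub ha.abs
      (C := K / (C / 2)) (by simpa using hb)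
    exact ⟨c, Ref.refl hc, e, by simpa using he⟩
  have hκ' : (κ : ℝ) ≠ 0 := by exact_mod_cast hκ
  obtain ⟨ℓ, -, hℓ⟩ := exists_tendsto_of_bdd hb
  have hℓ0 : 0 ≤ ℓ := by
    refine ge_of_tendsto hℓ ?_
    filter_upwards [k1] with z hz
    positivity
  have hβ := ha.rpow (1 / κ)
  have hpw : ∀ z : X × ℝ, 0 < c.p z →
      |a z.1| ^ ((1 / κ : ℚ) : ℝ) * c.p z = (|a z.1| * c.p z ^ (κ : ℝ)) ^ (1 / κ : ℝ) := by
    intro z hz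
    rw [mul_rpow (abs_nonneg _) (by positivity), ← rpow_mul hz.le, mul_one_div_cancel hκ', rpow_one]
    push_cast
    rfl
  rcases hℓ0.eq_or_lt with h0 | h0
  · rw [← h0] at hℓ
    rcases lt_or_gt_of_ne hκ with hκn | hκp
    · have hκn' : (κ : ℝ) < 0 := by exact_mod_cast hκn
      have hβ := ha.rpow (1 / -κ)
      have hpw : ∀ z : X × ℝ, 0 < c.p z →
          (|a z.1| ^ ((1 / -κ : ℚ) : ℝ) / c.p z) = (|a z.1| * c.p z ^ (κ : ℝ)) ^ (1 / -κ : ℝ) := by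
        intro z hz
        rw [mul_rpow (abs_nonneg _) (by positivity), ← rpow_mul hz.le,
          show (κ : ℝ) * (1 / -κ) = -1 by field_simp, rpow_neg_one]
        push_cast
        rfl
      have hr := shrink_ref hc hβ (IsTerm.const 0) (fun _ => rpow_nonneg (abs_nonneg _) _)
        (fun _ => le_rfl) (by
          have := hℓ.rpow_const (p := 1 / -κ) (.inr (by have := neg_pos.2 hκn'; positivity))
          rw [zero_rpow (by simpa using hκ')] at this
          refine this.congr' ?_
          filter_upwards [k1] with z hz
          rw [hpw z hz]) (by simp)
      refine ⟨_, hr, 0, (germ_small₁ (c := c.shrink _ _ _ _) (U := U) hβ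
        (fun _ => rpow_nonneg (abs_nonneg _) _) (fun x => le_add_of_nonneg_left (c.nn₁ x))
        (q := -κ) (by linarith)).congr_left ?_⟩
      filter_upwards [hr.le (c.p_pos U)] with z hz
      change _ = (|a z.1| ^ ((1 / -κ : ℚ) : ℝ) / c.p z) ^ ((-κ : ℚ) : ℝ)
      rw [hpw z hz, ← rpow_mul (by positivity)]
      push_cast
      rw [one_div_mul_cancel (by simpa using hκ'), rpow_one]
    · have hκp' : (0 : ℝ) < κ := by exact_mod_cast hκp
      have hr := shrink_ref hc (IsTerm.const 0) hβ (fun _ => le_rfl)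
        (fun _ => rpow_nonneg (abs_nonneg _) _) (by simp) (by
          have := hℓ.rpow_const (p := 1 / κ) (.inr (by positivity))
          rw [zero_rpow (by positivity)] at this
          refine this.congr' ?_
          filter_upwards [k1] with z hz
          rw [hpw z hz])
      refine ⟨_, hr, 0, (germ_small₂ (c := c.shrink _ _ _ _) (U := U) hβ
        (fun _ => rpow_nonneg (abs_nonneg _) _) (fun x => le_add_of_nonneg_left (c.nn₂ x))
        (q := κ) hκp).congr_left ?_⟩
      filter_upwards [hr.le (c.p_pos U)] with z hz
      change _ = (|a z.1| ^ ((1 / κ : ℚ) : ℝ) * c.p z) ^ (κ : ℝ)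
      rw [hpw z hz, ← rpow_mul (by positivity), one_div_mul_cancel hκ', rpow_one]
  · have h1 : Tendsto (fun z => |a z.1| ^ ((1 / κ : ℚ) : ℝ) * c.p z) U (𝓝 (ℓ ^ (1 / κ : ℝ))) := by
      refine (hℓ.rpow_const (p := 1 / κ) (.inl h0.ne')).congr' ?_
      filter_upwards [k1] with z hz
      rw [hpw z hz]
    obtain ⟨δ, hδ, hfin, hβ0, hp, href⟩ := exists_disc hc hβ (by positivity) h1
    obtain ⟨c', hc', hfin', -⟩ := Disc.exists_prepared (f := δ.s) (g := fun t => t) hU 1 δ hδ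
      Germ.var ⟨fun _ => 1, analyticAt_const, one_ne_zero, by simp⟩
    have h2 : Germ (δ.sys U) (fun z => |a z.1| * c.p z ^ (κ : ℝ)) fun t => ℓ * (1 + t) ^ (κ : ℝ) := by
      refine ((Germ.const ℓ).mul (((Germ.const 1).add Germ.var).rpow (by norm_num) κ)).congr_left ?_
      filter_upwards [hp, δ.eventually_base U hβ0, hfin.le (c.p_pos U)] with z h3 h4 h5
      have h6 : 0 < 1 + δ.s z := by
        rw [h3] at h5
        exact pos_of_mul_pos_right h5 (by positivity)
      have h7 : 0 < |a z.1| := by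
        refine lt_of_le_of_ne (abs_nonneg _) fun h => ?_
        rw [← h, zero_rpow (by simpa using hκ)] at h4
        exact lt_irrefl _ h4
      change _ = ℓ * (1 + δ.s z) ^ (κ : ℝ)
      rw [h3, mul_rpow (by positivity) h6.le, div_rpow (by positivity) (by positivity),
        ← rpow_mul h0.le, ← rpow_mul h7.le]
      push_cast
      rw [one_div_mul_cancel hκ', rpow_one, rpow_one]
      field_simp
    obtain ⟨g', -, hg'⟩ := hfin'.germ h2
    exact ⟨c', href c' hc' hfin', _, hg'.to_const rfl⟩

end Chart

end Tame

namespace Tame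
open Filter Topology

/-- A function analytic in parameters and a variable, vanishing with the variable. -/
theorem exists_noetherian_form_of_zero {κ : Type} [Fintype κ] {V : (κ → ℝ) × ℝ → ℝ}
    (hV : AnalyticAt ℝ V 0) (hV0 : ∀ x, V (x, 0) = 0) :
    ∃ (m : ℕ) (h : ℕ → (κ → ℝ) → ℝ) (X : ℕ → (κ → ℝ) × ℝ → ℝ),
      (∀ n, AnalyticAt ℝ (h n) 0) ∧ (∀ n, AnalyticAt ℝ (X n) 0) ∧
      ∀ᶠ z in 𝓝 0, V z = ∑ n ∈ Finset.range m, h n z.1 * z.2 ^ (n + 1) * (1 + z.2 * X n z) := by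
  obtain ⟨m, h, X, h1, h2, h3⟩ := exists_noetherian_form hV
  rcases m with _ | m
  · exact ⟨0, h, X, h1, h2, by simpa using h3⟩
  refine ⟨m, fun n => h (n + 1), fun n => X (n + 1), fun n => h1 _, fun n => h2 _, ?_⟩
  have h4 : ∀ᶠ z : (κ → ℝ) × ℝ in 𝓝 0, h 0 z.1 = 0 := by
    have : Tendsto (fun z : (κ → ℝ) × ℝ => (z.1, (0 : ℝ))) (𝓝 0) (𝓝 0) := by
      have : Continuous (fun z : (κ → ℝ) × ℝ => (z.1, (0 : ℝ))) := by fun_prop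
      exact this.tendsto' _ _ rfl
    filter_upwards [this.eventually h3] with z hz
    rw [hV0, Finset.sum_range_succ'] at hz
    simpa using hz.symm
  filter_upwards [h3, h4] with z hz h0
  rw [hz, Finset.sum_range_succ', h0]
  simp

namespace Chart

variable {X : Type} {G : Set (X → ℝ)} {c : Chart G} {U : Ultrafilter (X × ℝ)}

/-- Roots of the small quantities of a chart. -/
def vr (c : Chart G) (m : ℕ) (z : X × ℝ) : ℝ := (c.b₁ z.1 / c.p z) ^ ((m : ℝ)⁻¹)

/-- Roots of the small quantities of a chart. -/
def wr (c : Chart G) (m : ℕ) (z : X × ℝ) : ℝ := (c.b₂ z.1 * c.p z) ^ ((m : ℝ)⁻¹)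

theorem germ_vr {m : ℕ} (hm : 0 < m) : Germ (c.sys U) (c.vr m) fun _ => 0 :=
  Germ.param (Or.inr ⟨(m : ℚ)⁻¹, by positivity, .inl (by ext z; simp [vr])⟩)

theorem germ_wr {m : ℕ} (hm : 0 < m) : Germ (c.sys U) (c.wr m) fun _ => 0 :=
  Germ.param (Or.inr ⟨(m : ℚ)⁻¹, by positivity, .inr (by ext z; simp [wr])⟩)

theorem rpow_eq_pow_root {q : ℚ} (hq : 0 < q) {m : ℕ} (hm : 0 < m) (hd : q.den ∣ m) :
    ∃ n : ℕ, n ≠ 0 ∧ ∀ x : ℝ, 0 ≤ x → x ^ (q : ℝ) = (x ^ ((m : ℝ)⁻¹)) ^ n := by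
  obtain ⟨k, rfl⟩ := hd
  have hk : k ≠ 0 := by
    rintro rfl
    simp at hm
  refine ⟨q.num.toNat * k, mul_ne_zero ?_ hk, fun x hx => ?_⟩
  · have := Rat.num_pos.2 hq
    omega
  · rw [← rpow_natCast, ← rpow_mul hx]
    congr 1
    have h1 : ((q.num.toNat : ℕ) : ℝ) = (q.num : ℝ) := by
      have := Rat.num_pos.2 hq
      exact_mod_cast Int.toNat_of_nonneg this.le
    have h2 : (q : ℝ) = (q.num : ℝ) / (q.den : ℝ) := by
      rw [← Rat.cast_intCast, ← Rat.cast_natCast, ← Rat.cast_div, Rat.num_div_den]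
    have h3 : (q.den : ℝ) ≠ 0 := by exact_mod_cast q.den_ne_zero
    have h4 : (k : ℝ) ≠ 0 := by exact_mod_cast hk
    push_cast
    rw [h1, h2]
    field_simp

theorem exists_normal_form {f : X × ℝ → ℝ} {g : ℝ → ℝ} (hf : Germ (c.sys U) f g) :
    ∃ (m : ℕ) (κ : Type) (_ : Fintype κ) (ψ : κ → X → ℝ) (H : (Option κ → ℝ) × ℝ → ℝ),
      0 < m ∧ (∀ i, IsTerm G (ψ i)) ∧ (∀ i, Tendsto (ψ i) (baseF G U) (𝓝 0)) ∧
      AnalyticAt ℝ H 0 ∧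
      ∀ᶠ z in c.l U, f z = H (fun o => o.elim (c.vr m z) fun i => ψ i z.1, c.wr m z) := by
  obtain ⟨κ, hκ, φ, H, h1, h2, h3, -⟩ := hf
  have key : ∀ i, ∃ m₀ : ℕ, 0 < m₀ ∧ ∀ m : ℕ, 0 < m → m₀ ∣ m → ∃ (ψ : X → ℝ) (e : ℝ × ℝ × ℝ → ℝ),
      IsTerm G ψ ∧ Tendsto ψ (baseF G U) (𝓝 0) ∧ AnalyticAt ℝ e 0 ∧ e 0 = 0 ∧
      ∀ᶠ z in c.l U, φ i z = e (ψ z.1, c.vr m z, c.wr m z) := by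
    intro i
    rcases h1 i with ⟨ψ, k1, k2, h⟩ | ⟨q, hq, h | h⟩
    · exact ⟨1, one_pos, fun m _ _ => ⟨ψ, fun x => x.1, k1, k2, analyticAt_fst, rfl, by simp [h]⟩⟩
    · refine ⟨q.den, q.den_pos, fun m hm hd => ?_⟩
      obtain ⟨n, hn, hx⟩ := rpow_eq_pow_root hq hm hd
      refine ⟨fun _ => 0, fun x => x.2.1 ^ n, .const 0, tendsto_const_nhds, ?_, by simp [hn], ?_⟩
      · exact (analyticAt_fst.comp analyticAt_snd).pow n
      · filter_upwards [c.p_pos U] with z hz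
        rw [h]
        exact hx _ (div_nonneg (c.nn₁ _) hz.le)
    · refine ⟨q.den, q.den_pos, fun m hm hd => ?_⟩
      obtain ⟨n, hn, hx⟩ := rpow_eq_pow_root hq hm hd
      refine ⟨fun _ => 0, fun x => x.2.2 ^ n, .const 0, tendsto_const_nhds, ?_, by simp [hn], ?_⟩
      · exact (analyticAt_snd.comp analyticAt_snd).pow n
      · filter_upwards [c.p_pos U] with z hz
        rw [h]
        exact hx _ (mul_nonneg (c.nn₂ _) hz.le)
  choose m₀ hm₀ key using key
  have hM : 0 < ∏ i, m₀ i := Finset.prod_pos fun i _ => hm₀ i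
  choose ψ e hψ hψ0 he he0 hφ using fun i => key i _ hM (Finset.dvd_prod_of_mem m₀ (Finset.mem_univ i))
  refine ⟨∏ i, m₀ i, κ, hκ, ψ, fun z => H (fun i => e i (z.1 (some i), z.1 none, z.2), 0), hM,
    hψ, hψ0, ?_, ?_⟩
  · refine AnalyticAt.comp_of_eq h2 (AnalyticAt.prod ?_ analyticAt_const) ?_
    · refine analyticAt_pi_iff.2 fun i => AnalyticAt.comp_of_eq (he i)
        (AnalyticAt.prod (analyticAt_fst_apply _ _)
          (AnalyticAt.prod (analyticAt_fst_apply _ _) analyticAt_snd)) ?_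
      simp [Prod.mk_zero_zero]
    · ext i
      · simpa [Prod.mk_zero_zero] using he0 i
      · rfl
  · filter_upwards [h3, eventually_all.2 hφ] with z h4 h5
    rw [h4]
    have : (c.sys U).s z = 0 := rfl
    simp only [this, h5, Option.elim]

theorem exists_split_form (hc : c.Valid U) {f : X × ℝ → ℝ} {g : ℝ → ℝ}
    (hf : Germ (c.sys U) f g) :
    ∃ (m : ℕ) (κ : Type) (_ : Fintype κ) (ψ : κ → X → ℝ) (W V : (κ → ℝ) × ℝ → ℝ),
      0 < m ∧ (∀ i, IsTerm G (ψ i)) ∧ (∀ i, Tendsto (ψ i) (baseF G U) (𝓝 0)) ∧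
      AnalyticAt ℝ W 0 ∧ AnalyticAt ℝ V 0 ∧ (∀ x, V (x, 0) = 0) ∧
      ∀ᶠ z in c.l U, f z = W (fun i => ψ i z.1, c.wr m z) + V (fun i => ψ i z.1, c.vr m z) := by
  obtain ⟨m, κ, hκ, ψ, H, hm, hψ, hψ0, hH, hfe⟩ := exists_normal_form hf
  obtain ⟨W, V, hW, hV, hV0, hWV⟩ := exists_split hH
  obtain ⟨k1, k2, k3⟩ := valid_iff.1 hc
  have ht : IsTerm G fun x => |c.b₁ x * c.b₂ x| ^ (((m : ℚ)⁻¹ : ℚ) : ℝ) :=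
    (c.hb₁.mul c.hb₂).rpow _
  have hmi : 0 < (m : ℝ)⁻¹ := by positivity
  have ht0 : Tendsto (fun x => |c.b₁ x * c.b₂ x| ^ (((m : ℚ)⁻¹ : ℚ) : ℝ)) (baseF G U) (𝓝 0) := by
    refine ht.tendsto_baseF ?_
    have := (k2.mul k3).abs.rpow_const (p := (m : ℝ)⁻¹) (.inr hmi.le)
    rw [mul_zero, abs_zero, zero_rpow hmi.ne'] at this
    refine this.congr' ?_
    filter_upwards [k1] with z hz
    push_cast
    congr 2
    field_simp
  refine ⟨m, Option κ, inferInstance,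
    fun o => o.elim (fun x => |c.b₁ x * c.b₂ x| ^ (((m : ℚ)⁻¹ : ℚ) : ℝ)) ψ, W, V, hm, ?_, ?_,
    hW, hV, hV0, ?_⟩
  · rintro (_ | i)
    exacts [ht, hψ i]
  · rintro (_ | i)
    exacts [ht0, hψ0 i]
  · have hlim : Tendsto (fun z => ((fun o : Option κ => o.elim (c.vr m z) fun i => ψ i z.1),
        c.wr m z)) (c.l U) (𝓝 0) := by
      rw [← Prod.mk_zero_zero]
      refine Tendsto.prodMk_nhds (tendsto_pi_nhds.2 ?_) (germ_wr hm).tendsto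
      rintro (_ | i)
      · exact (germ_vr hm).tendsto
      · exact (hψ0 i).comp (tendsto_comap.mono_left (c.l_le U))
    filter_upwards [hfe, hlim.eventually hWV, c.p_pos U] with z h1 h2 h3
    have h4 : setNone (fun o : Option κ => o.elim (c.vr m z) fun i => ψ i z.1)
        (c.vr m z * c.wr m z) = fun o => (o.elim (fun x => |c.b₁ x * c.b₂ x| ^ (((m : ℚ)⁻¹ : ℚ) : ℝ))
          ψ : X → ℝ) z.1 := by
      ext o
      rcases o with _ | i
      · simp only [setNone, Option.elim, vr, wr]
        rw [← mul_rpow (div_nonneg (c.nn₁ _) h3.le) (mul_nonneg (c.nn₂ _) h3.le),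
          abs_of_nonneg (mul_nonneg (c.nn₁ _) (c.nn₂ _))]
        push_cast
        congr 1
        field_simp
      · rfl
    rw [h1, h2]
    simp only [Option.elim_none]
    rw [h4]

theorem vr_pow {m : ℕ} (hm : 0 < m) {z : X × ℝ} (hz : 0 < c.p z) (n : ℕ) :
    c.vr m z ^ n = |c.b₁ z.1| ^ ((n / m : ℚ) : ℝ) * c.p z ^ ((-n / m : ℚ) : ℝ) := by
  rw [vr, ← rpow_natCast, ← rpow_mul (div_nonneg (c.nn₁ _) hz.le), div_rpow (c.nn₁ _) hz.le,
    abs_of_nonneg (c.nn₁ _), div_eq_mul_inv, ← rpow_neg hz.le]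
  push_cast
  congr 2 <;> ring

theorem wr_pow {m : ℕ} (hm : 0 < m) {z : X × ℝ} (hz : 0 < c.p z) (n : ℕ) :
    c.wr m z ^ n = |c.b₂ z.1| ^ ((n / m : ℚ) : ℝ) * c.p z ^ ((n / m : ℚ) : ℝ) := by
  rw [wr, ← rpow_natCast, ← rpow_mul (mul_nonneg (c.nn₂ _) hz.le), mul_rpow (c.nn₂ _) hz.le,
    abs_of_nonneg (c.nn₂ _)]
  push_cast
  congr 2 <;> ring

theorem germ_unit {κ : Type} [Fintype κ] {ψ : κ → X → ℝ} (hψ : ∀ i, IsTerm G (ψ i))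
    (hψ0 : ∀ i, Tendsto (ψ i) (baseF G U) (𝓝 0)) {r : X × ℝ → ℝ}
    (hr : Germ (c.sys U) r fun _ => 0) {F : (κ → ℝ) × ℝ → ℝ} (hF : AnalyticAt ℝ F 0) :
    Germ (c.sys U) (fun z => 1 + r z * F (fun i => ψ i z.1, r z)) fun _ => 1 := by
  have := Germ.comp (S := c.sys U) (ι := Option κ)
    (f := fun o => o.elim r fun i z => ψ i z.1) (g := fun _ _ => 0)
    (F := fun x => F (fun i => x (some i), x none)) (fun o => by
      cases o with
      | none => exact hr
      | some i => exact Germ.of_tendsto c.base_sub (hψ i) (hψ0 i)) (by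
      refine AnalyticAt.comp_of_eq hF (AnalyticAt.prod ?_ (analyticAt_apply _ _)) ?_
      · exact analyticAt_pi_iff.2 fun j => analyticAt_apply _ _
      · simp [Prod.mk_zero_zero, Pi.zero_def])
  exact ((Germ.const 1).add (hr.mul this)).congr_right (by simp)

theorem exists_expansion (hc : c.Valid U) {f : X × ℝ → ℝ} {g : ℝ → ℝ}
    (hf : Germ (c.sys U) f g) :
    ∃ (m N K : ℕ) (a : ℕ → X → ℝ) (u : ℕ → X × ℝ → ℝ), 0 < m ∧ (∀ n, IsTerm G (a n)) ∧
      (∀ n, Germ (c.sys U) (u n) fun _ => 1) ∧ ∀ᶠ z in c.l U,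
        f z = ∑ n ∈ Finset.range K, a n z.1 * c.p z ^ (((n - N) / m : ℚ) : ℝ) * u n z := by
  obtain ⟨m, κ, hκ, ψ, W, V, hm, hψ, hψ0, hW, hV, hV0, hfe⟩ := exists_split_form hc hf
  obtain ⟨K, h, F, h1, h2, h3⟩ := exists_noetherian_form hW
  obtain ⟨N, h', F', h1', h2', h3'⟩ := exists_noetherian_form_of_zero hV hV0
  choose A hA hAe using fun n => exists_term_of_analyticAt (h1 n) hψ
  choose A' hA' hAe' using fun n => exists_term_of_analyticAt (h1' n) hψ
  replace hAe := fun n => hAe n _ hψ0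
  replace hAe' := fun n => hAe' n _ hψ0
  have hψl : Tendsto (fun z : X × ℝ => fun i => ψ i z.1) (c.l U) (𝓝 0) :=
    (tendsto_pi_nhds.2 hψ0).comp (tendsto_comap.mono_left (c.l_le U))
  refine ⟨m, N, N + K, fun n => if n < N then
      fun x => A' (N - 1 - n) x * |c.b₁ x| ^ (((N - 1 - n + 1 : ℕ) / m : ℚ) : ℝ)
    else fun x => A (n - N) x * |c.b₂ x| ^ (((n - N : ℕ) / m : ℚ) : ℝ),
    fun n => if n < N then
      fun z => 1 + c.vr m z * F' (N - 1 - n) (fun i => ψ i z.1, c.vr m z)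
    else fun z => 1 + c.wr m z * F (n - N) (fun i => ψ i z.1, c.wr m z), hm, ?_, ?_, ?_⟩
  · intro n
    beta_reduce
    split_ifs
    · exact (hA' _).mul (c.hb₁.rpow _)
    · exact (hA _).mul (c.hb₂.rpow _)
  · intro n
    beta_reduce
    split_ifs
    · exact germ_unit hψ hψ0 (germ_vr hm) (h2' _)
    · exact germ_unit hψ hψ0 (germ_wr hm) (h2 _)
  · have hw : Tendsto (fun z => ((fun i => ψ i z.1), c.wr m z)) (c.l U) (𝓝 0) := by
      rw [← Prod.mk_zero_zero]
      exact hψl.prodMk_nhds (germ_wr hm).tendsto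
    have hv : Tendsto (fun z => ((fun i => ψ i z.1), c.vr m z)) (c.l U) (𝓝 0) := by
      rw [← Prod.mk_zero_zero]
      exact hψl.prodMk_nhds (germ_vr hm).tendsto
    filter_upwards [hfe, hw.eventually h3, hv.eventually h3', c.p_pos U,
      c.eventually_base U (Filter.eventually_all_finset (Finset.range K) |>.2 fun n _ => hAe n),
      c.eventually_base U (Filter.eventually_all_finset (Finset.range N) |>.2 fun n _ => hAe' n)]
      with z e1 e2 e3 e4 e5 e6
    rw [e1, e2, e3, Finset.sum_range_add, add_comm]
    congr 1
    · rw [← Finset.sum_range_reflect]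
      refine Finset.sum_congr rfl fun n hn => ?_
      have hn' := Finset.mem_range.1 hn
      rw [if_pos hn', if_pos hn', e6 _ (Finset.mem_range.2 (by omega)), vr_pow hm e4,
        show ((n - N : ℚ) / m) = (-((N - 1 - n + 1 : ℕ) : ℚ)) / m by
          rw [show N - 1 - n + 1 = N - n by omega, Nat.cast_sub hn'.le]; ring]
      ring
    · refine Finset.sum_congr rfl fun n hn => ?_
      rw [if_neg (by omega), if_neg (by omega), show N + n - N = n by omega, e5 _ hn,
        wr_pow hm e4, show (((N + n : ℕ) - N : ℚ) / m) = (n : ℚ) / m by push_cast; ring]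
      ring

end Chart

end Tame

namespace Tame
open Filter Topology

/-- Linear independence of distinct powers. -/
theorem sum_rpow_not_eventually_zero {ξ : ℕ → ℝ} {K m n₀ : ℕ} (N e : ℝ) (hm : 0 < m)
    (hn₀ : n₀ < K) (hξ : ξ n₀ ≠ 0) :
    ¬ ∀ᶠ t in 𝓝 (0 : ℝ), ∑ n ∈ Finset.range K, ξ n * (1 + t) ^ ((n - N) / m - e : ℝ) = 0 := by
  intro h
  set P : Polynomial ℝ := ∑ n ∈ Finset.range K, Polynomial.C (ξ n) * Polynomial.X ^ n with hP
  have hP0 : P ≠ 0 := by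
    intro h0
    have : P.coeff n₀ = ξ n₀ := by
      simp only [hP, Polynomial.finsetSum_coeff, Polynomial.coeff_C_mul, Polynomial.coeff_X_pow]
      simp [hn₀]
    rw [h0, Polynomial.coeff_zero] at this
    exact hξ this.symm
  have ht : Tendsto (fun r : ℝ => r ^ m - 1) (𝓝 1) (𝓝 0) := by
    have : Continuous fun r : ℝ => r ^ m - 1 := by fun_prop
    exact this.tendsto' _ _ (by simp)
  have hev : ∀ᶠ r in 𝓝 (1 : ℝ), P.IsRoot r := by
    filter_upwards [ht.eventually h, eventually_gt_nhds one_pos] with r hr hr0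
    have hm' : (m : ℝ) ≠ 0 := by positivity
    have h1 : ∀ n : ℕ, (1 + (r ^ m - 1)) ^ ((n - N) / m - e : ℝ) = r ^ n * r ^ (-N - m * e) := by
      intro n
      rw [add_sub_cancel, ← rpow_natCast, ← rpow_mul hr0.le, ← rpow_natCast, ← rpow_add hr0]
      congr 1
      field_simp
      ring
    simp only [h1, ← mul_assoc, ← Finset.sum_mul] at hr
    have h2 := (rpow_pos_of_pos hr0 (-N - m * e)).ne'
    rw [Polynomial.IsRoot, hP, Polynomial.eval_finsetSum]
    simpa [h2] using hr
  exact hP0 (Polynomial.eq_zero_of_infinite_isRoot _ (infinite_of_mem_nhds 1 hev))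

namespace Chart

variable {X : Type} {G : Set (X → ℝ)} {c : Chart G} {U : Ultrafilter (X × ℝ)}

theorem exists_ref_forall {ι : Type} (s : Finset ι) {P : ι → Chart G → Prop}
    (hP : ∀ i c c', Ref U c' c → P i c → P i c') (hc : c.Valid U)
    (hs : ∀ i ∈ s, ∀ c', Ref U c' c → ∃ c'', Ref U c'' c' ∧ P i c'') :
    ∃ c', Ref U c' c ∧ ∀ i ∈ s, P i c' := by
  classical
  induction s using Finset.induction_on with
  | empty => exact ⟨c, Ref.refl hc, by simp⟩
  | insert i s hi ih =>
    obtain ⟨c', h1, h2⟩ := ih fun j hj => hs j (by simp [hj])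
    obtain ⟨c'', h3, h4⟩ := hs i (by simp) c' h1
    refine ⟨c'', h3.trans h1, fun j hj => ?_⟩
    rcases Finset.mem_insert.1 hj with rfl | hj
    exacts [h4, hP _ _ _ h3 (h2 j hj)]

theorem Prepared.inv {f : X × ℝ → ℝ} (hf : Prepared c U f) : Prepared c U fun z => (f z)⁻¹ :=
  (hf.mul (hf.abs_rpow (-2))).congr (.of_forall fun z => by
    push_cast
    rw [rpow_neg (abs_nonneg _), show (2 : ℝ) = (2 : ℕ) by norm_num, rpow_natCast, sq_abs]
    rcases eq_or_ne (f z) 0 with h | h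
    · simp [h]
    · field_simp)

theorem Prepared.sign {f : X × ℝ → ℝ} (hf : Prepared c U f) :
    (∀ᶠ z in c.l U, f z = 0) ∨ (∀ᶠ z in c.l U, 0 < f z) ∨ ∀ᶠ z in c.l U, f z < 0 := by
  obtain ⟨a, κ, u, C, ha, hC, hu, hfe⟩ := hf
  rcases (IsDef.pos ha).eventually_or (U := U) with h | h
  · refine .inr (.inl ?_)
    filter_upwards [hfe, germ_pos hC hu, c.p_pos U, c.eventually_base U h] with z h1 h2 h3 h4
    rw [h1]
    exact mul_pos (mul_pos h4 (rpow_pos_of_pos h3 _)) h2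
  rcases (IsDef.pos ha.neg).eventually_or (U := U) with h' | h'
  · refine .inr (.inr ?_)
    filter_upwards [hfe, germ_pos hC hu, c.p_pos U, c.eventually_base U h'] with z h1 h2 h3 h4
    rw [h1]
    have h4 : 0 < -a z.1 := h4
    exact mul_neg_of_neg_of_pos (mul_neg_of_neg_of_pos (by linarith) (rpow_pos_of_pos h3 _)) h2
  · refine .inl ?_
    filter_upwards [hfe, c.eventually_base U h, c.eventually_base U h'] with z h1 h2 h3
    have h2 : ¬ 0 < a z.1 := h2
    have h3 : ¬ 0 < -a z.1 := h3
    rw [h1, show a z.1 = 0 by linarith, zero_mul, zero_mul]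

theorem exists_prepared_of_expansion (hU : NonGraph G U) (hc : c.Valid U) {f : X × ℝ → ℝ}
    {m N K : ℕ} {a : ℕ → X → ℝ} {u : ℕ → X × ℝ → ℝ} (hm : 0 < m) (ha : ∀ n, IsTerm G (a n))
    (hu : ∀ n, Germ (c.sys U) (u n) fun _ => 1)
    (hfe : ∀ᶠ z in c.l U,
      f z = ∑ n ∈ Finset.range K, a n z.1 * c.p z ^ (((n - N) / m : ℚ) : ℝ) * u n z) :
    ∃ c', Ref U c' c ∧ Prepared c' U f := by
  rcases K.eq_zero_or_pos with rfl | hK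
  · exact ⟨c, Ref.refl hc, (Prepared.base (.const 0)).congr (by simpa using hfe)⟩
  obtain ⟨k1, k2, k3⟩ := valid_iff.1 hc
  set q : ℕ → ℚ := fun n => (n - N) / m with hq
  obtain ⟨n₀, hn₀, hmax⟩ := ultrafilter_exists_max U (s := Finset.range K) ⟨0, by simpa using hK⟩
    fun n z => |a n z.1| * c.p z ^ (q n : ℝ)
  rcases (IsDef.ne_zero (ha n₀)).eventually_or (U := U) with h0 | h0
  swap
  · refine ⟨c, Ref.refl hc, (Prepared.base (.const 0)).congr ?_⟩
    have h1 : ∀ n ∈ Finset.range K, ∀ᶠ x in baseF G U, a n x = 0 := by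
      intro n hn
      refine (IsDef.eq (ha n) (.const 0)).eventually_baseF ?_
      filter_upwards [hmax, k1, tendsto_fst_baseF.eventually h0] with z h2 h3 h4
      have h4 : a n₀ z.1 = 0 := by simpa using h4
      have h5 := h2 n hn
      rw [h4, abs_zero, zero_mul] at h5
      have h6 := rpow_pos_of_pos h3 (q n : ℝ)
      have h7 : |a n z.1| ≤ 0 := by
        by_contra! h
        have := mul_pos h h6
        linarith
      exact abs_nonpos_iff.1 h7
    filter_upwards [hfe, c.eventually_base U (Filter.eventually_all_finset _ |>.2 h1)] with z h2 h3
    rw [h2]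
    exact Finset.sum_eq_zero fun n hn => by rw [h3 n hn]; simp
  set R : ℕ → X × ℝ → ℝ := fun n z => a n z.1 / a n₀ z.1 * c.p z ^ ((q n - q n₀ : ℚ) : ℝ) with hR
  suffices h : ∃ c', Ref U c' c ∧
      Prepared c' U fun z => ∑ n ∈ Finset.range K, R n z * u n z by
    obtain ⟨c', hr, hp⟩ := h
    refine ⟨c', hr, ((Prepared.base (ha n₀)).mul ((hr.coord.abs_rpow (q n₀)).mul hp)).congr ?_⟩
    filter_upwards [hr.le hfe, hr.le (c.p_pos U), hr.le (c.eventually_base U h0)] with z h1 h2 h3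
    have h3 : a n₀ z.1 ≠ 0 := h3
    rw [h1, Finset.mul_sum, Finset.mul_sum]
    refine Finset.sum_congr rfl fun n _ => ?_
    rw [hR, abs_of_pos h2]
    push_cast
    rw [rpow_sub h2]
    have := (rpow_pos_of_pos h2 (q n₀ : ℝ)).ne'
    simp only [hq] at this ⊢
    push_cast at this ⊢
    field_simp
  have hRb : ∀ n ∈ Finset.range K, ∀ᶠ z in (U : Filter (X × ℝ)), |R n z| ≤ 1 := by
    intro n hn
    filter_upwards [hmax, k1, tendsto_fst_baseF.eventually h0] with z h2 h3 h4
    have h4 := abs_pos.2 (show a n₀ z.1 ≠ 0 from h4)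
    have h5 := rpow_pos_of_pos h3 (q n₀ : ℝ)
    have h6 := rpow_pos_of_pos h3 (q n : ℝ)
    simp only [hR]
    push_cast
    rw [rpow_sub h3, abs_mul, abs_div, abs_of_pos (div_pos h6 h5), div_mul_div_comm,
      div_le_one (mul_pos h4 h5)]
    exact h2 n hn
  choose! ℓ _ hℓ using fun n hn => exists_tendsto_of_bdd (hRb n hn)
  have hℓ0 : ℓ n₀ = 1 := by
    refine tendsto_nhds_unique (hℓ n₀ hn₀) (tendsto_const_nhds.congr' ?_)
    filter_upwards [tendsto_fst_baseF.eventually h0] with z h4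
    have h4 : a n₀ z.1 ≠ 0 := h4
    simp [hR, h4]
  have hn₀' := Finset.mem_range.1 hn₀
  by_cases hsum : ∑ n ∈ Finset.range K, ℓ n ≠ 0
  · obtain ⟨c', hr, hg⟩ := exists_ref_forall (Finset.range K)
      (P := fun n c' => ∃ C, Germ (c'.sys U) (R n) fun _ => C)
      (fun n c c' h => fun ⟨C, h'⟩ => ⟨C, h.germ h'⟩) hc (fun n hn c' hr =>
        Prepared.exists_germ hU hr.valid (((Prepared.base ((ha n).div (ha n₀))).mul
          (hr.coord.abs_rpow (q n - q n₀))).congr (by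
            filter_upwards [hr.le (c.p_pos U)] with z hz
            rw [abs_of_pos hz])) (hRb n hn))
    choose! C hC using hg
    refine ⟨c', hr, Prepared.unit (C := ∑ n ∈ Finset.range K, C n * 1) ?_
      (Germ.sum _ fun n hn => (hC n hn).mul (hr.germ (hu n)))⟩
    rwa [Finset.sum_congr rfl fun n hn => (mul_one (C n)).trans
      (tendsto_nhds_unique ((hC n hn).tendsto.mono_left hr.valid) (hℓ n hn))]
  push Not at hsum
  obtain ⟨n₁, hn₁, hne, hn₁0⟩ : ∃ n₁ ∈ Finset.range K, n₁ ≠ n₀ ∧ ℓ n₁ ≠ 0 := by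
    by_contra! h
    rw [Finset.sum_eq_single_of_mem n₀ hn₀ fun n hn hne => h n hn hne, hℓ0] at hsum
    exact one_ne_zero hsum
  have hκ : q n₁ - q n₀ ≠ 0 := by
    have : (m : ℚ) ≠ 0 := by positivity
    simp only [hq]
    rw [← sub_div, sub_sub_sub_cancel_right]
    exact div_ne_zero (sub_ne_zero.2 (by exact_mod_cast hne)) this
  have hκ' : ((q n₁ - q n₀ : ℚ) : ℝ) ≠ 0 := by exact_mod_cast hκ
  have hℓ1 := abs_pos.2 hn₁0
  obtain ⟨δ, hδ, hfin, hβ0, hp, href⟩ := exists_disc hc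
    (((ha n₁).div (ha n₀)).rpow (1 / (q n₁ - q n₀))) (r := |ℓ n₁| ^ (1 / ((q n₁ - q n₀ : ℚ) : ℝ)))
    (by positivity) (by
      refine ((hℓ n₁ hn₁).abs.rpow_const (.inl hℓ1.ne')).congr' ?_
      filter_upwards [k1] with z hz
      rw [hR, abs_mul, abs_of_pos (rpow_pos_of_pos hz _), mul_rpow (abs_nonneg _) (by positivity),
        ← rpow_mul hz.le, mul_one_div_cancel hκ', rpow_one]
      push_cast
      rfl)
  set r := |ℓ n₁| ^ (1 / ((q n₁ - q n₀ : ℚ) : ℝ)) with hr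
  have hr0 : 0 < r := by positivity
  have hβ := ((ha n₁).div (ha n₀)).rpow (1 / (q n₁ - q n₀))
  set β : X → ℝ := fun x => |a n₁ x / a n₀ x| ^ ((1 / (q n₁ - q n₀) : ℚ) : ℝ) with hβd
  have hβ0 : ∀ᶠ x in baseF G U, 0 < β x := hβ0
  have hp : ∀ᶠ z in (δ.sys U).l, c.p z = r / β z.1 * (1 + δ.s z) := hp
  set B : ℕ → X → ℝ := fun n x => a n x / a n₀ x * |r / β x| ^ ((q n - q n₀ : ℚ) : ℝ) with hB
  have hBt : ∀ n, IsTerm G (B n) := fun n =>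
    ((ha n).div (ha n₀)).mul (((IsTerm.const r).div hβ).rpow _)
  have hgs : Germ (δ.sys U) (fun z => 1 + δ.s z) fun t => 1 + t := (Germ.const 1).add Germ.var
  have hs1 : ∀ᶠ z in (δ.sys U).l, 0 < 1 + δ.s z :=
    hgs.tendsto.eventually (eventually_gt_nhds (by norm_num))
  have hRB : ∀ n, ∀ᶠ z in (δ.sys U).l,
      R n z = B n z.1 * (1 + δ.s z) ^ ((q n - q n₀ : ℚ) : ℝ) := by
    intro n
    filter_upwards [hp, hs1, δ.eventually_base U hβ0] with z h1 h2 h3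
    simp only [hR, hB]
    rw [h1, abs_of_pos (by positivity), mul_rpow (by positivity) h2.le]
    ring
  have hξ : ∀ n ∈ Finset.range K, ∃ ξ, Tendsto (B n) (baseF G U) (𝓝 ξ) ∧
      Germ (δ.sys U) (fun z => B n z.1) fun _ => ξ := by
    intro n hn
    obtain ⟨ξ, -, h1, h2⟩ := Germ.of_bdd (U := U) (S := δ.sys U) subset_rfl (hBt n) (C := 2) (by
      have h5 : Tendsto (fun z => (1 + δ.s z) ^ ((q n - q n₀ : ℚ) : ℝ)) (δ.sys U).l (𝓝 1) := by
        simpa using (hgs.rpow (by norm_num) ((q n - q n₀ : ℚ) : ℝ)).tendsto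
      filter_upwards [hδ.le (hRB n), hRb n hn,
        hδ.le (h5.eventually (eventually_gt_nhds (by norm_num : (1 / 2 : ℝ) < 1)))] with z h1 h2 h3
      rw [h1, abs_mul, abs_of_pos (by linarith : 0 < (1 + δ.s z) ^ ((q n - q n₀ : ℚ) : ℝ))] at h2
      nlinarith [abs_nonneg (B n z.1)])
    exact ⟨ξ, h1, h2⟩
  choose! ξ hξt hξg using hξ
  have hξ0 : ξ n₀ ≠ 0 := by
    have : ξ n₀ = 1 := by
      refine tendsto_nhds_unique (hξt n₀ hn₀) (tendsto_const_nhds.congr' ?_)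
      filter_upwards [h0] with x hx
      have hx : a n₀ x ≠ 0 := hx
      simp [hB, hx]
    rw [this]
    exact one_ne_zero
  have hF : Germ (δ.sys U) (fun z => ∑ n ∈ Finset.range K, R n z * u n z)
      fun t => ∑ n ∈ Finset.range K, ξ n * (1 + t) ^ (((n : ℝ) - N) / m - q n₀) := by
    refine ((Germ.sum (Finset.range K) fun n hn => (((hξg n hn).mul (hgs.rpow (by norm_num)
      ((q n - q n₀ : ℚ) : ℝ))).mul (hfin.germ_const (hu n)))).congr_left ?_).congr_right ?_
    · filter_upwards [Filter.eventually_all_finset (Finset.range K) |>.2 fun n _ => hRB n] with z hz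
      exact Finset.sum_congr rfl fun n hn => by rw [hz n hn]
    · intro t
      refine Finset.sum_congr rfl fun n _ => ?_
      simp only [hq]
      push_cast
      rw [mul_one]
  obtain ⟨d, hd⟩ := exists_ord hF.analyticAt
    (sum_rpow_not_eventually_zero (N : ℝ) (q n₀) hm hn₀' hξ0)
  obtain ⟨c', hc', hfin', hprep⟩ := Disc.exists_prepared hU d δ hδ hF hd
  exact ⟨c', href c' hc' hfin', hprep⟩

theorem exists_prepared_of_germ (hU : NonGraph G U) (hc : c.Valid U) {f : X × ℝ → ℝ} {g : ℝ → ℝ}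
    (hf : Germ (c.sys U) f g) : ∃ c', Ref U c' c ∧ Prepared c' U f := by
  obtain ⟨m, N, K, a, u, hm, ha, hu, hfe⟩ := exists_expansion hc hf
  exact exists_prepared_of_expansion hU hc hm ha hu hfe

theorem Prepared.exists_add_of_le (hU : NonGraph G U) (hc : c.Valid U) {f g : X × ℝ → ℝ}
    (hf : Prepared c U f) (hg : Prepared c U g)
    (hle : ∀ᶠ z in (U : Filter (X × ℝ)), |g z| ≤ |f z|) :
    ∃ c', Ref U c' c ∧ Prepared c' U fun z => f z + g z := by
  have hmain : (∀ᶠ z in c.l U, f z ≠ 0) → ∃ c', Ref U c' c ∧ Prepared c' U fun z => f z + g z := by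
    intro hne
    obtain ⟨c₁, h1, C, hC⟩ := Prepared.exists_germ hU hc (hg.mul hf.inv) (K := 1) (by
      filter_upwards [hle] with z hz
      rw [abs_mul, abs_inv, ← div_eq_mul_inv]
      exact div_le_one_of_le₀ hz (abs_nonneg _))
    obtain ⟨c₂, h2, hp⟩ := exists_prepared_of_germ hU h1.valid ((Germ.const 1).add hC)
    refine ⟨c₂, h2.trans h1, (((h2.trans h1).prepared hf).mul hp).congr ?_⟩
    filter_upwards [(h2.trans h1).le hne] with z hz
    field_simp
  rcases hf.sign with h | h | h
  · refine ⟨c, Ref.refl hc, hg.congr ?_⟩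
    filter_upwards [h] with z hz
    rw [hz, zero_add]
  · exact hmain (h.mono fun z hz => hz.ne')
  · exact hmain (h.mono fun z hz => hz.ne)

theorem Prepared.exists_add (hU : NonGraph G U) (hc : c.Valid U) {f g : X × ℝ → ℝ}
    (hf : Prepared c U f) (hg : Prepared c U g) :
    ∃ c', Ref U c' c ∧ Prepared c' U fun z => f z + g z := by
  rcases Ultrafilter.em U (fun z => |g z| ≤ |f z|) with h | h
  · exact hf.exists_add_of_le hU hc hg h
  · obtain ⟨c', h1, h2⟩ := hg.exists_add_of_le hU hc hf (h.mono fun z hz => (not_le.1 hz).le)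
    exact ⟨c', h1, h2.congr (.of_forall fun z => add_comm _ _)⟩

end Chart

/-- Every chart can be refined so that `f` becomes prepared. -/
def Prep {X : Type} (G : Set (X → ℝ)) (U : Ultrafilter (X × ℝ)) (f : X × ℝ → ℝ) : Prop :=
  ∀ c : Chart G, c.Valid U → ∃ c', Chart.Ref U c' c ∧ c'.Prepared U f

namespace Prep

open Chart

variable {X : Type} {G : Set (X → ℝ)} {U : Ultrafilter (X × ℝ)} {f g : X × ℝ → ℝ}

theorem congr (hf : Prep G U f) (h : ∀ z, g z = f z) : Prep G U g := (funext h) ▸ hf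

theorem base {a : X → ℝ} (ha : IsTerm G a) : Prep G U fun z => a z.1 :=
  fun c hc => ⟨c, Ref.refl hc, Prepared.base ha⟩

theorem mul (hf : Prep G U f) (hg : Prep G U g) : Prep G U fun z => f z * g z := by
  intro c hc
  obtain ⟨c₁, h1, h2⟩ := hf c hc
  obtain ⟨c₂, h3, h4⟩ := hg c₁ h1.valid
  exact ⟨c₂, h3.trans h1, (h3.prepared h2).mul h4⟩

theorem add (hU : NonGraph G U) (hf : Prep G U f) (hg : Prep G U g) :
    Prep G U fun z => f z + g z := by
  intro c hc
  obtain ⟨c₁, h1, h2⟩ := hf c hc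
  obtain ⟨c₂, h3, h4⟩ := hg c₁ h1.valid
  obtain ⟨c₃, h5, h6⟩ := (h3.prepared h2).exists_add hU h3.valid h4
  exact ⟨c₃, h5.trans (h3.trans h1), h6⟩

theorem rpow (hf : Prep G U f) (q : ℚ) : Prep G U fun z => |f z| ^ (q : ℝ) := by
  intro c hc
  obtain ⟨c₁, h1, h2⟩ := hf c hc
  exact ⟨c₁, h1, h2.abs_rpow q⟩

theorem snd (hU : NonGraph G U) : Prep G U Prod.snd := by
  intro c hc
  obtain ⟨c', h1, h2⟩ := (Prepared.base (c := c) (U := U) c.hθ).exists_add hU hc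
    ((Prepared.base (IsTerm.const c.σ)).mul Prepared.coord)
  refine ⟨c', h1, h2.congr (.of_forall fun z => ?_)⟩
  rcases c.hσ with h | h <;> simp [Chart.p, h]

theorem an (hU : NonGraph G U) {n : ℕ} {H : (Fin n → ℝ) → ℝ} {ψ : Fin n → X × ℝ → ℝ}
    (hH : ∀ c, (∀ i, |c i| ≤ 1) → AnalyticAt ℝ H c) (hψ : ∀ i, Prep G U (ψ i)) :
    Prep G U fun z => if ∀ i, |ψ i z| ≤ 1 then H (fun i => ψ i z) else 0 := by
  intro c hc
  have h1 : ∀ i, Prep G U fun z => 1 + -1 * |ψ i z| := fun i =>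
    (base (.const 1)).add hU ((base (.const (-1))).mul (((hψ i).rpow 1).congr fun z => by simp))
  obtain ⟨c₁, r1, p1⟩ := exists_ref_forall (Finset.univ : Finset (Fin n))
    (P := fun i c => Prepared c U (ψ i) ∧ Prepared c U fun z => 1 + -1 * |ψ i z|)
    (fun i c c' h h' => ⟨h.prepared h'.1, h.prepared h'.2⟩) hc (fun i _ c' hc' => by
      obtain ⟨c₁, h3, h4⟩ := hψ i c' hc'.valid
      obtain ⟨c₂, h5, h6⟩ := h1 i c₁ h3.valid
      exact ⟨c₂, h5.trans h3, h5.prepared h4, h6⟩)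
  by_cases hneg : ∃ i, ∀ᶠ z in c₁.l U, 1 + -1 * |ψ i z| < 0
  · obtain ⟨i, hi⟩ := hneg
    refine ⟨c₁, r1, (Prepared.base (.const 0)).congr ?_⟩
    filter_upwards [hi] with z hz
    rw [if_neg]
    intro h
    have := h i
    linarith
  have hle : ∀ i, ∀ᶠ z in c₁.l U, |ψ i z| ≤ 1 := by
    intro i
    rcases (p1 i (Finset.mem_univ i)).2.sign with h | h | h
    · exact h.mono fun z hz => by linarith
    · exact h.mono fun z hz => by linarith
    · exact absurd ⟨i, h⟩ hneg
  obtain ⟨c₂, r2, p2⟩ := exists_ref_forall (Finset.univ : Finset (Fin n))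
    (P := fun i c => ∃ C, Germ (c.sys U) (ψ i) fun _ => C)
    (fun i c c' h => fun ⟨C, h'⟩ => ⟨C, h.germ h'⟩) r1.valid (fun i _ c' hc' =>
      Prepared.exists_germ hU hc'.valid (hc'.prepared (p1 i (Finset.mem_univ i)).1)
        (r1.valid (hle i)))
  choose C hC using fun i => p2 i (Finset.mem_univ i)
  have hCb : ∀ i, |C i| ≤ 1 := fun i =>
    le_of_tendsto ((hC i).tendsto.mono_left r2.valid).abs (r1.valid (hle i))
  obtain ⟨c₃, r3, p3⟩ := exists_prepared_of_germ hU r2.valid (Germ.comp hC (hH C hCb))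
  refine ⟨c₃, r3.trans (r2.trans r1), p3.congr ?_⟩
  filter_upwards [(r3.trans r2).le (eventually_all.2 hle)] with z hz
  rw [if_pos hz]

end Prep

/-- The functions on `X × ℝ` obtained from `G` by adjoining the last coordinate. -/
def adj {X : Type} (G : Set (X → ℝ)) : Set (X × ℝ → ℝ) :=
  insert Prod.snd {f | ∃ g ∈ G, f = fun z => g z.1}

variable {X : Type} {G : Set (X → ℝ)} {U : Ultrafilter (X × ℝ)} {f : X × ℝ → ℝ}

/-- Preparation theorem: all terms can be prepared. -/
theorem IsTerm.prep (hU : NonGraph G U) (hf : IsTerm (adj G) f) : Prep G U f := by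
  induction hf with
  | gen h =>
    rcases h with rfl | ⟨g, hg, rfl⟩
    exacts [Prep.snd hU, Prep.base (.gen hg)]
  | const r => exact Prep.base (.const r)
  | add _ _ h1 h2 => exact h1.add hU h2
  | mul _ _ h1 h2 => exact h1.mul h2
  | rpow q _ h => exact h.rpow q
  | an h1 _ h2 => exact Prep.an hU h1 h2

theorem exists_valid_chart (hU : NonGraph G U) : ∃ c : Chart G, c.Valid U := by
  obtain ⟨σ, hσ, hp⟩ : ∃ σ : ℝ, (σ = 1 ∨ σ = -1) ∧
      ∀ᶠ z in (U : Filter (X × ℝ)), 0 < σ * (z.2 - 0) := by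
    rcases Ultrafilter.em U (fun z => 0 < z.2) with h | h
    · exact ⟨1, .inl rfl, h.mono fun z hz => by linarith⟩
    · refine ⟨-1, .inr rfl, ?_⟩
      filter_upwards [h, hU _ (.const 0)] with z h1 h2
      have := lt_of_le_of_ne (not_lt.1 h1) h2
      linarith
  exact ⟨⟨fun _ => 0, fun _ => 0, fun _ => 0, σ, .const 0, .const 0, .const 0, hσ,
    fun _ => le_rfl, fun _ => le_rfl⟩, Chart.valid_iff.2 ⟨hp, by simp, by simp⟩⟩

/-- Simultaneous preparation of finitely many terms. -/
theorem exists_chart_forall_prepared (hU : NonGraph G U) {ι : Type} (s : Finset ι)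
    {f : ι → X × ℝ → ℝ} (hf : ∀ i ∈ s, IsTerm (adj G) (f i)) :
    ∃ c : Chart G, c.Valid U ∧ ∀ i ∈ s, c.Prepared U (f i) := by
  obtain ⟨c, hc⟩ := exists_valid_chart hU
  obtain ⟨c', h1, h2⟩ := Chart.exists_ref_forall s (P := fun i c => c.Prepared U (f i))
    (fun i c c' h h' => h.prepared h') hc (fun i hi c' hc' => (hf i hi).prep hU c' hc'.valid)
  exact ⟨c', h1.valid, h2⟩

end Tame

namespace Tame
open Filter Topology

theorem IsTerm.measurable {X Y : Type} {G : Set (X → ℝ)} [MeasurableSpace Y] {e : Y → X}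
    (h : ∀ g ∈ G, Measurable fun y => g (e y)) {f : X → ℝ} (hf : IsTerm G f) :
    Measurable fun y => f (e y) := by
  induction hf with
  | gen hg => exact h _ hg
  | const c => exact measurable_const
  | add _ _ h1 h2 => exact h1.add h2
  | mul _ _ h1 h2 => exact h1.mul h2
  | rpow q _ h1 =>
    exact (continuous_abs.measurable.comp h1).pow_const (q : ℝ)
  | @an n H ψ hH _ h1 =>
    have hm : Measurable fun y => fun i => ψ i (e y) := measurable_pi_lambda _ h1
    have hK : MeasurableSet {c : Fin n → ℝ | ∀ i, |c i| ≤ 1} := by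
      rw [ofPred_forall]
      exact MeasurableSet.iInter fun i =>
        measurableSet_le (continuous_abs.measurable.comp (measurable_pi_apply i)) measurable_const
    have hc : ContinuousOn H {c : Fin n → ℝ | ∀ i, |c i| ≤ 1} := fun c hc =>
      (hH c hc).continuousAt.continuousWithinAt
    classical
    exact (hc.measurable_piecewise (continuousOn_const (c := (0 : ℝ))) hK).comp hm

/-- Polynomials in terms and logarithms of terms. -/
inductive IsLT {X : Type} (G : Set (X → ℝ)) : (X → ℝ) → Prop
  | term {f : X → ℝ} : IsTerm G f → IsLT G f
  | log {f : X → ℝ} : IsTerm G f → IsLT G fun x => Real.log (f x)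
  | add {f g : X → ℝ} : IsLT G f → IsLT G g → IsLT G fun x => f x + g x
  | mul {f g : X → ℝ} : IsLT G f → IsLT G g → IsLT G fun x => f x * g x

namespace IsLT

variable {X : Type} {G : Set (X → ℝ)} {f g : X → ℝ}

theorem congr (hf : IsLT G f) (h : ∀ x, g x = f x) : IsLT G g := (funext h) ▸ hf

theorem const (c : ℝ) : IsLT G fun _ => c := .term (.const c)

theorem neg (hf : IsLT G f) : IsLT G fun x => -f x :=
  ((const (-1)).mul hf).congr fun x => by ring

theorem sub (hf : IsLT G f) (hg : IsLT G g) : IsLT G fun x => f x - g x :=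
  (hf.add hg.neg).congr fun x => by ring

theorem pow (hf : IsLT G f) (n : ℕ) : IsLT G fun x => f x ^ n := by
  induction n with
  | zero => exact (const 1).congr fun x => pow_zero _
  | succ n ih => exact (ih.mul hf).congr fun x => pow_succ _ _

theorem comp {Y : Type} {G' : Set (Y → ℝ)} {pr : Y → X} (h : ∀ g ∈ G, IsTerm G' fun y => g (pr y))
    (hf : IsLT G f) : IsLT G' fun y => f (pr y) := by
  induction hf with
  | term h1 => exact .term (h1.comp h)
  | log h1 => exact .log (h1.comp h)
  | add _ _ h1 h2 => exact h1.add h2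
  | mul _ _ h1 h2 => exact h1.mul h2

theorem measurable {Y : Type} [MeasurableSpace Y] {e : Y → X}
    (h : ∀ g ∈ G, Measurable fun y => g (e y)) (hf : IsLT G f) :
    Measurable fun y => f (e y) := by
  induction hf with
  | term h1 => exact h1.measurable h
  | log h1 => exact Real.measurable_log.comp (h1.measurable h)
  | add _ _ h1 h2 => exact h1.add h2
  | mul _ _ h1 h2 => exact h1.mul h2

theorem ite {A : Set X} (hA : IsDef G A) [DecidablePred (· ∈ A)] (hf : IsLT G f) (hg : IsLT G g) :
    IsLT G fun x => if x ∈ A then f x else g x := by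
  refine ((IsLT.mul (.term hA) hf).add (IsLT.mul (.term hA.compl) hg)).congr fun x => ?_
  by_cases h : x ∈ A <;> simp [h]

end IsLT

namespace Chart

variable {X : Type} {G : Set (X → ℝ)} {c : Chart G} {U : Ultrafilter (X × ℝ)}

/-- Sums of prepared functions multiplied by powers of the logarithm of the coordinate. -/
def LPrep (c : Chart G) (U : Ultrafilter (X × ℝ)) (f : X × ℝ → ℝ) : Prop :=
  ∃ (ι : Type) (_ : Fintype ι) (a : ι → X → ℝ) (κ : ι → ℚ) (l : ι → ℕ) (u : ι → X × ℝ → ℝ)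
    (C : ι → ℝ), (∀ j, IsLT G (a j)) ∧ (∀ j, Germ (c.sys U) (u j) fun _ => C j) ∧
    ∀ᶠ z in c.l U, f z = ∑ j, a j z.1 * c.p z ^ (κ j : ℝ) * log (c.p z) ^ l j * u j z

namespace LPrep

variable {f g : X × ℝ → ℝ}

theorem congr (hf : LPrep c U f) (h : ∀ᶠ z in c.l U, g z = f z) : LPrep c U g := by
  obtain ⟨ι, hι, a, κ, l, u, C, h1, h2, h3⟩ := hf
  refine ⟨ι, hι, a, κ, l, u, C, h1, h2, ?_⟩
  filter_upwards [h, h3] with z hz hz' using hz.trans hz'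

theorem add (hf : LPrep c U f) (hg : LPrep c U g) : LPrep c U fun z => f z + g z := by
  obtain ⟨ι, hι, a, κ, l, u, C, h1, h2, h3⟩ := hf
  obtain ⟨ι', _, a', κ', l', u', C', k1, k2, k3⟩ := hg
  refine ⟨ι ⊕ ι', inferInstance, Sum.elim a a', Sum.elim κ κ', Sum.elim l l', Sum.elim u u',
    Sum.elim C C', Sum.rec h1 k1, Sum.rec h2 k2, ?_⟩
  filter_upwards [h3, k3] with z hz hz'
  simp [Fintype.sum_sum_type, hz, hz']

theorem mul (hf : LPrep c U f) (hg : LPrep c U g) : LPrep c U fun z => f z * g z := by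
  obtain ⟨ι, hι, a, κ, l, u, C, h1, h2, h3⟩ := hf
  obtain ⟨ι', _, a', κ', l', u', C', k1, k2, k3⟩ := hg
  refine ⟨ι × ι', inferInstance, fun j x => a j.1 x * a' j.2 x, fun j => κ j.1 + κ' j.2,
    fun j => l j.1 + l' j.2, fun j z => u j.1 z * u' j.2 z, fun j => C j.1 * C' j.2,
    fun j => (h1 _).mul (k1 _), fun j => (h2 _).mul (k2 _), ?_⟩
  filter_upwards [h3, k3, c.p_pos U] with z hz hz' hp
  rw [hz, hz', Fintype.sum_mul_sum, Fintype.sum_prod_type]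
  refine Finset.sum_congr rfl fun i _ => Finset.sum_congr rfl fun j _ => ?_
  push_cast
  rw [rpow_add hp, pow_add]
  ring

theorem single {a : X → ℝ} (ha : IsLT G a) (κ : ℚ) (l : ℕ) {u : X × ℝ → ℝ} {C : ℝ}
    (hu : Germ (c.sys U) u fun _ => C) :
    LPrep c U fun z => a z.1 * c.p z ^ (κ : ℝ) * log (c.p z) ^ l * u z :=
  ⟨Unit, inferInstance, fun _ => a, fun _ => κ, fun _ => l, fun _ => u, fun _ => C,
    fun _ => ha, fun _ => hu, .of_forall fun z => by simp⟩

theorem of_prepared (hf : Prepared c U f) : LPrep c U f := by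
  obtain ⟨a, κ, u, C, ha, -, hu, h⟩ := hf
  refine (single (.term ha) κ 0 hu).congr ?_
  filter_upwards [h] with z hz
  rw [hz, pow_zero, mul_one]

theorem log_of_prepared (hf : Prepared c U f) : LPrep c U fun z => log (f z) := by
  obtain ⟨a, κ, u, C, ha, hC, hu, h⟩ := hf
  have hlog : Germ (c.sys U) (fun z => log (u z)) fun _ => log C :=
    hu.comp₁ (F := Real.log) (analyticAt_log hC)
  rcases (IsDef.ne_zero ha).eventually_or (U := U) with h0 | h0
  · refine (((single (.log ha) 0 0 (Germ.const 1)).add (single (.const κ) 0 1 (Germ.const 1))).add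
      (single (.const 1) 0 0 hlog)).congr ?_
    filter_upwards [h, c.eventually_base U h0, germ_pos hC hu, c.p_pos U] with z h1 h2 h3 h4
    have h2 : a z.1 ≠ 0 := h2
    rw [h1, log_mul (mul_ne_zero h2 (rpow_pos_of_pos h4 _).ne') h3.ne',
      log_mul h2 (rpow_pos_of_pos h4 _).ne', log_rpow h4]
    simp
  · refine (of_prepared (Prepared.base (.const 0))).congr ?_
    filter_upwards [h, c.eventually_base U h0] with z h1 h2
    have h2 : a z.1 = 0 := not_not.1 h2
    rw [h1, h2]
    simp

end LPrep

end Chart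

theorem IsLT.exists_finset {X : Type} {G : Set (X → ℝ)} {f : X × ℝ → ℝ} (hf : IsLT (adj G) f) :
    ∃ s : Finset (X × ℝ → ℝ), (∀ t ∈ s, IsTerm (adj G) t) ∧
      ∀ (U : Ultrafilter (X × ℝ)) (c : Chart G), (∀ t ∈ s, c.Prepared U t) → c.LPrep U f := by
  classical
  induction hf with
  | @term f h => exact ⟨{f}, by simpa using h, fun U c h => .of_prepared (h f (by simp))⟩
  | @log f h => exact ⟨{f}, by simpa using h, fun U c h => .log_of_prepared (h f (by simp))⟩
  | add _ _ h1 h2 =>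
    obtain ⟨s, hs, h1⟩ := h1
    obtain ⟨t, ht, h2⟩ := h2
    refine ⟨s ∪ t, fun x hx => (Finset.mem_union.1 hx).elim (hs x) (ht x), fun U c h => ?_⟩
    exact (h1 U c fun x hx => h x (Finset.mem_union_left t hx)).add
      (h2 U c fun x hx => h x (Finset.mem_union_right s hx))
  | mul _ _ h1 h2 =>
    obtain ⟨s, hs, h1⟩ := h1
    obtain ⟨t, ht, h2⟩ := h2
    refine ⟨s ∪ t, fun x hx => (Finset.mem_union.1 hx).elim (hs x) (ht x), fun U c h => ?_⟩
    exact (h1 U c fun x hx => h x (Finset.mem_union_left t hx)).mul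
      (h2 U c fun x hx => h x (Finset.mem_union_right s hx))

theorem IsLT.exists_chart {X : Type} {G : Set (X → ℝ)} {U : Ultrafilter (X × ℝ)}
    (hU : NonGraph G U) {f : X × ℝ → ℝ} (hf : IsLT (adj G) f) :
    ∃ c : Chart G, c.Valid U ∧ c.LPrep U f := by
  obtain ⟨s, hs, h⟩ := hf.exists_finset
  obtain ⟨c, hc, h'⟩ := exists_chart_forall_prepared hU s (f := fun t => t) hs
  exact ⟨c, hc, h U c h'⟩

end Tame

namespace Tame
open Filter Topology

/-- Compactness of the space of ultrafilters. -/
theorem exists_finset_cover {Z : Type} {P : Set Z → Prop}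
    (h : ∀ U : Ultrafilter Z, ∃ A ∈ U, P A) :
    ∃ s : Finset (Set Z), (∀ A ∈ s, P A) ∧ ∀ z, ∃ A ∈ s, z ∈ A := by
  classical
  choose A hA hP using h
  obtain ⟨t, ht⟩ := isCompact_univ.elim_finite_subcover (fun U : Ultrafilter Z => {V | A U ∈ V})
    (fun U => ultrafilter_isOpen_basic _) fun U _ => mem_iUnion.2 ⟨U, hA U⟩
  refine ⟨t.image A, fun B hB => ?_, fun z => ?_⟩
  · obtain ⟨U, -, rfl⟩ := Finset.mem_image.1 hB
    exact hP U
  · obtain ⟨U, hU, hz⟩ := mem_iUnion₂.1 (ht (mem_univ (pure z : Ultrafilter Z)))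
    exact ⟨A U, Finset.mem_image_of_mem A hU, hz⟩

theorem IsTerm.adj_fst {X : Type} {G : Set (X → ℝ)} {a : X → ℝ} (ha : IsTerm G a) :
    IsTerm (adj G) fun z => a z.1 :=
  ha.comp fun g hg => .gen (.inr ⟨g, hg, rfl⟩)

theorem IsTerm.adj_snd {X : Type} {G : Set (X → ℝ)} : IsTerm (adj G) Prod.snd :=
  .gen (.inl rfl)

theorem IsLT.adj_fst {X : Type} {G : Set (X → ℝ)} {a : X → ℝ} (ha : IsLT G a) :
    IsLT (adj G) fun z => a z.1 :=
  ha.comp fun g hg => .gen (.inr ⟨g, hg, rfl⟩)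

/-- Substitution of a term for the last coordinate. -/
theorem adj_subst {X : Type} {G : Set (X → ℝ)} {e : X → ℝ} (he : IsTerm G e) :
    ∀ g ∈ adj G, IsTerm G fun x => g (x, e x) := by
  rintro g (rfl | ⟨g, hg, rfl⟩)
  · exact he
  · exact .gen hg

namespace Chart

variable {X : Type} {G : Set (X → ℝ)} {c : Chart G} {U : Ultrafilter (X × ℝ)}

/-- The cells on which a chart is used. -/
def cell (c : Chart G) (A : Set X) (ρ : ℝ) : Set (X × ℝ) :=
  {z | z.1 ∈ A ∧ 0 < c.p z ∧ c.b₁ z.1 < ρ * c.p z ∧ c.b₂ z.1 * c.p z < ρ}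

theorem hasTerm_p (c : Chart G) : IsTerm (adj G) c.p :=
  (IsTerm.const c.σ).mul (IsTerm.adj_snd.sub c.hθ.adj_fst)

theorem isDef_cell {A : Set X} (hA : IsDef G A) (ρ : ℝ) : IsDef (adj G) (c.cell A ρ) := by
  have h1 : IsDef (adj G) (Prod.fst ⁻¹' A) :=
    hA.comp fun g hg => .gen (.inr ⟨g, hg, rfl⟩)
  exact h1.inter ((IsDef.pos c.hasTerm_p).inter ((IsDef.lt c.hb₁.adj_fst
    ((IsTerm.const ρ).mul c.hasTerm_p)).inter
      (IsDef.lt (c.hb₂.adj_fst.mul c.hasTerm_p) (.const ρ))))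

theorem eventually_cell {A : Set X} (hA : ∀ᶠ x in baseF G U, x ∈ A) {ρ : ℝ} (hρ : 0 < ρ) :
    ∀ᶠ z in c.l U, z ∈ c.cell A ρ := by
  filter_upwards [c.eventually_base U hA, c.p_pos U,
    (c.tendsto_v U).eventually (gt_mem_nhds hρ), (c.tendsto_w U).eventually (gt_mem_nhds hρ)]
    with z h1 h2 h3 h4
  exact ⟨h1, h2, (div_lt_iff₀ h2).1 h3, h4⟩

theorem exists_cell {P : X × ℝ → Prop} (h : ∀ᶠ z in c.l U, P z) :
    ∃ (A : Set X) (ρ : ℝ), IsDef G A ∧ (∀ᶠ x in baseF G U, x ∈ A) ∧ 0 < ρ ∧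
      ∀ z ∈ c.cell A ρ, P z := by
  obtain ⟨S, hS, T, hT, h⟩ := mem_inf_iff_superset.1 h
  obtain ⟨S', hS', R, hR, h'⟩ := mem_inf_iff_superset.1 hS
  obtain ⟨B, hB, Q, hQ, h''⟩ := mem_inf_iff_superset.1 hS'
  obtain ⟨B', hB', hB⟩ := hB
  obtain ⟨A, hA, hAU, hAB⟩ := hB'
  obtain ⟨R', hR', hR⟩ := hR
  obtain ⟨T', hT', hT⟩ := hT
  obtain ⟨ε₁, hε₁, k₁⟩ := Metric.mem_nhds_iff.1 hR'
  obtain ⟨ε₂, hε₂, k₂⟩ := Metric.mem_nhds_iff.1 hT'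
  refine ⟨A, min ε₁ ε₂, hA, hA.mem_defF hAU, lt_min hε₁ hε₂, fun z hz => ?_⟩
  obtain ⟨h1, h2, h3, h4⟩ := hz
  refine h ⟨h' ⟨h'' ⟨hB (hAB h1), hQ h2⟩, hR (k₁ ?_)⟩, hT (k₂ ?_)⟩
  · rw [mem_ball_zero_iff, Real.norm_eq_abs, abs_of_nonneg (div_nonneg (c.nn₁ _) h2.le),
      div_lt_iff₀ h2]
    exact h3.trans_le (mul_le_mul_of_nonneg_right (min_le_left _ _) h2.le)
  · rw [mem_ball_zero_iff, Real.norm_eq_abs, abs_of_nonneg (mul_nonneg (c.nn₂ _) h2.le)]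
    exact h4.trans_le (min_le_right _ _)

theorem hasDerivAt_p (c : Chart G) (x : X) (y : ℝ) :
    HasDerivAt (fun y => c.p (x, y)) c.σ y := by
  simpa [p] using ((hasDerivAt_id y).sub_const (c.θ x)).const_mul c.σ

theorem continuous_p (c : Chart G) (x : X) : Continuous fun y => c.p (x, y) :=
  continuous_iff_continuousAt.2 fun y => (c.hasDerivAt_p x y).continuousAt

theorem p_center (c : Chart G) (x : X) : c.p (x, c.θ x) = 0 := by simp [p]

theorem σ_sq (c : Chart G) : c.σ * c.σ = 1 := by
  rcases c.hσ with h | h <;> rw [h] <;> norm_num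

theorem isOpen_cell (c : Chart G) (A : Set X) (ρ : ℝ) (x : X) :
    IsOpen {y | (x, y) ∈ c.cell A ρ} := by
  have hp := c.continuous_p x
  by_cases hx : x ∈ A
  · have : {y | (x, y) ∈ c.cell A ρ} =
        {y | 0 < c.p (x, y)} ∩ ({y | c.b₁ x < ρ * c.p (x, y)} ∩ {y | c.b₂ x * c.p (x, y) < ρ}) := by
      ext y
      simp [cell, hx]
    rw [this]
    exact (isOpen_lt continuous_const hp).inter ((isOpen_lt continuous_const
      (continuous_const.mul hp)).inter (isOpen_lt (continuous_const.mul hp) continuous_const))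
  · convert! isOpen_empty
    ext y
    simp [cell, hx]

theorem ordConnected_cell (c : Chart G) (A : Set X) {ρ : ℝ} (hρ : 0 < ρ) (x : X) :
    OrdConnected {y | (x, y) ∈ c.cell A ρ} := by
  refine ⟨fun y hy y' hy' t ht => ?_⟩
  obtain ⟨h1, h2, h3, h4⟩ := hy
  obtain ⟨k1, k2, k3, k4⟩ := hy'
  have n2 := c.nn₂ x
  have key : c.p (x, y) ≤ c.p (x, t) ∧ c.p (x, t) ≤ c.p (x, y') ∨
      c.p (x, y') ≤ c.p (x, t) ∧ c.p (x, t) ≤ c.p (x, y) := by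
    obtain ⟨t1, t2⟩ := ht
    simp only [p]
    rcases c.hσ with h | h <;> rw [h]
    · left; constructor <;> linarith
    · right; constructor <;> linarith
  dsimp only at h3 h4 k3 k4
  rcases key with ⟨q1, q2⟩ | ⟨q1, q2⟩
  · exact ⟨h1, by linarith, h3.trans_le (mul_le_mul_of_nonneg_left q1 hρ.le),
      (mul_le_mul_of_nonneg_left q2 n2).trans_lt k4⟩
  · exact ⟨h1, by linarith, k3.trans_le (mul_le_mul_of_nonneg_left q1 hρ.le),
      (mul_le_mul_of_nonneg_left q2 n2).trans_lt h4⟩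

theorem eventually_fiber_nhds {P : X × ℝ → Prop} (h : ∀ᶠ z in c.l U, P z) :
    ∀ᶠ z in c.l U, ∀ᶠ y in 𝓝 z.2, P (z.1, y) := by
  obtain ⟨A, ρ, -, hA, hρ, h⟩ := exists_cell h
  filter_upwards [eventually_cell hA hρ] with z hz
  filter_upwards [(c.isOpen_cell A ρ z.1).mem_nhds hz] with y hy using h _ hy

theorem tendsto_p_center (c : Chart G) (x : X) :
    Tendsto (fun y => c.p (x, y)) (𝓝[{y | 0 < c.p (x, y)}] c.θ x) (𝓝[>] 0) := by
  refine tendsto_nhdsWithin_iff.2 ⟨?_, eventually_mem_nhdsWithin⟩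
  have := (c.continuous_p x).tendsto (c.θ x)
  rw [p_center] at this
  exact this.mono_left nhdsWithin_le_nhds

theorem eventually_center {P : X × ℝ → Prop} (h : ∀ᶠ z in c.l U, P z) :
    ∀ᶠ x in baseF G U, c.b₁ x = 0 → ∀ᶠ y in 𝓝[{y | 0 < c.p (x, y)}] c.θ x, P (x, y) := by
  obtain ⟨A, ρ, -, hA, hρ, h⟩ := exists_cell h
  filter_upwards [hA] with x hx h0
  have h1 : Tendsto (fun y => c.b₂ x * c.p (x, y)) (𝓝[{y | 0 < c.p (x, y)}] c.θ x) (𝓝 0) := by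
    simpa using ((c.tendsto_p_center x).mono_right nhdsWithin_le_nhds).const_mul (c.b₂ x)
  filter_upwards [eventually_mem_nhdsWithin, h1.eventually (gt_mem_nhds hρ)] with y h2 h3
  exact h _ ⟨hx, h2, by rw [h0]; exact mul_pos hρ h2, h3⟩

instance (x : X) : (𝓝[{y | 0 < c.p (x, y)}] c.θ x).NeBot := by
  rcases c.hσ with h | h
  · have : {y | 0 < c.p (x, y)} = Ioi (c.θ x) := by ext y; simp [p, h]
    rw [this]
    infer_instance
  · have : {y | 0 < c.p (x, y)} = Iio (c.θ x) := by ext y; simp [p, h]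
    rw [this]
    infer_instance

end Chart

end Tame

namespace Tame
open Filter Topology
namespace Chart

variable {X : Type} {G : Set (X → ℝ)} {c : Chart G} {U : Ultrafilter (X × ℝ)}

/-- A power of the coordinate times a power of its logarithm. -/
def mon (c : Chart G) (k : ℚ × ℕ) (z : X × ℝ) : ℝ :=
  |c.p z| ^ (k.1 : ℝ) * log (c.p z) ^ k.2

theorem isLT_mon (c : Chart G) (k : ℚ × ℕ) : IsLT (adj G) (c.mon k) :=
  .mul (.term (c.hasTerm_p.rpow k.1)) (.pow (.log c.hasTerm_p) k.2)

theorem mon_of_pos {z : X × ℝ} (hz : 0 < c.p z) (k : ℚ × ℕ) :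
    c.mon k z = c.p z ^ (k.1 : ℝ) * log (c.p z) ^ k.2 := by rw [mon, abs_of_pos hz]

theorem rpow_mul_mon {z : X × ℝ} (hz : 0 < c.p z) (q e : ℚ) (l : ℕ) :
    c.p z ^ (q : ℝ) * c.mon (e, l) z = c.mon (e + q, l) z := by
  rw [mon_of_pos hz, mon_of_pos hz]
  push_cast
  rw [rpow_add hz]
  ring

theorem hasDerivAt_mon {z : X × ℝ} (hz : 0 < c.p z) (e : ℚ) (l : ℕ) :
    HasDerivAt (fun y => c.mon (e, l) (z.1, y))
      (c.σ * (e * c.mon (e - 1, l) z + l * c.mon (e - 1, l - 1) z)) z.2 := by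
  have h1 := c.hasDerivAt_p z.1 z.2
  have h2 := (h1.rpow_const (p := (e : ℝ)) (.inl hz.ne')).mul ((h1.log hz.ne').pow l)
  refine (h2.congr_of_eventuallyEq ?_).congr_deriv ?_
  · filter_upwards [(c.continuous_p z.1).tendsto z.2 |>.eventually (lt_mem_nhds hz)] with y hy
    simp only [mon, Pi.mul_apply, Pi.pow_apply]
    rw [abs_of_pos hy]
  · rw [mon_of_pos hz, mon_of_pos hz]
    simp only [Pi.pow_apply, Prod.mk.eta]
    push_cast
    rw [rpow_sub_one hz.ne']
    field_simp

/-- Existence of a primitive along the fibers, with an asymptotic expansion at the center. -/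
def HasPrim (c : Chart G) (U : Ultrafilter (X × ℝ)) (f : X × ℝ → ℝ) : Prop :=
  ∃ F, IsLT (adj G) F ∧ (∀ᶠ z in c.l U, HasDerivAt (fun y => F (z.1, y)) (f z) z.2) ∧
    ∃ (J : Finset (ℚ × ℕ)) (C : ℚ × ℕ → X → ℝ), (∀ k, IsLT G (C k)) ∧
      ∀ᶠ x in baseF G U, c.b₁ x = 0 → Tendsto
        (fun y => F (x, y) - ∑ k ∈ J, C k x * c.mon k (x, y))
        (𝓝[{y | 0 < c.p (x, y)}] c.θ x) (𝓝 0)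

namespace HasPrim

variable {f g : X × ℝ → ℝ}

theorem congr (hf : HasPrim c U f) (h : ∀ᶠ z in c.l U, g z = f z) : HasPrim c U g := by
  obtain ⟨F, hF, h1, h2⟩ := hf
  refine ⟨F, hF, ?_, h2⟩
  filter_upwards [h, h1] with z hz hz'
  rwa [hz]

theorem add (hf : HasPrim c U f) (hg : HasPrim c U g) : HasPrim c U fun z => f z + g z := by
  classical
  obtain ⟨F, hF, h1, J, C, hC, h2⟩ := hf
  obtain ⟨F', hF', h1', J', C', hC', h2'⟩ := hg
  refine ⟨_, hF.add hF', ?_, J ∪ J',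
    fun k x => (if k ∈ J then C k x else 0) + if k ∈ J' then C' k x else 0, fun k => ?_, ?_⟩
  · filter_upwards [h1, h1'] with z hz hz' using hz.add hz'
  · refine .add ?_ ?_
    · split_ifs
      exacts [hC k, .const 0]
    · split_ifs
      exacts [hC' k, .const 0]
  · filter_upwards [h2, h2'] with x hx hx' h0
    have := (hx h0).add (hx' h0)
    rw [add_zero] at this
    refine this.congr fun y => ?_
    have e1 : ∑ k ∈ J ∪ J', (if k ∈ J then C k x else 0) * c.mon k (x, y) =
        ∑ k ∈ J, C k x * c.mon k (x, y) := by
      rw [← Finset.sum_subset Finset.subset_union_left fun k _ hk => by rw [if_neg hk, zero_mul]]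
      exact Finset.sum_congr rfl fun k hk => by rw [if_pos hk]
    have e2 : ∑ k ∈ J ∪ J', (if k ∈ J' then C' k x else 0) * c.mon k (x, y) =
        ∑ k ∈ J', C' k x * c.mon k (x, y) := by
      rw [← Finset.sum_subset Finset.subset_union_right fun k _ hk => by rw [if_neg hk, zero_mul]]
      exact Finset.sum_congr rfl fun k hk => by rw [if_pos hk]
    simp only [add_mul, Finset.sum_add_distrib]
    rw [e1, e2]
    ring

theorem base_mul {a : X → ℝ} (ha : IsLT G a) (hf : HasPrim c U f) :
    HasPrim c U fun z => a z.1 * f z := by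
  obtain ⟨F, hF, h1, J, C, hC, h2⟩ := hf
  refine ⟨_, ha.adj_fst.mul hF, ?_, J, fun k x => a x * C k x, fun k => ha.mul (hC k), ?_⟩
  · filter_upwards [h1] with z hz using hz.const_mul _
  · filter_upwards [h2] with x hx h0
    have := (hx h0).const_mul (a x)
    rw [mul_zero] at this
    refine this.congr fun y => ?_
    rw [mul_sub, Finset.mul_sum]
    simp only [mul_assoc]

theorem zero : HasPrim c U fun _ => 0 :=
  ⟨_, .const 0, .of_forall fun z => hasDerivAt_const _ _, ∅, fun _ _ => 0, fun _ => .const 0,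
    .of_forall fun x _ => by simp⟩

theorem sum {ι : Type} (s : Finset ι) {f : ι → X × ℝ → ℝ} (hf : ∀ i ∈ s, HasPrim c U (f i)) :
    HasPrim c U fun z => ∑ i ∈ s, f i z := by
  classical
  induction s using Finset.induction_on with
  | empty => exact zero.congr (.of_forall fun z => by simp)
  | insert a s ha ih =>
    refine ((hf a (Finset.mem_insert_self a s)).add
      (ih fun i hi => hf i (Finset.mem_insert_of_mem hi))).congr (.of_forall fun z => ?_)
    rw [Finset.sum_insert ha]

theorem deriv_mon (e : ℚ) (l : ℕ) :
    HasPrim c U fun z => e * c.mon (e - 1, l) z + l * c.mon (e - 1, l - 1) z := by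
  refine ⟨_, (IsLT.const c.σ).mul (c.isLT_mon (e, l)), ?_, {(e, l)}, fun _ _ => c.σ,
    fun _ => .const _, .of_forall fun x _ => by simp⟩
  filter_upwards [c.p_pos U] with z hz
  refine ((hasDerivAt_mon hz e l).const_mul c.σ).congr_deriv ?_
  rw [← mul_assoc, c.σ_sq, one_mul]

theorem mon (k : ℚ × ℕ) : HasPrim c U (c.mon k) := by
  obtain ⟨κ, l⟩ := k
  by_cases hκ : κ + 1 = 0
  · refine (base_mul (.const ((l + 1 : ℝ)⁻¹)) (deriv_mon 0 (l + 1))).congr (.of_forall fun z => ?_)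
    have : κ = 0 - 1 := by linarith
    have h1 : (l + 1 : ℝ) ≠ 0 := by positivity
    rw [this, Nat.add_sub_cancel]
    push_cast
    field_simp
    ring
  · have hκ' : ((κ + 1 : ℚ) : ℝ) ≠ 0 := by exact_mod_cast hκ
    induction l with
    | zero =>
      refine (base_mul (.const ((κ + 1 : ℚ) : ℝ)⁻¹) (deriv_mon (κ + 1) 0)).congr
        (.of_forall fun z => ?_)
      rw [add_sub_cancel_right, Nat.cast_zero, zero_mul, add_zero, inv_mul_cancel_left₀ hκ']
    | succ l ih =>
      refine ((base_mul (.const ((κ + 1 : ℚ) : ℝ)⁻¹) (deriv_mon (κ + 1) (l + 1))).add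
        (base_mul (.const (-(l + 1 : ℝ) / (κ + 1 : ℚ))) ih)).congr (.of_forall fun z => ?_)
      rw [add_sub_cancel_right, Nat.add_sub_cancel]
      push_cast at hκ' ⊢
      field_simp
      ring

end HasPrim

end Chart

end Tame

namespace Tame
open Filter Topology
namespace Chart

variable {X : Type} {G : Set (X → ℝ)} {c : Chart G} {U : Ultrafilter (X × ℝ)}

/-- Analytic functions of infinitesimal terms of the base and one infinitesimal term. -/
theorem exists_term_pair {κ : Type} [Fintype κ] {A : (κ → ℝ) × ℝ → ℝ} (hA : AnalyticAt ℝ A 0)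
    {ψ : κ → X → ℝ} (hψ : ∀ i, IsTerm G (ψ i)) (hψ0 : ∀ i, Tendsto (ψ i) (baseF G U) (𝓝 0))
    {R : X × ℝ → ℝ} (hR : IsTerm (adj G) R) (hR0 : Tendsto R (c.l U) (𝓝 0)) :
    ∃ t, IsTerm (adj G) t ∧ ∀ᶠ z in c.l U, t z = A (fun i => ψ i z.1, R z) := by
  have hH : AnalyticAt ℝ (fun v : Option κ → ℝ => A (fun i => v (some i), v none)) 0 := by
    refine AnalyticAt.comp_of_eq (f := fun v : Option κ → ℝ => (fun i => v (some i), v none)) hA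
      (AnalyticAt.prod (AnalyticAt.pi fun i => analyticAt_apply _ _) (analyticAt_apply _ _)) rfl
  obtain ⟨t, ht, h⟩ := exists_term_of_analyticAt hH
    (ψ := fun o => o.elim R fun i z => ψ i z.1)
    (fun o => by cases o with
      | none => exact hR
      | some i => exact (hψ i).adj_fst)
  refine ⟨t, ht, h (c.l U) fun o => ?_⟩
  cases o with
  | none => exact hR0
  | some i => exact (hψ0 i).comp (tendsto_comap.mono_left (c.l_le U))

theorem tendsto_mon_center (c : Chart G) (x : X) {e : ℚ} (he : 0 < e) (l : ℕ) :
    Tendsto (fun y => c.mon (e, l) (x, y)) (𝓝[{y | 0 < c.p (x, y)}] c.θ x) (𝓝 0) := by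
  have he' : (0 : ℝ) < e := by exact_mod_cast he
  have h1 : Tendsto (fun t : ℝ => t ^ (e : ℝ) * log t ^ l) (𝓝[>] 0) (𝓝 0) := by
    have h := isLittleO_abs_log_rpow_rpow_nhdsGT_zero (s := -(e : ℝ)) (l : ℝ) (by linarith)
    have h' := h.tendsto_div_nhds_zero
    rw [tendsto_zero_iff_norm_tendsto_zero]
    refine h'.congr' ?_
    filter_upwards [self_mem_nhdsWithin] with t ht
    have ht : 0 < t := ht
    rw [rpow_natCast, rpow_neg ht.le, div_inv_eq_mul, norm_mul, norm_pow, Real.norm_eq_abs,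
      Real.norm_eq_abs, abs_of_pos (rpow_pos_of_pos ht _), mul_comm]
  refine (h1.comp (c.tendsto_p_center x)).congr' ?_
  filter_upwards [eventually_mem_nhdsWithin] with y hy
  rw [mon_of_pos (show 0 < c.p (x, y) from hy)]
  rfl

theorem HasPrim.unit {κ : Type} [Fintype κ] {ψ : κ → X → ℝ} (hψ : ∀ i, IsTerm G (ψ i))
    (hψ0 : ∀ i, Tendsto (ψ i) (baseF G U) (𝓝 0)) {R : X × ℝ → ℝ} (hR : IsTerm (adj G) R)
    (hR0 : Tendsto R (c.l U) (𝓝 0)) {ε m : ℝ} (hε : ε = 1 ∨ ε = -1) (hm : 0 < m)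
    (hRd : ∀ᶠ z in c.l U,
      HasDerivAt (fun y => R (z.1, y)) (c.σ * (ε * (R z / m) / c.p z)) z.2)
    {e : ℚ} (he : 0 < ε * e) {a : X → ℝ} (ha : IsLT G a)
    (ha0 : ε = -1 → ∀ x, c.b₁ x = 0 → a x = 0) {W : (κ → ℝ) × ℝ → ℝ} (hW : AnalyticAt ℝ W 0)
    (l : ℕ) :
    HasPrim c U fun z => a z.1 * (c.mon (e - 1, l) z * W (fun i => ψ i z.1, R z)) := by
  have hε2 : ε * ε = 1 := by rcases hε with rfl | rfl <;> norm_num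
  have htd : Tendsto (fun z : X × ℝ => ((fun i => ψ i z.1, R z) : (κ → ℝ) × ℝ)) (c.l U) (𝓝 0) := by
    have h1 : Tendsto (fun z : X × ℝ => fun i => ψ i z.1) (c.l U) (𝓝 (0 : κ → ℝ)) :=
      tendsto_pi_nhds.2 fun i => (hψ0 i).comp (tendsto_comap.mono_left (c.l_le U))
    exact h1.prodMk_nhds hR0
  have step : ∀ (l : ℕ) {W : (κ → ℝ) × ℝ → ℝ}, AnalyticAt ℝ W 0 →
      ∃ A : (κ → ℝ) × ℝ → ℝ, AnalyticAt ℝ A 0 ∧ HasPrim c U fun z =>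
        a z.1 * (c.mon (e - 1, l) z * W (fun i => ψ i z.1, R z)
          + l * (c.mon (e - 1, l - 1) z * A (fun i => ψ i z.1, R z))) := by
    intro l W hW
    obtain ⟨A, hA, hAe⟩ := exists_euler (analyticAt_const (v := ε).mul hW) (ε * e) hm fun n =>
      (by positivity : 0 < ε * e + n / m).ne'
    obtain ⟨t, ht, hte⟩ := exists_term_pair hA hψ hψ0 hR hR0
    refine ⟨A, hA, ?_⟩
    refine ⟨_, (ha.adj_fst.mul ((IsLT.const c.σ).mul (c.isLT_mon (e, l)))).mul (.term ht), ?_, ∅,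
      fun _ _ => 0, fun _ => .const 0, ?_⟩
    · filter_upwards [c.p_pos U, eventually_fiber_nhds hte, htd.eventually hAe, hRd, hte]
        with z hz h1 ⟨D, hD, h2⟩ h3 h1'
      have h4 : HasDerivAt (fun y => A (fun i => ψ i z.1, R (z.1, y)))
          (D * (c.σ * (ε * (R z / m) / c.p z))) z.2 :=
        HasDerivAt.comp z.2 (h := fun y => R (z.1, y)) (h₂ := fun s => A (fun i => ψ i z.1, s))
          hD h3
      refine ((((hasDerivAt_mon hz e l).const_mul c.σ).const_mul (a z.1)).mul
        (h4.congr_of_eventuallyEq h1)).congr_deriv ?_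
      have h5 : c.mon (e, l) z = c.p z * c.mon (e - 1, l) z := by
        rw [← rpow_one (c.p z), ← Rat.cast_one, rpow_mul_mon hz, sub_add_cancel]
      simp only [Prod.mk.eta, Pi.mul_apply] at h1' h2 ⊢
      rw [h1', h5]
      have h6 : e * A (fun i => ψ i z.1, R z) + ε * (R z / m) * D = W (fun i => ψ i z.1, R z) := by
        linear_combination ε * h2 + (W (fun i => ψ i z.1, R z)
          - e * A (fun i => ψ i z.1, R z)) * hε2
      rw [← h6]
      have h7 := c.σ_sq
      field_simp
      linear_combination (a z.1 * (e * c.mon (e - 1, l) z * A (fun i => ψ i z.1, R z) * m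
        + l * c.mon (e - 1, l - 1) z * A (fun i => ψ i z.1, R z) * m
        + c.mon (e - 1, l) z * D * ε * R z)) * h7
    · rcases hε with rfl | rfl
      · have he : 0 < e := by rw [one_mul] at he; exact_mod_cast he
        obtain ⟨K, hK⟩ : ∃ K, ∀ᶠ z in c.l U, |t z| ≤ K := by
          refine ⟨|A 0| + 1, ?_⟩
          filter_upwards [hte, htd.eventually (hA.continuousAt.abs.eventually_lt
            (continuousAt_const (y := |A 0| + 1)) (by simp))] with z h1 h2
          rw [h1]
          exact h2.le
        filter_upwards [eventually_center hK] with x hx h0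
        have h1 := ((c.tendsto_mon_center x he l).const_mul c.σ).const_mul (a x)
        rw [mul_zero, mul_zero] at h1
        simp only [Finset.sum_empty, sub_zero]
        refine h1.zero_mul_isBoundedUnder_le ⟨K, ?_⟩
        rw [eventually_map]
        exact hx h0
      · refine .of_forall fun x h0 => ?_
        simp [ha0 rfl x h0]
  induction l generalizing W with
  | zero =>
    obtain ⟨A, -, h⟩ := step 0 hW
    refine h.congr (.of_forall fun z => ?_)
    simp
  | succ l ih =>
    obtain ⟨A, hA, h⟩ := step (l + 1) hW
    refine (h.add (HasPrim.base_mul (.const (-(l + 1 : ℝ))) (ih hA))).congr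
      (.of_forall fun z => ?_)
    rw [Nat.add_sub_cancel]
    push_cast
    ring

end Chart

end Tame

namespace Tame
open Filter Topology
namespace Chart

variable {X : Type} {G : Set (X → ℝ)} {c : Chart G} {U : Ultrafilter (X × ℝ)}

theorem HasPrim.mon_mul {κ : Type} [Fintype κ] {ψ : κ → X → ℝ} (hψ : ∀ i, IsTerm G (ψ i))
    (hψ0 : ∀ i, Tendsto (ψ i) (baseF G U) (𝓝 0)) {R : X × ℝ → ℝ} (hR : IsTerm (adj G) R)
    (hR0 : Tendsto R (c.l U) (𝓝 0)) {ε : ℚ} {m : ℕ} (hε : ε = 1 ∨ ε = -1) (hm : 0 < m)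
    {B : ℕ → X → ℝ} (hB : ∀ n, IsLT G (B n))
    (hB0 : ε = -1 → ∀ n, n ≠ 0 → ∀ x, c.b₁ x = 0 → B n x = 0)
    (hRB : ∀ n, ∀ᶠ z in c.l U, R z ^ n = B n z.1 * c.p z ^ ((ε * (n / m) : ℚ) : ℝ))
    {W : (κ → ℝ) × ℝ → ℝ} (hW : AnalyticAt ℝ W 0) (k : ℚ × ℕ) :
    HasPrim c U fun z => c.mon k z * W (fun i => ψ i z.1, R z) := by
  obtain ⟨q, l⟩ := k
  have hε2 : ε * ε = 1 := by rcases hε with rfl | rfl <;> norm_num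
  have hm' : (0 : ℚ) < m := by exact_mod_cast hm
  obtain ⟨N, hN⟩ := exists_nat_gt (m * |q + 1|)
  have hN0 : N ≠ 0 := by
    rintro rfl
    have : 0 ≤ m * |q + 1| := by positivity
    simp only [Nat.cast_zero] at hN
    linarith
  have he : 0 < ε * (q + ε * (N / m) + 1) := by
    have h1 : -(ε * (q + 1)) ≤ |q + 1| := by
      rcases hε with rfl | rfl
      · rw [one_mul]; exact neg_le_abs _
      · rw [neg_one_mul, neg_neg]; exact le_abs_self _
    have h2 : |q + 1| < N / m := by rw [lt_div_iff₀ hm', mul_comm]; exact hN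
    linear_combination h2 + h1 - (N / m) * hε2
  have hR1 := hRB 1
  have hRd : ∀ᶠ z in c.l U, HasDerivAt (fun y => R (z.1, y))
      (c.σ * ((ε : ℝ) * (R z / m) / c.p z)) z.2 := by
    filter_upwards [eventually_fiber_nhds hR1, hR1, c.p_pos U] with z h1 h2 hz
    refine ((((c.hasDerivAt_p z.1 z.2).rpow_const (p := ((ε * ((1 : ℕ) / m) : ℚ) : ℝ))
      (.inl hz.ne')).const_mul (B 1 z.1)).congr_of_eventuallyEq ?_).congr_deriv ?_
    · filter_upwards [h1] with y hy
      rw [← hy, pow_one]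
    · rw [pow_one] at h2
      simp only [Prod.mk.eta]
      rw [h2, rpow_sub_one hz.ne']
      push_cast
      ring
  obtain ⟨h, K, hh, hK, hz⟩ := exists_taylor hW N
  have htd : Tendsto (fun z : X × ℝ => ((fun i => ψ i z.1, R z) : (κ → ℝ) × ℝ)) (c.l U) (𝓝 0) := by
    have h1 : Tendsto (fun z : X × ℝ => fun i => ψ i z.1) (c.l U) (𝓝 (0 : κ → ℝ)) :=
      tendsto_pi_nhds.2 fun i => (hψ0 i).comp (tendsto_comap.mono_left (c.l_le U))
    exact h1.prodMk_nhds hR0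
  choose t ht hte using fun n => exists_term_of_analyticAt (hh n) hψ
  have hte : ∀ᶠ z in c.l U, ∀ n ∈ Finset.range N, t n z.1 = h n fun i => ψ i z.1 :=
    (Filter.eventually_all_finset _).2 fun n _ =>
      c.eventually_base U (hte n (baseF G U) hψ0)
  have hRBN : ∀ᶠ z in c.l U, ∀ n ∈ Finset.range N,
      R z ^ n = B n z.1 * c.p z ^ ((ε * (n / m) : ℚ) : ℝ) :=
    (Filter.eventually_all_finset _).2 fun n _ => hRB n
  have hu := HasPrim.unit (l := l) hψ hψ0 hR hR0 (ε := ε) (m := m)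
    (by rcases hε with rfl | rfl <;> simp) (by exact_mod_cast hm) hRd
    (e := q + ε * (N / m) + 1) (by exact_mod_cast he) (hB N)
    (fun h x hx => hB0 (by exact_mod_cast h) N hN0 x hx) hK
  refine ((HasPrim.sum (Finset.range N) (f := fun n z => (t n z.1 * B n z.1) *
    c.mon (q + ε * (n / m), l) z) fun n _ =>
      (HasPrim.mon _).base_mul (a := fun x => t n x * B n x) ((IsLT.term (ht n)).mul (hB n))).add
    hu).congr ?_
  filter_upwards [htd.eventually hz, hte, hRBN, hRB N, c.p_pos U] with z h1 h2 h3 h4 hp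
  rw [h1, add_sub_cancel_right, h4, mul_add, Finset.mul_sum]
  congr 1
  · refine Finset.sum_congr rfl fun n hn => ?_
    rw [h3 n hn, h2 n hn, ← rpow_mul_mon hp]
    ring
  · rw [← rpow_mul_mon hp]
    ring

theorem LPrep.hasPrim (hc : c.Valid U) {f : X × ℝ → ℝ} (hf : LPrep c U f) : HasPrim c U f := by
  obtain ⟨ι, hι, a, κ, l, u, C, ha, hu, h⟩ := hf
  have key : ∀ j, HasPrim c U fun z => c.mon (κ j, l j) z * u j z := by
    intro j
    obtain ⟨m, τ, _, ψ, W, V, hm, hψ, hψ0, hW, hV, -, he⟩ := exists_split_form hc (hu j)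
    have hq : ((m : ℝ)⁻¹) = (((m : ℚ)⁻¹ : ℚ) : ℝ) := by push_cast; rfl
    have hp := c.p_pos U
    have hw : ∀ᶠ z in c.l U, |c.b₂ z.1 * c.p z| ^ (((m : ℚ)⁻¹ : ℚ) : ℝ) = c.wr m z := by
      filter_upwards [hp] with z hz
      rw [abs_of_nonneg (mul_nonneg (c.nn₂ _) hz.le), ← hq, wr]
    have hv : ∀ᶠ z in c.l U, |c.b₁ z.1 / c.p z| ^ (((m : ℚ)⁻¹ : ℚ) : ℝ) = c.vr m z := by
      filter_upwards [hp] with z hz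
      rw [abs_of_nonneg (div_nonneg (c.nn₁ _) hz.le), ← hq, vr]
    have h1 := HasPrim.mon_mul hψ hψ0 ((c.hb₂.adj_fst.mul c.hasTerm_p).rpow (m : ℚ)⁻¹)
      ((germ_wr (c := c) (U := U) hm).tendsto.congr' (hw.mono fun z hz => hz.symm)) (ε := 1)
      (.inl rfl) hm
      (B := fun n x => |c.b₂ x| ^ ((n / m : ℚ) : ℝ)) (fun n => .term (c.hb₂.rpow _))
      (fun h => absurd h (by norm_num)) (fun n => by
        filter_upwards [hw, hp] with z hz h2
        rw [hz, wr_pow hm h2, one_mul]) hW (κ j, l j)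
    have h2 := HasPrim.mon_mul hψ hψ0 ((c.hb₁.adj_fst.div c.hasTerm_p).rpow (m : ℚ)⁻¹)
      ((germ_vr (c := c) (U := U) hm).tendsto.congr' (hv.mono fun z hz => hz.symm)) (ε := -1)
      (.inr rfl) hm
      (B := fun n x => |c.b₁ x| ^ ((n / m : ℚ) : ℝ)) (fun n => .term (c.hb₁.rpow _))
      (fun _ n hn x hx => by
        have : ((n / m : ℚ) : ℝ) ≠ 0 := by push_cast; positivity
        rw [hx, abs_zero, zero_rpow this]) (fun n => by
        filter_upwards [hv, hp] with z hz h2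
        rw [hz, vr_pow hm h2, neg_one_mul, neg_div]) hV (κ j, l j)
    refine (h1.add h2).congr ?_
    filter_upwards [he, hw, hv] with z h3 h4 h5
    rw [h3, h4, h5, mul_add]
  refine (HasPrim.sum Finset.univ fun j _ => (key j).base_mul (ha j)).congr ?_
  filter_upwards [h, c.p_pos U] with z hz hp
  rw [hz]
  refine Finset.sum_congr rfl fun j _ => ?_
  rw [mon_of_pos hp]
  ring

end Chart

end Tame

namespace Tame
open Filter Topology

theorem tendsto_rpow_mul_log_pow {e : ℝ} (he : 0 < e) (l : ℕ) :
    Tendsto (fun t : ℝ => t ^ e * log t ^ l) (𝓝[>] 0) (𝓝 0) := by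
  have h := isLittleO_abs_log_rpow_rpow_nhdsGT_zero (s := -e) (l : ℝ) (by linarith)
  have h' := h.tendsto_div_nhds_zero
  rw [tendsto_zero_iff_norm_tendsto_zero]
  refine h'.congr' ?_
  filter_upwards [self_mem_nhdsWithin] with t ht
  have ht : 0 < t := ht
  rw [rpow_natCast, rpow_neg ht.le, div_inv_eq_mul, norm_mul, norm_pow, Real.norm_eq_abs,
    Real.norm_eq_abs, abs_of_pos (rpow_pos_of_pos ht _), mul_comm]

/-- The lexicographic order of growth at zero of the functions `t ^ k.1 * log t ^ k.2`. -/
def scale (k : ℚ × ℕ) : ℚ ×ₗ ℕᵒᵈ := toLex (k.1, OrderDual.toDual k.2)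

theorem scale_injective : Function.Injective scale := by
  rintro ⟨a, b⟩ ⟨a', b'⟩ h
  simpa [scale] using h

theorem scale_lt {k₀ k : ℚ × ℕ} (h : scale k₀ < scale k) :
    k₀.1 < k.1 ∨ k₀.1 = k.1 ∧ k.2 < k₀.2 :=
  Prod.Lex.toLex_lt_toLex.1 h

theorem tendsto_log_inv_pow {l : ℕ} (hl : 0 < l) :
    Tendsto (fun t : ℝ => (log t ^ l)⁻¹) (𝓝[>] 0) (𝓝 0) := by
  have h := (tendsto_inv_atBot_zero.comp tendsto_log_nhdsGT_zero).pow l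
  rw [zero_pow hl.ne'] at h
  simpa [Function.comp_def] using h

theorem tendsto_scale {k₀ k : ℚ × ℕ} (h : scale k₀ < scale k) :
    Tendsto (fun t : ℝ => (t ^ (k.1 : ℝ) * log t ^ k.2) / (t ^ (k₀.1 : ℝ) * log t ^ k₀.2))
      (𝓝[>] 0) (𝓝 0) := by
  obtain ⟨a₀, b₀⟩ := k₀
  obtain ⟨a, b⟩ := k
  rcases scale_lt h with h | ⟨h, h'⟩ <;> dsimp only at h
  · have he : (0 : ℝ) < a - a₀ := sub_pos.2 (by exact_mod_cast h)
    have h1 := tendsto_rpow_mul_log_pow he b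
    rcases Nat.eq_zero_or_pos b₀ with rfl | hb
    · refine h1.congr' ?_
      filter_upwards [self_mem_nhdsWithin] with t ht
      rw [rpow_sub ht, pow_zero, mul_one]
      ring
    · have h2 := h1.mul (tendsto_log_inv_pow hb)
      rw [mul_zero] at h2
      refine h2.congr' ?_
      filter_upwards [self_mem_nhdsWithin] with t ht
      rw [rpow_sub ht, mul_div_mul_comm, div_eq_mul_inv (log t ^ b), mul_assoc]
  · dsimp only at h'
    subst h
    refine (tendsto_log_inv_pow (Nat.sub_pos_of_lt h')).congr' ?_
    filter_upwards [self_mem_nhdsWithin, tendsto_log_nhdsGT_zero.eventually (eventually_lt_atBot 0)]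
      with t ht hl
    have ht' : t ^ (a₀ : ℝ) ≠ 0 := (rpow_pos_of_pos ht _).ne'
    rw [mul_div_mul_left _ _ ht', ← Nat.sub_add_cancel h'.le, pow_add, Nat.add_sub_cancel]
    field_simp [hl.ne]

theorem eq_zero_of_tendsto_scale {α : Type} {l : Filter α} [l.NeBot] {r : α → ℝ}
    (hr : Tendsto r l (𝓝[>] 0)) (J : Finset (ℚ × ℕ)) (hJ : (0, 0) ∈ J) {C : ℚ × ℕ → ℝ}
    (h : Tendsto (fun a => ∑ k ∈ J, C k * (r a ^ (k.1 : ℝ) * log (r a) ^ k.2)) l (𝓝 0)) :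
    C (0, 0) = 0 := by
  classical
  by_contra h0
  obtain ⟨k₀, hk₀, hm⟩ := (J.filter fun k => C k ≠ 0).exists_min_image scale
    ⟨(0, 0), Finset.mem_filter.2 ⟨hJ, h0⟩⟩
  obtain ⟨hk₀J, hk₀C⟩ := Finset.mem_filter.1 hk₀
  have hlog : ∀ᶠ a in l, r a ^ (k₀.1 : ℝ) * log (r a) ^ k₀.2 ≠ 0 := by
    have : ∀ᶠ t : ℝ in 𝓝[>] 0, t ^ (k₀.1 : ℝ) * log t ^ k₀.2 ≠ 0 := by
      filter_upwards [self_mem_nhdsWithin,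
        tendsto_log_nhdsGT_zero.eventually (eventually_lt_atBot 0)] with t ht hl
      exact mul_ne_zero (rpow_pos_of_pos ht _).ne' (pow_ne_zero _ hl.ne)
    exact hr.eventually this
  have h1 : Tendsto (fun a => ∑ k ∈ J, C k * ((r a ^ (k.1 : ℝ) * log (r a) ^ k.2) /
      (r a ^ (k₀.1 : ℝ) * log (r a) ^ k₀.2))) l (𝓝 (∑ k ∈ J, if k = k₀ then C k₀ else 0)) := by
    refine tendsto_finsetSum _ fun k hk => ?_
    split_ifs with hkk
    · subst hkk
      refine tendsto_const_nhds.congr' ?_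
      filter_upwards [hlog] with a ha
      rw [div_self ha, mul_one]
    · by_cases hC : C k = 0
      · simp [hC]
      · have := hm k (Finset.mem_filter.2 ⟨hk, hC⟩)
        have h2 := lt_of_le_of_ne this fun h => hkk (scale_injective h).symm
        simpa using ((tendsto_scale h2).comp hr).const_mul (C k)
  rw [Finset.sum_ite_eq' J k₀, if_pos hk₀J] at h1
  have h2 : ∃ L : ℝ, Tendsto (fun a => 1 / (r a ^ (k₀.1 : ℝ) * log (r a) ^ k₀.2)) l (𝓝 L) := by
    rcases (hm (0, 0) (Finset.mem_filter.2 ⟨hJ, h0⟩)).eq_or_lt with hk | hk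
    · rw [scale_injective hk]
      exact ⟨1, by simp⟩
    · exact ⟨0, by simpa [Function.comp_def] using (tendsto_scale hk).comp hr⟩
  obtain ⟨L, h2⟩ := h2
  have h3 := h.mul h2
  rw [zero_mul] at h3
  refine hk₀C (tendsto_nhds_unique (h1.congr fun a => ?_) h3)
  rw [Finset.sum_mul]
  exact Finset.sum_congr rfl fun k _ => by ring

theorem limit_of_tendsto_scale {α : Type} {l : Filter α} [l.NeBot] {r : α → ℝ}
    (hr : Tendsto r l (𝓝[>] 0)) (J : Finset (ℚ × ℕ)) {C : ℚ × ℕ → ℝ} {L : ℝ}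
    (h : Tendsto (fun a => ∑ k ∈ J, C k * (r a ^ (k.1 : ℝ) * log (r a) ^ k.2)) l (𝓝 L)) :
    L = if (0, 0) ∈ J then C (0, 0) else 0 := by
  classical
  have key := eq_zero_of_tendsto_scale hr (insert (0, 0) J) (Finset.mem_insert_self _ _)
    (C := fun k => (if k ∈ J then C k else 0) - if k = (0, 0) then L else 0) ?_
  · simp only [if_true] at key
    linarith
  · have h' := h.sub_const L
    rw [sub_self] at h'
    refine h'.congr fun a => ?_
    simp only [sub_mul, Finset.sum_sub_distrib]
    congr 1
    · refine (Finset.sum_subset_zero_on_sdiff (Finset.subset_insert _ _) (fun k hk => ?_)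
        fun k hk => ?_)
      · rw [if_neg (Finset.mem_sdiff.1 hk).2, zero_mul]
      · rw [if_pos hk]
    · simp only [ite_mul, zero_mul]
      rw [Finset.sum_ite_eq' (insert (0, 0) J) (0, 0), if_pos (Finset.mem_insert_self _ _)]
      simp

/-- Existence of a primitive on the fibers which is continuous up to the boundary. -/
def PrimOn {X : Type} (G : Set (X → ℝ)) (f : X × ℝ → ℝ) (A : Set (X × ℝ)) : Prop :=
  ∃ F, IsLT (adj G) F ∧ ∀ x y₁ y₂, y₁ < y₂ → (∀ y ∈ Ioo y₁ y₂, (x, y) ∈ A) →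
    ContinuousOn (fun y => F (x, y)) (Icc y₁ y₂) ∧
      ∀ y ∈ Ioo y₁ y₂, HasDerivAt (fun y => F (x, y)) (f (x, y)) y

theorem exists_primOn {X : Type} {G : Set (X → ℝ)} {U : Ultrafilter (X × ℝ)}
    (hU : NonGraph G U) {f : X × ℝ → ℝ} (hf : IsLT (adj G) f) {K : ℝ} (hK : ∀ z, |f z| ≤ K) :
    ∃ (c : Chart G) (A : Set X) (ρ : ℝ), IsDef G A ∧ 0 < ρ ∧ c.cell A ρ ∈ U ∧
      PrimOn G f (c.cell A ρ) := by
  classical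
  obtain ⟨c, hc, hL⟩ := hf.exists_chart hU
  obtain ⟨F, hF, hFd, J, C, hC, hJ⟩ := hL.hasPrim hc
  have ev : ∀ᶠ z in c.l U, HasDerivAt (fun y => F (z.1, y)) (f z) z.2 ∧ (c.b₁ z.1 = 0 → Tendsto
        (fun y => F (z.1, y) - ∑ k ∈ J, C k z.1 * c.mon k (z.1, y))
        (𝓝[{y | 0 < c.p (z.1, y)}] c.θ z.1) (𝓝 0)) := hFd.and (c.eventually_base U hJ)
  obtain ⟨A, ρ, hA, hAU, hρ, hcell⟩ := Chart.exists_cell ev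
  have hρ2 : 0 < ρ / 2 := half_pos hρ
  refine ⟨c, A, ρ / 2, hA, hρ2, hc (Chart.eventually_cell hAU hρ2), ?_⟩
  let L : X → ℝ := fun x => if (0, 0) ∈ J then C (0, 0) x else 0
  have hL : IsLT G L := by
    by_cases h : (0, 0) ∈ J
    · simpa [L, h] using hC (0, 0)
    · simpa [L, h] using IsLT.const 0
  refine ⟨fun z => if z ∈ {z | c.p z ≠ 0} then F z else L z.1,
    IsLT.ite (IsDef.ne_zero c.hasTerm_p) hF hL.adj_fst, fun x y₁ y₂ hy hx => ?_⟩
  have hlim : (∃ y, (x, y) ∈ c.cell A ρ) → c.b₁ x = 0 →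
      Tendsto (fun y => F (x, y)) (𝓝[{y | 0 < c.p (x, y)}] c.θ x) (𝓝 (L x)) := by
    rintro ⟨y, hy⟩ hb
    have hS : {y | (x, y) ∈ c.cell A ρ} ∈ 𝓝[{y | 0 < c.p (x, y)}] c.θ x := by
      have h1 : Tendsto (fun y => c.b₂ x * c.p (x, y)) (𝓝[{y | 0 < c.p (x, y)}] c.θ x) (𝓝 0) := by
        simpa using ((c.tendsto_p_center x).mono_right nhdsWithin_le_nhds).const_mul (c.b₂ x)
      filter_upwards [eventually_mem_nhdsWithin, h1.eventually (gt_mem_nhds hρ)] with y h2 h3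
      exact ⟨hy.1, h2, by rw [hb]; exact mul_pos hρ h2, h3⟩
    have hlip : LipschitzOnWith K.toNNReal (fun y => F (x, y)) {y | (x, y) ∈ c.cell A ρ} := by
      refine (c.ordConnected_cell A hρ x).convex.lipschitzOnWith_of_nnnorm_hasDerivWithin_le
        (fun y hy => (hcell (x, y) hy).1.hasDerivWithinAt) fun y hy => ?_
      rw [← NNReal.coe_le_coe, coe_nnnorm, Real.norm_eq_abs]
      exact (hK _).trans (Real.le_coe_toNNReal K)
    obtain ⟨g, hg, hgF⟩ := hlip.extend_real
    have h1 : Tendsto (fun y => F (x, y)) (𝓝[{y | 0 < c.p (x, y)}] c.θ x) (𝓝 (g (c.θ x))) := by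
      refine ((hg.continuous.tendsto _).mono_left nhdsWithin_le_nhds).congr' ?_
      filter_upwards [hS] with y hy using (hgF hy).symm
    have h2 := h1.sub ((hcell (x, y) hy).2 hb)
    rw [sub_zero] at h2
    have h3 := limit_of_tendsto_scale (c.tendsto_p_center x) J (C := fun k => C k x) (h2.congr' ?_)
    · rw [h3] at h1
      exact h1
    · filter_upwards [eventually_mem_nhdsWithin] with y hy
      simp only [sub_sub_cancel]
      exact Finset.sum_congr rfl fun k _ => by rw [Chart.mon_of_pos hy]
  have hmid : (x, (y₁ + y₂) / 2) ∈ c.cell A (ρ / 2) := hx _ ⟨by linarith, by linarith⟩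
  have hsub : ∀ z ∈ c.cell A (ρ / 2), z ∈ c.cell A ρ := fun z hz =>
    ⟨hz.1, hz.2.1, hz.2.2.1.trans_le (mul_le_mul_of_nonneg_right (by linarith) hz.2.1.le),
      hz.2.2.2.trans (by linarith)⟩
  have hcl : ∀ y ∈ Icc y₁ y₂, 0 ≤ c.p (x, y) ∧ c.b₁ x ≤ ρ / 2 * c.p (x, y) ∧
      c.b₂ x * c.p (x, y) ≤ ρ / 2 := by
    have hp := c.continuous_p x
    have hclosed : IsClosed {y | 0 ≤ c.p (x, y) ∧ c.b₁ x ≤ ρ / 2 * c.p (x, y) ∧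
      c.b₂ x * c.p (x, y) ≤ ρ / 2} :=
      (isClosed_le continuous_const hp).inter ((isClosed_le continuous_const
        (continuous_const.mul hp)).inter (isClosed_le (continuous_const.mul hp) continuous_const))
    rw [← closure_Ioo hy.ne]
    have hs : Ioo y₁ y₂ ⊆ {y | 0 ≤ c.p (x, y) ∧ c.b₁ x ≤ ρ / 2 * c.p (x, y) ∧
        c.b₂ x * c.p (x, y) ≤ ρ / 2} := fun y hy =>
      ⟨(hx y hy).2.1.le, (hx y hy).2.2.1.le, (hx y hy).2.2.2.le⟩
    exact fun y hyc => closure_minimal hs hclosed hyc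
  have hbig : ∀ y ∈ Icc y₁ y₂, c.p (x, y) ≠ 0 → (x, y) ∈ c.cell A ρ := by
    intro y hyI h0
    obtain ⟨h1, h2, h3⟩ := hcl y hyI
    have h1' := lt_of_le_of_ne h1 (Ne.symm h0)
    exact ⟨hmid.1, h1', h2.trans_lt (mul_lt_mul_of_pos_right (by linarith) h1'),
      h3.trans_lt (by linarith)⟩
  have hder : ∀ y ∈ Icc y₁ y₂, c.p (x, y) ≠ 0 → HasDerivAt
      (fun y => if (x, y) ∈ {z | c.p z ≠ 0} then F (x, y) else L x) (f (x, y)) y := by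
    intro y hyI h0
    refine (hcell _ (hbig y hyI h0)).1.congr_of_eventuallyEq ?_
    filter_upwards [(c.continuous_p x).continuousAt.eventually_ne h0] with t ht
    exact if_pos ht
  refine ⟨fun y hyI => ?_, fun y hyI => hder y (Ioo_subset_Icc_self hyI) (hx y hyI).2.1.ne'⟩
  by_cases h0 : c.p (x, y) = 0
  · have hyθ : y = c.θ x := by
      have hσ := c.σ_sq
      have h0' : c.σ * (y - c.θ x) = 0 := h0
      rcases mul_eq_zero.1 h0' with h | h
      · rw [h] at hσ; norm_num at hσ
      · linarith
    have hb : c.b₁ x = 0 := le_antisymm (by simpa [h0] using (hcl y hyI).2.1) (c.nn₁ x)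
    have hl := hlim ⟨_, hsub _ hmid⟩ hb
    rw [← hyθ] at hl
    have heq : (fun y => if (x, y) ∈ {z | c.p z ≠ 0} then F (x, y) else L x) =
        Function.update (fun y => F (x, y)) y (L x) := by
      funext t
      by_cases ht : t = y
      · subst ht
        rw [Function.update_self, if_neg]
        exact fun h => h h0
      · rw [Function.update_of_ne ht, if_pos]
        intro h
        have h' : c.σ * (t - c.θ x) = 0 := h
        have hσ := c.σ_sq
        rcases mul_eq_zero.1 h' with h | h
        · rw [h] at hσ; norm_num at hσ
        · exact ht (by rw [hyθ]; linarith)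
    rw [heq, continuousWithinAt_update_same]
    refine hl.mono_left (nhdsWithin_mono _ fun t ht => ?_)
    refine lt_of_le_of_ne (hcl t ht.1).1 fun h => ht.2 ?_
    have h' : c.σ * (t - c.θ x) = 0 := h.symm
    have hσ := c.σ_sq
    rcases mul_eq_zero.1 h' with h | h
    · rw [h] at hσ; norm_num at hσ
    · exact mem_singleton_iff.2 (by rw [hyθ]; linarith)
  · exact (hder y hyI h0).continuousAt.continuousWithinAt

end Tame

namespace Tame
open Filter Topology

theorem IsLT.exists_patch {X ι : Type} {G : Set (X → ℝ)} (s : Finset ι) {A : ι → Set X}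
    {g : ι → X → ℝ} (hA : ∀ i ∈ s, IsDef G (A i)) (hg : ∀ i ∈ s, IsLT G (g i)) :
    ∃ h, IsLT G h ∧ ∀ x, (∃ i ∈ s, x ∈ A i) → ∃ i ∈ s, x ∈ A i ∧ h x = g i x := by
  classical
  induction s using Finset.induction_on with
  | empty => exact ⟨_, .const 0, by simp⟩
  | insert i s _ ih =>
    obtain ⟨h, hh, H⟩ := ih (fun j hj => hA j (Finset.mem_insert_of_mem hj))
      fun j hj => hg j (Finset.mem_insert_of_mem hj)
    refine ⟨_, IsLT.ite (hA i (Finset.mem_insert_self _ _)) (hg i (Finset.mem_insert_self _ _)) hh,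
      fun x => ?_⟩
    by_cases hx : x ∈ A i
    · exact fun _ => ⟨i, Finset.mem_insert_self _ _, hx, if_pos hx⟩
    · rintro ⟨j, hj, hxj⟩
      rw [if_neg hx]
      rcases Finset.mem_insert.1 hj with rfl | hj
      · exact absurd hxj hx
      · obtain ⟨k, hk, h1, h2⟩ := H x ⟨j, hj, hxj⟩
        exact ⟨k, Finset.mem_insert_of_mem hk, h1, h2⟩

/-- The fibers of `B` can only be entered or left at finitely many terms. -/
def Adapted {X : Type} (G : Set (X → ℝ)) (B : Set (X × ℝ)) : Prop :=
  ∃ E : List (X → ℝ), (∀ e ∈ E, IsTerm G e) ∧ ∀ x y₁ y₂, (∀ e ∈ E, e x ∉ Ioo y₁ y₂) →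
    (∀ y ∈ Ioo y₁ y₂, (x, y) ∈ B) ∨ ∀ y ∈ Ioo y₁ y₂, (x, y) ∉ B

namespace Adapted

variable {X : Type} {G : Set (X → ℝ)} {B B' : Set (X × ℝ)}

theorem inter (h : Adapted G B) (h' : Adapted G B') : Adapted G (B ∩ B') := by
  obtain ⟨E, hE, H⟩ := h
  obtain ⟨E', hE', H'⟩ := h'
  refine ⟨E ++ E', fun e he => (List.mem_append.1 he).elim (hE e) (hE' e), fun x y₁ y₂ he => ?_⟩
  rcases H x y₁ y₂ fun e h => he e (List.mem_append_left _ h) with h1 | h1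
  · rcases H' x y₁ y₂ fun e h => he e (List.mem_append_right _ h) with h2 | h2
    · exact .inl fun y hy => ⟨h1 y hy, h2 y hy⟩
    · exact .inr fun y hy h => h2 y hy h.2
  · exact .inr fun y hy h => h1 y hy h.1

theorem base (A : Set X) : Adapted G (Prod.fst ⁻¹' A) := by
  refine ⟨[], by simp, fun x y₁ y₂ _ => ?_⟩
  by_cases hx : x ∈ A
  · exact .inl fun _ _ => hx
  · exact .inr fun _ _ => hx

theorem graph {θ : X → ℝ} (hθ : IsTerm G θ) : Adapted G {z | z.2 = θ z.1} := by
  refine ⟨[θ], by simpa using hθ, fun x y₁ y₂ he => .inr fun y hy h => ?_⟩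
  exact he θ (by simp) (show θ x ∈ Ioo y₁ y₂ from (show y = θ x from h) ▸ hy)

theorem affine {α β : X → ℝ} (hα : IsTerm G α) (hβ : IsTerm G β) :
    Adapted G {z | 0 < α z.1 * z.2 + β z.1} := by
  refine ⟨[fun x => -β x / α x], by simpa using hβ.neg.div hα, fun x y₁ y₂ he => ?_⟩
  have he := he _ (List.mem_singleton_self _)
  by_contra! hcon
  obtain ⟨⟨y, hy, h1⟩, ⟨t, ht, h2⟩⟩ := hcon
  have h1 : α x * y + β x ≤ 0 := not_lt.1 h1
  have h2 : 0 < α x * t + β x := h2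
  refine he ?_
  have h0 : α x ≠ 0 := by
    intro h0
    rw [h0] at h1 h2
    linarith
  rcases lt_or_gt_of_ne h0 with h0 | h0
  · have e1 : -β x / α x ≤ y := by rw [div_le_iff_of_neg h0]; linarith
    have e2 : t < -β x / α x := by rw [lt_div_iff_of_neg h0]; linarith
    exact ⟨ht.1.trans e2, e1.trans_lt hy.2⟩
  · have e1 : y ≤ -β x / α x := by rw [le_div_iff₀ h0]; linarith
    have e2 : -β x / α x < t := by rw [div_lt_iff₀ h0]; linarith
    exact ⟨hy.1.trans_le e1, e2.trans ht.2⟩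

theorem cell (c : Chart G) (A : Set X) (ρ : ℝ) : Adapted G (c.cell A ρ) := by
  have h1 := affine (G := G) (.const c.σ) ((IsTerm.const c.σ).mul c.hθ).neg
  have h2 := affine (G := G) (.const (ρ * c.σ))
    (((IsTerm.const (ρ * c.σ)).mul c.hθ).add c.hb₁).neg
  have h3 := affine (G := G) ((IsTerm.const c.σ).mul c.hb₂).neg
    ((((IsTerm.const c.σ).mul c.hb₂).mul c.hθ).add (.const ρ))
  convert! (base A).inter (h1.inter (h2.inter h3)) using 1
  ext z
  simp only [Chart.cell, Chart.p, mem_inter_iff, mem_preimage, mem_ofPred_eq]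
  refine and_congr_right fun _ => and_congr ?_ (and_congr ?_ ?_) <;> rw [← sub_pos] <;>
    ring_nf

end Adapted

/-- Sets over which integrals along fibers can be computed. -/
def GoodCell {X : Type} (G : Set (X → ℝ)) (f : X × ℝ → ℝ) (B : Set (X × ℝ)) : Prop :=
  IsDef (adj G) B ∧ PrimOn G f B ∧ Adapted G B

theorem exists_goodCell {X : Type} {G : Set (X → ℝ)} {f : X × ℝ → ℝ} (hf : IsLT (adj G) f) {K : ℝ}
    (hK : ∀ z, |f z| ≤ K) (U : Ultrafilter (X × ℝ)) : ∃ B ∈ U, GoodCell G f B := by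
  by_cases hU : NonGraph G U
  · obtain ⟨c, A, ρ, hA, hρ, hAU, hP⟩ := exists_primOn hU hf hK
    exact ⟨_, hAU, c.isDef_cell hA ρ, hP, .cell c A ρ⟩
  · simp only [NonGraph, not_forall] at hU
    obtain ⟨θ, hθ, h⟩ := hU
    have h' := Ultrafilter.eventually_not.2 h
    refine ⟨{z | z.2 = θ z.1}, ?_, IsDef.eq .adj_snd hθ.adj_fst, ⟨_, .const 0, ?_⟩, .graph hθ⟩
    · filter_upwards [h'] with z hz using not_not.1 hz
    · intro x y₁ y₂ hy h
      have e1 : y₁ + (y₂ - y₁) / 2 = θ x := h _ ⟨by linarith, by linarith⟩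
      have e2 : y₁ + (y₂ - y₁) / 3 = θ x := h _ ⟨by linarith, by linarith⟩
      linarith

theorem IsTerm.max {X : Type} {G : Set (X → ℝ)} {a b : X → ℝ} (ha : IsTerm G a)
    (hb : IsTerm G b) : IsTerm G fun x => max (a x) (b x) := by
  refine (((ha.add hb).add (ha.sub hb).abs).mul (.const (1 / 2))).congr fun x => ?_
  rw [max_def]
  split_ifs with h
  · rw [abs_of_nonpos (by linarith)]; ring
  · rw [abs_of_pos (by linarith)]; ring

theorem IsTerm.min {X : Type} {G : Set (X → ℝ)} {a b : X → ℝ} (ha : IsTerm G a)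
    (hb : IsTerm G b) : IsTerm G fun x => min (a x) (b x) := by
  refine (ha.neg.max hb.neg).neg.congr fun x => ?_
  rw [max_neg_neg, neg_neg]

theorem intervalIntegrable_of_bound {g : ℝ → ℝ} (hg : Measurable g) {K : ℝ} (hK : ∀ y, |g y| ≤ K)
    (a b : ℝ) : IntervalIntegrable g volume a b := by
  refine (intervalIntegrable_const (c := K)).mono_fun hg.aestronglyMeasurable ?_
  filter_upwards with y
  rw [Real.norm_eq_abs, Real.norm_eq_abs]
  exact (hK y).trans (le_abs_self K)

theorem IsLT.exists_integral {X : Type} {G : Set (X → ℝ)} {f : X × ℝ → ℝ} {K : ℝ}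
    (hK : ∀ z, |f z| ≤ K) (hm : ∀ x, Measurable fun y => f (x, y))
    {s : Finset (Set (X × ℝ))} (hs : ∀ B ∈ s, GoodCell G f B) (hcov : ∀ z, ∃ B ∈ s, z ∈ B)
    {E' : List (X → ℝ)} (hE' : ∀ B ∈ s, ∀ x y₁ y₂, (∀ e ∈ E', e x ∉ Ioo y₁ y₂) →
      (∀ y ∈ Ioo y₁ y₂, (x, y) ∈ B) ∨ ∀ y ∈ Ioo y₁ y₂, (x, y) ∉ B)
    (E : List (X → ℝ)) (hE : ∀ e ∈ E, IsTerm G e) {a b : X → ℝ} (ha : IsTerm G a)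
    (hb : IsTerm G b) : ∃ g, IsLT G g ∧ ∀ x, a x ≤ b x →
      (∀ e ∈ E', e ∉ E → e x ∉ Ioo (a x) (b x)) → ∫ y in a x..b x, f (x, y) = g x := by
  classical
  induction E generalizing a b with
  | nil =>
    have hP : ∀ B ∈ s, PrimOn G f B := fun B hB => (hs B hB).2.1
    simp only [PrimOn] at hP
    choose! F hF H using hP
    have hmid : IsTerm G fun x => (a x + b x) / 2 := (ha.add hb).div (.const 2)
    obtain ⟨h, hh, hh'⟩ := IsLT.exists_patch s (G := G)
      (A := fun B => {x | (x, (a x + b x) / 2) ∈ B})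
      (g := fun B x => F B (x, b x) - F B (x, a x))
      (fun B hB => (hs B hB).1.comp (adj_subst hmid))
      (fun B hB => ((hF B hB).comp (adj_subst hb)).sub ((hF B hB).comp (adj_subst ha)))
    refine ⟨_, IsLT.ite (IsDef.eq ha hb) (.const 0) hh, fun x hab he => ?_⟩
    split_ifs with hx
    · have hx : a x = b x := hx
      rw [hx, intervalIntegral.integral_same]
    · have hlt : a x < b x := lt_of_le_of_ne hab hx
      obtain ⟨B₀, hB₀, hxB₀⟩ := hcov (x, (a x + b x) / 2)
      obtain ⟨B, hB, hxB, hhx⟩ := hh' x ⟨B₀, hB₀, hxB₀⟩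
      have hin : ∀ y ∈ Ioo (a x) (b x), (x, y) ∈ B := by
        refine (hE' B hB x _ _ fun e h => he e h (by simp)).resolve_right fun h => ?_
        exact h _ ⟨by linarith, by linarith⟩ hxB
      obtain ⟨h1, h2⟩ := H B hB x _ _ hlt hin
      rw [hhx, intervalIntegral.integral_eq_sub_of_hasDerivAt_of_le hab h1 h2
        (intervalIntegrable_of_bound (hm x) (fun y => hK _) _ _)]
  | cons e E ih =>
    have he := hE e (by simp)
    have hE := fun t ht => hE t (List.mem_cons_of_mem _ ht)
    have hc := ha.max (hb.min he)
    obtain ⟨g₁, hg₁, h₁⟩ := ih hE ha hc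
    obtain ⟨g₂, hg₂, h₂⟩ := ih hE hc hb
    refine ⟨_, hg₁.add hg₂, fun x hab hx => ?_⟩
    have key : ∀ t : X → ℝ, t ∈ E' → t ∉ E →
        t x ∉ Ioo (a x) (Max.max (a x) (Min.min (b x) (e x))) ∧
        t x ∉ Ioo (Max.max (a x) (Min.min (b x) (e x))) (b x) := by
      intro t ht htE
      by_cases hte : t = e
      · subst hte
        refine ⟨fun ⟨h1, h2⟩ => ?_, fun ⟨h1, h2⟩ => ?_⟩
        · rcases lt_max_iff.1 h2 with h2 | h2
          · exact lt_asymm h1 h2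
          · exact (lt_min_iff.1 h2).2.false
        · rw [min_eq_right h2.le] at h1
          exact (max_lt_iff.1 h1).2.false
      · have h := hx t ht (by simp [hte, htE])
        exact ⟨fun h' => h ⟨h'.1, h'.2.trans_le (max_le hab (min_le_left _ _))⟩,
          fun h' => h ⟨(le_max_left _ _).trans_lt h'.1, h'.2⟩⟩
    rw [← h₁ x (le_max_left _ _) fun t h h' => (key t h h').1,
      ← h₂ x (max_le hab (min_le_left _ _)) fun t h h' => (key t h h').2,
      intervalIntegral.integral_add_adjacent_intervals] <;>
    exact intervalIntegrable_of_bound (hm x) (fun y => hK _) _ _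

/-- Stability under integration over the unit interval. -/
theorem IsLT.integral {X : Type} {G : Set (X → ℝ)} {f : X × ℝ → ℝ} (hf : IsLT (adj G) f) {K : ℝ}
    (hK : ∀ z, |f z| ≤ K) : IsLT G fun x => ∫ y in (0 : ℝ)..1, f (x, y) := by
  have hm : ∀ x, Measurable fun y => f (x, y) := fun x => hf.measurable (e := fun y => (x, y)) (by
    rintro g (rfl | ⟨g, hg, rfl⟩)
    · exact measurable_id
    · exact (measurable_const : Measurable fun _ : ℝ => g x))
  obtain ⟨s, hs, hcov⟩ := exists_finset_cover (exists_goodCell hf hK)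
  have hE : ∃ E : List (X → ℝ), (∀ e ∈ E, IsTerm G e) ∧ ∀ B ∈ s, ∀ x y₁ y₂,
      (∀ e ∈ E, e x ∉ Ioo y₁ y₂) →
        (∀ y ∈ Ioo y₁ y₂, (x, y) ∈ B) ∨ ∀ y ∈ Ioo y₁ y₂, (x, y) ∉ B := by
    have hA : ∀ B ∈ s, Adapted G B := fun B hB => (hs B hB).2.2
    clear hcov hs
    induction s using Finset.cons_induction with
    | empty => exact ⟨[], by simp, by simp⟩
    | cons B s _ ih =>
      obtain ⟨E, hE, H⟩ := ih fun B' hB' => hA B' (Finset.mem_cons_of_mem hB')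
      obtain ⟨E', hE', H'⟩ := hA B (Finset.mem_cons_self _ _)
      refine ⟨E ++ E', fun e he => (List.mem_append.1 he).elim (hE e) (hE' e),
        fun B' hB' x y₁ y₂ he => ?_⟩
      rcases Finset.mem_cons.1 hB' with rfl | hB'
      · exact H' x y₁ y₂ fun e h => he e (List.mem_append_right _ h)
      · exact H B' hB' x y₁ y₂ fun e h => he e (List.mem_append_left _ h)
  obtain ⟨E, hE, H⟩ := hE
  obtain ⟨g, hg, h⟩ := IsLT.exists_integral hK hm hs hcov H E hE (.const 0) (.const 1)
  exact hg.congr fun x => h x zero_le_one fun e h h' => absurd h h'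

end Tame

namespace Tame
open Filter Topology
namespace Chart

variable {X : Type} {G : Set (X → ℝ)} {c : Chart G} {U : Ultrafilter (X × ℝ)}

/-- Functions which agree with a term and whose fiberwise derivative agrees with a term. -/
def TermDiff (c : Chart G) (U : Ultrafilter (X × ℝ)) (f : X × ℝ → ℝ) : Prop :=
  ∃ t t', IsTerm (adj G) t ∧ IsTerm (adj G) t' ∧
    ∀ᶠ z in c.l U, f z = t z ∧ HasDerivAt (fun y => f (z.1, y)) (t' z) z.2

namespace TermDiff

variable {f g : X × ℝ → ℝ}

theorem congr (hf : TermDiff c U f) (h : ∀ᶠ z in c.l U, g z = f z) : TermDiff c U g := by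
  obtain ⟨t, t', ht, ht', H⟩ := hf
  refine ⟨t, t', ht, ht', ?_⟩
  filter_upwards [H, h, eventually_fiber_nhds h] with z hz h1 h2
  exact ⟨h1.trans hz.1, hz.2.congr_of_eventuallyEq h2⟩

theorem base {a : X → ℝ} (ha : IsTerm G a) : TermDiff c U fun z => a z.1 :=
  ⟨_, _, ha.adj_fst, .const 0, .of_forall fun z =>
    ⟨rfl, (hasDerivAt_const z.2 (a z.1) : HasDerivAt (fun _ : ℝ => a z.1) 0 z.2)⟩⟩

theorem add (hf : TermDiff c U f) (hg : TermDiff c U g) : TermDiff c U fun z => f z + g z := by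
  obtain ⟨t, t', ht, ht', H⟩ := hf
  obtain ⟨s, s', hs, hs', H'⟩ := hg
  refine ⟨_, _, ht.add hs, ht'.add hs', ?_⟩
  filter_upwards [H, H'] with z h h'
  exact ⟨by rw [h.1, h'.1], h.2.add h'.2⟩

theorem mul (hf : TermDiff c U f) (hg : TermDiff c U g) : TermDiff c U fun z => f z * g z := by
  obtain ⟨t, t', ht, ht', H⟩ := hf
  obtain ⟨s, s', hs, hs', H'⟩ := hg
  refine ⟨_, _, ht.mul hs, (ht'.mul hs).add (ht.mul hs'), ?_⟩
  filter_upwards [H, H'] with z h h'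
  refine ⟨by rw [h.1, h'.1], ?_⟩
  rw [← h.1, ← h'.1]
  exact h.2.mul h'.2

theorem sum {ι : Type} (s : Finset ι) {f : ι → X × ℝ → ℝ} (hf : ∀ i ∈ s, TermDiff c U (f i)) :
    TermDiff c U fun z => ∑ i ∈ s, f i z := by
  induction s using Finset.cons_induction with
  | empty => simpa using base (c := c) (U := U) (.const 0)
  | cons i s hi ih =>
    simp only [Finset.sum_cons]
    exact (hf i (Finset.mem_cons_self _ _)).add
      (ih fun j hj => hf j (Finset.mem_cons_of_mem hj))

theorem coord_rpow (κ : ℚ) : TermDiff c U fun z => c.p z ^ (κ : ℝ) := by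
  refine ⟨_, _, c.hasTerm_p.rpow κ,
    ((IsTerm.const (c.σ * κ)).mul (c.hasTerm_p.rpow (κ - 1))), ?_⟩
  filter_upwards [c.p_pos U] with z hz
  refine ⟨by rw [abs_of_pos hz], ?_⟩
  have := (c.hasDerivAt_p z.1 z.2).rpow_const (p := (κ : ℝ)) (.inl hz.ne')
  rw [abs_of_pos hz]
  push_cast
  exact this

theorem analytic {κ : Type} [Fintype κ] {A : (κ → ℝ) × ℝ → ℝ} (hA : AnalyticAt ℝ A 0)
    {ψ : κ → X → ℝ} (hψ : ∀ i, IsTerm G (ψ i)) (hψ0 : ∀ i, Tendsto (ψ i) (baseF G U) (𝓝 0))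
    {R : X × ℝ → ℝ} (hR : TermDiff c U R) (hR0 : Tendsto R (c.l U) (𝓝 0)) :
    TermDiff c U fun z => A (fun i => ψ i z.1, R z) := by
  obtain ⟨r, r', hr, hr', H⟩ := hR
  have hr0 : Tendsto r (c.l U) (𝓝 0) := hR0.congr' (H.mono fun z hz => hz.1)
  obtain ⟨t, ht, hte⟩ := exists_term_pair hA hψ hψ0 hr hr0
  obtain ⟨s, hs, hse⟩ := exists_term_pair (analyticAt_D hA) hψ hψ0 hr hr0
  have hlim : Tendsto (fun z : X × ℝ => (fun i => ψ i z.1, R z)) (c.l U) (𝓝 0) :=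
    (tendsto_pi_nhds.2 fun i => (hψ0 i).comp (tendsto_comap.mono_left (c.l_le U))).prodMk_nhds hR0
  refine ⟨_, _, ht, hs.mul hr', ?_⟩
  filter_upwards [H, hte, hse, hlim.eventually hA.eventually_analyticAt] with z h1 h2 h3 h4
  refine ⟨by rw [h2, h1.1], ?_⟩
  rw [h3, ← h1.1]
  exact (hasDerivAt_D h4).comp z.2 h1.2

theorem of_germ (hc : c.Valid U) {h : ℝ → ℝ} (hf : Germ (c.sys U) f h) : TermDiff c U f := by
  obtain ⟨m, τ, _, ψ, W, V, hm, hψ, hψ0, hW, hV, -, he⟩ := exists_split_form hc hf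
  have hw : TermDiff c U (c.wr m) :=
    ((base (c.hb₂.rpow ((1 : ℕ) / m))).mul (coord_rpow ((1 : ℕ) / m))).congr <| by
      filter_upwards [c.p_pos U] with z hz
      rw [← wr_pow hm hz, pow_one]
  have hv : TermDiff c U (c.vr m) :=
    ((base (c.hb₁.rpow ((1 : ℕ) / m))).mul (coord_rpow (-(1 : ℕ) / m))).congr <| by
      filter_upwards [c.p_pos U] with z hz
      rw [← vr_pow hm hz, pow_one]
  exact ((analytic hW hψ hψ0 hw (germ_wr hm).tendsto).add
    (analytic hV hψ hψ0 hv (germ_vr hm).tendsto)).congr he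

theorem of_prepared (hc : c.Valid U) (hf : Prepared c U f) : TermDiff c U f := by
  obtain ⟨a, κ, u, C, ha, -, hu, h⟩ := hf
  exact (((base ha).mul (coord_rpow κ)).mul (of_germ hc hu)).congr h

end TermDiff

/-- With all functions of the base allowed, the coefficients of logarithms are terms. -/
theorem LPrep.exists_coeff (hG : ∀ a : X → ℝ, IsTerm G a) (hc : c.Valid U) {f : X × ℝ → ℝ}
    (hf : LPrep c U f) : ∃ (n : ℕ) (P : ℕ → X × ℝ → ℝ), (∀ l, TermDiff c U (P l)) ∧
      ∀ᶠ z in c.l U, f z = ∑ l ∈ Finset.range n, P l z * log (c.p z) ^ l := by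
  classical
  obtain ⟨ι, hι, a, κ, l, u, C, ha, hu, h⟩ := hf
  refine ⟨Finset.univ.sup l + 1, fun i z => ∑ j with l j = i, a j z.1 * c.p z ^ (κ j : ℝ) * u j z,
    fun i => TermDiff.sum _ fun j _ => ((TermDiff.base (hG _)).mul (.coord_rpow _)).mul
      (.of_germ hc (hu j)), ?_⟩
  filter_upwards [h] with z hz
  rw [hz, ← Finset.sum_fiberwise_of_maps_to (g := l) (t := Finset.range (Finset.univ.sup l + 1))
    fun j _ => Finset.mem_range_succ_iff.2 (Finset.le_sup (Finset.mem_univ j))]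
  refine Finset.sum_congr rfl fun i _ => ?_
  rw [Finset.sum_mul]
  refine Finset.sum_congr rfl fun j hj => ?_
  rw [(Finset.mem_filter.1 hj).2]
  ring

end Chart

end Tame

namespace Tame
open Filter Topology

variable {X : Type}

/-- The fibers of `A` are covered by a bounded number of intervals satisfying `R`. -/
def PwOn (R : X → Set ℝ → Prop) (A : Set (X × ℝ)) : Prop :=
  ∃ M : ℕ, ∀ x, ∃ J : Finset (Set ℝ), J.card ≤ M ∧ (∀ I ∈ J, OrdConnected I ∧ R x I) ∧
    ∀ y, (x, y) ∈ A → ∃ I ∈ J, y ∈ I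

namespace PwOn

variable {R R' : X → Set ℝ → Prop} {A B : Set (X × ℝ)}

theorem mono (h : PwOn R B) (hA : A ⊆ B) : PwOn R A := by
  obtain ⟨M, h⟩ := h
  refine ⟨M, fun x => ?_⟩
  obtain ⟨J, h1, h2, h3⟩ := h x
  exact ⟨J, h1, h2, fun y hy => h3 y (hA hy)⟩

theorem union (h : PwOn R A) (h' : PwOn R B) : PwOn R (A ∪ B) := by
  classical
  obtain ⟨M, h⟩ := h
  obtain ⟨M', h'⟩ := h'
  refine ⟨M + M', fun x => ?_⟩
  obtain ⟨J, h1, h2, h3⟩ := h x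
  obtain ⟨J', h1', h2', h3'⟩ := h' x
  refine ⟨J ∪ J', (Finset.card_union_le _ _).trans (add_le_add h1 h1'), fun I hI => ?_,
    fun y hy => ?_⟩
  · exact (Finset.mem_union.1 hI).elim (h2 I) (h2' I)
  · rcases hy with hy | hy
    · obtain ⟨I, hI, hy⟩ := h3 y hy
      exact ⟨I, Finset.mem_union_left _ hI, hy⟩
    · obtain ⟨I, hI, hy⟩ := h3' y hy
      exact ⟨I, Finset.mem_union_right _ hI, hy⟩

theorem empty : PwOn R (∅ : Set (X × ℝ)) := ⟨0, fun _ => ⟨∅, by simp, by simp, by simp⟩⟩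

theorem of_ultrafilter (h : ∀ U : Ultrafilter (X × ℝ), ∃ A ∈ U, PwOn R A) : PwOn R univ := by
  obtain ⟨s, hs, hcov⟩ := exists_finset_cover h
  have key : PwOn R (⋃ A ∈ s, A) := by
    clear hcov
    induction s using Finset.cons_induction with
    | empty => simpa using empty
    | cons A s _ ih =>
      simp only [Finset.mem_cons, iUnion_iUnion_eq_or_left]
      exact (hs A (Finset.mem_cons_self _ _)).union
        (ih fun B hB => hs B (Finset.mem_cons_of_mem hB))
  exact key.mono fun z _ => by simpa using hcov z

theorem graph (θ : X → ℝ) (hR : ∀ x y, R x {y}) : PwOn R {z | z.2 = θ z.1} :=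
  ⟨1, fun x => ⟨{{θ x}}, by simp, by simpa using ⟨ordConnected_singleton, hR x _⟩,
    fun y hy => ⟨{θ x}, by simp, hy⟩⟩⟩

theorem of_nonGraph {G : Set (X → ℝ)} (hR : ∀ x y, R x {y})
    (h : ∀ U : Ultrafilter (X × ℝ), NonGraph G U → ∃ A ∈ U, PwOn R A) : PwOn R univ := by
  refine of_ultrafilter fun U => ?_
  by_cases hU : NonGraph G U
  · exact h U hU
  · simp only [NonGraph, not_forall] at hU
    obtain ⟨θ, -, h⟩ := hU
    refine ⟨{z | z.2 = θ z.1}, ?_, graph θ hR⟩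
    filter_upwards [Ultrafilter.eventually_not.2 h] with z hz using not_not.1 hz

theorem refine (h : PwOn R univ) (hA : ∀ x, OrdConnected {y | (x, y) ∈ A}) (N : ℕ)
    (H : ∀ x I I', R x I → I' ⊆ I → (∀ y ∈ I', (x, y) ∈ A) → OrdConnected I' →
      ∃ J : Finset (Set ℝ), J.card ≤ N ∧ (∀ I ∈ J, OrdConnected I ∧ R' x I) ∧
        ∀ y ∈ I', ∃ I ∈ J, y ∈ I) : PwOn R' A := by
  classical
  obtain ⟨M, h⟩ := h
  refine ⟨M * N, fun x => ?_⟩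
  obtain ⟨J, h1, h2, h3⟩ := h x
  have H' : ∀ I ∈ J, ∃ K : Finset (Set ℝ), K.card ≤ N ∧ (∀ I ∈ K, OrdConnected I ∧ R' x I) ∧
      ∀ y ∈ I, (x, y) ∈ A → ∃ I ∈ K, y ∈ I := by
    intro I hI
    obtain ⟨K, k1, k2, k3⟩ := H x I (I ∩ {y | (x, y) ∈ A}) (h2 I hI).2 inter_subset_left
      (fun y hy => hy.2) ((h2 I hI).1.inter (hA x))
    exact ⟨K, k1, k2, fun y hy hyA => k3 y ⟨hy, hyA⟩⟩
  choose! K k1 k2 k3 using H'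
  refine ⟨J.biUnion K, (Finset.card_biUnion_le_card_mul J K N k1).trans
    (Nat.mul_le_mul_right N h1), fun I hI => ?_, fun y hy => ?_⟩
  · obtain ⟨I', hI', hI⟩ := Finset.mem_biUnion.1 hI
    exact k2 I' hI' I hI
  · obtain ⟨I, hI, hyI⟩ := h3 y (mem_univ _)
    obtain ⟨I', hI', hy'⟩ := k3 I hI y hyI hy
    exact ⟨I', Finset.mem_biUnion.2 ⟨I, hI, hI'⟩, hy'⟩

theorem congr (h : PwOn R univ) (hA : ∀ x, OrdConnected {y | (x, y) ∈ A})
    (H : ∀ x I I', R x I → I' ⊆ I → (∀ y ∈ I', (x, y) ∈ A) → OrdConnected I' → R' x I') :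
    PwOn R' A :=
  h.refine hA 1 fun x I I' h1 h2 h3 h4 =>
    ⟨{I'}, by simp, by simpa using ⟨h4, H x I I' h1 h2 h3 h4⟩, fun y hy => ⟨I', by simp, hy⟩⟩

theorem single (hA : ∀ x, OrdConnected {y | (x, y) ∈ A}) (H : ∀ x, R x {y | (x, y) ∈ A}) :
    PwOn R A :=
  ⟨1, fun x => ⟨{{y | (x, y) ∈ A}}, by simp, by simpa using ⟨hA x, H x⟩,
    fun y hy => ⟨_, Finset.mem_singleton_self _, hy⟩⟩⟩

end PwOn

/-- Constancy of the sign. -/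
def SignOn (f : X × ℝ → ℝ) (x : X) (I : Set ℝ) : Prop :=
  (∀ y ∈ I, f (x, y) = 0) ∨ (∀ y ∈ I, 0 < f (x, y)) ∨ ∀ y ∈ I, f (x, y) < 0

/-- Monotonicity in either direction. -/
def MonoOn (f : X × ℝ → ℝ) (x : X) (I : Set ℝ) : Prop :=
  MonotoneOn (fun y => f (x, y)) I ∨ AntitoneOn (fun y => f (x, y)) I

theorem signOn_singleton (f : X × ℝ → ℝ) (x : X) (y : ℝ) : SignOn f x {y} := by
  simp only [SignOn, mem_singleton_iff, forall_eq]
  rcases lt_trichotomy (f (x, y)) 0 with h | h | h <;> simp [h]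

theorem monoOn_singleton (f : X × ℝ → ℝ) (x : X) (y : ℝ) : MonoOn f x {y} :=
  .inl (subsingleton_singleton.monotoneOn _)

theorem monoOn_of_signOn_deriv {f f' : X × ℝ → ℝ} {x : X} {I I' : Set ℝ} (hI : OrdConnected I')
    (hs : SignOn f' x I) (hI' : I' ⊆ I)
    (hd : ∀ y ∈ I', HasDerivAt (fun y => f (x, y)) (f' (x, y)) y) : MonoOn f x I' := by
  have hc : ContinuousOn (fun y => f (x, y)) I' := fun y hy =>
    (hd y hy).continuousAt.continuousWithinAt
  have hdi : DifferentiableOn ℝ (fun y => f (x, y)) (interior I') := fun y hy =>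
    (hd y (interior_subset hy)).differentiableAt.differentiableWithinAt
  have hpos : (∀ y ∈ I, 0 ≤ f' (x, y)) → MonotoneOn (fun y => f (x, y)) I' := fun h =>
    monotoneOn_of_deriv_nonneg hI.convex hc hdi fun y hy => by
      rw [(hd y (interior_subset hy)).deriv]
      exact h y (hI' (interior_subset hy))
  rcases hs with h | h | h
  · exact .inl (hpos fun y hy => (h y hy).ge)
  · exact .inl (hpos fun y hy => (h y hy).le)
  · refine .inr (antitoneOn_of_deriv_nonpos hI.convex hc hdi fun y hy => ?_)
    rw [(hd y (interior_subset hy)).deriv]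
    exact (h y (hI' (interior_subset hy))).le

theorem exists_signOn_of_monoOn {f g : X × ℝ → ℝ} {x : X} {I : Set ℝ} (hI : OrdConnected I)
    (hf : MonoOn f x I) (hg : (∀ y ∈ I, (0 < g (x, y) ↔ 0 < f (x, y)) ∧
      (g (x, y) < 0 ↔ f (x, y) < 0)) ∨ ∀ y ∈ I, (0 < g (x, y) ↔ f (x, y) < 0) ∧
      (g (x, y) < 0 ↔ 0 < f (x, y))) :
    ∃ J : Finset (Set ℝ), J.card ≤ 3 ∧ (∀ I ∈ J, OrdConnected I ∧ SignOn g x I) ∧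
      ∀ y ∈ I, ∃ I ∈ J, y ∈ I := by
  classical
  have hoc : ∀ S : Set ℝ, OrdConnected S → OrdConnected (I ∩ {y | f (x, y) ∈ S}) := by
    intro S hS
    refine ⟨fun y hy y' hy' t ht => ?_⟩
    have htI := hI.out hy.1 hy'.1 ht
    refine ⟨htI, ?_⟩
    rcases hf with h | h
    · exact hS.out hy.2 hy'.2 ⟨h hy.1 htI ht.1, h htI hy'.1 ht.2⟩
    · exact hS.out hy'.2 hy.2 ⟨h htI hy'.1 ht.2, h hy.1 htI ht.1⟩
  have hz : ∀ y ∈ I, f (x, y) = 0 → g (x, y) = 0 := by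
    intro y hy h
    rcases hg with hg | hg
    · have := hg y hy
      rw [h] at this
      simp only [lt_self_iff_false, iff_false, not_lt] at this
      exact le_antisymm this.1 this.2
    · have := hg y hy
      rw [h] at this
      simp only [lt_self_iff_false, iff_false, not_lt] at this
      exact le_antisymm this.1 this.2
  refine ⟨{I ∩ {y | f (x, y) ∈ Ioi 0}, I ∩ {y | f (x, y) ∈ ({0} : Set ℝ)},
    I ∩ {y | f (x, y) ∈ Iio 0}}, Finset.card_le_three, ?_, fun y hy => ?_⟩
  · simp only [Finset.mem_insert, Finset.mem_singleton, forall_eq_or_imp, forall_eq]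
    refine ⟨⟨hoc _ ordConnected_Ioi, ?_⟩, ⟨hoc _ ordConnected_singleton, ?_⟩,
      hoc _ ordConnected_Iio, ?_⟩
    · rcases hg with hg | hg
      · exact .inr (.inl fun y hy => (hg y hy.1).1.2 hy.2)
      · exact .inr (.inr fun y hy => (hg y hy.1).2.2 hy.2)
    · exact .inl fun y hy => hz y hy.1 hy.2
    · rcases hg with hg | hg
      · exact .inr (.inr fun y hy => (hg y hy.1).2.2 hy.2)
      · exact .inr (.inl fun y hy => (hg y hy.1).1.2 hy.2)
  · rcases lt_trichotomy (f (x, y)) 0 with h | h | h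
    · exact ⟨I ∩ {y | f (x, y) ∈ Iio 0}, by simp, hy, h⟩
    · exact ⟨I ∩ {y | f (x, y) ∈ ({0} : Set ℝ)}, by simp, hy, h⟩
    · exact ⟨I ∩ {y | f (x, y) ∈ Ioi 0}, by simp, hy, h⟩

end Tame

namespace Tame
open Filter Topology

theorem hasDerivAt_sum_log {q : ℝ → ℝ} {y s : ℝ} (hq : HasDerivAt q s y) (h0 : q y ≠ 0) {n : ℕ}
    {P : ℕ → ℝ → ℝ} {P' : ℕ → ℝ} (hP : ∀ l < n, HasDerivAt (P l) (P' l) y) :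
    HasDerivAt (fun y => ∑ l ∈ Finset.range n, P l y * log (q y) ^ l)
      (∑ l ∈ Finset.range n, (P' l + (l + 1) * (if l + 1 < n then P (l + 1) y else 0) *
        (s / q y)) * log (q y) ^ l) y := by
  have h1 := HasDerivAt.fun_sum (u := Finset.range n) fun l hl =>
    (hP l (Finset.mem_range.1 hl)).mul ((hq.log h0).pow l)
  convert! h1 using 1
  simp only [add_mul, Finset.sum_add_distrib]
  clear h1
  refine congrArg₂ (· + ·) rfl ?_
  cases n with
  | zero => simp
  | succ n =>
    rw [← Finset.sum_add_distrib, Finset.sum_range_succ, Finset.sum_range_succ' (fun x => P x y * _)]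
    simp only [lt_self_iff_false, if_false, Nat.cast_zero, zero_mul, mul_zero, add_zero,
      Nat.add_sub_cancel]
    refine Finset.sum_congr rfl fun l hl => ?_
    rw [if_pos (by have := Finset.mem_range.1 hl; omega)]
    push_cast
    ring

variable {X : Type} {G : Set (X → ℝ)}

theorem pwOn_signOn_sum_log (c₀ : Chart G) (n : ℕ) {P : ℕ → X × ℝ → ℝ}
    (hP : ∀ l, IsTerm (adj G) (P l)) :
    PwOn (SignOn fun z => ∑ l ∈ Finset.range n, P l z * log (c₀.p z) ^ l) univ := by
  classical
  induction n generalizing P with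
  | zero =>
    refine PwOn.single (fun x => ?_) fun x => ?_
    · simpa using ordConnected_univ
    · exact .inl fun y _ => Finset.sum_range_zero _
  | succ n ih =>
    refine PwOn.of_nonGraph (G := G) (fun x y => signOn_singleton _ x y) fun U hU => ?_
    let Q : ℕ → X × ℝ → ℝ := fun l z => P l z / P n z
    have hQ : ∀ l, IsTerm (adj G) (Q l) := fun l => (hP l).div (hP n)
    obtain ⟨c, hc, hprep⟩ := exists_chart_forall_prepared hU
      (insert c₀.p (insert (P n) ((Finset.range (n + 1)).image Q))) (f := id) (by
        simp only [Finset.mem_insert, Finset.mem_image, id]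
        rintro f (rfl | rfl | ⟨l, -, rfl⟩)
        · exact c₀.hasTerm_p
        · exact hP n
        · exact hQ l)
    have hp₀ : ∀ᶠ z in c.l U, c₀.p z ≠ 0 := by
      rcases (hprep c₀.p (by simp)).sign with h | h | h
      · exfalso
        obtain ⟨z, h1, h2⟩ := ((hU _ c₀.hθ).and (hc h)).exists
        refine h1 ?_
        have h2 : c₀.σ * (z.2 - c₀.θ z.1) = 0 := h2
        have hσ := c₀.σ_sq
        rcases mul_eq_zero.1 h2 with h | h
        · rw [h] at hσ; norm_num at hσ
        · linarith
      · exact h.mono fun z hz => ne_of_gt hz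
      · exact h.mono fun z hz => ne_of_lt hz
    have cell_case : ∀ {p : X × ℝ → Prop}, (∀ᶠ z in c.l U, p z) → ∃ A ∈ U,
        (∀ x, OrdConnected {y | (x, y) ∈ A}) ∧ ∀ z ∈ A, p z := fun h => by
      obtain ⟨A, ρ, -, hA, hρ, h⟩ := Chart.exists_cell h
      exact ⟨_, hc (Chart.eventually_cell hA hρ), c.ordConnected_cell A hρ, h⟩
    have main : (∀ᶠ z in c.l U, P n z ≠ 0) → ∃ t' : ℕ → X × ℝ → ℝ, (∀ l, IsTerm (adj G) (t' l)) ∧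
        ∀ᶠ z in c.l U, t' n z = 0 ∧
          ∀ l < n + 1, HasDerivAt (fun y => Q l (z.1, y)) (t' l z) z.2 := by
      intro hne
      have h1 : ∀ l, ∃ t', IsTerm (adj G) t' ∧ ∀ᶠ z in c.l U, (l = n → t' z = 0) ∧
          (l < n + 1 → HasDerivAt (fun y => Q l (z.1, y)) (t' z) z.2) := by
        intro l
        by_cases hln : l = n
        · subst hln
          refine ⟨_, .const 0, ?_⟩
          filter_upwards [Chart.eventually_fiber_nhds hne] with z hz
          refine ⟨fun _ => rfl, fun _ => (hasDerivAt_const z.2 (1 : ℝ)).congr_of_eventuallyEq ?_⟩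
          filter_upwards [hz] with y hy using div_self hy
        · by_cases hl : l < n + 1
          · obtain ⟨t, t', -, ht', H⟩ := Chart.TermDiff.of_prepared hc (hprep (Q l) (by
              simp only [Finset.mem_insert, Finset.mem_image, Finset.mem_range]
              exact .inr (.inr ⟨l, hl, rfl⟩)))
            exact ⟨t', ht', H.mono fun z hz => ⟨fun h => absurd h hln, fun _ => hz.2⟩⟩
          · exact ⟨_, .const 0, .of_forall fun z => ⟨fun h => absurd h hln, fun h => absurd h hl⟩⟩
      choose t' ht' H using h1
      refine ⟨t', ht', ?_⟩
      filter_upwards [(Filter.eventually_all_finset (Finset.range (n + 1))).2 fun l _ => H l]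
        with z hz
      exact ⟨(hz n (Finset.self_mem_range_succ n)).1 rfl,
        fun l hl => (hz l (Finset.mem_range.2 hl)).2 hl⟩
    have step : (∀ᶠ z in c.l U, P n z ≠ 0) → ((∀ᶠ z in c.l U, 0 < P n z) ∨
        ∀ᶠ z in c.l U, P n z < 0) → ∃ A ∈ U,
          PwOn (SignOn fun z => ∑ l ∈ Finset.range (n + 1), P l z * log (c₀.p z) ^ l) A := by
      intro hne hs
      obtain ⟨t', ht', H⟩ := main hne
      have hs : ∃ A ∈ U, (∀ x, OrdConnected {y | (x, y) ∈ A}) ∧ ((∀ z ∈ A, 0 < P n z) ∨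
          ∀ z ∈ A, P n z < 0) ∧ ∀ z ∈ A, P n z ≠ 0 ∧ c₀.p z ≠ 0 ∧ t' n z = 0 ∧
          ∀ l < n + 1, HasDerivAt (fun y => Q l (z.1, y)) (t' l z) z.2 := by
        rcases hs with hs | hs
        · obtain ⟨A, hA, h1, h2⟩ := cell_case (hs.and (hne.and (hp₀.and H)))
          exact ⟨A, hA, h1, .inl fun z hz => (h2 z hz).1, fun z hz => (h2 z hz).2⟩
        · obtain ⟨A, hA, h1, h2⟩ := cell_case (hs.and (hne.and (hp₀.and H)))
          exact ⟨A, hA, h1, .inr fun z hz => (h2 z hz).1, fun z hz => (h2 z hz).2⟩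
      obtain ⟨A, hA, h1, h2, h3⟩ := hs
      refine ⟨A, hA, (ih (P := fun l z => t' l z + (l + 1) *
        (if l + 1 < n + 1 then Q (l + 1) z else 0) * (c₀.σ / c₀.p z)) fun l => ?_).refine h1 3
          fun x I I' hI hI' hA' hc' => exists_signOn_of_monoOn
            (f := fun z => ∑ l ∈ Finset.range (n + 1), Q l z * log (c₀.p z) ^ l) hc'
              (monoOn_of_signOn_deriv hc' hI hI' fun y hy => ?_) ?_⟩
      · refine (ht' l).add (((IsTerm.const ((l : ℝ) + 1)).mul ?_).mul
          ((IsTerm.const c₀.σ).div c₀.hasTerm_p))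
        split_ifs
        · exact hQ _
        · exact .const 0
      · obtain ⟨-, h4, h5, h6⟩ := h3 _ (hA' y hy)
        have := hasDerivAt_sum_log (c₀.hasDerivAt_p x y) h4 h6
        rw [Finset.sum_range_succ, h5] at this
        simpa using this
      · have e : ∀ y ∈ I', ∑ l ∈ Finset.range (n + 1), P l (x, y) * log (c₀.p (x, y)) ^ l =
            P n (x, y) * ∑ l ∈ Finset.range (n + 1), Q l (x, y) * log (c₀.p (x, y)) ^ l := by
          intro y hy
          have h4 := (h3 _ (hA' y hy)).1
          rw [Finset.mul_sum]
          refine Finset.sum_congr rfl fun l _ => ?_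
          simp only [Q]
          field_simp
        rcases h2 with h2 | h2
        · refine .inl fun y hy => ?_
          have := h2 _ (hA' y hy)
          simp only [e y hy, mul_pos_iff_of_pos_left this, true_and]
          rw [mul_neg_iff]
          constructor
          · rintro (h | h)
            · exact h.2
            · linarith [h.1]
          · exact fun h => .inl ⟨this, h⟩
        · refine .inr fun y hy => ?_
          have := h2 _ (hA' y hy)
          simp only [e y hy]
          constructor
          · rw [mul_pos_iff]
            constructor
            · rintro (h | h)
              · linarith [h.1]
              · exact h.2
            · exact fun h => .inr ⟨this, h⟩
          · rw [mul_neg_iff]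
            constructor
            · rintro (h | h)
              · linarith [h.1]
              · exact h.2
            · exact fun h => .inr ⟨this, h⟩
    rcases (hprep (P n) (by simp)).sign with h | h | h
    · have h : ∀ᶠ z in c.l U, P n z = 0 := h
      obtain ⟨A, hA, h1, h2⟩ := cell_case h
      refine ⟨A, hA, (ih hP).congr h1 fun x I I' hI hI' hA' hc' => ?_⟩
      have e : ∀ y ∈ I', ∑ l ∈ Finset.range (n + 1), P l (x, y) * log (c₀.p (x, y)) ^ l =
          ∑ l ∈ Finset.range n, P l (x, y) * log (c₀.p (x, y)) ^ l := by
        intro y hy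
        rw [Finset.sum_range_succ, h2 _ (hA' y hy), zero_mul, add_zero]
      rcases hI with hI | hI | hI
      · exact .inl fun y hy => (e y hy).trans (hI y (hI' hy))
      · exact .inr (.inl fun y hy => (hI y (hI' hy)).trans_eq (e y hy).symm)
      · exact .inr (.inr fun y hy => (e y hy).trans_lt (hI y (hI' hy)))
    · exact step (h.mono fun z hz => ne_of_gt hz) (.inl h)
    · exact step (h.mono fun z hz => ne_of_lt hz) (.inr h)

/-- Uniform piecewise monotonicity along the fibers. -/
theorem IsLT.pwOn_monoOn (hG : ∀ a : X → ℝ, IsTerm G a) {f : X × ℝ → ℝ} (hf : IsLT (adj G) f) :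
    PwOn (MonoOn f) univ := by
  refine PwOn.of_nonGraph (G := G) (fun x y => monoOn_singleton _ x y) fun U hU => ?_
  obtain ⟨c, hc, hL⟩ := hf.exists_chart hU
  obtain ⟨n, P, hP, hfP⟩ := hL.exists_coeff hG hc
  choose t t' ht ht' H using hP
  have ev : ∀ᶠ z in c.l U, 0 < c.p z ∧ (∀ l ∈ Finset.range n, P l z = t l z ∧
      HasDerivAt (fun y => P l (z.1, y)) (t' l z) z.2) ∧
      ∀ᶠ y in 𝓝 z.2, f (z.1, y) = ∑ l ∈ Finset.range n, P l (z.1, y) *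
        Real.log (c.p (z.1, y)) ^ l :=
    (c.p_pos U).and (((Filter.eventually_all_finset _).2 fun l _ => H l).and
      (Chart.eventually_fiber_nhds hfP))
  obtain ⟨A, ρ, -, hA, hρ, h⟩ := Chart.exists_cell ev
  refine ⟨_, hc (Chart.eventually_cell hA hρ), (pwOn_signOn_sum_log c n
    (P := fun l z => t' l z + (l + 1) * (if l + 1 < n then t (l + 1) z else 0) *
      (c.σ / c.p z)) fun l => ?_).congr (c.ordConnected_cell A hρ)
      fun x I I' hI hI' hA' hc' => monoOn_of_signOn_deriv hc' hI hI' fun y hy => ?_⟩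
  · refine (ht' l).add (((IsTerm.const ((l : ℝ) + 1)).mul ?_).mul
      ((IsTerm.const c.σ).div c.hasTerm_p))
    split_ifs
    · exact ht _
    · exact .const 0
  · obtain ⟨h1, h2, h3⟩ := h _ (hA' y hy)
    have := hasDerivAt_sum_log (c.hasDerivAt_p x y) h1.ne'
      fun l hl => (h2 l (Finset.mem_range.2 hl)).2
    refine (this.congr_of_eventuallyEq h3).congr_deriv (Finset.sum_congr rfl fun l _ => ?_)
    split_ifs with hl
    · rw [(h2 (l + 1) (Finset.mem_range.2 hl)).1]
    · rfl

end Tame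

namespace Tame
open Filter Topology

theorem setIntegral_Icc_finCons {d : ℕ} {f : (Fin (d + 1) → ℝ) → ℝ} (hf : Measurable f) {K : ℝ}
    (hK : ∀ ξ, |f ξ| ≤ K) :
    ∫ ξ in Icc 0 1, f ξ = ∫ y in (0 : ℝ)..1, ∫ ξ in Icc (0 : Fin d → ℝ) 1, f (Fin.cons y ξ) := by
  let e := (MeasurableEquiv.piFinSuccAbove (fun _ : Fin (d + 1) => ℝ) 0).symm
  have hem : MeasurePreserving e :=
    (volume_preserving_piFinSuccAbove (fun _ : Fin (d + 1) => ℝ) 0).symm _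
  have he : ∀ z : ℝ × (Fin d → ℝ), e z = Fin.cons z.1 z.2 := fun z => by
    simp only [e, MeasurableEquiv.piFinSuccAbove_symm_apply, Fin.insertNthEquiv,
      Equiv.coe_fn_mk, Fin.insertNth_zero]
    rfl
  have hs : e ⁻¹' Icc 0 1 = Icc (0 : ℝ) 1 ×ˢ Icc (0 : Fin d → ℝ) 1 := by
    ext z
    simp only [mem_preimage, he, mem_prod, mem_Icc, Pi.le_def, Fin.forall_fin_succ, Fin.cons_zero,
      Fin.cons_succ, Pi.zero_apply, Pi.one_apply]
    tauto
  rw [← hem.setIntegral_preimage_emb e.measurableEmbedding, hs,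
    intervalIntegral.integral_of_le zero_le_one, ← integral_Icc_eq_integral_Ioc,
    Measure.volume_eq_prod, setIntegral_prod]
  · simp only [he]
  · refine Measure.integrableOn_of_bounded (M := K) ?_
      (hf.comp e.measurable).aestronglyMeasurable (.of_forall fun z => hK _)
    rw [Measure.prod_prod]
    exact (ENNReal.mul_lt_top isCompact_Icc.measure_lt_top isCompact_Icc.measure_lt_top).ne

/-- The generators on `X × ℝᵈ` obtained from `G` by adjoining the coordinates. -/
def cubeAdj {X : Type} (G : Set (X → ℝ)) (d : ℕ) : Set (X × (Fin d → ℝ) → ℝ) :=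
  {f | (∃ g ∈ G, f = fun z => g z.1) ∨ ∃ i, f = fun z => z.2 i}

theorem measurable_cubeAdj {X : Type} (G : Set (X → ℝ)) (d : ℕ) (x : X) :
    ∀ g ∈ cubeAdj G d, Measurable fun ξ => g (x, ξ) := by
  rintro g (⟨g, hg, rfl⟩ | ⟨i, rfl⟩)
  · exact (measurable_const : Measurable fun _ : Fin d → ℝ => g x)
  · exact measurable_pi_apply i

/-- The class of functions generated by terms and logarithms of terms is stable under integration
over the unit cube. -/
theorem IsLT.integral_cube (d : ℕ) {X : Type} {G : Set (X → ℝ)} {f : X × (Fin d → ℝ) → ℝ}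
    (hf : IsLT (cubeAdj G d) f) {K : ℝ} (hK : ∀ z, |f z| ≤ K) :
    IsLT G fun x => ∫ ξ in Icc 0 1, f (x, ξ) := by
  induction d generalizing X with
  | zero =>
    refine (IsLT.comp (pr := fun x => (x, (0 : Fin 0 → ℝ))) ?_ hf).congr fun x => ?_
    · rintro g (⟨g, hg, rfl⟩ | ⟨i, -⟩)
      · exact .gen hg
      · exact i.elim0
    · have : Icc (0 : Fin 0 → ℝ) 1 = univ := eq_univ_of_forall fun ξ => by
        simp [Pi.le_def]
      rw [this, setIntegral_univ, integral_unique]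
      simp [Measure.volume_pi_eq_dirac (0 : Fin 0 → ℝ), Measure.real]
      exact congrArg f (Prod.ext rfl (Subsingleton.elim _ _))
  | succ d ih =>
    have hF : IsLT (cubeAdj (adj G) d) fun w : (X × ℝ) × (Fin d → ℝ) =>
        f (w.1.1, Fin.cons w.1.2 w.2) := by
      refine IsLT.comp (pr := fun w : (X × ℝ) × (Fin d → ℝ) =>
        (w.1.1, (Fin.cons w.1.2 w.2 : Fin (d + 1) → ℝ))) ?_ hf
      rintro g (⟨g, hg, rfl⟩ | ⟨i, rfl⟩)
      · exact .gen (.inl ⟨_, .inr ⟨g, hg, rfl⟩, rfl⟩)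
      · refine Fin.cases ?_ (fun i => ?_) i
        · exact .gen (.inl ⟨_, .inl rfl, rfl⟩)
        · simp only [Fin.cons_succ]
          exact .gen (.inr ⟨i, rfl⟩)
    have hv : volume.real (Icc (0 : Fin d → ℝ) 1) = 1 := by
      simp [Measure.real, Real.volume_Icc_pi]
    have h1 := IsLT.integral (K := K) (ih hF fun w => hK _) fun z => by
      have := norm_setIntegral_le_of_norm_le_const (μ := volume) (s := Icc (0 : Fin d → ℝ) 1)
        isCompact_Icc.measure_lt_top (f := fun ξ => f (z.1, Fin.cons z.2 ξ)) (C := K)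
        fun ξ _ => hK _
      rwa [hv, mul_one, Real.norm_eq_abs] at this
    exact h1.congr fun x => (setIntegral_Icc_finCons
      (hf.measurable (measurable_cubeAdj G (d + 1) x)) fun ξ => hK _)

end Tame

namespace Tame
open Filter Topology

theorem eval_eq_sum_of_totalDegree_le {d k : ℕ} {Q : MvPolynomial (Fin d) ℝ}
    (hQ : Q.totalDegree ≤ k) (ξ : Fin d → ℝ) :
    MvPolynomial.eval ξ Q = ∑ s ∈ Finset.Icc 0 (Finsupp.equivFunOnFinite.symm fun _ => k),
      MvPolynomial.coeff s Q * ∏ i, ξ i ^ s i := by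
  rw [MvPolynomial.eval_eq']
  refine Finset.sum_subset (fun s hs => ?_) fun s _ hs => ?_
  · refine Finset.mem_Icc.2 ⟨zero_le, fun i => ?_⟩
    have h1 := (MvPolynomial.le_totalDegree hs).trans hQ
    rw [Finsupp.sum_fintype _ _ fun _ => rfl] at h1
    exact (Finset.single_le_sum (f := fun i => s i) (fun _ _ => zero_le)
      (Finset.mem_univ i)).trans h1
  · rw [MvPolynomial.notMem_support_iff.1 hs, zero_mul]

theorem IsTerm.prod {X ι : Type} {G : Set (X → ℝ)} (s : Finset ι) {f : ι → X → ℝ}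
    (hf : ∀ i ∈ s, IsTerm G (f i)) : IsTerm G fun x => ∏ i ∈ s, f i x := by
  classical
  induction s using Finset.induction_on with
  | empty => exact (IsTerm.const 1).congr fun x => by simp
  | insert a s ha ih =>
    refine ((hf a (Finset.mem_insert_self a s)).mul
      (ih fun i hi => hf i (Finset.mem_insert_of_mem hi))).congr fun x => ?_
    rw [Finset.prod_insert ha]

theorem pwOn_monoOn_Sfun (d k : ℕ) (δ : ℝ) : ∃ M : ℕ, ∀ Q : MvPolynomial (Fin d) ℝ,
    Q.totalDegree ≤ k → ∃ J : Finset (Set ℝ), J.card ≤ M ∧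
      (∀ I ∈ J, OrdConnected I ∧ (MonotoneOn (Sfun d δ Q) I ∨ AntitoneOn (Sfun d δ Q) I)) ∧
      ∀ y, ∃ I ∈ J, y ∈ I := by
  let G : Set (MvPolynomial (Fin d) ℝ → ℝ) := univ
  let P : MvPolynomial (Fin d) ℝ → (Fin d → ℝ) → ℝ := fun Q ξ =>
    ∑ s ∈ Finset.Icc 0 (Finsupp.equivFunOnFinite.symm fun _ => k),
      MvPolynomial.coeff s Q * ∏ i, ξ i ^ s i
  have hfst : ∀ {g : MvPolynomial (Fin d) ℝ × ℝ → ℝ}, g ∈ adj G →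
      IsTerm (cubeAdj (adj G) d) fun w => g w.1 := fun hg => .gen (.inl ⟨_, hg, rfl⟩)
  have hP : IsTerm (cubeAdj (adj G) d) fun w => P w.1.1 w.2 := by
    refine IsTerm.sum _ fun s _ => IsTerm.mul ?_ (IsTerm.prod _ fun i _ => IsTerm.pow ?_ _)
    · exact hfst (.inr ⟨fun Q => MvPolynomial.coeff s Q, mem_univ _, rfl⟩)
    · exact .gen (.inr ⟨i, rfl⟩)
  have hy : IsTerm (cubeAdj (adj G) d) fun w => w.1.2 := hfst (.inl rfl)
  have hA := (IsDef.le (hy.sub (.const δ)) hP).inter (IsDef.le hP (hy.add (.const δ)))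
  obtain ⟨M, hM⟩ := IsLT.pwOn_monoOn (G := G) (fun a => .gen (mem_univ a))
    (IsLT.integral_cube d (.term hA) (K := 1) fun z => by
      rw [indicator_apply]
      split_ifs <;> simp)
  refine ⟨M, fun Q hQ => ?_⟩
  obtain ⟨J, hJ, h1, h2⟩ := hM Q
  refine ⟨J, hJ, fun I hI => ⟨(h1 I hI).1, ?_⟩, fun y => h2 y (mem_univ _)⟩
  have hS : Sfun d δ Q = fun y => ∫ ξ in Icc (0 : Fin d → ℝ) 1, (({w | w.1.2 - δ ≤ P w.1.1 w.2} ∩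
      {w | P w.1.1 w.2 ≤ w.1.2 + δ}).indicator (fun _ => 1) ((Q, y), ξ) : ℝ) := by
    funext y
    have hm : MeasurableSet {ξ : Fin d → ℝ | y - δ ≤ P Q ξ ∧ P Q ξ ≤ y + δ} := by
      have hc : Measurable (P Q) := by
        have : P Q = fun ξ => MvPolynomial.eval ξ Q :=
          funext fun ξ => (eval_eq_sum_of_totalDegree_le hQ ξ).symm
        rw [this]
        exact (MvPolynomial.continuous_eval Q).measurable
      exact (measurableSet_le measurable_const hc).inter (measurableSet_le hc measurable_const)
    have h3 : (fun ξ => (({w | w.1.2 - δ ≤ P w.1.1 w.2} ∩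
        {w | P w.1.1 w.2 ≤ w.1.2 + δ}).indicator (fun _ => 1) ((Q, y), ξ) : ℝ)) =
        {ξ : Fin d → ℝ | y - δ ≤ P Q ξ ∧ P Q ξ ≤ y + δ}.indicator 1 := rfl
    rw [h3, setIntegral_indicator hm]
    simp only [Pi.one_apply, setIntegral_const, smul_eq_mul, mul_one, Sfun, Measure.real]
    congr 2
    ext ξ
    simp only [eval_eq_sum_of_totalDegree_le hQ]
    rfl
  rw [hS]
  exact (h1 I hI).2

end Tame

namespace Tame
open Filter Topology

theorem volume_eval_eq_zero {d : ℕ} {Q : MvPolynomial (Fin d) ℝ} (hQ : Q ≠ 0) :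
    volume {ξ : Fin d → ℝ | MvPolynomial.eval ξ Q = 0} = 0 := by
  induction d with
  | zero =>
    rw [MvPolynomial.eq_C_of_isEmpty Q] at hQ ⊢
    have : MvPolynomial.coeff 0 Q ≠ 0 := fun h => hQ (by rw [h, MvPolynomial.C_0])
    simp [this]
  | succ d ih =>
    let e := (MeasurableEquiv.piFinSuccAbove (fun _ : Fin (d + 1) => ℝ) 0).symm
    have hem : MeasurePreserving e :=
      (volume_preserving_piFinSuccAbove (fun _ : Fin (d + 1) => ℝ) 0).symm _
    have he : ∀ y (ξ : Fin d → ℝ), e (y, ξ) = Fin.cons y ξ := fun y ξ => by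
      simp only [e, MeasurableEquiv.piFinSuccAbove_symm_apply, Fin.insertNthEquiv,
        Equiv.coe_fn_mk, Fin.insertNth_zero]
      rfl
    have hm : MeasurableSet {ξ : Fin (d + 1) → ℝ | MvPolynomial.eval ξ Q = 0} :=
      measurableSet_eq_fun (MvPolynomial.continuous_eval Q).measurable measurable_const
    have hsw : MeasurePreserving (fun z : (Fin d → ℝ) × ℝ => e z.swap) :=
      hem.comp Measure.measurePreserving_swap
    rw [← hsw.measure_preimage hm.nullMeasurableSet, Measure.volume_eq_prod,
      Measure.measure_prod_null (hsw.measurable hm)]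
    let F := MvPolynomial.finSuccEquiv ℝ d Q
    have hF : F ≠ 0 := (map_ne_zero_iff _ (MvPolynomial.finSuccEquiv ℝ d).injective).2 hQ
    have h0 : ∀ᵐ ξ : Fin d → ℝ, MvPolynomial.eval ξ F.leadingCoeff ≠ 0 :=
      measure_eq_zero_iff_ae_notMem.1 (ih (Polynomial.leadingCoeff_ne_zero.2 hF))
    filter_upwards [h0] with ξ hξ
    have hne : F.map (MvPolynomial.eval ξ) ≠ 0 := fun h => hξ (by
      have := congrArg (fun p => Polynomial.coeff p F.natDegree) h
      simpa [Polynomial.coeff_map] using this)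
    refine ((F.map (MvPolynomial.eval ξ)).roots.toFinset.finite_toSet.subset fun y hy => ?_).measure_zero _
    have hy : MvPolynomial.eval (e (y, ξ)) Q = 0 := hy
    rw [he, MvPolynomial.eval_eq_eval_mv_eval'] at hy
    simpa using ⟨hne, hy⟩

theorem continuous_Sfun {d : ℕ} (δ : ℝ) {Q : MvPolynomial (Fin d) ℝ}
    (hQ : ∀ c, Q ≠ MvPolynomial.C c) : Continuous (Sfun d δ Q) := by
  have hc : Measurable fun ξ => MvPolynomial.eval ξ Q := (MvPolynomial.continuous_eval Q).measurable
  have hm : ∀ y : ℝ, MeasurableSet {ξ : Fin d → ℝ | y - δ ≤ MvPolynomial.eval ξ Q ∧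
      MvPolynomial.eval ξ Q ≤ y + δ} := fun y =>
    (measurableSet_le measurable_const hc).inter (measurableSet_le hc measurable_const)
  have hS : Sfun d δ Q = fun y => ∫ ξ in Icc (0 : Fin d → ℝ) 1,
      {ξ : Fin d → ℝ | y - δ ≤ MvPolynomial.eval ξ Q ∧ MvPolynomial.eval ξ Q ≤ y + δ}.indicator
        (fun _ => (1 : ℝ)) ξ := by
    funext y
    rw [setIntegral_indicator (hm y), setIntegral_const, smul_eq_mul, mul_one]
    rfl
  have hne : ∀ c : ℝ, ∀ᵐ ξ ∂(volume.restrict (Icc (0 : Fin d → ℝ) 1)),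
      MvPolynomial.eval ξ Q ≠ c := fun c => by
    refine ae_restrict_of_ae ?_
    have := volume_eval_eq_zero (sub_ne_zero.2 (hQ c))
    refine (measure_eq_zero_iff_ae_notMem.1 this).mono fun ξ h h' => h ?_
    simp [h']
  rw [hS]
  refine continuous_iff_continuousAt.2 fun y => continuousAt_of_dominated (bound := fun _ => 1)
    (.of_forall fun z => (measurable_const.indicator (hm z)).aestronglyMeasurable)
    (.of_forall fun z => .of_forall fun ξ => ?_) ?_ ?_
  · rw [indicator_apply]
    split_ifs <;> simp
  · exact integrableOn_const isCompact_Icc.measure_lt_top.ne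
  · filter_upwards [hne (y - δ), hne (y + δ)] with ξ h1 h2
    simp only [indicator_apply, mem_ofPred_eq]
    have key : ∀ᶠ z in 𝓝 y, (z - δ ≤ MvPolynomial.eval ξ Q ↔ y - δ ≤ MvPolynomial.eval ξ Q) ∧
        (MvPolynomial.eval ξ Q ≤ z + δ ↔ MvPolynomial.eval ξ Q ≤ y + δ) := by
      have c1 : Tendsto (fun z => z - δ) (𝓝 y) (𝓝 (y - δ)) := tendsto_id.sub_const δ
      have c2 : Tendsto (fun z => z + δ) (𝓝 y) (𝓝 (y + δ)) := tendsto_id.add_const δ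
      refine Eventually.and ?_ ?_
      · rcases lt_or_gt_of_ne h1 with h | h
        · exact (c1.eventually_const_lt h).mono fun z hz => by
            simp only [not_le.2 hz, not_le.2 h]
        · exact (c1.eventually_lt_const h).mono fun z hz => by simp only [hz.le, h.le]
      · rcases lt_or_gt_of_ne h2 with h | h
        · exact (c2.eventually_const_lt h).mono fun z hz => by simp only [hz.le, h.le]
        · exact (c2.eventually_lt_const h).mono fun z hz => by
            simp only [not_le.2 hz, not_le.2 h]
    refine (continuousAt_const (y := if y - δ ≤ MvPolynomial.eval ξ Q ∧
      MvPolynomial.eval ξ Q ≤ y + δ then (1 : ℝ) else 0)).congr ?_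
    filter_upwards [key] with z hz
    simp only [hz.1, hz.2]

theorem monotoneOn_closure {f : ℝ → ℝ} (hf : Continuous f) {s t : Set ℝ} (h : MonotoneOn f s)
    (ht : t ⊆ closure s) : MonotoneOn f t := by
  intro x hx y hy hxy
  rcases hxy.eq_or_lt with rfl | hxy
  · exact le_rfl
  obtain ⟨u, hu, hus⟩ := mem_closure_iff_seq_limit.1 (ht hx)
  obtain ⟨v, hv, hvs⟩ := mem_closure_iff_seq_limit.1 (ht hy)
  refine le_of_tendsto_of_tendsto ((hf.tendsto x).comp hus) ((hf.tendsto y).comp hvs) ?_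
  filter_upwards [hus.eventually_lt hvs hxy] with n hn using h (hu n) (hv n) hn.le

end Tame

namespace Tame
open Filter Topology

theorem exists_monotone_enumeration (E : Finset ℝ) :
    ∃ t : ℕ → ℝ, Monotone t ∧ ∀ e ∈ E, ∃ j < E.card, t j = e := by
  rcases E.eq_empty_or_nonempty with rfl | hE
  · exact ⟨fun _ => 0, monotone_const, by simp⟩
  · have hc := hE.card_pos
    refine ⟨fun i => E.orderEmbOfFin rfl ⟨min i (E.card - 1), by omega⟩, fun i j hij =>
      (E.orderEmbOfFin rfl).monotone ?_, fun e he => ?_⟩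
    · exact Fin.mk_le_mk.2 (min_le_min_right _ hij)
    · have : e ∈ Set.range (E.orderEmbOfFin rfl) := by rwa [Finset.range_orderEmbOfFin]
      obtain ⟨⟨j, hj⟩, rfl⟩ := this
      exact ⟨j, hj, congrArg _ (Fin.ext (by simp only []; omega))⟩

/-- An interval which avoids the endpoints of an order connected set that it meets lies in it. -/
theorem subset_of_endpoints_notMem {I U : Set ℝ} (hI : OrdConnected I) (hU : OrdConnected U)
    (h1 : sInf I ∉ U) (h2 : sSup I ∉ U) {y : ℝ} (hyU : y ∈ U) (hyI : y ∈ I) : U ⊆ I := by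
  intro z hz
  by_contra hzI
  rcases le_total y z with h | h
  · have hb : z ∈ upperBounds I := fun w hw => le_of_not_gt fun hlt => hzI (hI.out hyI hw ⟨h, hlt.le⟩)
    exact h2 (hU.out hyU hz ⟨le_csSup ⟨z, hb⟩ hyI, csSup_le ⟨y, hyI⟩ hb⟩)
  · have hb : z ∈ lowerBounds I := fun w hw => le_of_not_gt fun hlt => hzI (hI.out hw hyI ⟨hlt.le, h⟩)
    exact h1 (hU.out hz hyU ⟨le_csInf ⟨y, hyI⟩ hb, csInf_le ⟨z, hb⟩ hyI⟩)

theorem exists_monotone_pieces {f : ℝ → ℝ} (hf : Continuous f) {J : Finset (Set ℝ)}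
    (hJ : ∀ I ∈ J, OrdConnected I ∧ (MonotoneOn f I ∨ AntitoneOn f I)) (hc : ∀ y, ∃ I ∈ J, y ∈ I) :
    ∃ (n : ℕ) (t : ℕ → ℝ), n ≤ 2 * J.card ∧ Monotone t ∧
      ∀ i ≤ n, MonotoneOn f (piece t n i) ∨ AntitoneOn f (piece t n i) := by
  classical
  let E := J.image sInf ∪ J.image sSup
  obtain ⟨t, ht, hE⟩ := exists_monotone_enumeration E
  refine ⟨E.card, t, ?_, ht, fun i hi => ?_⟩
  · have h1 := Finset.card_union_le (J.image sInf) (J.image sSup)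
    have h2 : (J.image sInf).card ≤ J.card := Finset.card_image_le
    have h3 : (J.image sSup).card ≤ J.card := Finset.card_image_le
    change (J.image sInf ∪ J.image sSup).card ≤ _
    omega
  set n := E.card
  let U : Set ℝ := {x | (i = 0 ∨ t (i - 1) < x) ∧ (i = n ∨ x < t i)}
  have hU : OrdConnected U := ⟨fun x hx y hy z hz =>
    ⟨hx.1.imp_right fun h => h.trans_le hz.1, hy.2.imp_right fun h => hz.2.trans_lt h⟩⟩
  have hEU : ∀ e ∈ E, e ∉ U := by
    rintro e he ⟨h1, h2⟩
    obtain ⟨j, hj, rfl⟩ := hE e he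
    rcases lt_or_ge j i with hji | hij
    · rcases h1 with h1 | h1
      · omega
      · exact (ht (show j ≤ i - 1 by omega)).not_gt h1
    · rcases h2 with h2 | h2
      · omega
      · exact (ht hij).not_gt h2
  rcases U.eq_empty_or_nonempty with h0 | ⟨y, hy⟩
  · left
    have hi0 : i ≠ 0 := by
      rintro rfl
      have : t 0 - 1 ∈ U := ⟨.inl rfl, .inr (by linarith)⟩
      rw [h0] at this
      exact this
    have hin : i ≠ n := by
      intro h
      have : t (i - 1) + 1 ∈ U := ⟨.inr (by linarith), .inl h⟩
      rw [h0] at this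
      exact this
    have hle : t i ≤ t (i - 1) := by
      by_contra! h
      have : (t (i - 1) + t i) / 2 ∈ U := ⟨.inr (by linarith), .inr (by linarith)⟩
      rw [h0] at this
      exact this
    rintro x ⟨hx1, hx2⟩ z ⟨hz1, hz2⟩ hxz
    have : x = z := le_antisymm hxz
      ((hz2.resolve_left hin).trans (hle.trans (hx1.resolve_left hi0)))
    rw [this]
  · obtain ⟨I, hI, hyI⟩ := hc y
    have hUI : U ⊆ I := subset_of_endpoints_notMem (hJ I hI).1 hU
      (hEU _ (Finset.mem_union_left _ (Finset.mem_image_of_mem _ hI)))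
      (hEU _ (Finset.mem_union_right _ (Finset.mem_image_of_mem _ hI))) hy hyI
    have hcl : piece t n i ⊆ closure U := by
      intro x hx
      have hseq : Tendsto (fun m : ℕ => x + (1 / ((m : ℝ) + 1)) * (y - x)) atTop (𝓝 x) := by
        simpa using (tendsto_one_div_add_atTop_nhds_zero_nat (𝕜 := ℝ)).mul_const (y - x)
          |>.const_add x
      refine mem_closure_of_tendsto hseq (.of_forall fun m => ?_)
      have h1 : 0 < 1 / ((m : ℝ) + 1) := by positivity
      have h2 : 1 / ((m : ℝ) + 1) ≤ 1 := by
        rw [div_le_one (by positivity)]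
        linarith [(Nat.cast_nonneg m : (0 : ℝ) ≤ m)]
      generalize 1 / ((m : ℝ) + 1) = r at h1 h2
      refine ⟨?_, ?_⟩
      · rcases hx.1 with h | h
        · exact .inl h
        · refine hy.1.imp_right fun h' => ?_
          nlinarith [mul_nonneg (sub_nonneg.2 h2) (sub_nonneg.2 h), mul_pos h1 (sub_pos.2 h')]
      · rcases hx.2 with h | h
        · exact .inl h
        · refine hy.2.imp_right fun h' => ?_
          nlinarith [mul_nonneg (sub_nonneg.2 h2) (sub_nonneg.2 h), mul_pos h1 (sub_pos.2 h')]
    rcases (hJ I hI).2 with h | h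
    · exact .inl (monotoneOn_closure hf (h.mono hUI) hcl)
    · right
      have := monotoneOn_closure hf.neg (h.mono hUI).neg hcl
      intro a ha b hb hab
      simpa using this ha hb hab

theorem exists_pieces_Sfun_C (d : ℕ) {δ : ℝ} (hδ : 0 < δ) (c : ℝ) :
    ∃ t : ℕ → ℝ, Monotone t ∧ ∀ i ≤ 2,
      MonotoneOn (Sfun d δ (MvPolynomial.C c)) (piece t 2 i) ∨
        AntitoneOn (Sfun d δ (MvPolynomial.C c)) (piece t 2 i) := by
  have h0 : ∀ β, 0 ≤ Sfun d δ (MvPolynomial.C c) β := fun β => ENNReal.toReal_nonneg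
  have hz : ∀ β, (β < c - δ ∨ c + δ < β) → Sfun d δ (MvPolynomial.C c) β = 0 := fun β h => by
    have : ¬ (β - δ ≤ c ∧ c ≤ β + δ) := by
      rintro ⟨h1, h2⟩
      rcases h with h | h <;> linarith
    simp only [Sfun, MvPolynomial.eval_C, this, and_false]
    simp
  have hone : ∀ β, c - δ ≤ β → β ≤ c + δ → Sfun d δ (MvPolynomial.C c) β = 1 := fun β h1 h2 => by
    have h3 : β - δ ≤ c := by linarith
    have h4 : c ≤ β + δ := by linarith
    simp only [Sfun, MvPolynomial.eval_C, h3, h4, and_true]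
    change (volume (Icc (0 : Fin d → ℝ) 1)).toReal = 1
    simp [Real.volume_Icc_pi]
  refine ⟨fun i => if i = 0 then c - δ else c + δ, fun i j hij => ?_, fun i hi => ?_⟩
  · beta_reduce
    split_ifs <;> first | omega | linarith
  · interval_cases i
    · refine .inl fun x hx y hy hxy => ?_
      have hy : y ≤ c - δ := hy.2.resolve_left (by decide)
      rcases hxy.eq_or_lt with rfl | hlt
      · exact le_rfl
      · rw [hz x (.inl (by linarith))]
        exact h0 y
    · refine .inl fun x hx y hy hxy => ?_
      have hx1 : c - δ ≤ x := hx.1.resolve_left (by decide)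
      have hy1 : y ≤ c + δ := hy.2.resolve_left (by decide)
      rw [hone x hx1 (by linarith), hone y (by linarith) hy1]
    · refine .inr fun x hx y hy hxy => ?_
      have hx : c + δ ≤ x := hx.1.resolve_left (by decide)
      rcases hxy.eq_or_lt with rfl | hlt
      · exact le_rfl
      · rw [hz y (.inr (by linarith))]
        exact h0 x

end Tame

/-- Piecewise monotonicity of the stationary-set measure function (used in the proof of
Theorem 1.1): for all `d, k ≥ 1` and `δ₀ ∈ (0, 1/2)` there is `M = M(d,k,δ₀)` such that
for every real polynomial `Q` in `d` variables of degree at most `k`, the function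
`S(β) = |{ξ ∈ [0,1]^d : β − δ₀ ≤ Q(ξ) ≤ β + δ₀}|` is piecewise monotone with at most
`M` pieces: there are at most `M − 1` points `t₁ ≤ t₂ ≤ ⋯` such that on each of the at
most `M` intervals into which they partition `ℝ`, `S` is nondecreasing or nonincreasing. -/
theorem stationary_measure_piecewise_monotone (d k : ℕ) (hd : 1 ≤ d) (hk : 1 ≤ k)
    (δ₀ : ℝ) (hδ₀ : 0 < δ₀) (hδ₀' : δ₀ < 1 / 2) :
    ∃ M : ℕ, ∀ Q : MvPolynomial (Fin d) ℝ, Q.totalDegree ≤ k →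
      ∃ (n : ℕ) (t : ℕ → ℝ), n + 1 ≤ M ∧ Monotone t ∧
        ∀ i ≤ n, MonotoneOn (Sfun d δ₀ Q) (piece t n i) ∨
          AntitoneOn (Sfun d δ₀ Q) (piece t n i) := by
  obtain ⟨M, hM⟩ := Tame.pwOn_monoOn_Sfun d k δ₀
  refine ⟨2 * M + 3, fun Q hQ => ?_⟩
  by_cases hC : ∃ c, Q = MvPolynomial.C c
  · obtain ⟨c, rfl⟩ := hC
    obtain ⟨t, ht, h⟩ := Tame.exists_pieces_Sfun_C d hδ₀ c
    exact ⟨2, t, by omega, ht, h⟩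
  · push Not at hC
    obtain ⟨J, hJ, h1, h2⟩ := hM Q hQ
    obtain ⟨n, t, hn, ht, h⟩ := Tame.exists_monotone_pieces (Tame.continuous_Sfun δ₀ hC) h1 h2
    exact ⟨n, t, by omega, ht, h⟩
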